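/- Continuous vector-valued maximal theorem for truncated singular Radon transforms: for every p ∈ (1, ∞), every k, d₀ ∈ ℕ and every degree bound D ∈ ℕ, there is a constant C_p > 0 (depending only on p, k, d₀ and D, and in particular independent of the coefficients of the polynomial mapping) such that for every polynomial mapping P : ℝ^k → ℝ^{d₀} whose components have degree at most D, every Calderón–Zygmund kernel K as in the context, and every sequence (f_t)_{t∈ℕ} of measurable functions on ℝ^{d₀} with ‖(Σ_{t∈ℕ}|f_t|²)^{1/2}‖_{L^p} < ∞, one has ‖ ( Σ_{t∈ℕ} sup_{r>0} |T_r^P f_t|² )^{1/2} ‖_{L^p(ℝ^{d₀})} ≤ C_p ‖ ( Σ_{t∈ℕ} |f_t|² )^{1/2} ‖_{L^p(ℝ^{d₀})}. -/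

import Mathlib

open scoped ENNReal

noncomputable section

/-- A Calderón–Zygmund kernel on `ℝ^k`: a `C¹` function off the origin satisfying
`‖y‖^k|K(y)| + ‖y‖^{k+1}‖∇K(y)‖ ≤ 1` for all `y ≠ 0` and the cancellation condition
`sup_{0<r<R<∞} |∫_{r ≤ ‖y‖ ≤ R} K| ≤ 1`. -/
def IsCZKernelCont (k : ℕ) (K : EuclideanSpace ℝ (Fin k) → ℂ) : Prop :=
  ContDiffOn ℝ 1 K {0}ᶜ ∧
    (∀ y : EuclideanSpace ℝ (Fin k), y ≠ 0 →
      ‖y‖ ^ k * ‖K y‖ + ‖y‖ ^ (k + 1) * ‖fderiv ℝ K y‖ ≤ 1) ∧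
    ∀ r R : ℝ, 0 < r → r < R →
      ‖∫ y in {y : EuclideanSpace ℝ (Fin k) | r ≤ ‖y‖ ∧ ‖y‖ ≤ R}, K y‖ ≤ 1

/-- The continuous truncated singular Radon transform
`T_r^P f(x) = ∫_{‖y‖ > r} f(x − P(y)) K(y) dy`. -/
def contTruncRadon (k d₀ : ℕ) (P : Fin d₀ → MvPolynomial (Fin k) ℝ)
    (K : EuclideanSpace ℝ (Fin k) → ℂ) (r : ℝ)
    (f : EuclideanSpace ℝ (Fin d₀) → ℂ) (x : EuclideanSpace ℝ (Fin d₀)) : ℂ :=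
  ∫ y in {y : EuclideanSpace ℝ (Fin k) | r < ‖y‖},
    f (WithLp.toLp 2 (fun j => x j - MvPolynomial.eval (fun i => y i) (P j))) * K y

section SRwork
set_option linter.unusedSectionVars false
set_option linter.unusedVariables false
open scoped ENNReal NNReal Topology
open MeasureTheory
section

namespace SR

/-- Bounded integrable measurable functions. -/
structure Nice {X H : Type*} [MeasureSpace X] [NormedAddCommGroup H] (f : X → H) : Prop where
  meas : StronglyMeasurable f
  bdd : ∃ C : ℝ, ∀ x, ‖f x‖ ≤ C
  int : Integrable f

/-- Convolution with the image under `Q` of the density `k`. -/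
def Op {E V H : Type*} [MeasureSpace E] [Sub V] [NormedAddCommGroup H] [NormedSpace ℂ H]
    (k : E → ℂ) (Q : E → V) (f : V → H) (x : V) : H :=
  ∫ y, k y • f (x - Q y)

section basics
variable {X : Type*} [MeasureSpace X] {H : Type*} [NormedAddCommGroup H] [NormedSpace ℂ H]

lemma Nice.add {f g : X → H} (hf : Nice f) (hg : Nice g) : Nice (fun x => f x + g x) := by
  obtain ⟨a, ha⟩ := hf.bdd
  obtain ⟨b, hb⟩ := hg.bdd
  exact ⟨hf.meas.add hg.meas, ⟨a + b, fun x => (norm_add_le _ _).trans (add_le_add (ha x) (hb x))⟩,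
    hf.int.add hg.int⟩

lemma Nice.const_smul {f : X → H} (c : ℂ) (hf : Nice f) : Nice (fun x => c • f x) := by
  obtain ⟨a, ha⟩ := hf.bdd
  refine ⟨hf.meas.const_smul c, ⟨‖c‖ * a, fun x => ?_⟩, hf.int.smul c⟩
  rw [norm_smul]; exact mul_le_mul_of_nonneg_left (ha x) (norm_nonneg _)

lemma Nice.sub {f g : X → H} (hf : Nice f) (hg : Nice g) : Nice (fun x => f x - g x) := by
  have := hf.add (hg.const_smul (-1))
  simpa [sub_eq_add_neg] using this

lemma Nice.zero : Nice (fun _ : X => (0 : H)) :=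
  ⟨stronglyMeasurable_const, ⟨0, by simp⟩, integrable_zero _ _ _⟩

lemma Nice.sum {α : Type*} {s : Finset α} {f : α → X → H} (hf : ∀ i ∈ s, Nice (f i)) :
    Nice (fun x => ∑ i ∈ s, f i x) := by
  classical
  induction s using Finset.induction_on with
  | empty => simpa using Nice.zero
  | insert a s ha ih =>
    simp only [Finset.sum_insert ha]
    exact (hf a (by simp)).add (ih fun i hi => hf i (by simp [hi]))

lemma Nice.clm {H' : Type*} [NormedAddCommGroup H'] [NormedSpace ℂ H'] {f : X → H} (hf : Nice f)
    (A : H →L[ℂ] H') : Nice (fun x => A (f x)) := by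
  obtain ⟨a, ha⟩ := hf.bdd
  refine ⟨A.continuous.comp_stronglyMeasurable hf.meas, ⟨‖A‖ * a, fun x => ?_⟩,
    A.integrable_comp hf.int⟩
  exact (A.le_opNorm _).trans (mul_le_mul_of_nonneg_left (ha x) (norm_nonneg _))

/-- Nice functions lie in all `L^p`, `p ≥ 1`. -/
lemma Nice.lintegral_rpow_lt_top {f : X → H} (hf : Nice f) {p : ℝ} (hp : 1 ≤ p) :
    ∫⁻ x, ‖f x‖ₑ ^ p < ∞ := by
  obtain ⟨C, hC⟩ := hf.bdd
  have h : ∀ x, ‖f x‖ₑ ^ p ≤ ENNReal.ofReal C ^ (p - 1) * ‖f x‖ₑ := by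
    intro x
    rcases eq_or_ne (‖f x‖ₑ) 0 with h0 | h0
    · rw [h0, ENNReal.zero_rpow_of_pos (by linarith)]; exact zero_le
    calc ‖f x‖ₑ ^ p = ‖f x‖ₑ ^ ((p - 1) + 1) := by ring_nf
      _ = ‖f x‖ₑ ^ (p - 1) * ‖f x‖ₑ := by
        rw [ENNReal.rpow_add _ _ h0 (by simp), ENNReal.rpow_one]
      _ ≤ _ := by
        gcongr
        rw [← ofReal_norm_eq_enorm]; exact ENNReal.ofReal_le_ofReal (hC x)
  refine (lintegral_mono h).trans_lt ?_
  rw [lintegral_const_mul' _ _ (ENNReal.rpow_ne_top_of_nonneg (by linarith) (by simp))]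
  exact ENNReal.mul_lt_top (ENNReal.rpow_lt_top_of_nonneg (by linarith) (by simp)) hf.int.2

lemma Nice.memLp {f : X → H} (hf : Nice f) {p : ℝ} (hp : 1 ≤ p) :
    MemLp f (ENNReal.ofReal p) := by
  refine ⟨hf.meas.aestronglyMeasurable, ?_⟩
  rw [eLpNorm_lt_top_iff_lintegral_rpow_enorm_lt_top (by simp; linarith) (by simp)]
  rw [ENNReal.toReal_ofReal (by linarith)]
  exact hf.lintegral_rpow_lt_top hp

end basics

section op
variable {E : Type*} [MeasureSpace E] [SFinite (volume : Measure E)]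
variable {V : Type*} [NormedAddCommGroup V] [MeasureSpace V] [BorelSpace V]
  [SecondCountableTopology V] [SFinite (volume : Measure V)]
  [(volume : Measure V).IsAddLeftInvariant]
variable {H : Type*} [NormedAddCommGroup H] [NormedSpace ℂ H]

lemma op_meas_aux {k : E → ℂ} {Q : E → V} {f : V → H} (hk : Measurable k) (hQ : Measurable Q)
    (hf : StronglyMeasurable f) : StronglyMeasurable (fun z : V × E => k z.2 • f (z.1 - Q z.2)) :=
  ((hk.comp measurable_snd).stronglyMeasurable).smul
    (hf.comp_measurable (measurable_fst.sub (hQ.comp measurable_snd)))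

lemma op_integrable {k : E → ℂ} {Q : E → V} {f : V → H} (hki : Integrable k) (hQ : Measurable Q)
    (hf : Nice f) (x : V) : Integrable (fun y => k y • f (x - Q y)) := by
  obtain ⟨C, hC⟩ := hf.bdd
  exact hki.smul_bdd C
    ((hf.meas.comp_measurable (measurable_const.sub hQ)).aestronglyMeasurable)
    (Filter.Eventually.of_forall fun y => hC _)

lemma op_norm_le {k : E → ℂ} {Q : E → V} {f : V → H} (x : V) :
    ‖Op k Q f x‖ₑ ≤ ∫⁻ y, ‖k y‖ₑ * ‖f (x - Q y)‖ₑ := by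
  refine (enorm_integral_le_lintegral_enorm _).trans (le_of_eq ?_)
  simp [enorm_smul]

lemma op_young_key {k : E → ℂ} {Q : E → V} {F : V → ℝ≥0∞} (hk : Measurable k)
    (hQ : Measurable Q) (hF : Measurable F) {p : ℝ} (hp : 1 ≤ p) (x : V) :
    (∫⁻ y, ‖k y‖ₑ * F (x - Q y)) ^ p ≤
      (∫⁻ y, ‖k y‖ₑ) ^ (p - 1) * ∫⁻ y, ‖k y‖ₑ * F (x - Q y) ^ p := by
  rcases hp.eq_or_lt with h1 | h1
  · subst h1; simp
  have hpq : p.HolderConjugate (p / (p - 1)) := Real.HolderConjugate.conjExponent h1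
  have hm : Measurable fun y => F (x - Q y) := (hF.comp (measurable_const.sub hQ))
  have := ENNReal.lintegral_mul_le_Lp_mul_Lq volume hpq.symm
    (f := fun y => ‖k y‖ₑ ^ (1 / (p / (p - 1)))) (g := fun y => ‖k y‖ₑ ^ (1 / p) * F (x - Q y))
    (hk.enorm.pow_const _).aemeasurable ((hk.enorm.pow_const _).mul hm).aemeasurable
  have h2 : ∀ y, ((fun y => ‖k y‖ₑ ^ (1 / (p / (p - 1)))) * (fun y => ‖k y‖ₑ ^ (1 / p) * F (x - Q y))) y
      = ‖k y‖ₑ * F (x - Q y) := by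
    intro y
    simp only [Pi.mul_apply]
    rw [← mul_assoc, ← ENNReal.rpow_add_of_nonneg _ _ (by positivity) (by positivity)]
    · congr 1
      have : 1 / (p / (p - 1)) + 1 / p = 1 := by
        field_simp
        ring
      rw [this, ENNReal.rpow_one]
  simp only [h2] at this
  refine (ENNReal.rpow_le_rpow this (by linarith)).trans ?_
  rw [ENNReal.mul_rpow_of_nonneg _ _ (by linarith), ← ENNReal.rpow_mul, ← ENNReal.rpow_mul]
  have e1 : 1 / (p / (p - 1)) * p = p - 1 := by field_simp
  have e2 : 1 / p * p = 1 := by field_simp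
  rw [e1, e2, ENNReal.rpow_one]
  apply le_of_eq
  congr 1
  · congr 1
    refine lintegral_congr fun y => ?_
    rw [← ENNReal.rpow_mul]
    have : 1 / (p / (p - 1)) * (p / (p - 1)) = 1 := by
      have : p - 1 ≠ 0 := by linarith
      field_simp
    rw [this, ENNReal.rpow_one]
  · refine lintegral_congr fun y => ?_
    rw [ENNReal.mul_rpow_of_nonneg _ _ (by linarith), ← ENNReal.rpow_mul, e2, ENNReal.rpow_one]

/-- Young inequality. -/
lemma op_young {k : E → ℂ} {Q : E → V} {f : V → H} (hk : Measurable k)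
    (hQ : Measurable Q) (hf : StronglyMeasurable f) {p : ℝ} (hp : 1 ≤ p) :
    ∫⁻ x, ‖Op k Q f x‖ₑ ^ p ≤ (∫⁻ y, ‖k y‖ₑ) ^ p * ∫⁻ x, ‖f x‖ₑ ^ p := by
  have hfm : Measurable fun x => ‖f x‖ₑ := hf.enorm
  have key : ∀ x, ‖Op k Q f x‖ₑ ^ p ≤
      (∫⁻ y, ‖k y‖ₑ) ^ (p - 1) * ∫⁻ y, ‖k y‖ₑ * ‖f (x - Q y)‖ₑ ^ p := by
    intro x
    refine (ENNReal.rpow_le_rpow (op_norm_le x) (by linarith)).trans ?_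
    exact op_young_key hk hQ hfm hp x
  refine (lintegral_mono key).trans ?_
  have hm : Measurable (fun z : V × E => ‖k z.2‖ₑ * ‖f (z.1 - Q z.2)‖ₑ ^ p) :=
    (hk.comp measurable_snd).enorm.mul
      ((hfm.comp (measurable_fst.sub (hQ.comp measurable_snd))).pow_const _)
  rw [lintegral_const_mul _ hm.lintegral_prod_right']
  rw [lintegral_lintegral_swap hm.aemeasurable]
  have : ∀ y, ∫⁻ x, ‖k y‖ₑ * ‖f (x - Q y)‖ₑ ^ p = ‖k y‖ₑ * ∫⁻ x, ‖f x‖ₑ ^ p := by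
    intro y
    rw [lintegral_const_mul' _ _ (by simp)]
    rw [lintegral_sub_right_eq_self (fun x => ‖f x‖ₑ ^ p) (Q y)]
  simp only [this]
  rw [lintegral_mul_const _ hk.enorm, ← mul_assoc]
  gcongr
  by_cases h0 : ∫⁻ y, ‖k y‖ₑ = 0
  · rw [h0, mul_zero]; exact zero_le
  by_cases ht : ∫⁻ y, ‖k y‖ₑ = ∞
  · rw [ht, ENNReal.top_rpow_of_pos (by linarith : (0:ℝ) < p)]; exact le_top
  · nth_rewrite 2 [← ENNReal.rpow_one (∫⁻ y, ‖k y‖ₑ)]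
    rw [← ENNReal.rpow_add _ _ h0 ht]; simp

lemma Nice.op {k : E → ℂ} {Q : E → V} {f : V → H} (hk : Measurable k) (hki : Integrable k)
    (hQ : Measurable Q) (hf : Nice f) : Nice (Op k Q f) := by
  have hm : StronglyMeasurable (Op k Q f) :=
    ((op_meas_aux hk hQ hf.meas).integral_prod_right)
  refine ⟨hm, ?_, ?_⟩
  · obtain ⟨C, hC⟩ := hf.bdd
    refine ⟨∫ y, ‖k y‖ * C, fun x => ?_⟩
    refine norm_integral_le_of_norm_le (hki.norm.mul_const C) (Filter.Eventually.of_forall fun y => ?_)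
    rw [norm_smul]; exact mul_le_mul_of_nonneg_left (hC _) (norm_nonneg _)
  · refine ⟨hm.aestronglyMeasurable, ?_⟩
    have := op_young (p := 1) hk hQ hf.meas le_rfl
    simp only [ENNReal.rpow_one] at this
    exact this.trans_lt (ENNReal.mul_lt_top hki.2 hf.int.2)

lemma op_add {k : E → ℂ} {Q : E → V} {f g : V → H} (hki : Integrable k) (hQ : Measurable Q)
    (hf : Nice f) (hg : Nice g) (x : V) :
    Op k Q (fun x => f x + g x) x = Op k Q f x + Op k Q g x := by
  simp only [Op, smul_add]
  exact integral_add (op_integrable hki hQ hf x) (op_integrable hki hQ hg x)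

lemma op_sub {k : E → ℂ} {Q : E → V} {f g : V → H} (hki : Integrable k) (hQ : Measurable Q)
    (hf : Nice f) (hg : Nice g) (x : V) :
    Op k Q (fun x => f x - g x) x = Op k Q f x - Op k Q g x := by
  simp only [Op, smul_sub]
  exact integral_sub (op_integrable hki hQ hf x) (op_integrable hki hQ hg x)

lemma op_sum {k : E → ℂ} {Q : E → V} {α : Type*} {s : Finset α} {f : α → V → H}
    (hki : Integrable k) (hQ : Measurable Q) (hf : ∀ i ∈ s, Nice (f i)) (x : V) :
    Op k Q (fun x => ∑ i ∈ s, f i x) x = ∑ i ∈ s, Op k Q (f i) x := by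
  simp only [Op, Finset.smul_sum]
  exact integral_finsetSum s fun i hi => op_integrable hki hQ (hf i hi) x

lemma op_clm {H' : Type*} [NormedAddCommGroup H'] [NormedSpace ℂ H'] [CompleteSpace H]
    [CompleteSpace H'] {k : E → ℂ} {Q : E → V} {f : V → H}
    (hki : Integrable k) (hQ : Measurable Q) (hf : Nice f) (A : H →L[ℂ] H') (x : V) :
    Op k Q (fun x => A (f x)) x = A (Op k Q f x) := by
  simp only [Op]
  rw [← A.integral_comp_comm (op_integrable hki hQ hf x)]
  simp

lemma op_kadd {k k' : E → ℂ} {Q : E → V} {f : V → H} (hki : Integrable k) (hki' : Integrable k')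
    (hQ : Measurable Q) (hf : Nice f) (x : V) :
    Op (fun y => k y + k' y) Q f x = Op k Q f x + Op k' Q f x := by
  simp only [Op, add_smul]
  exact integral_add (op_integrable hki hQ hf x) (op_integrable hki' hQ hf x)

lemma op_ksub {k k' : E → ℂ} {Q : E → V} {f : V → H} (hki : Integrable k) (hki' : Integrable k')
    (hQ : Measurable Q) (hf : Nice f) (x : V) :
    Op (fun y => k y - k' y) Q f x = Op k Q f x - Op k' Q f x := by
  simp only [Op, sub_smul]
  exact integral_sub (op_integrable hki hQ hf x) (op_integrable hki' hQ hf x)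

lemma op_kconst_mul {k : E → ℂ} {Q : E → V} {f : V → H} (c : ℂ) (x : V) :
    Op (fun y => c * k y) Q f x = c • Op k Q f x := by
  simp only [Op, ← integral_smul, mul_smul]

lemma op_ksum {α : Type*} {s : Finset α} {k : α → E → ℂ} {Q : E → V} {f : V → H}
    (hki : ∀ i ∈ s, Integrable (k i)) (hQ : Measurable Q) (hf : Nice f) (x : V) :
    Op (fun y => ∑ i ∈ s, k i y) Q f x = ∑ i ∈ s, Op (k i) Q f x := by
  simp only [Op, Finset.sum_smul]
  exact integral_finsetSum s fun i hi => op_integrable (hki i hi) hQ hf x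

lemma op_comm {E' : Type*} [MeasureSpace E'] [SFinite (volume : Measure E')]
    {k : E → ℂ} {Q : E → V} {k' : E' → ℂ} {Q' : E' → V} {f : V → H}
    (hk : Measurable k) (hki : Integrable k) (hQ : Measurable Q)
    (hk' : Measurable k') (hki' : Integrable k') (hQ' : Measurable Q') (hf : Nice f) (x : V) :
    Op k Q (Op k' Q' f) x = Op k' Q' (Op k Q f) x := by
  simp only [Op, ← integral_smul]
  rw [integral_integral_swap]
  · congr 1; ext y; congr 1; ext z
    rw [sub_right_comm, smul_smul, smul_smul, mul_comm]
  · obtain ⟨C, hC⟩ := hf.bdd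
    have := (hki.mul_prod hki').smul_bdd C (f := fun z : E × E' => f (x - Q z.1 - Q' z.2))
      ((hf.meas.comp_measurable ((measurable_const.sub (hQ.comp measurable_fst)).sub
        (hQ'.comp measurable_snd))).aestronglyMeasurable) (Filter.Eventually.of_forall fun y => hC _)
    refine this.congr (Filter.Eventually.of_forall fun z => ?_)
    simp [Function.uncurry, mul_smul]

lemma op_assoc [CompleteSpace H] {k : E → ℂ} {Q : E → V} {d : V → ℂ} {f : V → H}
    (hk : Measurable k) (hki : Integrable k) (hQ : Measurable Q)
    (hd : Nice d) (hf : Nice f) (x : V) :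
    Op (Op k Q d) id f x = Op k Q (Op d id f) x := by
  have e : ∀ y, (∫ z, k z • d (y - Q z)) • f (x - y) = ∫ z, (k z * d (y - Q z)) • f (x - y) := by
    intro y
    rw [← integral_smul_const]; rfl
  simp only [Op, ← integral_smul, id, e]
  rw [integral_integral_swap]
  · congr 1; ext y
    rw [← integral_add_right_eq_self _ (Q y)]
    congr 1; ext z
    rw [add_sub_cancel_right, sub_add_eq_sub_sub_swap, mul_smul]
  · obtain ⟨C, hC⟩ := hf.bdd
    have hm : StronglyMeasurable (fun z : V × E => k z.2 * d (z.1 - Q z.2)) := op_meas_aux hk hQ hd.meas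
    have h1 : Integrable (fun z : V × E => k z.2 * d (z.1 - Q z.2)) := by
      refine ⟨hm.aestronglyMeasurable, ?_⟩
      rw [HasFiniteIntegral, MeasureTheory.Measure.volume_eq_prod, lintegral_prod_symm' _ hm.enorm]
      have : ∀ y, ∫⁻ x, ‖k y * d (x - Q y)‖ₑ = ‖k y‖ₑ * ∫⁻ x, ‖d x‖ₑ := by
        intro y
        simp only [enorm_mul]
        rw [lintegral_const_mul' _ _ (by simp)]
        rw [lintegral_sub_right_eq_self (fun x => ‖d x‖ₑ) (Q y)]
      simp only [this]
      rw [lintegral_mul_const _ hk.enorm]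
      exact ENNReal.mul_lt_top hki.2 hd.int.2
    have := h1.smul_bdd C (f := fun z : V × E => f (x - z.1))
      ((hf.meas.comp_measurable (measurable_const.sub (measurable_fst))).aestronglyMeasurable)
      (Filter.Eventually.of_forall fun y => hC _)
    exact this

end op
end SR
end

section

namespace SR

section planch
open FourierTransform SchwartzMap
variable {E F : Type*}
  [NormedAddCommGroup E] [InnerProductSpace ℝ E] [FiniteDimensional ℝ E] [MeasurableSpace E] [BorelSpace E]
  [NormedAddCommGroup F] [InnerProductSpace ℂ F] [CompleteSpace F]

lemma fourier_Lp_ae {f : E → F} (hf : Integrable f) (h2 : MemLp f 2) :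
    ((𝓕 (h2.toLp f) : Lp (α := E) F 2) : E → F) =ᵐ[volume] 𝓕 f := by
  have hc : Continuous (𝓕 f) := by
    exact VectorFourier.fourierIntegral_continuous Real.continuous_fourierChar
      (by exact continuous_inner) hf
  refine ae_eq_of_integral_contDiff_smul_eq ?_ ?_ ?_
  · exact (Lp.memLp _).locallyIntegrable (by norm_num)
  · exact hc.locallyIntegrable
  intro g hg hgc
  have hgc' : HasCompactSupport (fun x => (g x : ℂ)) := hgc.comp_left (g := fun t : ℝ => (t : ℂ)) (by simp)
  have hg' : ContDiff ℝ (⊤ : ℕ∞) (fun x => (g x : ℂ)) := Complex.ofRealCLM.contDiff.comp hg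
  let φ : 𝓢(E, ℂ) := hgc'.toSchwartzMap hg'
  have hφ : ∀ x, φ x = (g x : ℂ) := fun x => rfl
  have h1 := congrArg (fun D : 𝓢'(E, F) => D φ) (Lp.fourier_toTemperedDistribution_eq (h2.toLp f))
  simp only [TemperedDistribution.fourier_apply, Lp.toTemperedDistribution_apply] at h1
  have e1 : ∫ x, g x • ((𝓕 (h2.toLp f) : Lp F 2 (volume : Measure E)) : E → F) x
      = ∫ x, φ x • ((𝓕 (h2.toLp f) : Lp F 2 (volume : Measure E)) : E → F) x := by
    refine integral_congr_ae (Filter.Eventually.of_forall fun x => ?_)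
    simp [hφ]
  have e2 : ∫ x, g x • 𝓕 f x = ∫ x, φ x • 𝓕 f x := by
    refine integral_congr_ae (Filter.Eventually.of_forall fun x => ?_)
    simp [hφ]
  rw [e1, e2, ← h1]
  have e3 : ∫ x, (𝓕 φ) x • (h2.toLp f : E → F) x = ∫ x, (𝓕 φ) x • f x := by
    refine integral_congr_ae ?_
    filter_upwards [h2.coeFn_toLp] with x hx
    rw [hx]
  rw [e3]
  have := VectorFourier.integral_fourierIntegral_smul_eq_flip (L := innerₗ E)
      (μ := volume) (ν := volume) (f := fun x => φ x) (g := f) Real.continuous_fourierChar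
      (by exact continuous_inner) φ.integrable hf
  rw [flip_innerₗ] at this
  exact this

lemma plancherel_aux {f : E → F} (hf : Integrable f) (h2 : MemLp f 2) :
    ∫⁻ x, ‖𝓕 f x‖ₑ ^ (2:ℝ) = ∫⁻ x, ‖f x‖ₑ ^ (2:ℝ) := by
  have h := Lp.norm_fourier_eq (h2.toLp f)
  have e := fourier_Lp_ae hf h2
  have hm : MemLp (𝓕 f) 2 := (memLp_congr_ae e).1 (Lp.memLp _)
  have : eLpNorm (𝓕 f) 2 volume = eLpNorm f 2 volume := by
    rw [← eLpNorm_congr_ae e, ← eLpNorm_congr_ae h2.coeFn_toLp]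
    rw [Lp.norm_def, Lp.norm_def] at h
    exact (ENNReal.toReal_eq_toReal_iff' (Lp.eLpNorm_ne_top _) (Lp.eLpNorm_ne_top _)).1 h
  rw [eLpNorm_eq_lintegral_rpow_enorm_toReal (by norm_num) (by norm_num),
    eLpNorm_eq_lintegral_rpow_enorm_toReal (by norm_num) (by norm_num)] at this
  simp only [ENNReal.toReal_ofNat] at this
  have h3 := congrArg (fun t => t ^ (2:ℝ)) this
  simpa only [← ENNReal.rpow_mul, one_div, inv_mul_cancel₀ (two_ne_zero (α := ℝ)), ENNReal.rpow_one] using h3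

end planch

section ft
variable {Γ : Type*} [Fintype Γ]
variable {H : Type*} [NormedAddCommGroup H] [InnerProductSpace ℂ H] [CompleteSpace H]

def dotp (x ξ : Γ → ℝ) : ℝ := ∑ α, x α * ξ α

def chi (t : ℝ) : ℂ := Complex.exp ((-2 * Real.pi * t : ℝ) * Complex.I)

lemma norm_chi (t : ℝ) : ‖chi t‖ = 1 := Complex.norm_exp_ofReal_mul_I _
lemma enorm_chi (t : ℝ) : ‖chi t‖ₑ = 1 := by
  rw [← ofReal_norm, norm_chi]; simp

lemma chi_add (s t : ℝ) : chi (s + t) = chi s * chi t := by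
  simp only [chi, ← Complex.exp_add]; congr 1; push_cast; ring

lemma chi_zero : chi 0 = 1 := by simp [chi]

lemma continuous_chi : Continuous chi := by unfold chi; fun_prop

lemma norm_chi_sub_one (t : ℝ) : ‖chi t - 1‖ ≤ 2 * Real.pi * |t| := by
  have := Real.norm_exp_I_mul_ofReal_sub_one_le (x := -2 * Real.pi * t)
  unfold chi
  rw [mul_comm]
  refine this.trans (le_of_eq ?_)
  rw [Real.norm_eq_abs, abs_mul, abs_mul, abs_neg, abs_of_pos Real.pi_pos]
  simp

lemma dotp_add (x y ξ : Γ → ℝ) : dotp (x + y) ξ = dotp x ξ + dotp y ξ := by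
  simp [dotp, add_mul, Finset.sum_add_distrib]

lemma continuous_dotp (ξ : Γ → ℝ) : Continuous fun x => dotp x ξ := by unfold dotp; fun_prop

/-- Fourier transform on `Γ → ℝ`. -/
def ft (f : (Γ → ℝ) → H) (ξ : Γ → ℝ) : H := ∫ x, chi (dotp x ξ) • f x

/-- multiplier of `Op k Q`. -/
def mu {E : Type*} [MeasureSpace E] (k : E → ℂ) (Q : E → Γ → ℝ) (ξ : Γ → ℝ) : ℂ :=
  ∫ y, k y * chi (dotp (Q y) ξ)

lemma plancherel {f : (Γ → ℝ) → H} (hf : Nice f) :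
    ∫⁻ ξ, ‖ft f ξ‖ₑ ^ (2:ℝ) = ∫⁻ x, ‖f x‖ₑ ^ (2:ℝ) := by
  have mp := EuclideanSpace.volume_preserving_symm_measurableEquiv_toLp Γ
  have me := (MeasurableEquiv.toLp 2 (Γ → ℝ)).symm.measurableEmbedding
  let g : EuclideanSpace ℝ Γ → H := fun x => f ((MeasurableEquiv.toLp 2 (Γ → ℝ)).symm x)
  have hgi : Integrable g := (mp.integrable_comp_emb me).2 hf.int
  have hf2 : MemLp f 2 := by simpa using hf.memLp (p := 2) (by norm_num)
  have hg2 : MemLp g 2 := hf2.comp_measurePreserving mp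
  have := plancherel_aux hgi hg2
  have e1 : ∫⁻ x, ‖g x‖ₑ ^ (2:ℝ) = ∫⁻ x, ‖f x‖ₑ ^ (2:ℝ) :=
    mp.lintegral_comp_emb me (fun x => ‖f x‖ₑ ^ (2:ℝ))
  have e2 : ∀ ξ, FourierTransform.fourier g ξ = ft f ((MeasurableEquiv.toLp 2 (Γ → ℝ)).symm ξ) := by
    intro ξ
    rw [Real.fourier_eq', ft, ← mp.integral_comp me]
    congr 1; ext x
    congr 1
    unfold chi
    rw [show inner ℝ x ξ = dotp ((MeasurableEquiv.toLp 2 (Γ → ℝ)).symm x)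
      ((MeasurableEquiv.toLp 2 (Γ → ℝ)).symm ξ) from ?_]
    · simp [dotp, PiLp.inner_apply, mul_comm]
  have e3 : ∫⁻ ξ, ‖FourierTransform.fourier g ξ‖ₑ ^ (2:ℝ) = ∫⁻ x, ‖ft f x‖ₑ ^ (2:ℝ) := by
    simp only [e2]
    exact mp.lintegral_comp_emb me (fun x => ‖ft f x‖ₑ ^ (2:ℝ))
  rw [← e1, ← e3, this]

lemma chi_smul_integrable {X : Type*} [MeasureSpace X] {f : X → H} (hf : Integrable f)
    {Q : X → Γ → ℝ} (hQ : Measurable Q) (ξ : Γ → ℝ) :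
    Integrable (fun x => chi (dotp (Q x) ξ) • f x) := by
  refine hf.bdd_smul 1 ?_ ?_
  · exact ((continuous_chi.comp (continuous_dotp ξ)).measurable.comp hQ).aestronglyMeasurable
  · exact Filter.Eventually.of_forall fun x => (norm_chi _).le

lemma ft_add {f g : (Γ → ℝ) → H} (hf : Nice f) (hg : Nice g) (ξ : Γ → ℝ) :
    ft (fun x => f x + g x) ξ = ft f ξ + ft g ξ := by
  simp only [ft, smul_add]
  exact integral_add (chi_smul_integrable hf.int measurable_id ξ)
    (chi_smul_integrable hg.int measurable_id ξ)

lemma ft_sum {α : Type*} {s : Finset α} {f : α → (Γ → ℝ) → H} (hf : ∀ i ∈ s, Nice (f i)) (ξ : Γ → ℝ) :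
    ft (fun x => ∑ i ∈ s, f i x) ξ = ∑ i ∈ s, ft (f i) ξ := by
  simp only [ft, Finset.smul_sum]
  exact integral_finsetSum _ fun i hi => chi_smul_integrable (hf i hi).int measurable_id ξ

lemma ft_op {E : Type*} [MeasureSpace E] [SFinite (volume : Measure E)]
    {k : E → ℂ} {Q : E → Γ → ℝ} {f : (Γ → ℝ) → H}
    (hk : Measurable k) (hki : Integrable k) (hQ : Measurable Q) (hf : Nice f) (ξ : Γ → ℝ) :
    ft (Op k Q f) ξ = mu k Q ξ • ft f ξ := by
  have hm : StronglyMeasurable (fun z : (Γ → ℝ) × E => k z.2 • f (z.1 - Q z.2)) := op_meas_aux hk hQ hf.meas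
  have h1 : Integrable (fun z : (Γ → ℝ) × E => k z.2 • f (z.1 - Q z.2)) (volume.prod volume) := by
    refine ⟨hm.aestronglyMeasurable, ?_⟩
    rw [HasFiniteIntegral, lintegral_prod_symm' _ hm.enorm]
    have : ∀ y, ∫⁻ x, ‖k y • f (x - Q y)‖ₑ = ‖k y‖ₑ * ∫⁻ x, ‖f x‖ₑ := by
      intro y
      simp only [enorm_smul]
      rw [lintegral_const_mul' _ _ (by simp)]
      rw [lintegral_sub_right_eq_self (fun x => ‖f x‖ₑ) (Q y)]
    simp only [this]
    rw [lintegral_mul_const _ hk.enorm]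
    exact ENNReal.mul_lt_top hki.2 hf.int.2
  have e0 : ft (Op k Q f) ξ = ∫ x, ∫ y, chi (dotp x ξ) • (k y • f (x - Q y)) := by
    simp only [ft, Op, ← integral_smul]
  rw [e0, integral_integral_swap]
  · rw [mu, ← integral_smul_const]
    congr 1; ext y
    rw [← integral_add_right_eq_self _ (Q y), ft, ← integral_smul]
    congr 1; ext z
    rw [add_sub_cancel_right, dotp_add, chi_add, smul_smul, smul_smul]
    congr 1; ring
  · refine h1.bdd_smul 1 (φ := fun z : (Γ → ℝ) × E => chi (dotp z.1 ξ)) ?_ ?_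
    · exact ((continuous_chi.comp (continuous_dotp ξ)).measurable.comp measurable_fst).aestronglyMeasurable
    · exact Filter.Eventually.of_forall fun x => (norm_chi _).le

lemma mu_op {E : Type*} [MeasureSpace E] [SFinite (volume : Measure E)]
    {k : E → ℂ} {Q : E → Γ → ℝ} {d : (Γ → ℝ) → ℂ}
    (hk : Measurable k) (hki : Integrable k) (hQ : Measurable Q) (hd : Nice d) (ξ : Γ → ℝ) :
    mu (Op k Q d) id ξ = mu k Q ξ * mu d id ξ := by
  have := ft_op hk hki hQ hd ξ
  simp only [ft, smul_eq_mul] at this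
  simp only [mu, id, smul_eq_mul] at this ⊢
  simp only [mul_comm (d _), mul_comm (Op _ _ _ _)]
  exact this

lemma stronglyMeasurable_ft {f : (Γ → ℝ) → H} (hf : Nice f) : StronglyMeasurable (ft f) := by
  have : StronglyMeasurable (fun z : (Γ → ℝ) × (Γ → ℝ) => chi (dotp z.2 z.1) • f z.2) := by
    refine StronglyMeasurable.smul ?_ (hf.meas.comp_measurable measurable_snd)
    have : Continuous (fun z : (Γ → ℝ) × (Γ → ℝ) => chi (dotp z.2 z.1)) := by
      refine continuous_chi.comp ?_
      unfold dotp; fun_prop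
    exact this.stronglyMeasurable
  exact this.integral_prod_right

/-- `L²` bound of a square function. -/
lemma l2_square {E : Type*} [MeasureSpace E] [SFinite (volume : Measure E)]
    {J : Type*} (s : Finset J) {k : J → E → ℂ} {Q : E → Γ → ℝ} {f : (Γ → ℝ) → H}
    (hk : ∀ j ∈ s, Measurable (k j)) (hki : ∀ j ∈ s, Integrable (k j)) (hQ : Measurable Q) (hf : Nice f)
    {C : ℝ} (hC : ∀ ξ, ∑ j ∈ s, ‖mu (k j) Q ξ‖ ≤ C) :
    ∑ j ∈ s, ∫⁻ x, ‖Op (k j) Q f x‖ₑ ^ (2:ℝ) ≤ ENNReal.ofReal C ^ (2:ℝ) * ∫⁻ x, ‖f x‖ₑ ^ (2:ℝ) := by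
  calc ∑ j ∈ s, ∫⁻ x, ‖Op (k j) Q f x‖ₑ ^ (2:ℝ)
      = ∑ j ∈ s, ∫⁻ ξ, ‖mu (k j) Q ξ‖ₑ ^ (2:ℝ) * ‖ft f ξ‖ₑ ^ (2:ℝ) := by
        refine Finset.sum_congr rfl fun j hj => ?_
        rw [← plancherel (hf.op (hk j hj) (hki j hj) hQ)]
        refine lintegral_congr fun ξ => ?_
        rw [ft_op (hk j hj) (hki j hj) hQ hf, enorm_smul, ENNReal.mul_rpow_of_nonneg _ _ (by norm_num)]
    _ ≤ ∫⁻ ξ, ∑ j ∈ s, ‖mu (k j) Q ξ‖ₑ ^ (2:ℝ) * ‖ft f ξ‖ₑ ^ (2:ℝ) := by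
        have : ∀ j ∈ s, Measurable fun ξ => ‖mu (k j) Q ξ‖ₑ ^ (2:ℝ) * ‖ft f ξ‖ₑ ^ (2:ℝ) := by
          intro j hj
          have := (stronglyMeasurable_ft (hf.op (hk j hj) (hki j hj) hQ)).enorm.pow_const (2:ℝ)
          convert this using 2 with ξ
          rw [ft_op (hk j hj) (hki j hj) hQ hf, enorm_smul, ENNReal.mul_rpow_of_nonneg _ _ (by norm_num)]
        rw [lintegral_finsetSum' _ fun j hj => (this j hj).aemeasurable]
    _ ≤ ∫⁻ ξ, ENNReal.ofReal C ^ (2:ℝ) * ‖ft f ξ‖ₑ ^ (2:ℝ) := by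
        refine lintegral_mono fun ξ => ?_
        rw [← Finset.sum_mul]
        gcongr
        calc ∑ j ∈ s, ‖mu (k j) Q ξ‖ₑ ^ (2:ℝ) ≤ (∑ j ∈ s, ‖mu (k j) Q ξ‖ₑ) ^ (2:ℝ) := by
              simp only [ENNReal.rpow_ofNat]
              exact Finset.sum_sq_le_sq_sum_of_nonneg (fun i _ => zero_le)
          _ ≤ _ := by
              gcongr
              simp only [← ofReal_norm]
              rw [← ENNReal.ofReal_sum_of_nonneg fun i _ => norm_nonneg _]
              exact ENNReal.ofReal_le_ofReal (hC ξ)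
    _ = _ := by
        rw [lintegral_const_mul' _ _ (ENNReal.rpow_ne_top_of_nonneg (by norm_num) (by simp)), plancherel hf]

lemma l2_cosquare {E : Type*} [MeasureSpace E] [SFinite (volume : Measure E)]
    {J : Type*} (s : Finset J) {k : J → E → ℂ} {Q : E → Γ → ℝ} {g : J → (Γ → ℝ) → H}
    (hk : ∀ j ∈ s, Measurable (k j)) (hki : ∀ j ∈ s, Integrable (k j)) (hQ : Measurable Q)
    (hg : ∀ j ∈ s, Nice (g j))
    {C : ℝ} (hC : ∀ ξ, ∑ j ∈ s, ‖mu (k j) Q ξ‖ ≤ C) :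
    ∫⁻ x, ‖∑ j ∈ s, Op (k j) Q (g j) x‖ₑ ^ (2:ℝ) ≤
      ENNReal.ofReal C ^ (2:ℝ) * ∫⁻ x, ∑ j ∈ s, ‖g j x‖ₑ ^ (2:ℝ) := by
  have hC0 : 0 ≤ C := le_trans (Finset.sum_nonneg fun i _ => norm_nonneg _) (hC 0)
  rw [← plancherel (Nice.sum fun j hj => (hg j hj).op (hk j hj) (hki j hj) hQ)]
  have hp : ∀ ξ, ‖ft (fun x => ∑ j ∈ s, Op (k j) Q (g j) x) ξ‖ₑ ^ (2:ℝ) ≤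
      ENNReal.ofReal C ^ (2:ℝ) * ∑ j ∈ s, ‖ft (g j) ξ‖ₑ ^ (2:ℝ) := by
    intro ξ
    rw [ft_sum fun j hj => (hg j hj).op (hk j hj) (hki j hj) hQ]
    rw [Finset.sum_congr rfl fun j hj => ft_op (hk j hj) (hki j hj) hQ (hg j hj) ξ]
    simp only [← ofReal_norm, ENNReal.rpow_ofNat]
    simp only [← ENNReal.ofReal_pow (norm_nonneg _)]
    rw [← ENNReal.ofReal_pow hC0, ← ENNReal.ofReal_sum_of_nonneg fun i _ => by positivity,
      ← ENNReal.ofReal_mul (by positivity)]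
    apply ENNReal.ofReal_le_ofReal
    have h1 : ‖∑ j ∈ s, mu (k j) Q ξ • ft (g j) ξ‖ ≤ ∑ j ∈ s, ‖mu (k j) Q ξ‖ * ‖ft (g j) ξ‖ :=
      (norm_sum_le _ _).trans (Finset.sum_le_sum fun j _ => (norm_smul _ _).le)
    calc _ ≤ (∑ j ∈ s, ‖mu (k j) Q ξ‖ * ‖ft (g j) ξ‖) ^ 2 := by gcongr
      _ ≤ (∑ j ∈ s, ‖mu (k j) Q ξ‖ ^ 2) * ∑ j ∈ s, ‖ft (g j) ξ‖ ^ 2 :=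
        Finset.sum_mul_sq_le_sq_mul_sq _ _ _
      _ ≤ C ^ 2 * _ := by
        gcongr
        refine (Finset.sum_sq_le_sq_sum_of_nonneg (fun i _ => norm_nonneg _)).trans ?_
        have := hC ξ
        have h0 : 0 ≤ ∑ j ∈ s, ‖mu (k j) Q ξ‖ := Finset.sum_nonneg fun i _ => norm_nonneg _
        gcongr
  refine (lintegral_mono hp).trans ?_
  rw [lintegral_const_mul' _ _ (ENNReal.rpow_ne_top_of_nonneg (by norm_num) (by simp)),
    lintegral_finsetSum' _ fun j hj => ((stronglyMeasurable_ft (hg j hj)).enorm.pow_const _).aemeasurable,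
    lintegral_finsetSum' _ fun j hj => ((hg j hj).meas.enorm.pow_const _).aemeasurable]
  refine mul_le_mul_right (Finset.sum_le_sum fun j hj => ?_) _
  exact (plancherel (hg j hj)).le

end ft
end SR
end

section

namespace SR

section sublevel
open Polynomial

lemma sublevel_1d (R : ℝ) (hR : 1 ≤ R) (D : ℕ) : ∃ C ε : ℝ, 0 < C ∧ 0 < ε ∧ ε ≤ 1 ∧
    ∀ (P : ℝ[X]) (B t : ℝ) (m : ℕ), P.natDegree ≤ D → 0 < B → 0 < t → B ≤ |P.coeff m| →
      volume {s : ℝ | |s| ≤ R ∧ |P.eval s| ≤ t} ≤ ENNReal.ofReal (C * (t / B) ^ ε) := by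
  have hvol : ∀ P : ℝ[X], ∀ t : ℝ, volume {s : ℝ | |s| ≤ R ∧ |P.eval s| ≤ t} ≤ ENNReal.ofReal (2 * R) := by
    intro P t
    calc _ ≤ volume (Set.Icc (-R) R) := measure_mono fun s hs => abs_le.1 hs.1
      _ = _ := by rw [Real.volume_Icc]; congr 1; ring
  induction D with
  | zero =>
    refine ⟨2 * R, 1, by linarith, one_pos, le_rfl, fun P B t m hP hB ht hm => ?_⟩
    have h0 : P = C (P.coeff 0) := eq_C_of_natDegree_le_zero hP
    rcases le_or_gt B t with h | h
    · refine (hvol P t).trans (ENNReal.ofReal_le_ofReal ?_)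
      have : 1 ≤ t / B := (one_le_div hB).2 h
      rw [Real.rpow_one]; nlinarith
    · have : {s : ℝ | |s| ≤ R ∧ |P.eval s| ≤ t} = ∅ := by
        ext s
        simp only [Set.mem_ofPred_eq, Set.mem_empty_iff_false, iff_false, not_and, not_le]
        intro _
        rw [h0, eval_C]
        have : m = 0 := by
          by_contra hm0
          rw [coeff_eq_zero_of_natDegree_lt (by omega)] at hm
          simp at hm; linarith
        subst this; linarith
      rw [this]; simp
  | succ D ih =>
    obtain ⟨C₀, ε, hC₀, hε, hε1, ih⟩ := ih
    -- constants
    set S : ℝ := ∑ i ∈ Finset.range (D + 1), R ^ (i + 1) with hS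
    have hS0 : 0 ≤ S := Finset.sum_nonneg fun i _ => by positivity
    set c : ℝ := 1 / (2 * (S + 1)) with hc
    have hcpos : 0 < c := by positivity
    have hc1 : c ≤ 1 := by rw [hc, div_le_one (by positivity)]; linarith
    have hcS : c * S ≤ 1 / 2 := by
      rw [hc, one_div_mul_eq_div, div_le_div_iff₀ (by positivity) (by norm_num)]; linarith
    set A : ℝ := 2 * (1 + R) / c with hA
    have hApos : 0 < A := by positivity
    have hA2 : 2 ≤ A := by
      rw [hA, le_div_iff₀ hcpos]; nlinarith
    refine ⟨2 * R * 2 + 2 + C₀ * A ^ ε, ε / 2, by positivity, by positivity, by linarith,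
      fun P B t m hP hB ht hm => ?_⟩
    have hx : 0 < t / B := by positivity
    -- trivial case
    rcases le_or_gt (1 / 2) (t / B) with h | h
    · refine (hvol P t).trans (ENNReal.ofReal_le_ofReal ?_)
      have h1 : (1 / 2 : ℝ) ≤ (t / B) ^ (ε / 2) := by
        rcases le_or_gt 1 (t / B) with h' | h'
        · have := Real.one_le_rpow h' (by positivity : 0 ≤ ε / 2); linarith
        · calc (1/2 : ℝ) ≤ t / B := h
            _ = (t / B) ^ (1:ℝ) := (Real.rpow_one _).symm
            _ ≤ _ := Real.rpow_le_rpow_of_exponent_ge hx h'.le (by linarith)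
      have h2 : 0 < C₀ * A ^ ε := by positivity
      nlinarith
    by_cases hE : ∃ s₀ : ℝ, |s₀| ≤ R ∧ |P.eval s₀| ≤ t
    swap
    · have : {s : ℝ | |s| ≤ R ∧ |P.eval s| ≤ t} = ∅ := by
        ext s; simp only [Set.mem_ofPred_eq, Set.mem_empty_iff_false, iff_false]
        exact fun hs => hE ⟨s, hs⟩
      rw [this]; simp
    obtain ⟨s₀, hs₀, hPs₀⟩ := hE
    have htB : t < B / 2 := by
      rw [div_lt_iff₀ hB] at h; linarith
    -- some higher coefficient is large
    obtain ⟨m', hm'1, hm'⟩ : ∃ m', 1 ≤ m' ∧ c * B ≤ |P.coeff m'| := by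
      by_contra hcon
      push Not at hcon
      have hm0 : m = 0 := by
        by_contra h0
        have := hcon m (by omega)
        nlinarith
      subst hm0
      have e : P.eval s₀ = (∑ i ∈ Finset.range (D + 1), P.coeff (i + 1) * s₀ ^ (i + 1)) + P.coeff 0 := by
        rw [eval_eq_sum_range' (n := D + 2) (by omega), Finset.sum_range_succ']; simp
      have h3 : |∑ i ∈ Finset.range (D + 1), P.coeff (i + 1) * s₀ ^ (i + 1)| ≤ c * B * S := by
        rw [hS, Finset.mul_sum]
        refine (Finset.abs_sum_le_sum_abs _ _).trans (Finset.sum_le_sum fun i _ => ?_)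
        rw [abs_mul, abs_pow]
        exact mul_le_mul (hcon _ (by omega)).le (pow_le_pow_left₀ (abs_nonneg _) hs₀ _) (by positivity) (by positivity)
      have h4 : |P.coeff 0| ≤ |P.eval s₀| + c * B * S := by
        have : P.coeff 0 = P.eval s₀ - ∑ i ∈ Finset.range (D + 1), P.coeff (i + 1) * s₀ ^ (i + 1) := by
          rw [e]; ring
        rw [this]
        exact (abs_sub _ _).trans (by linarith)
      nlinarith
    set Q := P /ₘ (X - C s₀) with hQ
    have hPQ : P = C (P.eval s₀) + (X - C s₀) * Q := by
      conv_lhs => rw [← modByMonic_add_div P (X - C s₀)]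
      rw [modByMonic_X_sub_C_eq_C_eval]
    have hQdeg : Q.natDegree ≤ D := by
      rw [hQ, natDegree_divByMonic _ (monic_X_sub_C s₀), natDegree_X_sub_C]; omega
    -- a large coefficient for Q
    obtain ⟨m'', hm''⟩ : ∃ m'', c * B / (1 + R) ≤ |Q.coeff m''| := by
      by_contra hcon
      push Not at hcon
      have e : P.coeff m' = Q.coeff (m' - 1) - s₀ * Q.coeff m' := by
        obtain ⟨j, rfl⟩ : ∃ j, m' = j + 1 := ⟨m' - 1, by omega⟩
        conv_lhs => rw [hPQ]
        rw [sub_mul, coeff_add, coeff_sub, coeff_X_mul, coeff_C_mul, coeff_C_of_ne_zero (by omega)]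
        simp
      have h3 : |P.coeff m'| < c * B / (1 + R) + R * (c * B / (1 + R)) := by
        rw [e]
        refine (abs_sub _ _).trans_lt ?_
        rw [abs_mul]
        refine add_lt_add_of_lt_of_le (hcon _) ?_
        exact mul_le_mul hs₀ (hcon _).le (abs_nonneg _) (by linarith)
      have h4 : c * B / (1 + R) + R * (c * B / (1 + R)) = c * B := by field_simp
      linarith
    set η := (t / B) ^ (1 / 2 : ℝ) with hη
    have hηpos : 0 < η := by positivity
    have hsub : {s : ℝ | |s| ≤ R ∧ |P.eval s| ≤ t} ⊆
        Set.Icc (s₀ - η) (s₀ + η) ∪ {s : ℝ | |s| ≤ R ∧ |Q.eval s| ≤ 2 * t / η} := by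
      intro s ⟨hs, hPs⟩
      by_cases hd : |s - s₀| ≤ η
      · left; rw [abs_le] at hd; constructor <;> linarith
      · right
        push Not at hd
        refine ⟨hs, ?_⟩
        have e : (s - s₀) * Q.eval s = P.eval s - P.eval s₀ := by
          conv_rhs => rw [hPQ]
          simp
        have h3 : |s - s₀| * |Q.eval s| ≤ 2 * t := by
          rw [← abs_mul, e]; exact (abs_sub _ _).trans (by linarith)
        rw [le_div_iff₀ hηpos]
        nlinarith [abs_nonneg (Q.eval s)]
    have hR0 : 0 < 1 + R := by linarith
    have hmain := ih Q (c * B / (1 + R)) (2 * t / η) m'' hQdeg (div_pos (mul_pos hcpos hB) hR0)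
      (div_pos (mul_pos two_pos ht) hηpos) hm''
    have hηη : η * η = t / B := by
      rw [hη, ← Real.rpow_add hx]; norm_num
    have e1 : 2 * t / η / (c * B / (1 + R)) = A * η := by
      rw [hA]
      have : t = η * η * B := by rw [hηη]; field_simp
      rw [this]; field_simp
    rw [e1] at hmain
    refine (measure_mono hsub).trans ((measure_union_le _ _).trans ?_)
    refine (add_le_add (le_of_eq Real.volume_Icc) hmain).trans ?_
    rw [← ENNReal.ofReal_add (by linarith) (mul_nonneg hC₀.le (Real.rpow_nonneg (mul_pos hApos hηpos).le _))]
    apply ENNReal.ofReal_le_ofReal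
    have e2 : (A * η) ^ ε = A ^ ε * (t / B) ^ (ε / 2) := by
      rw [Real.mul_rpow hApos.le hηpos.le, hη, ← Real.rpow_mul hx.le]
      congr 2; ring
    have e3 : η ≤ (t / B) ^ (ε / 2) :=
      Real.rpow_le_rpow_of_exponent_ge hx (by linarith) (by linarith)
    rw [e2]
    have : 0 ≤ (t / B) ^ (ε / 2) := by positivity
    nlinarith

end sublevel
end SR
end

section

namespace SR

section osc
open Polynomial

lemma chi_lip (a b : ℝ) : ‖chi a - chi b‖ ≤ 2 * Real.pi * |a - b| := by
  have : chi a - chi b = chi b * (chi (a - b) - 1) := by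
    rw [mul_sub, ← chi_add, mul_one]; congr 2; ring
  rw [this, norm_mul, norm_chi, one_mul]; exact norm_chi_sub_one _

lemma chi_integral_bound (η θ : ℝ) (hη : 0 ≤ η) : ‖∫ h in (0:ℝ)..η, chi (h * θ)‖ ≤ η := by
  have := intervalIntegral.norm_integral_le_of_norm_le_const (a := 0) (b := η) (C := 1)
    (f := fun h => chi (h * θ)) (fun h _ => (norm_chi _).le)
  simpa [abs_of_nonneg hη] using this

lemma chi_integral_bound' (η θ : ℝ) (hθ : θ ≠ 0) : ‖∫ h in (0:ℝ)..η, chi (h * θ)‖ ≤ 1 / |θ| := by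
  set c : ℂ := (-2 * Real.pi * θ : ℝ) * Complex.I with hc
  have hc0 : c ≠ 0 := by
    rw [hc]; simp [Real.pi_ne_zero, hθ]
  have e : ∀ h : ℝ, chi (h * θ) = Complex.exp (c * h) := by
    intro h; rw [chi, hc]; congr 1; push_cast; ring
  simp only [e]
  rw [integral_exp_mul_complex hc0, norm_div]
  have hcn : ‖c‖ = 2 * Real.pi * |θ| := by
    rw [hc, norm_mul, Complex.norm_I, mul_one, Complex.norm_real, Real.norm_eq_abs, abs_mul, abs_mul, abs_neg,
      abs_of_pos Real.pi_pos]; simp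
  have h1 : ‖Complex.exp (c * η) - Complex.exp (c * (0:ℝ))‖ ≤ 2 := by
    rw [← e, ← e]
    refine (norm_sub_le _ _).trans ?_
    rw [norm_chi, norm_chi]; norm_num
  rw [hcn]
  have hθ' : 0 < |θ| := abs_pos.2 hθ
  have hpi := Real.pi_gt_three
  rw [div_le_div_iff₀ (by positivity) hθ']
  nlinarith

lemma poly_taylor (P : ℝ[X]) (R K s h : ℝ) (hK : ∀ u, |u| ≤ R → |P.derivative.derivative.eval u| ≤ K)
    (hs : |s| ≤ R) (hh : 0 ≤ h) (hsh : |s + h| ≤ R) :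
    |P.eval (s + h) - P.eval s - h * P.derivative.eval s| ≤ K * h ^ 2 := by
  have hseg : ∀ u ∈ Set.Icc s (s + h), |u| ≤ R := by
    intro u hu
    rw [abs_le] at *
    exact ⟨by linarith [hu.1, hs.1], by linarith [hu.2, hsh.2]⟩
  have h1 : ∀ u ∈ Set.Icc s (s + h), |P.derivative.eval u - P.derivative.eval s| ≤ K * h := by
    intro u hu
    have := (convex_Icc s (s + h)).norm_image_sub_le_of_norm_hasDerivWithin_le
      (f := fun u => P.derivative.eval u) (f' := fun u => P.derivative.derivative.eval u) (C := K)
      (fun v hv => (P.derivative.hasDerivAt v).hasDerivWithinAt)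
      (fun v hv => hK v (hseg v hv)) (x := s) (y := u) (by constructor <;> linarith) hu
    have hK0 : 0 ≤ K := (abs_nonneg _).trans (hK s hs)
    rw [Real.norm_eq_abs, Real.norm_eq_abs] at this
    refine this.trans (mul_le_mul_of_nonneg_left ?_ hK0)
    rw [abs_of_nonneg (by linarith [hu.1])]; linarith [hu.2]
  have := (convex_Icc s (s + h)).norm_image_sub_le_of_norm_hasDerivWithin_le
      (f := fun u => P.eval u - u * P.derivative.eval s)
      (f' := fun u => P.derivative.eval u - 1 * P.derivative.eval s) (C := K * h)
      (fun v hv => ((P.hasDerivAt v).sub ((hasDerivAt_id v).mul_const _)).hasDerivWithinAt)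
      (fun v hv => by rw [one_mul]; exact h1 v hv) (x := s) (y := s + h) (by constructor <;> linarith)
      (by constructor <;> linarith)
  rw [Real.norm_eq_abs, Real.norm_eq_abs, add_sub_cancel_left, abs_of_nonneg hh] at this
  have e : P.eval (s + h) - (s + h) * P.derivative.eval s - (P.eval s - s * P.derivative.eval s)
    = P.eval (s + h) - P.eval s - h * P.derivative.eval s := by ring
  rw [e] at this
  refine this.trans (le_of_eq (by ring))

/-- quantitative core of the one-dimensional oscillatory estimate. -/
lemma osc_core (R : ℝ) (hR : 1 ≤ R) (P : ℝ[X]) (K η t Vt : ℝ) (hη : 0 < η) (hη1 : η ≤ 1) (ht : 0 < t)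
    (hVt0 : 0 ≤ Vt)
    (hK : ∀ u, |u| ≤ R + 1 → |P.derivative.derivative.eval u| ≤ K)
    (hV : volume {s : ℝ | |s| ≤ R ∧ |P.derivative.eval s| ≤ t} ≤ ENNReal.ofReal Vt)
    (k : ℝ → ℂ) (hk1 : ∀ s, ‖k s‖ ≤ 1) (hkl : ∀ s s', ‖k s - k s'‖ ≤ |s - s'|)
    (hks : ∀ s, R < |s| → k s = 0) :
    ‖∫ s, k s * chi (P.eval s)‖ ≤
      2 * (R + 1) * (η + 2 * Real.pi * K * η ^ 2) + Vt + 2 * R / (t * η) := by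
  have hK0 : 0 ≤ K := (abs_nonneg _).trans (hK 0 (by simp; linarith))
  have hkc : Continuous k := by
    have : LipschitzWith 1 k := LipschitzWith.of_dist_le_mul fun a b => by
      simpa [dist_eq_norm] using hkl a b
    exact this.continuous
  have hPc : Continuous fun s => P.eval s := P.continuous
  have hP'c : Continuous fun s => P.derivative.eval s := P.derivative.continuous
  have hcs : HasCompactSupport k := by
    refine HasCompactSupport.intro (isCompact_Icc (a := -R) (b := R)) fun s hs => hks s ?_
    by_contra h
    exact hs (abs_le.1 (not_lt.1 h))
  set I := ∫ s, k s * chi (P.eval s) with hI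
  set J : ℝ → ℂ := fun h => ∫ s, k s * chi (P.eval s) * chi (h * P.derivative.eval s) with hJ
  have hitg : ∀ h, Integrable (fun s => k s * chi (P.eval s) * chi (h * P.derivative.eval s)) := by
    intro h
    refine Continuous.integrable_of_hasCompactSupport ?_ (hcs.mul_right.mul_right)
    have := continuous_chi
    fun_prop
  have hitg0 : Integrable (fun s => k s * chi (P.eval s)) := by
    refine Continuous.integrable_of_hasCompactSupport ?_ hcs.mul_right
    have := continuous_chi
    fun_prop
  -- comparison
  have hcomp : ∀ h ∈ Set.Icc 0 η, ‖I - J h‖ ≤ 2 * (R + 1) * (η + 2 * Real.pi * K * η ^ 2) := by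
    intro h hh
    have e1 : I = ∫ s, k (s + h) * chi (P.eval (s + h)) := by
      rw [hI]; exact (integral_add_right_eq_self (fun s => k s * chi (P.eval s)) h).symm
    rw [e1, hJ]
    simp only
    rw [← integral_sub (hitg0.comp_add_right h) (hitg h)]
    have hind : Integrable ((Set.Icc (-(R+1)) (R+1)).indicator
        (fun _ : ℝ => η + 2 * Real.pi * K * η ^ 2)) := by
      rw [integrable_indicator_iff measurableSet_Icc]
      exact integrableOn_const (by simp) (by simp)
    refine (norm_integral_le_of_norm_le hind (Filter.Eventually.of_forall fun s => ?_)).trans ?_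
    · by_cases hs : s ∈ Set.Icc (-(R+1)) (R+1)
      · rw [Set.indicator_of_mem hs]
        by_cases hsR : R < s
        · rw [hks (s + h) (by rw [abs_of_pos] <;> linarith [hh.1]), hks s (by rw [abs_of_pos] <;> linarith)]
          simp; positivity
        push Not at hsR
        have hs1 : |s| ≤ R + 1 := abs_le.2 hs
        have hs2 : |s + h| ≤ R + 1 := abs_le.2 ⟨by linarith [hs.1, hh.1], by linarith [hh.2]⟩
        have hT := poly_taylor P (R + 1) K s h hK hs1 hh.1 hs2
        have e2 : k (s + h) * chi (P.eval (s + h)) - k s * chi (P.eval s) * chi (h * P.derivative.eval s)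
          = (k (s + h) - k s) * chi (P.eval (s + h)) +
            k s * (chi (P.eval (s + h)) - chi (P.eval s + h * P.derivative.eval s)) := by
          rw [chi_add]; ring
        rw [e2]
        refine (norm_add_le _ _).trans (add_le_add ?_ ?_)
        · rw [norm_mul, norm_chi, mul_one]
          refine (hkl _ _).trans ?_
          rw [add_sub_cancel_left, abs_of_nonneg hh.1]; exact hh.2
        · rw [norm_mul]
          have h3 := chi_lip (P.eval (s + h)) (P.eval s + h * P.derivative.eval s)
          rw [← sub_sub] at h3
          calc _ ≤ 1 * (2 * Real.pi * |P.eval (s + h) - P.eval s - h * P.derivative.eval s|) :=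
                mul_le_mul (hk1 _) h3 (norm_nonneg _) (by norm_num)
            _ ≤ 1 * (2 * Real.pi * (K * η ^ 2)) := by
                have : K * h ^ 2 ≤ K * η ^ 2 := by
                  have := hh.2; have := hh.1; gcongr
                have hpi := Real.pi_pos
                gcongr; linarith
            _ = _ := by ring
      · rw [Set.indicator_of_notMem hs]
        have : R + 1 < |s| := by
          by_contra h'; exact hs (abs_le.1 (not_lt.1 h'))
        have h2 : R < |s + h| := by
          have h3 : |s| ≤ |s + h| + |h| := by
            have := abs_sub (s + h) h; simpa using this
          rw [abs_of_nonneg hh.1] at h3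
          linarith [hh.2]
        rw [hks _ h2, hks s (by linarith)]; simp
    · rw [integral_indicator measurableSet_Icc, setIntegral_const]
      simp only [Measure.real, Real.volume_Icc, smul_eq_mul]
      rw [ENNReal.toReal_ofReal (by linarith)]
      apply le_of_eq; ring
  -- average
  have hJc : Continuous J := by
    have hb : Integrable (fun s => ‖k s‖) := (hkc.integrable_of_hasCompactSupport hcs).norm
    refine continuous_of_dominated (bound := fun s => ‖k s‖) (fun h => (hitg h).aestronglyMeasurable) ?_ hb ?_
    · intro h; refine Filter.Eventually.of_forall fun s => ?_
      rw [norm_mul, norm_mul, norm_chi, norm_chi]; simp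
    · refine Filter.Eventually.of_forall fun s => ?_
      have := continuous_chi
      fun_prop
  have havg : ‖∫ h in (0:ℝ)..η, J h‖ ≤ η * Vt + 2 * R / t := by
    have e : ∫ h in (0:ℝ)..η, J h = ∫ s, k s * chi (P.eval s) * ∫ h in (0:ℝ)..η, chi (h * P.derivative.eval s) := by
      rw [hJ, intervalIntegral_integral_swap]
      · simp only [intervalIntegral.integral_const_mul]
      · have hb : Integrable (fun z : ℝ × ℝ => k z.2) ((volume.restrict (Set.uIoc 0 η)).prod volume) := by
          have : Integrable (fun _ : ℝ => (1:ℂ)) (volume.restrict (Set.uIoc 0 η)) := by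
            refine integrableOn_const (by simp) (by simp)
          simpa using this.mul_prod (hkc.integrable_of_hasCompactSupport hcs)
        refine hb.mono ?_ (Filter.Eventually.of_forall fun z => ?_)
        · have : Continuous (Function.uncurry fun h s => k s * chi (P.eval s) * chi (h * P.derivative.eval s)) := by
            have := continuous_chi
            simp only [Function.uncurry_def]
            fun_prop
          exact this.aestronglyMeasurable
        · simp [Function.uncurry, norm_chi]
    rw [e]
    set A := {s : ℝ | |s| ≤ R ∧ |P.derivative.eval s| ≤ t} with hA
    have hAm : MeasurableSet A := by
      have h1 : MeasurableSet {s : ℝ | |s| ≤ R} := measurableSet_le (by fun_prop) measurable_const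
      have h2 : MeasurableSet {s : ℝ | |P.derivative.eval s| ≤ t} :=
        measurableSet_le hP'c.abs.measurable measurable_const
      exact h1.inter h2
    have hAfin : volume A ≠ ∞ := (hV.trans_lt (by simp)).ne
    have hi1 : Integrable (A.indicator (fun _ : ℝ => η)) := by
      rw [integrable_indicator_iff hAm]
      exact integrableOn_const hAfin (by simp)
    have hi2 : Integrable ((Set.Icc (-R) R).indicator (fun _ : ℝ => 1 / t)) := by
      rw [integrable_indicator_iff measurableSet_Icc]
      exact integrableOn_const (by simp) (by simp)
    refine (norm_integral_le_of_norm_le (hi1.add hi2) (Filter.Eventually.of_forall fun s => ?_)).trans ?_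
    · rw [norm_mul, norm_mul, norm_chi, mul_one, Pi.add_apply]
      have hn1 : 0 ≤ A.indicator (fun _ : ℝ => η) s := Set.indicator_nonneg (fun _ _ => hη.le) _
      have hn2 : 0 ≤ (Set.Icc (-R) R).indicator (fun _ : ℝ => 1 / t) s :=
        Set.indicator_nonneg (fun _ _ => by positivity) _
      by_cases hs : R < |s|
      · rw [hks s hs]; simp only [norm_zero, zero_mul]; linarith
      push Not at hs
      rw [Set.indicator_of_mem (show s ∈ Set.Icc (-R) R from abs_le.1 hs)]
      by_cases hsA : s ∈ A
      · rw [Set.indicator_of_mem hsA]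
        have := chi_integral_bound η (P.derivative.eval s) hη.le
        have h5 : 0 ≤ 1 / t := by positivity
        nlinarith [hk1 s, norm_nonneg (k s), norm_nonneg (∫ h in (0:ℝ)..η, chi (h * P.derivative.eval s))]
      · have h6 : t < |P.derivative.eval s| := by
          by_contra h'; exact hsA ⟨hs, not_lt.1 h'⟩
        have := chi_integral_bound' η (P.derivative.eval s) (by
          intro h0; rw [h0] at h6; simp at h6; linarith)
        have h7 : 1 / |P.derivative.eval s| ≤ 1 / t := one_div_le_one_div_of_le ht h6.le
        nlinarith [hk1 s, norm_nonneg (k s), norm_nonneg (∫ h in (0:ℝ)..η, chi (h * P.derivative.eval s))]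
    · rw [integral_add' hi1 hi2, integral_indicator measurableSet_Icc, integral_indicator hAm,
        setIntegral_const, setIntegral_const]
      simp only [Measure.real, Real.volume_Icc, smul_eq_mul]
      rw [ENNReal.toReal_ofReal (by linarith)]
      have : (volume A).toReal ≤ Vt := ENNReal.toReal_le_of_le_ofReal hVt0 hV
      have h8 : (R - -R) * (1 / t) = 2 * R / t := by ring
      rw [h8]; nlinarith
  have hfin : η * ‖I‖ ≤ η * (2 * (R + 1) * (η + 2 * Real.pi * K * η ^ 2)) + (η * Vt + 2 * R / t) := by
    have e : (η : ℂ) * I = (∫ h in (0:ℝ)..η, (I - J h)) + ∫ h in (0:ℝ)..η, J h := by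
      rw [intervalIntegral.integral_sub (by simp) (hJc.intervalIntegrable _ _)]
      simp
    have e2 : η * ‖I‖ = ‖(η : ℂ) * I‖ := by
      rw [norm_mul, Complex.norm_real, Real.norm_eq_abs, abs_of_pos hη]
    rw [e2, e]
    refine (norm_add_le _ _).trans (add_le_add ?_ havg)
    have := intervalIntegral.norm_integral_le_of_norm_le_const (a := 0) (b := η)
      (C := 2 * (R + 1) * (η + 2 * Real.pi * K * η ^ 2)) (f := fun h => I - J h)
      (fun h hh => hcomp h (by
        rw [Set.uIoc_of_le hη.le] at hh; exact ⟨hh.1.le, hh.2⟩))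
    rw [sub_zero, abs_of_pos hη] at this
    linarith
  have h9 : ‖I‖ ≤ (η * (2 * (R + 1) * (η + 2 * Real.pi * K * η ^ 2)) + (η * Vt + 2 * R / t)) / η := by
    rw [le_div_iff₀ hη]; linarith
  refine h9.trans (le_of_eq ?_)
  field_simp
  ring

end osc
end SR
end

section

namespace SR

section osc1
open Polynomial

lemma norm_integral_cutoff_le (R : ℝ) (hR : 0 ≤ R) (k g : ℝ → ℂ) (hk1 : ∀ s, ‖k s‖ ≤ 1) (hg : ∀ s, ‖g s‖ ≤ 1)
    (hks : ∀ s, R < |s| → k s = 0) : ‖∫ s, k s * g s‖ ≤ 2 * R := by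
  have e : ∫ s, k s * g s = ∫ s in Set.Icc (-R) R, k s * g s := by
    symm; apply setIntegral_eq_integral_of_forall_compl_eq_zero
    intro x hx
    rw [hks x, zero_mul]
    by_contra h
    push Not at h
    exact hx (abs_le.1 h)
  rw [e]
  have := norm_setIntegral_le_of_norm_le_const (μ := volume) (s := Set.Icc (-R) R) (C := 1)
    (f := fun s => k s * g s) (by simp) (fun x _ => by
      rw [norm_mul]; exact mul_le_one₀ (hk1 x) (norm_nonneg _) (hg x))
  refine this.trans ?_
  simp [Measure.real]
  rw [ENNReal.toReal_ofReal (by linarith)]; linarith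

theorem osc_1d (R : ℝ) (hR : 1 ≤ R) (D : ℕ) : ∃ C ε : ℝ, 0 < C ∧ 0 < ε ∧ ε ≤ 1 ∧
    ∀ (P : ℝ[X]) (B : ℝ) (m : ℕ), P.natDegree ≤ D → 0 < B → 1 ≤ m → B ≤ |P.coeff m| →
    ∀ k : ℝ → ℂ, (∀ s, ‖k s‖ ≤ 1) → (∀ s s', ‖k s - k s'‖ ≤ |s - s'|) → (∀ s, R < |s| → k s = 0) →
    ‖∫ s, k s * chi (P.eval s)‖ ≤ C * B ^ (-ε) := by
  obtain ⟨C₁, ε₁, hC₁, hε₁, hε1', hsub⟩ := sublevel_1d R hR D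
  set M : ℝ := ∑ n ∈ Finset.range (D + 1), ((n:ℝ) + 1) * (n + 2) * (R + 1) ^ n with hM
  have hM0 : 0 ≤ M := Finset.sum_nonneg fun n _ => by positivity
  refine ⟨2 * (R + 1) * (1 + 2 * Real.pi * M) + C₁ + 2 * R, ε₁ / 6, ?_, by positivity, by linarith, ?_⟩
  · have := Real.pi_pos; positivity
  intro P B m hP hB hm hBm k hk1 hkl hks
  have hpi := Real.pi_pos
  obtain ⟨m', hm'mem, hmax⟩ := Finset.exists_max_image (Finset.Icc 1 (max m D)) (fun n => |P.coeff n|)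
    ⟨m, by simp [hm]⟩
  have hm'1 : 1 ≤ m' := (Finset.mem_Icc.1 hm'mem).1
  set b := |P.coeff m'| with hb
  have hall : ∀ n, 1 ≤ n → |P.coeff n| ≤ b := by
    intro n hn
    by_cases h : n ≤ max m D
    · exact hmax n (Finset.mem_Icc.2 ⟨hn, h⟩)
    · rw [Polynomial.coeff_eq_zero_of_natDegree_lt (by have := le_max_right m D; omega)]
      rw [abs_zero]; exact abs_nonneg _
  have hBb : B ≤ b := hBm.trans (hall m hm)
  have hb0 : 0 < b := hB.trans_le hBb
  rcases le_or_gt b 1 with h1 | h1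
  · refine (norm_integral_cutoff_le R (by linarith) k _ hk1 (fun s => (norm_chi _).le) hks).trans ?_
    have : 1 ≤ B ^ (-(ε₁ / 6)) := Real.one_le_rpow_of_pos_of_le_one_of_nonpos hB (hBb.trans h1) (by linarith)
    have h2 : 2 * R ≤ 2 * (R + 1) * (1 + 2 * Real.pi * M) + C₁ + 2 * R := by
      have : 0 ≤ 2 * (R + 1) * (1 + 2 * Real.pi * M) := by positivity
      linarith
    calc 2 * R ≤ (2 * (R + 1) * (1 + 2 * Real.pi * M) + C₁ + 2 * R) * 1 := by linarith
      _ ≤ _ := mul_le_mul_of_nonneg_left this (by linarith)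
  · have hK : ∀ u, |u| ≤ R + 1 → |P.derivative.derivative.eval u| ≤ M * b := by
      intro u hu
      rw [Polynomial.eval_eq_sum_range' (n := D + 1)
        (by have := Polynomial.natDegree_derivative_le P.derivative
            have := Polynomial.natDegree_derivative_le P; omega), hM, Finset.sum_mul]
      refine (Finset.abs_sum_le_sum_abs _ _).trans (Finset.sum_le_sum fun n _ => ?_)
      rw [Polynomial.coeff_derivative, Polynomial.coeff_derivative, abs_mul, abs_mul, abs_mul, abs_pow]
      have h3 : |((n + 1 : ℕ) : ℝ) + 1| = n + 2 := by
        rw [abs_of_nonneg (by positivity)]; push_cast; ring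
      have h4 : |(n : ℝ) + 1| = n + 1 := abs_of_nonneg (by positivity)
      rw [h3, h4]
      calc |P.coeff (n + 1 + 1)| * (n + 2) * (n + 1) * |u| ^ n
          ≤ b * (n + 2) * (n + 1) * (R + 1) ^ n := by
            gcongr; exact hall _ (by omega)
        _ = _ := by ring
    have hsubl := hsub P.derivative b (b ^ (5/6 : ℝ)) (m' - 1)
      ((Polynomial.natDegree_derivative_le P).trans (by omega)) hb0 (by positivity) (by
        rw [Polynomial.coeff_derivative, Nat.sub_add_cancel hm'1, abs_mul, ← hb]
        have : 1 ≤ |((m' - 1 : ℕ) : ℝ) + 1| := by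
          rw [abs_of_nonneg (by positivity)]; linarith [Nat.cast_nonneg (α := ℝ) (m' - 1)]
        nlinarith)
    have := osc_core R hR P (M * b) (b ^ (-(2/3) : ℝ)) (b ^ (5/6 : ℝ)) (C₁ * (b ^ (5/6:ℝ) / b) ^ ε₁)
      (by positivity) (Real.rpow_le_one_of_one_le_of_nonpos h1.le (by norm_num)) (by positivity) (by positivity)
      hK hsubl k hk1 hkl hks
    refine this.trans ?_
    set X := b ^ (-(ε₁ / 6)) with hX
    have hX0 : 0 < X := by positivity
    have hle : ∀ e : ℝ, e ≤ -(1/6) → b ^ e ≤ X := fun e he =>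
      Real.rpow_le_rpow_of_exponent_le h1.le (by linarith)
    have e1 : b ^ (-(2/3) : ℝ) ≤ X := hle _ (by norm_num)
    have e2 : M * b * (b ^ (-(2/3) : ℝ)) ^ 2 ≤ M * X := by
      rw [mul_assoc]
      refine mul_le_mul_of_nonneg_left ?_ hM0
      calc b * (b ^ (-(2/3) : ℝ)) ^ 2 = b ^ (1:ℝ) * (b ^ (-(2/3):ℝ) * b ^ (-(2/3):ℝ)) := by
            rw [Real.rpow_one, sq]
        _ = b ^ (-(1/3) : ℝ) := by rw [← Real.rpow_add hb0, ← Real.rpow_add hb0]; norm_num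
        _ ≤ X := hle _ (by norm_num)
    have e3 : (b ^ (5/6:ℝ) / b) ^ ε₁ = X := by
      have : b ^ (5/6:ℝ) / b = b ^ (-(1/6) : ℝ) := by
        conv_lhs => rw [← Real.rpow_one b, ← Real.rpow_mul hb0.le, ← Real.rpow_sub hb0]
        norm_num
      rw [this, ← Real.rpow_mul hb0.le]; congr 1; ring
    have e4 : 2 * R / (b ^ (5/6:ℝ) * b ^ (-(2/3):ℝ)) ≤ 2 * R * X := by
      rw [← Real.rpow_add hb0, div_eq_mul_inv, ← Real.rpow_neg hb0.le]
      exact mul_le_mul_of_nonneg_left (hle _ (by norm_num)) (by linarith)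
    have e5 : X ≤ B ^ (-(ε₁ / 6)) := Real.rpow_le_rpow_of_nonpos hB hBb (by linarith)
    rw [e3]
    have e6 : 2 * (R + 1) * (b ^ (-(2/3):ℝ) + 2 * Real.pi * (M * b) * (b ^ (-(2/3):ℝ)) ^ 2) ≤
        2 * (R + 1) * (X + 2 * Real.pi * (M * X)) := by
      have : 2 * Real.pi * (M * b) * (b ^ (-(2/3):ℝ)) ^ 2 ≤ 2 * Real.pi * (M * X) := by
        rw [mul_assoc]; exact mul_le_mul_of_nonneg_left e2 (by positivity)
      gcongr
    calc _ ≤ 2 * (R + 1) * (X + 2 * Real.pi * (M * X)) + C₁ * X + 2 * R * X := by gcongr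
      _ = (2 * (R + 1) * (1 + 2 * Real.pi * M) + C₁ + 2 * R) * X := by ring
      _ ≤ _ := mul_le_mul_of_nonneg_left e5 (by positivity)

end osc1
end SR
end

section

namespace SR

section oscn
open Polynomial

/-- polynomial with coefficients `c` -/
def pol {n D : ℕ} (c : (Fin n → Fin (D+1)) → ℝ) (y : Fin n → ℝ) : ℝ :=
  ∑ α, c α * ∏ i, y i ^ (α i : ℕ)

lemma continuous_pol {n D : ℕ} (c : (Fin n → Fin (D+1)) → ℝ) : Continuous (pol c) := by
  unfold pol; fun_prop

/-- slice coefficient -/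
def slc {n D : ℕ} (i : Fin (n+1)) (c : (Fin (n+1) → Fin (D+1)) → ℝ) (a : Fin (D+1)) :
    (Fin n → Fin (D+1)) → ℝ := fun α => c (i.insertNth a α)

/-- the slice as a univariate polynomial -/
def slp {n D : ℕ} (i : Fin (n+1)) (c : (Fin (n+1) → Fin (D+1)) → ℝ) (y : Fin n → ℝ) : ℝ[X] :=
  ∑ a : Fin (D+1), C (pol (slc i c a) y) * X ^ (a : ℕ)

lemma slp_natDegree {n D : ℕ} (i : Fin (n+1)) (c : (Fin (n+1) → Fin (D+1)) → ℝ) (y : Fin n → ℝ) :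
    (slp i c y).natDegree ≤ D := by
  unfold slp
  refine Polynomial.natDegree_sum_le_of_forall_le _ _ fun a _ => ?_
  exact (Polynomial.natDegree_C_mul_X_pow_le _ _).trans (by omega)

lemma slp_coeff {n D : ℕ} (i : Fin (n+1)) (c : (Fin (n+1) → Fin (D+1)) → ℝ) (y : Fin n → ℝ) (a : Fin (D+1)) :
    (slp i c y).coeff a = pol (slc i c a) y := by
  unfold slp
  simp only [Polynomial.finsetSum_coeff, Polynomial.coeff_C_mul, Polynomial.coeff_X_pow]
  rw [Finset.sum_eq_single a]
  · simp
  · intro b _ hb; rw [if_neg (fun h => hb (Fin.ext h.symm)), mul_zero]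
  · simp

lemma slp_eval {n D : ℕ} (i : Fin (n+1)) (c : (Fin (n+1) → Fin (D+1)) → ℝ) (y : Fin n → ℝ) (s : ℝ) :
    (slp i c y).eval s = pol c (i.insertNth (α := fun _ => ℝ) s y) := by
  unfold slp pol
  rw [Polynomial.eval_finsetSum, ← (Fin.insertNthEquiv (fun _ => Fin (D+1)) i).sum_comp, Fintype.sum_prod_type]
  refine Finset.sum_congr rfl fun a _ => ?_
  simp only [Polynomial.eval_mul, Polynomial.eval_C, Polynomial.eval_pow, Polynomial.eval_X, Fin.insertNthEquiv_apply,
    slc, Finset.sum_mul, Fin.prod_univ_succAbove _ i, Fin.insertNth_apply_same, Fin.insertNth_apply_succAbove]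
  refine Finset.sum_congr rfl fun α _ => ?_
  have e : (Fin.insertNthEquiv (fun _ => Fin (D + 1)) i) (a, α) = i.insertNth a α := rfl
  rw [e]; ring

lemma norm_insertNth {n : ℕ} (i : Fin (n+1)) (s : ℝ) (y : Fin n → ℝ) (R : ℝ) (hR : 0 ≤ R) :
    ‖(i.insertNth (α := fun _ => ℝ) s y : Fin (n+1) → ℝ)‖ ≤ R ↔ |s| ≤ R ∧ ‖y‖ ≤ R := by
  rw [pi_norm_le_iff_of_nonneg hR, pi_norm_le_iff_of_nonneg hR, Fin.forall_iff_succAbove i]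
  simp

lemma volume_slice {n : ℕ} (i : Fin (n+1)) (S : Set (Fin (n+1) → ℝ)) (hS : MeasurableSet S) :
    volume S = ∫⁻ y : Fin n → ℝ, volume {s : ℝ | (i.insertNth (α := fun _ => ℝ) s y : Fin (n+1) → ℝ) ∈ S} := by
  have h := (volume_preserving_piFinSuccAbove (fun _ : Fin (n+1) => ℝ) i).symm
  rw [← h.measure_preimage_equiv S, Measure.volume_eq_prod, Measure.prod_apply_symm]
  · rfl
  · exact (MeasurableEquiv.measurable _) hS

lemma integral_slice {n : ℕ} (i : Fin (n+1)) (f : (Fin (n+1) → ℝ) → ℂ) (hf : Integrable f) :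
    ∫ y, f y = ∫ y : Fin n → ℝ, ∫ s : ℝ, f (i.insertNth (α := fun _ => ℝ) s y) := by
  have h := (volume_preserving_piFinSuccAbove (fun _ : Fin (n+1) => ℝ) i).symm
  rw [← h.integral_comp' f, Measure.volume_eq_prod, integral_prod_symm]
  · rfl
  · rw [← Measure.volume_eq_prod]
    exact (h.integrable_comp_emb (MeasurableEquiv.measurableEmbedding _)).2 hf

lemma volume_ball (n : ℕ) (R : ℝ) (hR : 0 ≤ R) : volume {y : Fin n → ℝ | ‖y‖ ≤ R} = ENNReal.ofReal ((2 * R) ^ n) := by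
  have := Real.volume_pi_closedBall (0 : Fin n → ℝ) hR
  rw [Fintype.card_fin] at this
  rw [← this]; congr 1; ext y; simp

theorem sublevel_nd (R : ℝ) (hR : 1 ≤ R) (D n : ℕ) : ∃ C ε : ℝ, 0 < C ∧ 0 < ε ∧ ε ≤ 1 ∧
    ∀ (c : (Fin n → Fin (D+1)) → ℝ) (α : Fin n → Fin (D+1)) (t B : ℝ), 0 < t → 0 < B → B ≤ |c α| →
    volume {y : Fin n → ℝ | ‖y‖ ≤ R ∧ |pol c y| ≤ t} ≤ ENNReal.ofReal (C * (t / B) ^ ε) := by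
  induction n with
  | zero =>
    refine ⟨1, 1, one_pos, one_pos, le_rfl, fun c α t B ht hB hc => ?_⟩
    by_cases h : |c α| ≤ t
    · have h1 := volume_ball 0 R (by linarith)
      refine (measure_mono (t := {y : Fin 0 → ℝ | ‖y‖ ≤ R}) (fun y hy => hy.1)).trans ?_
      rw [h1]
      apply ENNReal.ofReal_le_ofReal
      rw [Real.rpow_one, pow_zero, one_mul, one_le_div hB]; linarith
    · have : {y : Fin 0 → ℝ | ‖y‖ ≤ R ∧ |pol c y| ≤ t} = ∅ := by
        ext y
        simp only [Set.mem_ofPred_eq, Set.mem_empty_iff_false, iff_false]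
        rintro ⟨_, h2⟩
        apply h
        have : pol c y = c α := by
          simp [pol]; congr 1; exact Subsingleton.elim _ _
        rwa [this] at h2
      rw [this]; simp
  | succ n ih =>
    obtain ⟨C₁, ε₁, hC₁, hε₁, hε₁', h1⟩ := sublevel_1d R hR D
    obtain ⟨C₂, ε₂, hC₂, hε₂, hε₂', h2⟩ := ih
    set ε := min ε₁ ε₂ / 2 with hε
    have hε0 : 0 < ε := by have := lt_min hε₁ hε₂; positivity
    have hεa : ε ≤ ε₁ / 2 := by rw [hε]; have := min_le_left ε₁ ε₂; linarith
    have hεb : ε ≤ ε₂ / 2 := by rw [hε]; have := min_le_right ε₁ ε₂; linarith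
    refine ⟨2 * R * C₂ + (2 * R) ^ n * C₁ + (2 * R) ^ (n+1), ε, by positivity, hε0, by linarith, ?_⟩
    intro c α t B ht hB hc
    set r := t / B with hr
    have hr0 : 0 < r := by positivity
    have hvm : MeasurableSet {y : Fin (n+1) → ℝ | ‖y‖ ≤ R ∧ |pol c y| ≤ t} :=
      (measurableSet_le continuous_norm.measurable measurable_const).inter
        (measurableSet_le (continuous_pol c).abs.measurable measurable_const)
    rcases le_or_gt 1 r with hr1 | hr1
    · refine (measure_mono (t := {y : Fin (n+1) → ℝ | ‖y‖ ≤ R}) (fun y hy => hy.1)).trans ?_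
      rw [volume_ball _ _ (by linarith)]
      apply ENNReal.ofReal_le_ofReal
      have : 1 ≤ r ^ ε := Real.one_le_rpow hr1 hε0.le
      have h3 : (2 * R) ^ (n+1) ≤ 2 * R * C₂ + (2 * R) ^ n * C₁ + (2 * R) ^ (n+1) := by
        have : 0 ≤ 2 * R * C₂ + (2 * R) ^ n * C₁ := by positivity
        linarith
      calc (2 * R) ^ (n+1) = (2 * R) ^ (n+1) * 1 := (mul_one _).symm
        _ ≤ _ := mul_le_mul h3 this zero_le_one (by positivity)
    · set u := Real.sqrt (t * B) with hu
      have hu0 : 0 < u := Real.sqrt_pos.2 (by positivity)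
      have huu : u * u = t * B := Real.mul_self_sqrt (by positivity)
      have hur : u / B = r ^ (1/2 : ℝ) := by
        rw [← Real.sqrt_eq_rpow, eq_comm, Real.sqrt_eq_iff_mul_self_eq hr0.le (by positivity), hr, div_mul_div_comm, huu]
        field_simp
      have htu : t / u = r ^ (1/2 : ℝ) := by
        rw [← hur, div_eq_div_iff hu0.ne' hB.ne', huu]
      set i : Fin (n+1) := 0
      set a := α i with ha
      set q := slc i c a
      have hq : B ≤ |q (fun j => α (i.succAbove j))| := by
        have : q (fun j => α (i.succAbove j)) = c α := by
          show c (i.insertNth (α i) (i.removeNth α)) = c α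
          rw [Fin.insertNth_self_removeNth]
        rwa [this]
      have hb := h2 q _ u B hu0 hB hq
      rw [volume_slice i _ hvm]
      set bad : Set (Fin n → ℝ) := {y | ‖y‖ ≤ R ∧ |pol q y| ≤ u} with hbad
      have hbm : MeasurableSet bad :=
        (measurableSet_le continuous_norm.measurable measurable_const).inter
        (measurableSet_le (continuous_pol q).abs.measurable measurable_const)
      have hballm : MeasurableSet {y : Fin n → ℝ | ‖y‖ ≤ R} := measurableSet_le (by fun_prop) measurable_const
      have hpt : ∀ y : Fin n → ℝ, volume {s : ℝ | (i.insertNth (α := fun _ => ℝ) s y : Fin (n+1) → ℝ) ∈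
          {y : Fin (n+1) → ℝ | ‖y‖ ≤ R ∧ |pol c y| ≤ t}} ≤
          bad.indicator (fun _ => ENNReal.ofReal (2 * R)) y +
          {y : Fin n → ℝ | ‖y‖ ≤ R}.indicator (fun _ => ENNReal.ofReal (C₁ * (t / u) ^ ε₁)) y := by
        intro y
        by_cases hy : ‖y‖ ≤ R
        · by_cases hyb : |pol q y| ≤ u
          · refine le_add_right ?_
            rw [Set.indicator_of_mem (show y ∈ bad from ⟨hy, hyb⟩)]
            refine (measure_mono (t := Set.Icc (-R) R) ?_).trans ?_
            · intro s hs
              exact abs_le.1 ((norm_insertNth i s y R (by linarith)).1 hs.1).1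
            · rw [Real.volume_Icc]; apply ENNReal.ofReal_le_ofReal; linarith
          · push Not at hyb
            refine le_add_left ?_
            rw [Set.indicator_of_mem (show y ∈ {y : Fin n → ℝ | ‖y‖ ≤ R} from hy)]
            refine le_trans ?_ (h1 (slp i c y) u t a (slp_natDegree i c y) hu0 ht (by
              rw [slp_coeff]; exact hyb.le))
            refine measure_mono fun s hs => ⟨((norm_insertNth i s y R (by linarith)).1 hs.1).1, ?_⟩
            rw [slp_eval]; exact hs.2
        · have : {s : ℝ | (i.insertNth (α := fun _ => ℝ) s y : Fin (n+1) → ℝ) ∈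
            {y : Fin (n+1) → ℝ | ‖y‖ ≤ R ∧ |pol c y| ≤ t}} = ∅ := by
            ext s
            simp only [Set.mem_ofPred_eq, Set.mem_empty_iff_false, iff_false]
            rintro ⟨h, _⟩
            exact hy ((norm_insertNth i s y R (by linarith)).1 h).2
          rw [this]; simp
      refine (lintegral_mono hpt).trans ?_
      rw [lintegral_add_left (measurable_const.indicator hbm), lintegral_indicator_const hbm,
        lintegral_indicator_const hballm, volume_ball _ _ (by linarith)]
      refine (add_le_add_left (mul_le_mul_right hb _) _).trans ?_
      rw [← ENNReal.ofReal_mul (by positivity), ← ENNReal.ofReal_mul (by positivity),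
        ← ENNReal.ofReal_add (by positivity) (by positivity)]
      apply ENNReal.ofReal_le_ofReal
      rw [htu, hur, ← Real.rpow_mul hr0.le, ← Real.rpow_mul hr0.le]
      have f1 : r ^ (1/2 * ε₁) ≤ r ^ ε := Real.rpow_le_rpow_of_exponent_ge hr0 hr1.le (by linarith)
      have f2 : r ^ (1/2 * ε₂) ≤ r ^ ε := Real.rpow_le_rpow_of_exponent_ge hr0 hr1.le (by linarith)
      calc _ ≤ 2 * R * (C₂ * r ^ ε) + C₁ * r ^ ε * (2 * R) ^ n := by gcongr
        _ ≤ 2 * R * (C₂ * r ^ ε) + C₁ * r ^ ε * (2 * R) ^ n + (2 * R) ^ (n+1) * r ^ ε := by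
          have : 0 ≤ (2 * R) ^ (n+1) * r ^ ε := by positivity
          linarith
        _ = _ := by ring

theorem osc_nd (R : ℝ) (hR : 1 ≤ R) (D n : ℕ) : ∃ C ε : ℝ, 0 < C ∧ 0 < ε ∧ ε ≤ 1 ∧
    ∀ (c : (Fin n → Fin (D+1)) → ℝ) (α : Fin n → Fin (D+1)) (B : ℝ), α ≠ 0 → 0 < B → B ≤ |c α| →
    ∀ k : (Fin n → ℝ) → ℂ, (∀ y, ‖k y‖ ≤ 1) → (∀ y y', ‖k y - k y'‖ ≤ ‖y - y'‖) →
    (∀ y, R < ‖y‖ → k y = 0) →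
    ‖∫ y, k y * chi (pol c y)‖ ≤ C * B ^ (-ε) := by
  cases n with
  | zero =>
    refine ⟨1, 1, one_pos, one_pos, le_rfl, fun c α B hα => ?_⟩
    exact absurd (Subsingleton.elim _ _) hα
  | succ n =>
    obtain ⟨C₁, ε₁, hC₁, hε₁, hε₁', h1⟩ := osc_1d R hR D
    obtain ⟨C₂, ε₂, hC₂, hε₂, hε₂', h2⟩ := sublevel_nd R hR D n
    set ε := min ε₁ ε₂ / 2 with hε
    have hε0 : 0 < ε := by have := lt_min hε₁ hε₂; positivity
    have hεa : ε ≤ ε₁ / 2 := by rw [hε]; have := min_le_left ε₁ ε₂; linarith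
    have hεb : ε ≤ ε₂ / 2 := by rw [hε]; have := min_le_right ε₁ ε₂; linarith
    refine ⟨2 * R * C₂ + (2 * R) ^ n * C₁ + (2 * R) ^ (n+1), ε, by positivity, hε0, by linarith, ?_⟩
    intro c α B hα hB hc k hk1 hkl hks
    have hkc : Continuous k := by
      have : LipschitzWith 1 k := LipschitzWith.of_dist_le_mul fun a b => by
        simpa [dist_eq_norm] using hkl a b
      exact this.continuous
    have hitg : Integrable (fun y => k y * chi (pol c y)) := by
      refine Continuous.integrable_of_hasCompactSupport
        (hkc.mul (continuous_chi.comp (continuous_pol c))) ?_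
      refine HasCompactSupport.intro (isCompact_closedBall (0 : Fin (n+1) → ℝ) R) fun s hs => ?_
      rw [hks s (by simpa using hs), zero_mul]
    obtain ⟨i, hi⟩ : ∃ i, α i ≠ 0 := by
      by_contra h; push Not at h; exact hα (funext h)
    set a := α i with ha
    set q := slc i c a
    have hq : B ≤ |q (fun j => α (i.succAbove j))| := by
      have : q (fun j => α (i.succAbove j)) = c α := by
        show c (i.insertNth (α i) (i.removeNth α)) = c α
        rw [Fin.insertNth_self_removeNth]
      rwa [this]
    set u := B ^ (1/2 : ℝ) with hu
    have hu0 : 0 < u := by positivity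
    have hb := h2 q _ u B hu0 hB hq
    set bad : Set (Fin n → ℝ) := {y | ‖y‖ ≤ R ∧ |pol q y| ≤ u} with hbad
    have hbm : MeasurableSet bad :=
      (measurableSet_le continuous_norm.measurable measurable_const).inter
      (measurableSet_le (continuous_pol q).abs.measurable measurable_const)
    have hballm : MeasurableSet {y : Fin n → ℝ | ‖y‖ ≤ R} := measurableSet_le (by fun_prop) measurable_const
    have hslice0 : ∀ y : Fin n → ℝ, R < ‖y‖ → ∀ s : ℝ, k (i.insertNth (α := fun _ => ℝ) s y) = 0 := by
      intro y hy s
      apply hks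
      by_contra h
      push Not at h
      exact absurd ((norm_insertNth i s y R (by linarith)).1 h).2 (not_le.2 hy)
    have hslice1 : ∀ (y : Fin n → ℝ) (s : ℝ), R < |s| → k (i.insertNth (α := fun _ => ℝ) s y) = 0 := by
      intro y s hs
      apply hks
      by_contra h
      push Not at h
      exact absurd ((norm_insertNth i s y R (by linarith)).1 h).1 (not_le.2 hs)
    have hlip1 : ∀ (y : Fin n → ℝ) (s s' : ℝ), ‖k (i.insertNth (α := fun _ => ℝ) s y) - k (i.insertNth (α := fun _ => ℝ) s' y)‖ ≤ |s - s'| := by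
      intro y s s'
      refine (hkl _ _).trans ?_
      rw [pi_norm_le_iff_of_nonneg (abs_nonneg _), Fin.forall_iff_succAbove i]
      simp
    rw [integral_slice i _ hitg]
    have hpt : ∀ y : Fin n → ℝ, ‖∫ s : ℝ, k (i.insertNth (α := fun _ => ℝ) s y) * chi (pol c (i.insertNth (α := fun _ => ℝ) s y))‖ₑ ≤
          bad.indicator (fun _ => ENNReal.ofReal (2 * R)) y +
          {y : Fin n → ℝ | ‖y‖ ≤ R}.indicator (fun _ => ENNReal.ofReal (C₁ * u ^ (-ε₁))) y := by
      intro y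
      by_cases hy : ‖y‖ ≤ R
      · rw [← ofReal_norm]
        by_cases hyb : |pol q y| ≤ u
        · refine le_add_right ?_
          rw [Set.indicator_of_mem (show y ∈ bad from ⟨hy, hyb⟩)]
          apply ENNReal.ofReal_le_ofReal
          exact norm_integral_cutoff_le R (by linarith) (fun s => k (i.insertNth (α := fun _ => ℝ) s y)) _
            (fun s => hk1 _) (fun s => (norm_chi _).le) (hslice1 y)
        · push Not at hyb
          refine le_add_left ?_
          rw [Set.indicator_of_mem (show y ∈ {y : Fin n → ℝ | ‖y‖ ≤ R} from hy)]
          apply ENNReal.ofReal_le_ofReal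
          have := h1 (slp i c y) u a (slp_natDegree i c y) hu0
            (Nat.one_le_iff_ne_zero.2 (fun h => hi (Fin.ext h))) (by rw [slp_coeff]; exact hyb.le)
            (fun s => k (i.insertNth (α := fun _ => ℝ) s y)) (fun s => hk1 _) (hlip1 y) (hslice1 y)
          simpa only [slp_eval] using this
      · push Not at hy
        simp only [hslice0 y hy, zero_mul, integral_zero]
        simp
    rcases le_or_gt B 1 with hB1 | hB1
    · have h3 : ‖∫ y : Fin n → ℝ, ∫ s : ℝ, k (i.insertNth (α := fun _ => ℝ) s y) * chi (pol c (i.insertNth (α := fun _ => ℝ) s y))‖ ≤ (2 * R) ^ (n+1) := by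
        rw [← integral_slice i _ hitg]
        have e : ∫ y, k y * chi (pol c y) = ∫ y in {y | ‖y‖ ≤ R}, k y * chi (pol c y) := by
          symm; apply setIntegral_eq_integral_of_forall_compl_eq_zero
          intro x hx
          rw [hks x (not_le.1 hx), zero_mul]
        rw [e]
        have := norm_setIntegral_le_of_norm_le_const (μ := volume) (s := {y : Fin (n+1) → ℝ | ‖y‖ ≤ R}) (C := 1)
          (f := fun y => k y * chi (pol c y)) (by rw [volume_ball _ _ (by linarith)]; simp) (fun x _ => by
            rw [norm_mul]; exact mul_le_one₀ (hk1 x) (norm_nonneg _) (norm_chi _).le)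
        refine this.trans ?_
        rw [Measure.real, volume_ball _ _ (by linarith), ENNReal.toReal_ofReal (by positivity), one_mul]
      have : 1 ≤ B ^ (-ε) := Real.one_le_rpow_of_pos_of_le_one_of_nonpos hB hB1 (by linarith)
      have h4 : (2 * R) ^ (n+1) ≤ 2 * R * C₂ + (2 * R) ^ n * C₁ + (2 * R) ^ (n+1) := by
        have : 0 ≤ 2 * R * C₂ + (2 * R) ^ n * C₁ := by positivity
        linarith
      refine h3.trans ?_
      calc (2 * R) ^ (n+1) = (2 * R) ^ (n+1) * 1 := (mul_one _).symm
        _ ≤ _ := mul_le_mul h4 this zero_le_one (by positivity)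
    · have key : ‖∫ y : Fin n → ℝ, ∫ s : ℝ, k (i.insertNth (α := fun _ => ℝ) s y) * chi (pol c (i.insertNth (α := fun _ => ℝ) s y))‖ₑ ≤
          ENNReal.ofReal (2 * R * (C₂ * (u / B) ^ ε₂) + C₁ * u ^ (-ε₁) * (2 * R) ^ n) := by
        refine (enorm_integral_le_lintegral_enorm _).trans ((lintegral_mono hpt).trans ?_)
        rw [lintegral_add_left (measurable_const.indicator hbm), lintegral_indicator_const hbm,
          lintegral_indicator_const hballm, volume_ball _ _ (by linarith)]
        refine (add_le_add_left (mul_le_mul_right hb _) _).trans ?_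
        rw [← ENNReal.ofReal_mul (by positivity), ← ENNReal.ofReal_mul (by positivity),
          ← ENNReal.ofReal_add (by positivity) (by positivity)]
      rw [← ofReal_norm, ENNReal.ofReal_le_ofReal_iff (by positivity)] at key
      refine key.trans ?_
      have f1 : u ^ (-ε₁) ≤ B ^ (-ε) := by
        rw [hu, ← Real.rpow_mul hB.le]
        exact Real.rpow_le_rpow_of_exponent_le hB1.le (by linarith)
      have f2 : (u / B) ^ ε₂ ≤ B ^ (-ε) := by
        have : u / B = B ^ (-(1/2) : ℝ) := by
          rw [hu]
          nth_rewrite 2 [← Real.rpow_one B]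
          rw [← Real.rpow_sub hB]; norm_num
        rw [this, ← Real.rpow_mul hB.le]
        exact Real.rpow_le_rpow_of_exponent_le hB1.le (by linarith)
      set Y := B ^ (-ε) with hY
      have hY0 : 0 < Y := by positivity
      calc _ ≤ 2 * R * (C₂ * Y) + C₁ * Y * (2 * R) ^ n := by gcongr
        _ ≤ 2 * R * (C₂ * Y) + C₁ * Y * (2 * R) ^ n + (2 * R) ^ (n+1) * Y := by
          have : 0 ≤ (2 * R) ^ (n+1) * Y := by positivity
          linarith
        _ = _ := by ring

end oscn
end SR
end

section

namespace SR

section grid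
variable {Γ : Type*} [Fintype Γ] (w : Γ → ℕ)

/-- anisotropic scale -/
def sc (l : ℤ) (α : Γ) : ℝ := (2:ℝ) ^ (l * (w α : ℤ))
/-- dyadic index -/
def idx (l : ℤ) (x : Γ → ℝ) : Γ → ℤ := fun α => ⌊x α / sc w l α⌋
/-- dyadic cell -/
def cell (i : ℤ × (Γ → ℤ)) : Set (Γ → ℝ) := {x | idx w i.1 x = i.2}
/-- volume of a level `l` cell -/
def vl (l : ℤ) : ℝ≥0∞ := ∏ α, ENNReal.ofReal (sc w l α)
/-- anisotropic box -/
def box (l : ℤ) (x : Γ → ℝ) : Set (Γ → ℝ) := {y | ∀ α, |y α - x α| ≤ sc w l α}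

lemma sc_pos (l : ℤ) (α : Γ) : 0 < sc w l α := by unfold sc; positivity

lemma sc_add (l m : ℤ) (α : Γ) : sc w (l + m) α = sc w l α * sc w m α := by
  unfold sc; rw [add_mul, zpow_add₀ two_ne_zero]

lemma sc_mono {l m : ℤ} (h : l ≤ m) (α : Γ) : sc w l α ≤ sc w m α := by
  unfold sc
  apply zpow_le_zpow_right₀ one_le_two
  exact mul_le_mul_of_nonneg_right h (by positivity)

lemma sc_one (α : Γ) : sc w 1 α = 2 ^ (w α) := by unfold sc; simp

lemma two_mul_sc_le (hw : ∀ α, 1 ≤ w α) (l : ℤ) (α : Γ) : 2 * sc w l α ≤ sc w (l+1) α := by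
  rw [sc_add, sc_one, mul_comm]
  apply mul_le_mul_of_nonneg_left _ (sc_pos w l α).le
  calc (2:ℝ) = 2 ^ 1 := (pow_one _).symm
    _ ≤ 2 ^ w α := pow_le_pow_right₀ one_le_two (hw α)

lemma sc_le_of_nonpos (hw : ∀ α, 1 ≤ w α) {l : ℤ} (hl : l ≤ 0) (α : Γ) : sc w l α ≤ 2 ^ l := by
  unfold sc
  apply zpow_le_zpow_right₀ one_le_two
  have : (1:ℤ) ≤ w α := by exact_mod_cast hw α
  nlinarith

lemma idx_nested {l m : ℤ} (h : l ≤ m) {x y : Γ → ℝ} (hxy : idx w l x = idx w l y) : idx w m x = idx w m y := by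
  obtain ⟨k, rfl⟩ := Int.le.dest h
  have key : ∀ z : Γ → ℝ, ∀ α, idx w (l + k) z α = idx w l z α / ((2 ^ (k * w α) : ℕ) : ℤ) := by
    intro z α
    unfold idx
    rw [← Int.floor_div_natCast, div_div, sc_add]
    congr 3
    unfold sc
    rw [← Nat.cast_mul, zpow_natCast]; push_cast; rfl
  funext α
  rw [key, key, hxy]

lemma measurable_idx (l : ℤ) : Measurable (idx w l) := by
  unfold idx
  refine measurable_pi_lambda _ fun α => Int.measurable_floor.comp ?_
  exact (measurable_pi_apply α).div_const _

lemma measurableSet_cell (i : ℤ × (Γ → ℤ)) : MeasurableSet (cell w i) :=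
  measurable_idx w i.1 (measurableSet_singleton i.2)

lemma measurableSet_box (l : ℤ) (x : Γ → ℝ) : MeasurableSet (box w l x) := by
  unfold box
  rw [Set.ofPred_forall]
  refine MeasurableSet.iInter fun α => measurableSet_le ?_ measurable_const
  fun_prop

lemma mem_cell_idx (l : ℤ) (x : Γ → ℝ) : x ∈ cell w (l, idx w l x) := rfl

lemma cell_eq (i : ℤ × (Γ → ℤ)) : cell w i =
    Set.univ.pi fun α => Set.Ico ((i.2 α : ℝ) * sc w i.1 α) (((i.2 α : ℝ) + 1) * sc w i.1 α) := by
  ext x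
  simp only [cell, Set.mem_ofPred_eq, Set.mem_univ_pi, Set.mem_Ico, funext_iff, idx, Int.floor_eq_iff]
  refine forall_congr' fun α => ?_
  rw [le_div_iff₀ (sc_pos w _ _), div_lt_iff₀ (sc_pos w _ _)]

lemma volume_cell (i : ℤ × (Γ → ℤ)) : volume (cell w i) = vl w i.1 := by
  rw [cell_eq, Real.volume_pi_Ico]
  unfold vl
  refine Finset.prod_congr rfl fun α _ => ?_
  congr 1; ring

lemma volume_box (l : ℤ) (x : Γ → ℝ) : volume (box w l x) = 2 ^ (Fintype.card Γ) * vl w l := by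
  have : box w l x = Set.Icc (fun α => x α - sc w l α) (fun α => x α + sc w l α) := by
    ext y
    simp only [box, Set.mem_ofPred_eq, Set.mem_Icc, Pi.le_def, ← forall_and, abs_le]
    refine forall_congr' fun α => ⟨fun h => ⟨by linarith, by linarith⟩, fun h => ⟨by linarith, by linarith⟩⟩
  rw [this, Real.volume_Icc_pi]
  have e : ∀ α, ENNReal.ofReal (x α + sc w l α - (x α - sc w l α)) = 2 * ENNReal.ofReal (sc w l α) := by
    intro α
    rw [show x α + sc w l α - (x α - sc w l α) = 2 * sc w l α by ring, ENNReal.ofReal_mul (by norm_num)]; simp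
  simp only [e, Finset.prod_mul_distrib, Finset.prod_const, Finset.card_univ]
  rfl

lemma vl_ne_top (l : ℤ) : vl w l ≠ ∞ := ENNReal.prod_ne_top fun α _ => ENNReal.ofReal_ne_top
lemma vl_ne_zero (l : ℤ) : vl w l ≠ 0 :=
  Finset.prod_ne_zero_iff.2 fun α _ => by simpa using sc_pos w l α

lemma vl_eq (l : ℤ) : vl w l = ENNReal.ofReal ((2:ℝ) ^ (l * ((∑ α, w α : ℕ) : ℤ))) := by
  unfold vl sc
  rw [← ENNReal.ofReal_prod_of_nonneg (fun α _ => by positivity)]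
  congr 1
  push_cast
  rw [Finset.mul_sum]
  induction (Finset.univ : Finset Γ) using Finset.cons_induction with
  | empty => simp
  | cons a s ha ih => rw [Finset.prod_cons, Finset.sum_cons, zpow_add₀ two_ne_zero, ih]

lemma vl_add (l m : ℤ) : vl w (l + m) = vl w l * vl w m := by
  unfold vl
  rw [← Finset.prod_mul_distrib]
  refine Finset.prod_congr rfl fun α _ => ?_
  rw [sc_add, ENNReal.ofReal_mul (sc_pos w _ _).le]

lemma cell_subset_box (l : ℤ) (x : Γ → ℝ) : cell w (l, idx w l x) ⊆ box w l x := by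
  intro y hy α
  have h : ⌊y α / sc w l α⌋ = ⌊x α / sc w l α⌋ := congrFun hy α
  have h1 := Int.abs_sub_lt_one_of_floor_eq_floor h
  have hs := sc_pos w l α
  rw [← sub_div, abs_div, abs_of_pos hs, div_lt_one hs] at h1
  exact h1.le

lemma idx_sub_le_of_box {l : ℤ} {x y : Γ → ℝ} (h : y ∈ box w l x) (α : Γ) : |idx w l y α - idx w l x α| ≤ 1 := by
  have hs := sc_pos w l α
  have h1 := h α
  have h2 : |y α / sc w l α - x α / sc w l α| ≤ 1 := by
    rw [← sub_div, abs_div, abs_of_pos hs, div_le_one hs]; exact h1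
  unfold idx
  rw [abs_le] at h2 ⊢
  constructor
  · have : ⌊x α / sc w l α⌋ ≤ ⌊y α / sc w l α⌋ + 1 := by
      rw [← Int.floor_add_one]; exact Int.floor_le_floor (by linarith)
    linarith
  · have : ⌊y α / sc w l α⌋ ≤ ⌊x α / sc w l α⌋ + 1 := by
      rw [← Int.floor_add_one]; exact Int.floor_le_floor (by linarith)
    linarith

lemma box_comm {l : ℤ} {x y : Γ → ℝ} : y ∈ box w l x ↔ x ∈ box w l y := by
  unfold box
  simp only [Set.mem_ofPred_eq]
  refine forall_congr' fun α => ?_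
  rw [abs_sub_comm]

lemma box_mono {l m : ℤ} (h : l ≤ m) (x : Γ → ℝ) : box w l x ⊆ box w m x :=
  fun y hy α => (hy α).trans (sc_mono w h α)

/-- tripled cell -/
def tri (i : ℤ × (Γ → ℤ)) : Set (Γ → ℝ) := {x | ∀ α, |idx w i.1 x α - i.2 α| ≤ 1}

lemma measurableSet_tri (i : ℤ × (Γ → ℤ)) : MeasurableSet (tri w i) := by
  have : tri w i = idx w i.1 ⁻¹' {n | ∀ α, |n α - i.2 α| ≤ 1} := rfl
  rw [this]; exact measurable_idx w i.1 (Set.to_countable _).measurableSet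

lemma tri_subset_box (hw : ∀ α, 1 ≤ w α) (i : ℤ × (Γ → ℤ)) {z : Γ → ℝ} (hz : z ∈ cell w i) :
    tri w i ⊆ box w (i.1 + 1) z := by
  intro x hx α
  refine le_trans ?_ (two_mul_sc_le w hw i.1 α)
  have hs := sc_pos w i.1 α
  have h1 : |⌊x α / sc w i.1 α⌋ - ⌊z α / sc w i.1 α⌋| ≤ 1 := by
    have := hx α; rw [← show idx w i.1 z = i.2 from hz] at this; exact this
  have h2 : |x α / sc w i.1 α - z α / sc w i.1 α| ≤ 2 := by
    rw [abs_le] at h1 ⊢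
    have a1 : ((⌊x α / sc w i.1 α⌋ : ℤ) : ℝ) - ⌊z α / sc w i.1 α⌋ ≤ 1 := by exact_mod_cast h1.2
    have a2 : (-1 : ℝ) ≤ ((⌊x α / sc w i.1 α⌋ : ℤ) : ℝ) - ⌊z α / sc w i.1 α⌋ := by exact_mod_cast h1.1
    have b1 := Int.floor_le (x α / sc w i.1 α)
    have b2 := Int.lt_floor_add_one (x α / sc w i.1 α)
    have b3 := Int.floor_le (z α / sc w i.1 α)
    have b4 := Int.lt_floor_add_one (z α / sc w i.1 α)
    constructor <;> linarith
  rwa [← sub_div, abs_div, abs_of_pos hs, div_le_iff₀ hs] at h2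

/-- maximal cells -/
lemma mcel (p : ℤ → (Γ → ℝ) → Prop) (hp : ∀ l x y, idx w l x = idx w l y → p l x → p l y)
    (hb : ∀ x, ∃ b, ∀ l, p l x → l ≤ b) :
    ∃ I : Set (ℤ × (Γ → ℤ)), (∀ i ∈ I, ∃ x ∈ cell w i, p i.1 x ∧ ∀ l, p l x → l ≤ i.1) ∧
      (∀ x l, p l x → ∃ i ∈ I, l ≤ i.1 ∧ x ∈ cell w i) ∧ I.PairwiseDisjoint (cell w) := by
  refine ⟨{i | ∃ x ∈ cell w i, p i.1 x ∧ ∀ l, p l x → l ≤ i.1}, fun i hi => hi, ?_, ?_⟩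
  · intro x l hl
    obtain ⟨u, hu, hmax⟩ := Int.exists_greatest_of_bdd (hb x) ⟨l, hl⟩
    exact ⟨(u, idx w u x), ⟨x, rfl, hu, hmax⟩, hmax l hl, rfl⟩
  · have key : ∀ i : ℤ × (Γ → ℤ), (∃ x ∈ cell w i, p i.1 x ∧ ∀ l, p l x → l ≤ i.1) →
        ∀ y ∈ cell w i, p i.1 y ∧ ∀ l, p l y → l ≤ i.1 := by
      rintro i ⟨x, hx, hpx, hmax⟩ y hy
      have e : idx w i.1 x = idx w i.1 y := hx.trans hy.symm
      refine ⟨hp _ _ _ e hpx, fun l hl => ?_⟩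
      by_contra h
      push Not at h
      exact absurd (hmax l (hp _ _ _ (idx_nested w h.le e).symm hl)) (not_le.2 h)
    intro i hi j hj hij
    rw [Function.onFun, Set.disjoint_left]
    intro y hyi hyj
    obtain ⟨a1, a2⟩ := key i hi y hyi
    obtain ⟨b1, b2⟩ := key j hj y hyj
    apply hij
    have e : i.1 = j.1 := le_antisymm (b2 _ a1) (a2 _ b1)
    refine Prod.ext e ?_
    have h1 : idx w i.1 y = i.2 := hyi
    have h2 : idx w j.1 y = j.2 := hyj
    rw [← h1, ← h2, e]

/-- Lebesgue differentiation in the form needed. -/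
lemma ae_le_of_cell (hw : ∀ α, 1 ≤ w α) (F : (Γ → ℝ) → ℝ≥0∞) (hF : Measurable F) (t : ℝ≥0∞) :
    ∀ᵐ x, (∀ l, ∫⁻ y in cell w (l, idx w l x), F y ≤ t * vl w l) → F x ≤ t := by
  set S : Set (Γ → ℝ) := {x | ∀ l, ∫⁻ y in cell w (l, idx w l x), F y ≤ t * vl w l} with hS
  have hSm : MeasurableSet S := by
    rw [hS, Set.ofPred_forall]
    refine MeasurableSet.iInter fun l => ?_
    have : {x : Γ → ℝ | ∫⁻ y in cell w (l, idx w l x), F y ≤ t * vl w l} =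
      idx w l ⁻¹' {n | ∫⁻ y in cell w (l, n), F y ≤ t * vl w l} := rfl
    rw [this]; exact measurable_idx w l (Set.to_countable _).measurableSet
  have key : ∀ s : Set (Γ → ℝ), MeasurableSet s → volume s < ∞ → ∫⁻ x in s, S.indicator F x ≤ ∫⁻ x in s, (fun _ => t) x := by
    intro s hs hsf
    rw [lintegral_indicator hSm, Measure.restrict_restrict hSm, lintegral_const, Measure.restrict_apply .univ,
      Set.univ_inter]
    set A := S ∩ s with hA
    have hopen : ∀ U : Set (Γ → ℝ), A ⊆ U → IsOpen U → ∫⁻ x in A, F x ≤ t * volume U := by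
      intro U hAU hU
      obtain ⟨I, hI1, hI2, hI3⟩ := mcel w (fun l x => l ≤ 0 ∧ cell w (l, idx w l x) ⊆ U ∧ (cell w (l, idx w l x) ∩ A).Nonempty)
        (by intro l x y h; simp only [h]; exact id) (fun x => ⟨0, fun l h => h.1⟩)
      have hIc : I.Countable := I.to_countable
      have hcov : A ⊆ ⋃ i ∈ I, cell w i := by
        intro x hx
        obtain ⟨ε, hε, hball⟩ := Metric.isOpen_iff.1 hU x (hAU hx)
        obtain ⟨n, hn⟩ := exists_pow_lt_of_lt_one hε (show (1/2 : ℝ) < 1 by norm_num)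
        have hcU : cell w (-(n:ℤ), idx w (-(n:ℤ)) x) ⊆ U := by
          intro y hy
          apply hball
          rw [Metric.mem_ball, dist_pi_lt_iff hε]
          intro α
          rw [Real.dist_eq]
          refine (cell_subset_box w _ _ hy α).trans_lt ((sc_le_of_nonpos w hw (by simp) α).trans_lt ?_)
          simpa using hn
        obtain ⟨i, hi, _, hxi⟩ := hI2 x (-(n:ℤ)) ⟨by simp, hcU, ⟨x, rfl, hx⟩⟩
        exact Set.mem_biUnion hi hxi
      have hsub : (⋃ i ∈ I, cell w i) ⊆ U := by
        refine Set.iUnion₂_subset fun i hi => ?_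
        obtain ⟨x, hx, hp, _⟩ := hI1 i hi
        have : (i.1, idx w i.1 x) = i := Prod.ext rfl hx
        rw [this] at hp; exact hp.2.1
      calc ∫⁻ x in A, F x ≤ ∫⁻ x in ⋃ i ∈ I, cell w i, F x := lintegral_mono_set hcov
        _ = ∑' i : I, ∫⁻ x in cell w i, F x := lintegral_biUnion hIc (fun i _ => measurableSet_cell w i) hI3 F
        _ ≤ ∑' i : I, t * volume (cell w i) := by
          refine ENNReal.tsum_le_tsum fun i => ?_
          obtain ⟨x, hx, hp, _⟩ := hI1 i i.2
          have e : ((i:ℤ × (Γ → ℤ)).1, idx w (i:ℤ × (Γ → ℤ)).1 x) = i := Prod.ext rfl hx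
          rw [e] at hp
          obtain ⟨z, hz, hzA⟩ := hp.2.2
          have := hzA.1 (i:ℤ × (Γ → ℤ)).1
          rw [show idx w (i:ℤ × (Γ → ℤ)).1 z = (i:ℤ × (Γ → ℤ)).2 from hz] at this
          rw [volume_cell]; exact this
        _ = t * volume (⋃ i ∈ I, cell w i) := by
          rw [ENNReal.tsum_mul_left, measure_biUnion hIc hI3 (fun i _ => measurableSet_cell w i)]
        _ ≤ t * volume U := by gcongr
    have hA1 : ∫⁻ x in A, F x ≤ t * volume A := by
      by_cases ht : t = ∞
      · by_cases h0 : volume A = 0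
        · rw [setLIntegral_measure_zero _ _ h0]; simp
        · rw [ht, ENNReal.top_mul h0]; exact le_top
      refine ENNReal.le_of_forall_pos_le_add fun δ hδ _ => ?_
      obtain ⟨U, hAU, hU, hUm⟩ := Set.exists_isOpen_le_add A volume (ε := (δ : ℝ≥0∞) / t)
        (ENNReal.div_pos (by simpa using hδ.ne') ht).ne'
      refine (hopen U hAU hU).trans ((mul_le_mul_right hUm t).trans ?_)
      rw [mul_add]
      gcongr
      exact ENNReal.mul_div_le
    exact hA1.trans (by gcongr; exact Set.inter_subset_right)
  have := ae_le_of_forall_setLIntegral_le_of_sigmaFinite (hF.indicator hSm) key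
  filter_upwards [this] with x hx hxS
  rwa [Set.indicator_of_mem (show x ∈ S from hxS)] at hx

end grid
end SR
end

section

namespace SR

section layer

lemma lc_fin (q a : ℝ) (hq : 0 < q) (ha : 0 ≤ a) :
    ENNReal.ofReal q * ∫⁻ s in Set.Ioi (0:ℝ), (Set.Iio a).indicator (fun s => ENNReal.ofReal (s ^ (q-1))) s
      = ENNReal.ofReal (a ^ q) := by
  rw [lintegral_indicator measurableSet_Iio, Measure.restrict_restrict measurableSet_Iio]
  have e : Set.Iio a ∩ Set.Ioi 0 = Set.Ioo 0 a := by ext; simp [and_comm]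
  rw [e]
  have h0 : IntervalIntegrable (fun s : ℝ => s ^ (q-1)) volume 0 a :=
    intervalIntegral.intervalIntegrable_rpow' (by linarith)
  have h1 : IntegrableOn (fun s : ℝ => s ^ (q-1)) (Set.Ioo 0 a) := by
    rw [intervalIntegrable_iff_integrableOn_Ioo_of_le ha] at h0; exact h0
  rw [← ofReal_integral_eq_lintegral_ofReal h1
    ((ae_restrict_iff' measurableSet_Ioo).2 (ae_of_all _ fun s hs => Real.rpow_nonneg hs.1.le _)),
    ← integral_Ioc_eq_integral_Ioo, ← intervalIntegral.integral_of_le ha, integral_rpow (Or.inl (by linarith)),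
    ← ENNReal.ofReal_mul hq.le]
  congr 1
  rw [sub_add_cancel, Real.zero_rpow hq.ne']
  field_simp
  simp

lemma lc (q : ℝ) (hq : 0 < q) (x : ℝ≥0∞) :
    ENNReal.ofReal q * ∫⁻ s in Set.Ioi (0:ℝ), {s : ℝ | ENNReal.ofReal s < x}.indicator (fun s => ENNReal.ofReal (s ^ (q-1))) s
      = x ^ q := by
  by_cases hx : x = ∞
  · subst hx
    rw [ENNReal.top_rpow_of_pos hq]
    refine ENNReal.eq_top_of_forall_nnreal_le fun r => ?_
    have h2 := lc_fin q ((r:ℝ) ^ (1/q)) hq (by positivity)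
    rw [← Real.rpow_mul r.coe_nonneg, one_div_mul_cancel hq.ne', Real.rpow_one, ENNReal.ofReal_coe_nnreal] at h2
    rw [← h2]
    refine mul_le_mul_right (lintegral_mono fun s => ?_) _
    simp only [Set.indicator]
    split_ifs with h1 h2
    · exact le_rfl
    · exact absurd ENNReal.ofReal_lt_top h2
    · exact bot_le
    · exact le_rfl
  · have := lc_fin q x.toReal hq ENNReal.toReal_nonneg
    rw [← ENNReal.ofReal_rpow_of_nonneg ENNReal.toReal_nonneg hq.le, ENNReal.ofReal_toReal hx] at this
    rw [← this]
    congr 1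
    refine setLIntegral_congr_fun measurableSet_Ioi fun s hs => ?_
    simp only [Set.indicator]
    congr 1
    simp only [Set.mem_ofPred_eq, Set.mem_Iio, eq_iff_iff]
    rw [ENNReal.ofReal_lt_iff_lt_toReal (le_of_lt hs) hx]

lemma layer_aux {X : Type*} [MeasurableSpace X] (μ : Measure X) [SFinite μ] (q : ℝ) (hq : 0 < q)
    (G U : X → ℝ≥0∞) (hG : Measurable G) (hU : Measurable U) :
    ∫⁻ x, U x * G x ^ q ∂μ = ENNReal.ofReal q * ∫⁻ s in Set.Ioi (0:ℝ), ENNReal.ofReal (s ^ (q-1)) *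
      ∫⁻ x in {x | ENNReal.ofReal s < G x}, U x ∂μ := by
  have hm : Measurable fun z : X × ℝ => U z.1 * {s : ℝ | ENNReal.ofReal s < G z.1}.indicator (fun s => ENNReal.ofReal (s ^ (q-1))) z.2 := by
    refine (hU.comp measurable_fst).mul ?_
    have : (fun z : X × ℝ => {s : ℝ | ENNReal.ofReal s < G z.1}.indicator (fun s => ENNReal.ofReal (s ^ (q-1))) z.2)
      = {z : X × ℝ | ENNReal.ofReal z.2 < G z.1}.indicator (fun z => ENNReal.ofReal (z.2 ^ (q-1))) := by
      funext z; simp [Set.indicator]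
    rw [this]
    refine Measurable.indicator (by fun_prop) (measurableSet_lt (by fun_prop) (hG.comp measurable_fst))
  calc ∫⁻ x, U x * G x ^ q ∂μ = ∫⁻ x, ENNReal.ofReal q * (∫⁻ s in Set.Ioi (0:ℝ),
        U x * {s : ℝ | ENNReal.ofReal s < G x}.indicator (fun s => ENNReal.ofReal (s ^ (q-1))) s) ∂μ := by
        refine lintegral_congr fun x => ?_
        rw [lintegral_const_mul, ← lc q hq]
        · ring
        · exact Measurable.indicator (by fun_prop) (measurableSet_lt (by fun_prop) measurable_const)
    _ = ENNReal.ofReal q * ∫⁻ x, (∫⁻ s in Set.Ioi (0:ℝ),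
        U x * {s : ℝ | ENNReal.ofReal s < G x}.indicator (fun s => ENNReal.ofReal (s ^ (q-1))) s) ∂μ :=
        lintegral_const_mul' _ _ ENNReal.ofReal_ne_top
    _ = _ := by
      congr 1
      rw [lintegral_lintegral_swap (by exact hm.aemeasurable)]
      refine setLIntegral_congr_fun measurableSet_Ioi fun s hs => ?_
      rw [← lintegral_const_mul' _ _ ENNReal.ofReal_ne_top,
        ← lintegral_indicator (measurableSet_lt measurable_const hG)]
      refine lintegral_congr fun x => ?_
      simp only [Set.indicator, Set.mem_ofPred_eq]
      split_ifs
      · ring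
      · simp

lemma layer {X : Type*} [MeasurableSpace X] (μ : Measure X) [SFinite μ] (q : ℝ) (hq : 0 < q)
    (G : X → ℝ≥0∞) (hG : Measurable G) :
    ∫⁻ x, G x ^ q ∂μ = ENNReal.ofReal q * ∫⁻ s in Set.Ioi (0:ℝ), ENNReal.ofReal (s ^ (q-1)) *
      μ {x | ENNReal.ofReal s < G x} := by
  have := layer_aux μ q hq G (fun _ => 1) hG measurable_const
  simpa using this

end layer

section max
variable {Γ : Type*} [Fintype Γ] (w : Γ → ℕ)

lemma vl_bdd [Nonempty Γ] (hw : ∀ α, 1 ≤ w α) (K t : ℝ≥0∞) (hK : K ≠ ∞) (ht : t ≠ 0) :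
    ∃ b : ℤ, ∀ l, t * vl w l < K → l ≤ b := by
  by_cases ht' : t = ∞
  · refine ⟨0, fun l h => ?_⟩
    rw [ht', ENNReal.top_mul (vl_ne_zero w l)] at h
    exact absurd h not_top_lt
  obtain ⟨n, hn⟩ := exists_nat_gt (K / t).toReal
  refine ⟨n, fun l hl => ?_⟩
  by_contra h
  push Not at h
  have hl0 : 0 ≤ l := by omega
  have h1 : ENNReal.ofReal (n:ℝ) ≤ vl w l := by
    rw [vl_eq]
    apply ENNReal.ofReal_le_ofReal
    have hW : (1:ℤ) ≤ ((∑ α, w α : ℕ) : ℤ) := by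
      obtain ⟨α⟩ := ‹Nonempty Γ›
      exact_mod_cast (hw α).trans (Finset.single_le_sum (f := w) (fun _ _ => Nat.zero_le _) (Finset.mem_univ α))
    calc (n:ℝ) ≤ 2 ^ n := by exact_mod_cast Nat.lt_two_pow_self.le
      _ = 2 ^ (n:ℤ) := by simp
      _ ≤ _ := zpow_le_zpow_right₀ one_le_two (by nlinarith)
  have h2 : K / t < ENNReal.ofReal n := by
    rwa [ENNReal.lt_ofReal_iff_toReal_lt (ENNReal.div_ne_top hK ht)]
  have h3 := h2.trans_le h1
  rw [ENNReal.div_lt_iff (Or.inl ht) (Or.inl ht'), mul_comm] at h3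
  exact absurd (hl.trans h3) (lt_irrefl _)

lemma cz_cells [Nonempty Γ] (hw : ∀ α, 1 ≤ w α) (F : (Γ → ℝ) → ℝ≥0∞) (hF : ∫⁻ x, F x ≠ ∞)
    (t : ℝ≥0∞) (ht : t ≠ 0) : ∃ I : Set (ℤ × (Γ → ℤ)), I.PairwiseDisjoint (cell w) ∧
      (∀ i ∈ I, t * vl w i.1 < ∫⁻ x in cell w i, F x ∧ ∫⁻ x in cell w i, F x ≤ vl w 1 * t * vl w i.1) ∧
      (∀ x l, t * vl w l < ∫⁻ y in cell w (l, idx w l x), F y → ∃ i ∈ I, l ≤ i.1 ∧ x ∈ cell w i) := by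
  obtain ⟨b, hb⟩ := vl_bdd w hw _ t hF ht
  obtain ⟨I, h1, h2, h3⟩ := mcel w (fun l x => t * vl w l < ∫⁻ y in cell w (l, idx w l x), F y)
    (by intro l x y h; simp only [h]; exact id)
    (fun x => ⟨b, fun l hl => hb l (hl.trans_le (setLIntegral_le_lintegral _ _))⟩)
  refine ⟨I, h3, fun i hi => ?_, h2⟩
  obtain ⟨x, hx, hp, hmax⟩ := h1 i hi
  have e : (i.1, idx w i.1 x) = i := Prod.ext rfl hx
  rw [e] at hp
  refine ⟨hp, ?_⟩
  have h4 : ¬ (t * vl w (i.1+1) < ∫⁻ y in cell w (i.1+1, idx w (i.1+1) x), F y) := fun h => by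
    have := hmax _ h; omega
  push Not at h4
  refine le_trans (lintegral_mono_set ?_) (h4.trans (le_of_eq ?_))
  · intro y hy
    exact idx_nested w (by omega) ((show idx w i.1 y = i.2 from hy).trans (show idx w i.1 x = i.2 from hx).symm)
  · rw [vl_add]; ring

/-- box maximal function -/
def mx (F : (Γ → ℝ) → ℝ≥0∞) (x : Γ → ℝ) : ℝ≥0∞ := ⨆ l : ℤ, (vl w l)⁻¹ * ∫⁻ y in box w l x, F y

lemma lintegral_box_eq (l : ℤ) (F : (Γ → ℝ) → ℝ≥0∞) (x : Γ → ℝ) :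
    ∫⁻ y in box w l x, F y = ∫⁻ y, {z : (Γ → ℝ) × (Γ → ℝ) | ∀ α, |z.2 α - z.1 α| ≤ sc w l α}.indicator (fun z => F z.2) (x, y) := by
  rw [← lintegral_indicator (measurableSet_box w l x)]
  rfl

lemma measurable_mx (F : (Γ → ℝ) → ℝ≥0∞) (hF : Measurable F) : Measurable (mx w F) := by
  unfold mx
  refine Measurable.iSup fun l => Measurable.const_mul ?_ _
  simp only [lintegral_box_eq]
  refine Measurable.lintegral_prod_right' ?_
  refine Measurable.indicator (hF.comp measurable_snd) ?_
  rw [Set.ofPred_forall]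
  refine MeasurableSet.iInter fun α => measurableSet_le ?_ measurable_const
  fun_prop

lemma box_le_mx (F : (Γ → ℝ) → ℝ≥0∞) (l : ℤ) (x : Γ → ℝ) : ∫⁻ y in box w l x, F y ≤ vl w l * mx w F x := by
  have : (vl w l)⁻¹ * ∫⁻ y in box w l x, F y ≤ mx w F x := le_iSup (fun l : ℤ => (vl w l)⁻¹ * ∫⁻ y in box w l x, F y) l
  calc _ = vl w l * ((vl w l)⁻¹ * ∫⁻ y in box w l x, F y) := by
        rw [← mul_assoc, ENNReal.mul_inv_cancel (vl_ne_zero w l) (vl_ne_top w l), one_mul]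
    _ ≤ _ := by gcongr

lemma mx_mono {F G : (Γ → ℝ) → ℝ≥0∞} (h : ∀ x, F x ≤ G x) (x : Γ → ℝ) : mx w F x ≤ mx w G x := by
  unfold mx; gcongr; exact h _

lemma mx_weak [Nonempty Γ] (hw : ∀ α, 1 ≤ w α) (F u : (Γ → ℝ) → ℝ≥0∞) (hF : ∫⁻ x, F x ≠ ∞) (hFm : Measurable F)
    (hu : Measurable u) (s : ℝ≥0∞) (hs : s ≠ 0) (hs' : s ≠ ∞) :
    ∫⁻ x in {x | s < mx w F x}, u x ≤ 3 ^ Fintype.card Γ * vl w 1 / s * ∫⁻ x, F x * mx w u x := by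
  classical
  set N : ℝ≥0∞ := 3 ^ Fintype.card Γ with hN
  have hN0 : N ≠ 0 := by simp [hN]
  have hNt : N ≠ ∞ := by simp [hN]
  set t := s / N with ht
  have ht0 : t ≠ 0 := (ENNReal.div_pos hs hNt).ne'
  have htt : t ≠ ∞ := ENNReal.div_ne_top hs' hN0
  have hNts : N * t = s := ENNReal.mul_div_cancel hN0 hNt
  obtain ⟨I, hd, hI, hcov⟩ := cz_cells w hw F hF t ht0
  have hIc : I.Countable := I.to_countable
  have hsub : {x | s < mx w F x} ⊆ ⋃ i ∈ I, tri w i := by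
    intro x hx
    obtain ⟨l, hl⟩ := lt_iSup_iff.1 (show s < ⨆ l : ℤ, (vl w l)⁻¹ * ∫⁻ y in box w l x, F y from hx)
    have hl' : s * vl w l < ∫⁻ y in box w l x, F y := by
      rw [mul_comm, ← div_eq_mul_inv] at hl
      rwa [ENNReal.lt_div_iff_mul_lt (Or.inl (vl_ne_zero w l)) (Or.inl (vl_ne_top w l))] at hl
    set nb : Finset (Γ → ℤ) := Fintype.piFinset (fun α => Finset.Icc (idx w l x α - 1) (idx w l x α + 1)) with hnb
    have hcard : (nb.card : ℝ≥0∞) = N := by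
      rw [hnb, Fintype.card_piFinset]
      simp [hN]
      have : ∀ a : ℤ, (a + 1 + 1 - (a - 1)).toNat = 3 := by intro a; omega
      simp [this]
    have hbox : box w l x ⊆ ⋃ n ∈ nb, (box w l x ∩ cell w (l, n)) := by
      intro y hy
      refine Set.mem_biUnion (x := idx w l y) ?_ ⟨hy, rfl⟩
      simp only [hnb, SetLike.mem_coe, Fintype.mem_piFinset, Finset.mem_Icc]
      intro α
      have := abs_le.1 (idx_sub_le_of_box w hy α)
      constructor <;> linarith
    have : ∃ n ∈ nb, t * vl w l < ∫⁻ y in box w l x ∩ cell w (l, n), F y := by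
      by_contra hcon
      push Not at hcon
      have : ∫⁻ y in box w l x, F y ≤ s * vl w l := by
        calc ∫⁻ y in box w l x, F y ≤ ∫⁻ y in ⋃ n ∈ nb, (box w l x ∩ cell w (l, n)), F y := lintegral_mono_set hbox
          _ ≤ ∑ n ∈ nb, ∫⁻ y in (box w l x ∩ cell w (l, n)), F y := by
            rw [lintegral_biUnion_finset]
            · intro a _ b _ hab
              rw [Function.onFun, Set.disjoint_left]
              rintro z ⟨_, h1⟩ ⟨_, h2⟩
              exact hab ((show idx w l z = a from h1).symm.trans h2)
            · exact fun n _ => (measurableSet_box w l x).inter (measurableSet_cell w _)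
          _ ≤ ∑ n ∈ nb, t * vl w l := Finset.sum_le_sum hcon
          _ = s * vl w l := by rw [Finset.sum_const, nsmul_eq_mul, hcard, ← mul_assoc, hNts]
      exact absurd hl' (not_lt.2 this)
    obtain ⟨n, hn, hlt⟩ := this
    obtain ⟨y, hyb, hyc⟩ : (box w l x ∩ cell w (l, n)).Nonempty := by
      by_contra h
      rw [Set.not_nonempty_iff_eq_empty] at h
      rw [h] at hlt; simp at hlt
    have hyc' : idx w l y = n := hyc
    obtain ⟨i, hi, hli, hyi⟩ := hcov y l (by
      rw [hyc']; exact hlt.trans_le (lintegral_mono_set Set.inter_subset_right))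
    refine Set.mem_biUnion hi ?_
    intro α
    have hyi' : idx w i.1 y = i.2 := hyi
    rw [← hyi']
    exact idx_sub_le_of_box w (box_mono w hli _ ((box_comm w).1 hyb)) α
  have hone : ∀ i ∈ I, ∫⁻ x in tri w i, u x ≤ vl w 1 / t * ∫⁻ z in cell w i, F z * mx w u z := by
    intro i hi
    have h1 : (∫⁻ z in cell w i, F z) * ∫⁻ x in tri w i, u x ≤ vl w (i.1+1) * ∫⁻ z in cell w i, F z * mx w u z := by
      rw [← lintegral_mul_const _ hFm, ← lintegral_const_mul _ (show Measurable (fun z => F z * mx w u z) from hFm.mul (measurable_mx w u hu))]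
      refine setLIntegral_mono' (measurableSet_cell w i) fun z hz => ?_
      calc F z * ∫⁻ x in tri w i, u x ≤ F z * (vl w (i.1+1) * mx w u z) := by
            gcongr
            exact (lintegral_mono_set (tri_subset_box w hw i hz)).trans (box_le_mx w u _ z)
        _ = _ := by ring
    have h2 : t * vl w i.1 * ∫⁻ x in tri w i, u x ≤ vl w 1 * vl w i.1 * ∫⁻ z in cell w i, F z * mx w u z := by
      rw [mul_comm (vl w 1), ← vl_add]
      exact le_trans (by gcongr; exact (hI i hi).1.le) h1
    have h3 : t * ∫⁻ x in tri w i, u x ≤ vl w 1 * ∫⁻ z in cell w i, F z * mx w u z := by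
      rw [← ENNReal.mul_le_mul_iff_right (vl_ne_zero w i.1) (vl_ne_top w i.1)]
      calc _ = t * vl w i.1 * ∫⁻ x in tri w i, u x := by ring
        _ ≤ _ := h2
        _ = _ := by ring
    rw [ENNReal.div_eq_inv_mul, mul_assoc, ← ENNReal.div_eq_inv_mul]
    rw [ENNReal.le_div_iff_mul_le (Or.inl ht0) (Or.inl htt), mul_comm]
    exact h3
  calc ∫⁻ x in {x | s < mx w F x}, u x ≤ ∫⁻ x in ⋃ i ∈ I, tri w i, u x := lintegral_mono_set hsub
    _ ≤ ∑' i : I, ∫⁻ x in tri w i, u x := by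
      rw [Set.biUnion_eq_iUnion]
      have : Countable I := hIc.to_subtype
      exact lintegral_iUnion_le _ _
    _ ≤ ∑' i : I, vl w 1 / t * ∫⁻ z in cell w i, F z * mx w u z := ENNReal.tsum_le_tsum fun i => hone i i.2
    _ = vl w 1 / t * ∫⁻ z in ⋃ i ∈ I, cell w i, F z * mx w u z := by
      rw [ENNReal.tsum_mul_left, lintegral_biUnion hIc (fun i _ => measurableSet_cell w i) hd]
    _ ≤ vl w 1 / t * ∫⁻ z, F z * mx w u z := by gcongr; exact Measure.restrict_le_self
    _ = _ := by
      congr 1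
      rw [ht, ENNReal.div_eq_inv_mul, ENNReal.inv_div (Or.inl hNt) (Or.inl hN0), ENNReal.div_eq_inv_mul,
        ENNReal.div_eq_inv_mul]
      ring

lemma mx_sub (F : (Γ → ℝ) → ℝ≥0∞) (hF : Measurable F) (a : ℝ≥0∞) (x : Γ → ℝ) :
    mx w F x ≤ mx w ({y | a < F y}.indicator F) x + 2 ^ Fintype.card Γ * a := by
  refine iSup_le fun l => ?_
  have h1 : ∫⁻ y in box w l x, F y ≤ (∫⁻ y in box w l x, {y | a < F y}.indicator F y) + a * (2 ^ Fintype.card Γ * vl w l) := by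
    rw [← volume_box w l x, ← setLIntegral_const, ← lintegral_add_right _ measurable_const]
    refine lintegral_mono fun y => ?_
    by_cases h : a < F y
    · rw [Set.indicator_of_mem (show y ∈ {y | a < F y} from h)]; exact le_self_add
    · exact le_add_left (not_lt.1 h)
  calc (vl w l)⁻¹ * ∫⁻ y in box w l x, F y
      ≤ (vl w l)⁻¹ * ((∫⁻ y in box w l x, {y | a < F y}.indicator F y) + a * (2 ^ Fintype.card Γ * vl w l)) := by gcongr
    _ = (vl w l)⁻¹ * (∫⁻ y in box w l x, {y | a < F y}.indicator F y) + 2 ^ Fintype.card Γ * a * ((vl w l)⁻¹ * vl w l) := by ring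
    _ ≤ _ := by
      rw [ENNReal.inv_mul_cancel (vl_ne_zero w l) (vl_ne_top w l), mul_one]
      gcongr
      exact le_iSup (fun l : ℤ => (vl w l)⁻¹ * ∫⁻ y in box w l x, {y | a < F y}.indicator F y) l

lemma mx_strong [Nonempty Γ] (hw : ∀ α, 1 ≤ w α) (q : ℝ) (hq : 1 < q) : ∃ C : ℝ≥0∞, C ≠ ∞ ∧
    ∀ (F u : (Γ → ℝ) → ℝ≥0∞) (hF : ∫⁻ x, F x ≠ ∞) (hFm : Measurable F) (hu : Measurable u),
    ∫⁻ x, u x * mx w F x ^ q ≤ C * ∫⁻ x, mx w u x * F x ^ q := by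
  set c : ℝ≥0∞ := 2 ^ Fintype.card Γ with hc
  have hc0 : c ≠ 0 := by simp [hc]
  have hct : c ≠ ∞ := by simp [hc]
  set A : ℝ≥0∞ := 3 ^ Fintype.card Γ * vl w 1 with hA
  have hAt : A ≠ ∞ := ENNReal.mul_ne_top (by simp) (vl_ne_top w 1)
  refine ⟨ENNReal.ofReal q * (2 * A) * ((ENNReal.ofReal (q-1))⁻¹ * (2 * c) ^ (q-1)), ?_, ?_⟩
  · refine ENNReal.mul_ne_top (ENNReal.mul_ne_top (by simp) (ENNReal.mul_ne_top (by simp) hAt))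
      (ENNReal.mul_ne_top (by simp [hq]) (ENNReal.rpow_ne_top_of_nonneg (by linarith) (ENNReal.mul_ne_top (by simp) hct)))
  intro F u hF hFm hu
  have hmF := measurable_mx w F hFm
  have hmu := measurable_mx w u hu
  rw [layer_aux volume q (by linarith) _ _ hmF hu]
  have h1 : ∀ s ∈ Set.Ioi (0:ℝ), ENNReal.ofReal (s ^ (q-1)) * ∫⁻ x in {x | ENNReal.ofReal s < mx w F x}, u x ≤
      2 * A * (ENNReal.ofReal (s ^ (q-1-1)) * ∫⁻ x in {x | ENNReal.ofReal s < 2 * c * F x}, F x * mx w u x) := by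
    intro s hs
    have hs0 : 0 < s := hs
    set a := ENNReal.ofReal s / (2 * c) with ha
    have hset : {x | ENNReal.ofReal s < 2 * c * F x} = {y | a < F y} := by
      ext x
      simp only [Set.mem_ofPred_eq, ha]
      rw [ENNReal.div_lt_iff (Or.inl (by simp [hc])) (Or.inl (by simp [hc, ENNReal.mul_eq_top])), mul_comm]
    have hms : MeasurableSet {y | a < F y} := measurableSet_lt measurable_const hFm
    have hsub : {x | ENNReal.ofReal s < mx w F x} ⊆ {x | ENNReal.ofReal (s/2) < mx w ({y | a < F y}.indicator F) x} := by
      intro x hx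
      have h2 := (show ENNReal.ofReal s < mx w F x from hx).trans_le (mx_sub w F hFm a x)
      have h3 : c * a = ENNReal.ofReal (s/2) := by
        rw [ha, ENNReal.ofReal_div_of_pos two_pos, mul_comm (2:ℝ≥0∞) c, ← mul_div_assoc,
          ENNReal.mul_div_mul_left _ _ hc0 hct]
        simp
      have h3' : ENNReal.ofReal s = ENNReal.ofReal (s/2) + ENNReal.ofReal (s/2) := by
        rw [← ENNReal.ofReal_add (by positivity) (by positivity), add_halves]
      rw [← hc, h3, h3'] at h2
      exact (ENNReal.add_lt_add_iff_right ENNReal.ofReal_ne_top).1 h2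
    have h4 := mx_weak w hw ({y | a < F y}.indicator F) u
      (ne_top_of_le_ne_top hF (lintegral_mono fun x => Set.indicator_le_self _ _ x)) (hFm.indicator hms) hu
      (ENNReal.ofReal (s/2)) (by simpa using hs0) ENNReal.ofReal_ne_top
    have h5 : ∫⁻ x, ({y | a < F y}.indicator F) x * mx w u x = ∫⁻ x in {y | a < F y}, F x * mx w u x := by
      rw [← lintegral_indicator hms]
      refine lintegral_congr fun x => ?_
      simp only [Set.indicator]; split_ifs <;> simp
    rw [h5] at h4
    have hset' : ∫⁻ x in {y | a < F y}, F x * mx w u x = ∫⁻ x in {x | ENNReal.ofReal s < 2 * c * F x}, F x * mx w u x := by rw [hset]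
    rw [hset'] at h4
    calc ENNReal.ofReal (s ^ (q-1)) * ∫⁻ x in {x | ENNReal.ofReal s < mx w F x}, u x
        ≤ ENNReal.ofReal (s ^ (q-1)) * (A / ENNReal.ofReal (s/2) * ∫⁻ x in {x | ENNReal.ofReal s < 2 * c * F x}, F x * mx w u x) := by
          gcongr
          exact (lintegral_mono_set hsub).trans h4
      _ = 2 * A * (ENNReal.ofReal (s ^ (q-1-1)) * ∫⁻ x in {x | ENNReal.ofReal s < 2 * c * F x}, F x * mx w u x) := by
          have e1 : ENNReal.ofReal (s ^ (q-1)) * (ENNReal.ofReal (s/2))⁻¹ = 2 * ENNReal.ofReal (s ^ (q-1-1)) := by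
            rw [← ENNReal.ofReal_inv_of_pos (by positivity), ← ENNReal.ofReal_mul (by positivity),
              show (2:ℝ≥0∞) = ENNReal.ofReal 2 by simp, ← ENNReal.ofReal_mul (by norm_num)]
            congr 1
            rw [Real.rpow_sub_one hs0.ne' (q-1)]; field_simp
          rw [div_eq_mul_inv]
          calc _ = A * (ENNReal.ofReal (s ^ (q-1)) * (ENNReal.ofReal (s/2))⁻¹) * ∫⁻ x in {x | ENNReal.ofReal s < 2 * c * F x}, F x * mx w u x := by ring
            _ = _ := by rw [e1]; ring
  have h6 := layer_aux volume (q-1) (by linarith) (fun x => 2 * c * F x) (fun x => F x * mx w u x)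
    (hFm.const_mul _) (hFm.mul hmu)
  have h7 : ∫⁻ s in Set.Ioi (0:ℝ), ENNReal.ofReal (s ^ (q-1-1)) * ∫⁻ x in {x | ENNReal.ofReal s < 2 * c * F x}, F x * mx w u x
      = (ENNReal.ofReal (q-1))⁻¹ * (2 * c) ^ (q-1) * ∫⁻ x, mx w u x * F x ^ q := by
    have h8 : ∫⁻ x, F x * mx w u x * (2 * c * F x) ^ (q-1) = (2 * c) ^ (q-1) * ∫⁻ x, mx w u x * F x ^ q := by
      rw [← lintegral_const_mul' _ _ (ENNReal.rpow_ne_top_of_nonneg (by linarith) (ENNReal.mul_ne_top (by simp) hct))]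
      refine lintegral_congr fun x => ?_
      rw [ENNReal.mul_rpow_of_nonneg _ _ (by linarith)]
      have : F x ^ q = F x * F x ^ (q-1) := by
        nth_rewrite 2 [← ENNReal.rpow_one (F x)]
        rw [← ENNReal.rpow_add_of_nonneg _ _ zero_le_one (by linarith)]; congr 1; ring
      rw [this]; ring
    rw [h8] at h6
    have hq0 : ENNReal.ofReal (q-1) ≠ 0 := by simpa using hq
    rw [mul_assoc, h6, ← mul_assoc, ENNReal.inv_mul_cancel hq0 ENNReal.ofReal_ne_top, one_mul]
  calc _ ≤ ENNReal.ofReal q * ∫⁻ s in Set.Ioi (0:ℝ), 2 * A * (ENNReal.ofReal (s ^ (q-1-1)) * ∫⁻ x in {x | ENNReal.ofReal s < 2 * c * F x}, F x * mx w u x) := by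
        gcongr 1
        exact setLIntegral_mono' measurableSet_Ioi h1
    _ = _ := by
        rw [lintegral_const_mul' _ _ (ENNReal.mul_ne_top (by simp) hAt), h7]; ring

end max
end SR
end

section

namespace SR

variable {Γ : Type*} [Fintype Γ] (w : Γ → ℕ)

lemma cell_eq_of_mem {i : ℤ × (Γ → ℤ)} {x : Γ → ℝ} (hx : x ∈ cell w i) : cell w i = cell w (i.1, idx w i.1 x) := by
  have h : idx w i.1 x = i.2 := hx
  rw [h]

lemma volume_tri_le (hw : ∀ α, 1 ≤ w α) (i : ℤ × (Γ → ℤ)) :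
    volume (tri w i) ≤ 2 ^ Fintype.card Γ * vl w 1 * volume (cell w i) := by
  have hne : (cell w i).Nonempty := by
    rw [Set.nonempty_iff_ne_empty]; intro h
    have := volume_cell w i
    rw [h, measure_empty] at this
    exact vl_ne_zero w i.1 this.symm
  obtain ⟨z, hz⟩ := hne
  refine (measure_mono (tri_subset_box w hw i hz)).trans ?_
  rw [volume_box, volume_cell, vl_add]
  apply le_of_eq; ring

variable {H : Type*} [NormedAddCommGroup H] [NormedSpace ℂ H] [CompleteSpace H]

lemma enorm_avg_le {s : Set (Γ → ℝ)} {f : (Γ → ℝ) → H} {m c : ℝ≥0∞} (hm : m ≠ 0) (hm' : m ≠ ∞)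
    (h : ∫⁻ x in s, ‖f x‖ₑ ≤ c * m) : ‖(m.toReal)⁻¹ • ∫ x in s, f x‖ₑ ≤ c := by
  rw [enorm_smul]
  have hp : 0 < m.toReal := ENNReal.toReal_pos hm hm'
  have e : ‖(m.toReal)⁻¹‖ₑ = m⁻¹ := by
    rw [Real.enorm_eq_ofReal (by positivity), ENNReal.ofReal_inv_of_pos hp, ENNReal.ofReal_toReal hm']
  rw [e]
  calc m⁻¹ * ‖∫ x in s, f x‖ₑ ≤ m⁻¹ * (c * m) := by
        gcongr
        exact (enorm_integral_le_lintegral_enorm _).trans h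
    _ = c := by rw [mul_comm c, ← mul_assoc, ENNReal.inv_mul_cancel hm hm', one_mul]

open Classical in
lemma cz_decomp [Nonempty Γ] (hw : ∀ α, 1 ≤ w α) (f : (Γ → ℝ) → H) (hf : Nice f) (t : ℝ≥0∞) (ht : t ≠ 0) (ht' : t ≠ ∞) :
    ∃ (I : Set (ℤ × (Γ → ℤ))) (g b : (Γ → ℝ) → H), I.PairwiseDisjoint (cell w) ∧ Nice g ∧ Nice b ∧
      (∀ x, f x = g x + b x) ∧ (∀ x, (∀ i ∈ I, x ∉ cell w i) → b x = 0) ∧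
      (∀ i ∈ I, ∫ x in cell w i, b x = 0) ∧
      ∫⁻ x, ‖g x‖ₑ ^ (2:ℝ) ≤ (∫⁻ x in {x | ‖f x‖ₑ ≤ t}, ‖f x‖ₑ ^ (2:ℝ)) +
        (vl w 1 * t) ^ (2:ℝ) * volume {x | t < mx w (fun y => ‖f y‖ₑ) x} ∧
      ∫⁻ x, ‖b x‖ₑ ≤ 2 * vl w 1 * t * volume {x | t < mx w (fun y => ‖f y‖ₑ) x} ∧
      volume (⋃ i ∈ I, tri w i) ≤ 2 ^ Fintype.card Γ * vl w 1 * volume {x | t < mx w (fun y => ‖f y‖ₑ) x} := by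
  set F : (Γ → ℝ) → ℝ≥0∞ := fun y => ‖f y‖ₑ with hF
  have hFm : Measurable F := hf.meas.enorm
  have hFi : ∫⁻ x, F x ≠ ∞ := hf.int.hasFiniteIntegral.ne
  obtain ⟨I, hdis, hI, hcov⟩ := cz_cells w hw F hFi t ht
  have hIc : I.Countable := Set.to_countable I
  set Ω := ⋃ i ∈ I, cell w i with hΩ
  have hΩm : MeasurableSet Ω := MeasurableSet.biUnion hIc fun i _ => measurableSet_cell w i
  have huniq : ∀ x, ∀ i ∈ I, ∀ j ∈ I, x ∈ cell w i → x ∈ cell w j → i = j := by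
    intro x i hi j hj hxi hxj
    by_contra hne
    exact Set.disjoint_left.1 (hdis hi hj hne) hxi hxj
  set V1 := {x | t < mx w F x} with hV1
  have hΩV : Ω ⊆ V1 := by
    intro x hx
    simp only [hΩ, Set.mem_iUnion] at hx
    obtain ⟨i, hi, hxi⟩ := hx
    have h1 := (hI i hi).1
    have h2 : ∫⁻ x in cell w i, F x ≤ vl w i.1 * mx w F x := by
      refine le_trans ?_ (box_le_mx w F i.1 x)
      apply lintegral_mono_set
      rw [cell_eq_of_mem w hxi]
      exact cell_subset_box w i.1 x
    have h3 := h1.trans_le h2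
    rw [mul_comm] at h3
    show t < _
    by_contra hc
    push Not at hc
    exact absurd h3 (not_lt.2 (by gcongr))
  have hsumcell : ∑' i : I, volume (cell w i) ≤ volume V1 := by
    rw [← measure_biUnion hIc hdis (fun i _ => measurableSet_cell w i)]
    exact measure_mono hΩV
  -- averages
  set a : ℤ × (Γ → ℤ) → H := fun i => ((vl w i.1).toReal)⁻¹ • ∫ x in cell w i, f x with ha
  have hab : ∀ i ∈ I, ‖a i‖ₑ ≤ vl w 1 * t := fun i hi =>
    enorm_avg_le (vl_ne_zero w _) (vl_ne_top w _) (hI i hi).2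
  set io : (Γ → ℝ) → Option (ℤ × (Γ → ℤ)) := fun x => if h : ∃ i ∈ I, x ∈ cell w i then some h.choose else none with hio
  have hio1 : ∀ i ∈ I, ∀ x ∈ cell w i, io x = some i := by
    intro i hi x hx
    have h : ∃ i ∈ I, x ∈ cell w i := ⟨i, hi, hx⟩
    simp only [hio, dif_pos h]
    exact congrArg some (huniq x _ h.choose_spec.1 i hi h.choose_spec.2 hx)
  have hio2 : ∀ x, x ∉ Ω → io x = none := by
    intro x hx
    have h : ¬ ∃ i ∈ I, x ∈ cell w i := by simpa [hΩ] using hx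
    simp only [hio, dif_neg h]
  let _ : MeasurableSpace (Option (ℤ × (Γ → ℤ))) := ⊤
  have hiom : Measurable io := by
    refine measurable_to_countable' fun o => ?_
    rcases o with _ | i
    · have : io ⁻¹' {none} = Ωᶜ := by
        ext x
        simp only [Set.mem_preimage, Set.mem_singleton_iff, Set.mem_compl_iff]
        refine ⟨fun h hx => ?_, hio2 x⟩
        simp only [hΩ, Set.mem_iUnion] at hx
        obtain ⟨i, hi, hxi⟩ := hx
        rw [hio1 i hi x hxi] at h
        exact absurd h (by simp)
      rw [this]; exact hΩm.compl
    · by_cases hi : i ∈ I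
      · have : io ⁻¹' {some i} = cell w i := by
          ext x
          simp only [Set.mem_preimage, Set.mem_singleton_iff]
          refine ⟨fun h => ?_, hio1 i hi x⟩
          by_cases hx : x ∈ Ω
          · simp only [hΩ, Set.mem_iUnion] at hx
            obtain ⟨j, hj, hxj⟩ := hx
            rw [hio1 j hj x hxj] at h
            simp only [Option.some.injEq] at h
            rwa [← h]
          · rw [hio2 x hx] at h; exact absurd h (by simp)
        rw [this]; exact measurableSet_cell w i
      · have : io ⁻¹' {some i} = ∅ := by
          ext x
          simp only [Set.mem_preimage, Set.mem_singleton_iff, Set.mem_empty_iff_false, iff_false]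
          intro h
          by_cases hx : x ∈ Ω
          · simp only [hΩ, Set.mem_iUnion] at hx
            obtain ⟨j, hj, hxj⟩ := hx
            rw [hio1 j hj x hxj] at h
            simp only [Option.some.injEq] at h
            exact hi (h ▸ hj)
          · rw [hio2 x hx] at h; exact absurd h (by simp)
        rw [this]; exact MeasurableSet.empty
  set g : (Γ → ℝ) → H := fun x => Ωᶜ.indicator f x + (io x).elim 0 a with hg
  have hg1 : ∀ i ∈ I, ∀ x ∈ cell w i, g x = a i := by
    intro i hi x hx
    have hxΩ : x ∈ Ω := Set.mem_biUnion hi hx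
    simp [hg, hio1 i hi x hx, hxΩ]
  have hg2 : ∀ x ∉ Ω, g x = f x := by
    intro x hx
    simp [hg, hio2 x hx, hx]
  have hgm : StronglyMeasurable g := by
    refine (hf.meas.indicator hΩm.compl).add ?_
    have : StronglyMeasurable (fun o : Option (ℤ × (Γ → ℤ)) => o.elim 0 a) := by
      have hd : DiscreteMeasurableSpace (Option (ℤ × (Γ → ℤ))) := ⟨fun _ => trivial⟩
      exact StronglyMeasurable.of_discrete
    exact this.comp_measurable hiom
  obtain ⟨M, hM⟩ := hf.bdd
  have hAt : vl w 1 * t ≠ ∞ := ENNReal.mul_ne_top (vl_ne_top w 1) ht'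
  have hgb : ∀ x, ‖g x‖ ≤ max M (vl w 1 * t).toReal := by
    intro x
    by_cases hx : x ∈ Ω
    · simp only [hΩ, Set.mem_iUnion] at hx
      obtain ⟨i, hi, hxi⟩ := hx
      rw [hg1 i hi x hxi]
      refine le_trans ?_ (le_max_right _ _)
      rw [← toReal_enorm]
      exact ENNReal.toReal_mono hAt (hab i hi)
    · rw [hg2 x hx]; exact (hM x).trans (le_max_left _ _)
  have hV1fin : volume Ω ≠ ∞ := by
    have : t * volume Ω ≤ ∫⁻ x, F x := by
      rw [hΩ, measure_biUnion hIc hdis (fun i _ => measurableSet_cell w i), ← ENNReal.tsum_mul_left]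
      calc ∑' i : I, t * volume (cell w i) ≤ ∑' i : I, ∫⁻ x in cell w i, F x :=
            ENNReal.tsum_le_tsum fun i => by rw [volume_cell]; exact (hI i i.2).1.le
        _ = ∫⁻ x in ⋃ i ∈ I, cell w i, F x := (lintegral_biUnion hIc (fun i _ => measurableSet_cell w i) hdis _).symm
        _ ≤ _ := setLIntegral_le_lintegral _ _
    intro h
    rw [h, ENNReal.mul_top ht] at this
    exact hFi (top_le_iff.1 this)
  have hgle : ∀ x, ‖g x‖ₑ ≤ F x + Ω.indicator (fun _ => vl w 1 * t) x := by
    intro x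
    by_cases hx : x ∈ Ω
    · rw [Set.indicator_of_mem hx]
      simp only [hΩ, Set.mem_iUnion] at hx
      obtain ⟨i, hi, hxi⟩ := hx
      rw [hg1 i hi x hxi]
      exact (hab i hi).trans le_add_self
    · rw [hg2 x hx]; exact le_self_add
  have hgN : Nice g := by
    refine ⟨hgm, ⟨_, hgb⟩, hgm.aestronglyMeasurable, ?_⟩
    refine (lintegral_mono hgle).trans_lt ?_
    rw [lintegral_add_left hFm, lintegral_indicator_const hΩm]
    exact ENNReal.add_lt_top.2 ⟨hFi.lt_top, ENNReal.mul_lt_top hAt.lt_top hV1fin.lt_top⟩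
  have hbN : Nice (fun x => f x - g x) := hf.sub hgN
  refine ⟨I, g, fun x => f x - g x, hdis, hgN, hbN, fun x => by simp, ?_, ?_, ?_, ?_, ?_⟩
  · intro x hx
    show f x - g x = 0
    rw [hg2 x (by simpa [hΩ] using hx), sub_self]
  · intro i hi
    rw [integral_sub hf.int.integrableOn hgN.int.integrableOn]
    have : ∫ x in cell w i, g x = ∫ x in cell w i, a i :=
      setIntegral_congr_fun (measurableSet_cell w i) fun x hx => hg1 i hi x hx
    rw [this, setIntegral_const, ha]
    simp only [measureReal_def, volume_cell]
    rw [smul_inv_smul₀, sub_self]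
    exact (ENNReal.toReal_pos (vl_ne_zero w _) (vl_ne_top w _)).ne'
  · have hae := ae_le_of_cell w hw F hFm t
    have h1 : ∀ᵐ x, ‖g x‖ₑ ^ (2:ℝ) ≤ {x | F x ≤ t}.indicator (fun x => F x ^ (2:ℝ)) x + Ω.indicator (fun _ => (vl w 1 * t) ^ (2:ℝ)) x := by
      filter_upwards [hae] with x hx
      by_cases hxΩ : x ∈ Ω
      · rw [Set.indicator_of_mem hxΩ]
        refine le_trans ?_ le_add_self
        simp only [hΩ, Set.mem_iUnion] at hxΩ
        obtain ⟨i, hi, hxi⟩ := hxΩ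
        rw [hg1 i hi x hxi]
        gcongr
        exact hab i hi
      · have h2 : F x ≤ t := by
          apply hx
          intro l
          by_contra hc
          push Not at hc
          obtain ⟨i, hi, _, hxi⟩ := hcov x l hc
          exact hxΩ (Set.mem_biUnion hi hxi)
        rw [Set.indicator_of_mem (show x ∈ {x | F x ≤ t} from h2), hg2 x hxΩ]
        exact le_self_add
    refine (lintegral_mono_ae h1).trans ?_
    have hms : MeasurableSet {x | F x ≤ t} := measurableSet_le hFm measurable_const
    rw [lintegral_add_left ((hFm.pow_const _).indicator hms), lintegral_indicator hms, lintegral_indicator_const hΩm]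
    gcongr
  · have e : ∫⁻ x, ‖f x - g x‖ₑ = ∫⁻ x in Ω, ‖f x - g x‖ₑ := by
      rw [← lintegral_indicator hΩm]
      refine lintegral_congr fun x => ?_
      by_cases hx : x ∈ Ω
      · rw [Set.indicator_of_mem hx]
      · rw [Set.indicator_of_notMem hx, hg2 x hx, sub_self, enorm_zero]
    rw [e, hΩ, lintegral_biUnion hIc (fun i _ => measurableSet_cell w i) hdis]
    refine le_trans ?_ (mul_le_mul_right hsumcell _)
    rw [← ENNReal.tsum_mul_left]
    refine ENNReal.tsum_le_tsum fun i => ?_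
    calc ∫⁻ x in cell w i, ‖f x - g x‖ₑ ≤ ∫⁻ x in cell w i, (F x + vl w 1 * t) := by
          refine setLIntegral_mono' (measurableSet_cell w i) fun x hx => ?_
          refine enorm_sub_le.trans ?_
          rw [hg1 i i.2 x hx]
          gcongr
          exact hab i i.2
      _ ≤ _ := by
          rw [lintegral_add_left hFm, setLIntegral_const, volume_cell]
          calc _ ≤ vl w 1 * t * vl w (i : ℤ × (Γ → ℤ)).1 + vl w 1 * t * vl w (i : ℤ × (Γ → ℤ)).1 := by
                gcongr
                exact (hI i i.2).2
            _ = _ := by ring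
  · refine (measure_biUnion_le volume hIc _).trans ?_
    refine le_trans ?_ (mul_le_mul_right hsumcell _)
    rw [← ENNReal.tsum_mul_left]
    exact ENNReal.tsum_le_tsum fun i => volume_tri_le w hw _

end SR
end

section

namespace SR

lemma tail_int (p : ℝ) (hp2 : p < 2) (γ : ℝ) (hγ : 0 < γ) (a : ℝ≥0∞) (ha : a ≠ ∞) :
    ∫⁻ s in Set.Ioi (0:ℝ), ENNReal.ofReal (s ^ (p-3)) * {s : ℝ | a ≤ ENNReal.ofReal (γ * s)}.indicator (fun _ => a ^ (2:ℝ)) s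
      ≤ ENNReal.ofReal (γ ^ (2-p) / (2-p)) * a ^ p := by
  by_cases h0 : a = 0
  · subst h0
    have : ∀ s : ℝ, ENNReal.ofReal (s ^ (p-3)) * {s : ℝ | (0:ℝ≥0∞) ≤ ENNReal.ofReal (γ * s)}.indicator (fun _ => (0:ℝ≥0∞) ^ (2:ℝ)) s = 0 := by
      intro s; simp
    simp only [this, lintegral_zero]; exact zero_le
  lift a to ℝ≥0 using ha
  have hapos : 0 < (a:ℝ) := by
    have : a ≠ 0 := by simpa using h0
    positivity
  have e : ∀ s : ℝ, ENNReal.ofReal (s ^ (p-3)) * {s : ℝ | (a:ℝ≥0∞) ≤ ENNReal.ofReal (γ * s)}.indicator (fun _ => (a:ℝ≥0∞) ^ (2:ℝ)) s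
      = (a:ℝ≥0∞) ^ (2:ℝ) * (Set.Ici ((a:ℝ)/γ)).indicator (fun s => ENNReal.ofReal (s ^ (p-3))) s := by
    intro s
    have : s ∈ {s : ℝ | (a:ℝ≥0∞) ≤ ENNReal.ofReal (γ * s)} ↔ s ∈ Set.Ici ((a:ℝ)/γ) := by
      rw [Set.mem_ofPred_eq, ← ENNReal.ofReal_coe_nnreal, Set.mem_Ici, div_le_iff₀ hγ, mul_comm s]
      by_cases hs : 0 ≤ γ * s
      · rw [ENNReal.ofReal_le_ofReal_iff hs]
      · push Not at hs
        rw [ENNReal.ofReal_of_nonpos hs.le]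
        constructor
        · intro h; simp at h; exact absurd h (by simpa using h0)
        · intro h; linarith
    by_cases h : s ∈ {s : ℝ | (a:ℝ≥0∞) ≤ ENNReal.ofReal (γ * s)}
    · rw [Set.indicator_of_mem h, Set.indicator_of_mem (this.1 h), mul_comm]
    · rw [Set.indicator_of_notMem h, Set.indicator_of_notMem (fun h' => h (this.2 h')), mul_zero, mul_zero]
  simp only [e]
  have hm : Measurable (fun s : ℝ => (Set.Ici ((a:ℝ)/γ)).indicator (fun s => ENNReal.ofReal (s ^ (p-3))) s) := by
    refine Measurable.indicator ?_ measurableSet_Ici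
    fun_prop
  rw [lintegral_const_mul _ hm, lintegral_indicator measurableSet_Ici]
  have hag : 0 < (a:ℝ)/γ := by positivity
  have h1 : ∫⁻ s in Set.Ici ((a:ℝ)/γ), ENNReal.ofReal (s ^ (p-3)) ∂(volume.restrict (Set.Ioi 0))
      ≤ ENNReal.ofReal (((a:ℝ)/γ) ^ (p-2) / (2-p)) := by
    have h2 : ∫⁻ s in Set.Ici ((a:ℝ)/γ), ENNReal.ofReal (s ^ (p-3)) ∂(volume.restrict (Set.Ioi 0))
      ≤ ∫⁻ s in Set.Ici ((a:ℝ)/γ), ENNReal.ofReal (s ^ (p-3)) :=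
      lintegral_mono' (Measure.restrict_mono_measure Measure.restrict_le_self _) le_rfl
    refine h2.trans ?_
    rw [setLIntegral_congr Ioi_ae_eq_Ici.symm]
    rw [← ofReal_integral_eq_lintegral_ofReal]
    · rw [integral_Ioi_rpow_of_lt (by linarith) hag]
      apply le_of_eq; congr 1
      rw [show p - 3 + 1 = p - 2 by ring, ← neg_sub p 2, div_neg, neg_div]
    · exact integrableOn_Ioi_rpow_of_lt (by linarith) hag
    · refine (ae_restrict_iff' measurableSet_Ioi).2 (Filter.Eventually.of_forall fun s hs => ?_)
      have : 0 < s := hag.trans hs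
      positivity
  refine (mul_le_mul_right h1 _).trans (le_of_eq ?_)
  have hb : (a:ℝ≥0∞) = ENNReal.ofReal (a:ℝ) := by simp
  rw [hb, ENNReal.ofReal_rpow_of_pos hapos, ENNReal.ofReal_rpow_of_pos hapos, ← ENNReal.ofReal_mul (by positivity),
    ← ENNReal.ofReal_mul (div_nonneg (by positivity) (by linarith))]
  congr 1
  rw [Real.div_rpow hapos.le hγ.le, show p - 2 = -(2-p) by ring, Real.rpow_neg hγ.le]
  have : (a:ℝ)^p = (a:ℝ)^(2:ℝ) * (a:ℝ) ^ (-(2-p)) := by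
    rw [← Real.rpow_add hapos]; congr 1; ring
  rw [this]
  field_simp

lemma tail_layer {X : Type*} [MeasurableSpace X] (μ : Measure X) [SFinite μ] (p : ℝ) (hp2 : p < 2) (γ : ℝ) (hγ : 0 < γ)
    (F : X → ℝ≥0∞) (hF : Measurable F) (hF' : ∀ x, F x ≠ ∞) :
    ∫⁻ s in Set.Ioi (0:ℝ), ENNReal.ofReal (s ^ (p-3)) * ∫⁻ x in {x | F x ≤ ENNReal.ofReal (γ * s)}, F x ^ (2:ℝ) ∂μ
      ≤ ENNReal.ofReal (γ ^ (2-p) / (2-p)) * ∫⁻ x, F x ^ p ∂μ := by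
  have hmS : MeasurableSet {z : ℝ × X | F z.2 ≤ ENNReal.ofReal (γ * z.1)} :=
    measurableSet_le (hF.comp measurable_snd) (by fun_prop)
  have e : ∀ s : ℝ, ENNReal.ofReal (s ^ (p-3)) * ∫⁻ x in {x | F x ≤ ENNReal.ofReal (γ * s)}, F x ^ (2:ℝ) ∂μ
      = ∫⁻ x, ENNReal.ofReal (s ^ (p-3)) * {z : ℝ × X | F z.2 ≤ ENNReal.ofReal (γ * z.1)}.indicator (fun z => F z.2 ^ (2:ℝ)) (s, x) ∂μ := by
    intro s
    rw [lintegral_const_mul, ← lintegral_indicator (measurableSet_le hF measurable_const)]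
    · rfl
    · exact (((hF.comp measurable_snd).pow_const _).indicator hmS).comp measurable_prodMk_left
  simp only [e]
  rw [lintegral_lintegral_swap]
  · rw [← lintegral_const_mul _ (hF.pow_const _)]
    refine lintegral_mono fun x => ?_
    exact tail_int p hp2 γ hγ (F x) (hF' x)
  · refine Measurable.aemeasurable ?_
    refine Measurable.mul (by fun_prop) ?_
    exact (((hF.comp measurable_snd).pow_const _).indicator hmS)

lemma mx_one_le {Γ : Type*} [Fintype Γ] (w : Γ → ℕ) (x : Γ → ℝ) : mx w (fun _ => 1) x ≤ 2 ^ Fintype.card Γ := by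
  refine iSup_le fun l => ?_
  rw [setLIntegral_const, one_mul, volume_box, mul_left_comm, ENNReal.inv_mul_cancel (vl_ne_zero w l) (vl_ne_top w l), mul_one]

lemma mx_lp {Γ : Type*} [Fintype Γ] [Nonempty Γ] (w : Γ → ℕ) (hw : ∀ α, 1 ≤ w α) (q : ℝ) (hq : 1 < q) : ∃ C : ℝ≥0∞, C ≠ ∞ ∧
    ∀ (F : (Γ → ℝ) → ℝ≥0∞) (hF : ∫⁻ x, F x ≠ ∞) (hFm : Measurable F),
    ∫⁻ x, mx w F x ^ q ≤ C * ∫⁻ x, F x ^ q := by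
  obtain ⟨C, hC, h⟩ := mx_strong w hw q hq
  refine ⟨C * 2 ^ Fintype.card Γ, ENNReal.mul_ne_top hC (by simp), fun F hF hFm => ?_⟩
  have := h F (fun _ => 1) hF hFm measurable_const
  simp only [one_mul] at this
  refine this.trans ?_
  rw [mul_assoc, ← lintegral_const_mul _ (hFm.pow_const _)]
  gcongr
  exact mx_one_le w _

theorem cz_abs {Γ : Type} [Fintype Γ] [Nonempty Γ] (w : Γ → ℕ) (hw : ∀ α, 1 ≤ w α) (p : ℝ) (hp : 1 < p) (hp2 : p < 2) :
    ∃ C : ℝ≥0∞, C ≠ ∞ ∧ ∀ (H1 H2 : Type) [NormedAddCommGroup H1] [NormedSpace ℂ H1] [CompleteSpace H1]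
      [NormedAddCommGroup H2] (T : ((Γ → ℝ) → H1) → (Γ → ℝ) → H2) (C0 C1 : ℝ≥0∞),
      (∀ f, Nice f → Measurable (fun x => ‖T f x‖ₑ)) →
      (∀ f g, Nice f → Nice g → ∀ x, ‖T (fun x => f x + g x) x‖ₑ ≤ ‖T f x‖ₑ + ‖T g x‖ₑ) →
      (∀ f, Nice f → ∫⁻ x, ‖T f x‖ₑ ^ (2:ℝ) ≤ C0 ^ (2:ℝ) * ∫⁻ x, ‖f x‖ₑ ^ (2:ℝ)) →
      (∀ (I : Set (ℤ × (Γ → ℤ))) (b : (Γ → ℝ) → H1), I.PairwiseDisjoint (cell w) → Nice b →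
        (∀ x, (∀ i ∈ I, x ∉ cell w i) → b x = 0) → (∀ i ∈ I, ∫ x in cell w i, b x = 0) →
        ∫⁻ x in (⋃ i ∈ I, tri w i)ᶜ, ‖T b x‖ₑ ≤ C1 * ∫⁻ x, ‖b x‖ₑ) →
      ∀ f, Nice f → ∀ γ : ℝ, 0 < γ → ∫⁻ x, ‖T f x‖ₑ ^ p ≤
        C * (C0 ^ (2:ℝ) * ENNReal.ofReal (γ ^ (2-p)) + ENNReal.ofReal (γ ^ (-p)) + C1 * ENNReal.ofReal (γ ^ (1-p))) *
          ∫⁻ x, ‖f x‖ₑ ^ p := by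
  obtain ⟨B, hB, hmx⟩ := mx_lp w hw p hp
  set A := vl w 1 with hA
  have hAt : A ≠ ∞ := vl_ne_top w 1
  set N : ℝ≥0∞ := 2 ^ Fintype.card Γ with hN
  have hNt : N ≠ ∞ := by simp [hN]
  set C : ℝ≥0∞ := ENNReal.ofReal (4 * p / (2-p)) + 4 * A ^ (2:ℝ) * B + N * A * B + 4 * A * B with hC
  refine ⟨C, ?_, ?_⟩
  · have h2 : A ^ (2:ℝ) ≠ ∞ := ENNReal.rpow_ne_top_of_nonneg (by norm_num) hAt
    have h4 : (4:ℝ≥0∞) ≠ ∞ := by simp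
    have h5 := ENNReal.mul_ne_top (ENNReal.mul_ne_top h4 h2) hB
    have h6 := ENNReal.mul_ne_top (ENNReal.mul_ne_top hNt hAt) hB
    have h7 := ENNReal.mul_ne_top (ENNReal.mul_ne_top h4 hAt) hB
    exact ENNReal.add_ne_top.2 ⟨ENNReal.add_ne_top.2 ⟨ENNReal.add_ne_top.2 ⟨ENNReal.ofReal_ne_top, h5⟩, h6⟩, h7⟩
  intro H1 H2 _ _ _ _ T C0 C1 hTm hTs hT2 hT1 f hf γ hγ
  set F : (Γ → ℝ) → ℝ≥0∞ := fun x => ‖f x‖ₑ with hF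
  have hFm : Measurable F := hf.meas.enorm
  have hFi : ∫⁻ x, F x ≠ ∞ := hf.int.hasFiniteIntegral.ne
  set Φ : ℝ → ℝ≥0∞ := fun s => ∫⁻ x in {x | F x ≤ ENNReal.ofReal (γ * s)}, F x ^ (2:ℝ) with hΦ
  set G : ℝ → ℝ≥0∞ := fun s => volume {x | ENNReal.ofReal (γ * s) < mx w F x} with hG
  set K : ℝ≥0∞ := 4 * C0 ^ (2:ℝ) * A ^ (2:ℝ) * ENNReal.ofReal (γ ^ (2:ℝ)) + N * A + 4 * C1 * A * ENNReal.ofReal γ with hK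
  have key : ∀ s ∈ Set.Ioi (0:ℝ), volume {x | ENNReal.ofReal s < ‖T f x‖ₑ} ≤ 4 * C0 ^ (2:ℝ) * ENNReal.ofReal (s ^ (-2:ℝ)) * Φ s + K * G s := by
    intro s hs
    have hs : 0 < s := hs
    have hgs : 0 < γ * s := by positivity
    obtain ⟨I, g, b, hdis, hg, hb, hfgb, hb0, hbi, hgL, hbL, htri⟩ := cz_decomp w hw f hf (ENNReal.ofReal (γ * s)) (by simpa using hgs) ENNReal.ofReal_ne_top
    have hT1' := hT1 I b hdis hb hb0 hbi
    have hT2' := hT2 g hg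
    have hs2 : ENNReal.ofReal (s/2) ≠ 0 := by simpa using hs
    have hsub : {x | ENNReal.ofReal s < ‖T f x‖ₑ} ⊆ {x | ENNReal.ofReal ((s/2)^(2:ℝ)) ≤ ‖T g x‖ₑ ^ (2:ℝ)} ∪ ((⋃ i ∈ I, tri w i) ∪ ({x | ENNReal.ofReal (s/2) ≤ ‖T b x‖ₑ} ∩ (⋃ i ∈ I, tri w i)ᶜ)) := by
      intro x hx
      by_contra hc
      simp only [Set.mem_union, Set.mem_inter_iff, Set.mem_compl_iff, Set.mem_ofPred_eq, not_or, not_and_or, not_not, not_le] at hc hx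
      obtain ⟨h1, h2, h3⟩ := hc
      have h3 := h3.resolve_right h2
      have h1 : ‖T g x‖ₑ < ENNReal.ofReal (s/2) := by
        rw [← ENNReal.ofReal_rpow_of_pos (by positivity)] at h1
        exact (ENNReal.rpow_lt_rpow_iff (by norm_num)).1 h1
      have h4 := hTs g b hg hb x
      have h5 : (fun x => g x + b x) = f := by funext x; exact (hfgb x).symm
      rw [h5] at h4
      have h6 := hx.trans_le (h4.trans (add_le_add h1.le h3.le))
      rw [← ENNReal.ofReal_add (by positivity) (by positivity), add_halves] at h6
      exact lt_irrefl _ h6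
    have hA1 : volume {x | ENNReal.ofReal ((s/2)^(2:ℝ)) ≤ ‖T g x‖ₑ ^ (2:ℝ)} ≤ 4 * C0 ^ (2:ℝ) * ENNReal.ofReal (s ^ (-2:ℝ)) * Φ s + 4 * C0 ^ (2:ℝ) * A ^ (2:ℝ) * ENNReal.ofReal (γ ^ (2:ℝ)) * G s := by
      refine (meas_ge_le_lintegral_div ((hTm g hg).pow_const _).aemeasurable (by simp; positivity) ENNReal.ofReal_ne_top).trans ?_
      rw [div_eq_mul_inv, ← ENNReal.ofReal_inv_of_pos (by positivity), mul_comm]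
      have e1 : ((s/2)^(2:ℝ))⁻¹ = 4 * s ^ (-2:ℝ) := by
        rw [Real.div_rpow hs.le (by norm_num), Real.rpow_neg hs.le, inv_div]
        norm_num
        ring
      rw [e1, ENNReal.ofReal_mul (by norm_num)]
      calc _ ≤ ENNReal.ofReal 4 * ENNReal.ofReal (s ^ (-2:ℝ)) * (C0 ^ (2:ℝ) * (Φ s + (A * ENNReal.ofReal (γ * s)) ^ (2:ℝ) * G s)) := by
            gcongr
            exact hT2'.trans (mul_le_mul_right hgL _)
        _ = 4 * C0 ^ (2:ℝ) * ENNReal.ofReal (s ^ (-2:ℝ)) * Φ s + 4 * C0 ^ (2:ℝ) * A ^ (2:ℝ) * (ENNReal.ofReal (s ^ (-2:ℝ)) * ENNReal.ofReal (γ * s) ^ (2:ℝ)) * G s := by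
            rw [ENNReal.mul_rpow_of_nonneg _ _ (by norm_num)]
            rw [show ENNReal.ofReal 4 = 4 by simp]
            ring
        _ = _ := by
            rw [ENNReal.ofReal_rpow_of_pos hgs, ← ENNReal.ofReal_mul (by positivity)]
            congr 4
            rw [Real.mul_rpow hγ.le hs.le, Real.rpow_neg hs.le]
            field_simp
    have hA3 : volume ({x | ENNReal.ofReal (s/2) ≤ ‖T b x‖ₑ} ∩ (⋃ i ∈ I, tri w i)ᶜ) ≤ 4 * C1 * A * ENNReal.ofReal γ * G s := by
      have hm : MeasurableSet {x | ENNReal.ofReal (s/2) ≤ ‖T b x‖ₑ} := measurableSet_le measurable_const (hTm b hb)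
      rw [← Measure.restrict_apply hm]
      refine (meas_ge_le_lintegral_div (hTm b hb).aemeasurable hs2 ENNReal.ofReal_ne_top).trans ?_
      rw [div_eq_mul_inv, ← ENNReal.ofReal_inv_of_pos (by positivity), mul_comm]
      calc _ ≤ ENNReal.ofReal (s/2)⁻¹ * (C1 * (2 * A * ENNReal.ofReal (γ * s) * G s)) := by
            gcongr
            exact hT1'.trans (mul_le_mul_right hbL _)
        _ = 2 * C1 * A * (ENNReal.ofReal (s/2)⁻¹ * ENNReal.ofReal (γ * s)) * G s := by ring
        _ = 2 * C1 * A * (2 * ENNReal.ofReal γ) * G s := by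
            rw [← ENNReal.ofReal_mul (by positivity), show (s/2)⁻¹ * (γ * s) = 2 * γ by field_simp, ENNReal.ofReal_mul (by norm_num)]
            simp
        _ = _ := by ring
    calc _ ≤ _ := measure_mono hsub
      _ ≤ _ := (measure_union_le _ _).trans (add_le_add le_rfl (measure_union_le _ _))
      _ ≤ _ := add_le_add hA1 (add_le_add htri hA3)
      _ = _ := by rw [hK]; ring
  rw [layer volume p (by linarith) _ (hTm f hf)]
  have hmxm := measurable_mx w F hFm
  have hGI : ENNReal.ofReal p * ∫⁻ s in Set.Ioi (0:ℝ), ENNReal.ofReal (s ^ (p-1)) * G s ≤ ENNReal.ofReal (γ ^ (-p)) * (B * ∫⁻ x, F x ^ p) := by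
    have h1 := layer (volume : Measure (Γ → ℝ)) p (by linarith) (fun x => ENNReal.ofReal γ⁻¹ * mx w F x) (hmxm.const_mul _)
    have h2 : ∀ s : ℝ, {x | ENNReal.ofReal s < ENNReal.ofReal γ⁻¹ * mx w F x} = {x | ENNReal.ofReal (γ * s) < mx w F x} := by
      intro s
      ext x
      simp only [Set.mem_ofPred_eq]
      have hγ0 : ENNReal.ofReal γ ≠ 0 := by simpa using hγ
      rw [ENNReal.ofReal_mul hγ.le, ENNReal.ofReal_inv_of_pos hγ]
      constructor
      · intro h
        have := (ENNReal.mul_lt_mul_iff_right hγ0 ENNReal.ofReal_ne_top).2 h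
        rwa [← mul_assoc, ENNReal.mul_inv_cancel hγ0 ENNReal.ofReal_ne_top, one_mul] at this
      · intro h
        refine (ENNReal.mul_lt_mul_iff_right hγ0 ENNReal.ofReal_ne_top).1 ?_
        rwa [← mul_assoc, ENNReal.mul_inv_cancel hγ0 ENNReal.ofReal_ne_top, one_mul]
    simp only [h2] at h1
    rw [← h1]
    simp only [ENNReal.mul_rpow_of_nonneg _ _ (show (0:ℝ) ≤ p by linarith)]
    rw [lintegral_const_mul _ (hmxm.pow_const _), ENNReal.ofReal_rpow_of_pos (by positivity), Real.inv_rpow hγ.le, ← Real.rpow_neg hγ.le]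
    gcongr
    exact hmx F hFi hFm
  have hΦI : ∫⁻ s in Set.Ioi (0:ℝ), ENNReal.ofReal (s ^ (p-3)) * Φ s ≤ ENNReal.ofReal (γ ^ (2-p) / (2-p)) * ∫⁻ x, F x ^ p :=
    tail_layer volume p hp2 γ hγ F hFm (fun x => by simp [hF])
  have hGm : Measurable G := by
    have : Antitone G := by
      intro s s' h
      refine measure_mono fun x hx => ?_
      simp only [Set.mem_ofPred_eq] at hx ⊢
      exact lt_of_le_of_lt (ENNReal.ofReal_le_ofReal (by gcongr)) hx
    exact this.measurable
  calc _ ≤ ENNReal.ofReal p * ∫⁻ s in Set.Ioi (0:ℝ), (4 * C0 ^ (2:ℝ) * (ENNReal.ofReal (s ^ (p-3)) * Φ s) + K * (ENNReal.ofReal (s ^ (p-1)) * G s)) := by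
        refine mul_le_mul_right (setLIntegral_mono' measurableSet_Ioi fun s hs => ?_) _
        refine (mul_le_mul_right (key s hs) _).trans (le_of_eq ?_)
        have hs : 0 < s := hs
        have : ENNReal.ofReal (s ^ (p-3)) = ENNReal.ofReal (s ^ (p-1)) * ENNReal.ofReal (s ^ (-2:ℝ)) := by
          rw [← ENNReal.ofReal_mul (by positivity), ← Real.rpow_add hs]; congr 2; ring
        rw [this]; ring
    _ ≤ ENNReal.ofReal p * (4 * C0 ^ (2:ℝ) * (ENNReal.ofReal (γ ^ (2-p) / (2-p)) * ∫⁻ x, F x ^ p)) + K * (ENNReal.ofReal (γ ^ (-p)) * (B * ∫⁻ x, F x ^ p)) := by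
        have hm2 : Measurable (fun s : ℝ => ENNReal.ofReal (s ^ (p-1)) * G s) := by
          refine Measurable.mul ?_ hGm
          fun_prop
        have hm3 : Measurable (fun s : ℝ => ENNReal.ofReal (s ^ (p-3)) * Φ s) := by
          refine Measurable.mul (by fun_prop) ?_
          have : Monotone (fun s : Set.Ioi (0:ℝ) => Φ s) := by
            intro s s' h
            refine lintegral_mono_set fun x hx => ?_
            simp only [Set.mem_ofPred_eq] at hx ⊢
            exact hx.trans (ENNReal.ofReal_le_ofReal (by have : (s:ℝ) ≤ s' := h; gcongr))
          have : Monotone Φ := by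
            intro s s' h
            refine lintegral_mono_set fun x hx => ?_
            simp only [Set.mem_ofPred_eq] at hx ⊢
            exact hx.trans (ENNReal.ofReal_le_ofReal (by gcongr))
          exact this.measurable
        rw [lintegral_add_right _ (hm2.const_mul _), lintegral_const_mul _ hm3, lintegral_const_mul _ hm2, mul_add]
        refine add_le_add (by gcongr) ?_
        rw [mul_left_comm]
        gcongr
    _ ≤ _ := by
        have hh : ENNReal.ofReal (γ ^ (2-p) / (2-p)) * 4 * ENNReal.ofReal p = ENNReal.ofReal (4 * p / (2-p)) * ENNReal.ofReal (γ ^ (2-p)) := by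
          rw [show (4:ℝ≥0∞) = ENNReal.ofReal 4 by simp, ← ENNReal.ofReal_mul (div_nonneg (by positivity) (by linarith)), ← ENNReal.ofReal_mul (by refine mul_nonneg (div_nonneg (by positivity) (by linarith)) (by norm_num)),
            ← ENNReal.ofReal_mul (div_nonneg (by positivity) (by linarith))]
          congr 1; ring
        have e2 : ENNReal.ofReal (γ ^ (2:ℝ)) * ENNReal.ofReal (γ ^ (-p)) = ENNReal.ofReal (γ ^ (2-p)) := by
          rw [← ENNReal.ofReal_mul (by positivity), ← Real.rpow_add hγ]; rfl
        have e1 : ENNReal.ofReal γ * ENNReal.ofReal (γ ^ (-p)) = ENNReal.ofReal (γ ^ (1-p)) := by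
          rw [← ENNReal.ofReal_mul (by positivity), show (1 - p) = 1 + -p by ring, Real.rpow_add hγ, Real.rpow_one]
        set X := ∫⁻ x, F x ^ p
        calc _ = (C0 ^ (2:ℝ) * (ENNReal.ofReal (γ ^ (2-p) / (2-p)) * 4 * ENNReal.ofReal p) + (4 * A ^ (2:ℝ) * B * (C0 ^ (2:ℝ) * (ENNReal.ofReal (γ ^ (2:ℝ)) * ENNReal.ofReal (γ ^ (-p)))) + N * A * B * ENNReal.ofReal (γ ^ (-p)) + 4 * A * B * (C1 * (ENNReal.ofReal γ * ENNReal.ofReal (γ ^ (-p)))))) * X := by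
              rw [hK]; ring
          _ ≤ _ := by
              rw [hh, e1, e2]
              gcongr
              set U := C0 ^ (2:ℝ) * ENNReal.ofReal (γ ^ (2-p))
              set W := ENNReal.ofReal (γ ^ (-p))
              set Z := C1 * ENNReal.ofReal (γ ^ (1-p))
              calc _ = ENNReal.ofReal (4 * p / (2-p)) * U + 4 * A ^ (2:ℝ) * B * U + N * A * B * W + 4 * A * B * Z := by
                    simp only [U]; ring
                _ ≤ C * U + C * W + C * Z := by
                    rw [← add_mul]
                    gcongr
                    · rw [hC, add_assoc]; exact le_self_add
                    · rw [hC, add_right_comm]; exact le_add_self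
                    · rw [hC]; exact le_add_self
                _ = _ := by ring

end SR
end

section

namespace SR

section TTsec
variable {Γ : Type} [Fintype Γ] (w : Γ → ℕ)
variable {J : Type} {H1 H2 : Type} [NormedAddCommGroup H1] [NormedSpace ℂ H1] [CompleteSpace H1]
  [NormedAddCommGroup H2] [NormedSpace ℂ H2]

/-- vector valued convolution operator -/
def TT (s : Finset J) (A : J → H1 →L[ℂ] H2) (K : J → (Γ → ℝ) → ℂ) (f : (Γ → ℝ) → H1) (x : Γ → ℝ) : H2 :=
  ∑ j ∈ s, A j (Op (K j) id f x)

/-- Hörmander condition -/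
def Hor (s : Finset J) (K : J → (Γ → ℝ) → ℂ) (C1 : ℝ≥0∞) : Prop :=
  ∀ l h, h ∈ box w l 0 → ∑ j ∈ s, ∫⁻ x in {x | x ∉ box w l 0 ∧ x - h ∉ box w l 0}, ‖K j (x - h) - K j x‖ₑ ≤ C1

lemma Nice.TT {s : Finset J} {A : J → H1 →L[ℂ] H2} {K : J → (Γ → ℝ) → ℂ} (hK : ∀ j ∈ s, Nice (K j))
    {f : (Γ → ℝ) → H1} (hf : Nice f) : Nice (TT s A K f) :=
  Nice.sum fun j hj => (hf.op (hK j hj).meas.measurable (hK j hj).int measurable_id).clm (A j)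

lemma TT_add {s : Finset J} {A : J → H1 →L[ℂ] H2} {K : J → (Γ → ℝ) → ℂ} (hK : ∀ j ∈ s, Nice (K j))
    {f g : (Γ → ℝ) → H1} (hf : Nice f) (hg : Nice g) (x : Γ → ℝ) :
    TT s A K (fun x => f x + g x) x = TT s A K f x + TT s A K g x := by
  unfold TT
  rw [← Finset.sum_add_distrib]
  refine Finset.sum_congr rfl fun j hj => ?_
  rw [op_add (hK j hj).int measurable_id hf hg, map_add]

lemma op_conv {K : (Γ → ℝ) → ℂ} {b : (Γ → ℝ) → H1} (x : Γ → ℝ) :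
    Op K id b x = ∫ z, K (x - z) • b z := by
  unfold Op
  rw [← integral_sub_left_eq_self _ volume x]
  simp

lemma op_conv_integrable {K : (Γ → ℝ) → ℂ} (hK : Nice K) {b : (Γ → ℝ) → H1} (hb : Nice b) (x : Γ → ℝ) :
    Integrable (fun z => K (x - z) • b z) := by
  obtain ⟨M, hM⟩ := hK.bdd
  refine Integrable.bdd_smul (𝕜 := ℂ) hb.int M ?_ ?_
  · exact (hK.meas.comp_measurable (measurable_const.sub measurable_id)).aestronglyMeasurable
  · exact Filter.Eventually.of_forall fun z => hM _

lemma op_cell {K : (Γ → ℝ) → ℂ} (hK : Nice K) {b : (Γ → ℝ) → H1} (hb : Nice b) (I : Set (ℤ × (Γ → ℤ)))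
    (hdis : I.PairwiseDisjoint (cell w)) (hb0 : ∀ x, (∀ i ∈ I, x ∉ cell w i) → b x = 0)
    (hbi : ∀ i ∈ I, ∫ x in cell w i, b x = 0) (z0 : ℤ × (Γ → ℤ) → Γ → ℝ) (x : Γ → ℝ) :
    ‖Op K id b x‖ₑ ≤ ∑' i : I, ∫⁻ z in cell w i, ‖K (x - z) - K (x - z0 i)‖ₑ * ‖b z‖ₑ := by
  have hitg := op_conv_integrable hK hb x
  have hΩm : MeasurableSet (⋃ i : I, cell w (i : ℤ × (Γ → ℤ))) := MeasurableSet.iUnion fun i => measurableSet_cell w i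
  have e : Op K id b x = ∑' i : I, ∫ z in cell w i, K (x - z) • b z := by
    rw [op_conv, ← integral_iUnion (fun i : I => measurableSet_cell w i) ?_ hitg.integrableOn]
    · rw [setIntegral_eq_integral_of_forall_compl_eq_zero]
      intro z hz
      rw [hb0 z, smul_zero]
      simpa using hz
    · intro i j hij
      exact hdis i.2 j.2 (fun h => hij (Subtype.ext h))
  rw [e]
  refine enorm_tsum_le_tsum_enorm.trans (ENNReal.tsum_le_tsum fun i => ?_)
  have e2 : ∫ z in cell w i, K (x - z) • b z = ∫ z in cell w i, (K (x - z) - K (x - z0 i)) • b z := by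
    simp only [sub_smul]
    have hc : IntegrableOn (fun z => K (x - z0 i) • b z) (cell w i) := (hb.int.smul (K (x - z0 i))).integrableOn
    rw [integral_sub hitg.integrableOn hc, integral_smul, hbi i i.2, smul_zero, sub_zero]
  rw [e2]
  refine (enorm_integral_le_lintegral_enorm _).trans (le_of_eq ?_)
  simp only [enorm_smul]

lemma cell_nonempty (i : ℤ × (Γ → ℤ)) : (cell w i).Nonempty := by
  rw [Set.nonempty_iff_ne_empty]; intro h
  have := volume_cell w i
  rw [h, measure_empty] at this
  exact vl_ne_zero w i.1 this.symm

lemma box_sub {l : ℤ} {x z : Γ → ℝ} : x - z ∈ box w l 0 ↔ x ∈ box w l z := by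
  simp [box]

lemma TT_cz {s : Finset J} {A : J → H1 →L[ℂ] H2} (hA : ∀ j, ‖A j‖ ≤ 1) {K : J → (Γ → ℝ) → ℂ}
    (hK : ∀ j ∈ s, Nice (K j)) {C1 : ℝ≥0∞} (hH : Hor w s K C1) (I : Set (ℤ × (Γ → ℤ))) (b : (Γ → ℝ) → H1)
    (hdis : I.PairwiseDisjoint (cell w)) (hb : Nice b) (hb0 : ∀ x, (∀ i ∈ I, x ∉ cell w i) → b x = 0)
    (hbi : ∀ i ∈ I, ∫ x in cell w i, b x = 0) :
    ∫⁻ x in (⋃ i ∈ I, tri w i)ᶜ, ‖TT s A K b x‖ₑ ≤ C1 * ∫⁻ x, ‖b x‖ₑ := by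
  choose z0 hz0 using cell_nonempty w
  have hIc : I.Countable := Set.to_countable I
  have hmeas : ∀ j ∈ s, ∀ i : ℤ × (Γ → ℤ), Measurable (fun p : (Γ → ℝ) × (Γ → ℝ) => ‖K j (p.1 - p.2) - K j (p.1 - z0 i)‖ₑ * ‖b p.2‖ₑ) := by
    intro j hj i
    have h1 : Measurable (K j) := (hK j hj).meas.measurable
    have h2 : Measurable (fun x => ‖b x‖ₑ) := hb.meas.enorm
    have h3 : Measurable (fun p : (Γ → ℝ) × (Γ → ℝ) => K j (p.1 - p.2)) := h1.comp (measurable_fst.sub measurable_snd)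
    have h4 : Measurable (fun p : (Γ → ℝ) × (Γ → ℝ) => K j (p.1 - z0 i)) := h1.comp (measurable_fst.sub measurable_const)
    exact (h3.sub h4).enorm.mul (h2.comp measurable_snd)
  calc ∫⁻ x in (⋃ i ∈ I, tri w i)ᶜ, ‖TT s A K b x‖ₑ
      ≤ ∫⁻ x in (⋃ i ∈ I, tri w i)ᶜ, ∑ j ∈ s, ∑' i : I, ∫⁻ z in cell w i, ‖K j (x - z) - K j (x - z0 i)‖ₑ * ‖b z‖ₑ := by
        refine lintegral_mono fun x => ?_
        refine (enorm_sum_le _ _).trans (Finset.sum_le_sum fun j hj => ?_)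
        refine le_trans ?_ (op_cell w (hK j hj) hb I hdis hb0 hbi z0 x)
        have h1 : ‖A j‖ₑ ≤ 1 := by rw [← ofReal_norm, ENNReal.ofReal_le_one]; exact hA j
        exact ((A j).le_opENorm _).trans (by simpa using mul_le_mul_left h1 ‖Op (K j) id b x‖ₑ)
    _ = ∑' i : I, ∑ j ∈ s, ∫⁻ x in (⋃ i ∈ I, tri w i)ᶜ, ∫⁻ z in cell w i, ‖K j (x - z) - K j (x - z0 i)‖ₑ * ‖b z‖ₑ := by
        rw [lintegral_finsetSum']
        · rw [Summable.tsum_finsetSum (fun _ _ => ENNReal.summable)]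
          refine Finset.sum_congr rfl fun j hj => ?_
          rw [lintegral_tsum]
          intro i
          exact ((hmeas j hj i).lintegral_prod_right').aemeasurable
        · intro j hj
          exact (Measurable.tsum fun i : I => (hmeas j hj i).lintegral_prod_right').aemeasurable
    _ ≤ ∑' i : I, C1 * ∫⁻ z in cell w i, ‖b z‖ₑ := by
        refine ENNReal.tsum_le_tsum fun i => ?_
        have h1 : ∀ j ∈ s, ∫⁻ x in (⋃ i ∈ I, tri w i)ᶜ, ∫⁻ z in cell w i, ‖K j (x - z) - K j (x - z0 i)‖ₑ * ‖b z‖ₑ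
            = ∫⁻ z in cell w i, ∫⁻ x in (⋃ i ∈ I, tri w i)ᶜ, ‖K j (x - z) - K j (x - z0 i)‖ₑ * ‖b z‖ₑ := by
          intro j hj
          exact lintegral_lintegral_swap (hmeas j hj i).aemeasurable
        rw [Finset.sum_congr rfl h1, ← lintegral_finsetSum']
        · rw [← lintegral_const_mul _ hb.meas.enorm]
          refine setLIntegral_mono' (measurableSet_cell w i) fun z hz => ?_
          have h2 : ∀ j ∈ s, ∫⁻ x in (⋃ i ∈ I, tri w i)ᶜ, ‖K j (x - z) - K j (x - z0 i)‖ₑ * ‖b z‖ₑ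
             = (∫⁻ x in (⋃ i ∈ I, tri w i)ᶜ, ‖K j (x - z) - K j (x - z0 i)‖ₑ) * ‖b z‖ₑ := by
            intro j hj
            have h1 : Measurable (K j) := (hK j hj).meas.measurable
            have h3 : Measurable (fun x => K j (x - z)) := h1.comp (measurable_id.sub measurable_const)
            have h4 : Measurable (fun x => K j (x - z0 i)) := h1.comp (measurable_id.sub measurable_const)
            exact lintegral_mul_const _ (h3.sub h4).enorm
          rw [Finset.sum_congr rfl h2, ← Finset.sum_mul]
          gcongr
          set l := (i : ℤ × (Γ → ℤ)).1 with hl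
          have hzi : idx w l z = (i : ℤ × (Γ → ℤ)).2 := hz
          have hzi0 : idx w l (z0 i) = (i : ℤ × (Γ → ℤ)).2 := hz0 i
          have hh : z - z0 i ∈ box w l 0 := by
            rw [box_sub]
            have := cell_subset_box w l (z0 i)
            apply this
            show idx w l z = idx w l (z0 i)
            rw [hzi, hzi0]
          refine le_trans (Finset.sum_le_sum fun j hj => ?_) (hH l (z - z0 i) hh)
          have hnb : ∀ x, x ∉ tri w i → ∀ y, idx w l y = (i : ℤ × (Γ → ℤ)).2 → x - y ∉ box w l 0 := by
            intro x hx y hy hc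
            rw [box_sub] at hc
            apply hx
            intro α
            have := idx_sub_le_of_box w hc α
            rwa [hy] at this
          have hbm : MeasurableSet {x | x ∉ box w l 0 ∧ x - (z - z0 i) ∉ box w l 0} :=
            (measurableSet_box w l 0).compl.inter ((measurableSet_box w l 0).compl.preimage (measurable_id.sub measurable_const))
          calc ∫⁻ x in (⋃ i ∈ I, tri w i)ᶜ, ‖K j (x - z) - K j (x - z0 i)‖ₑ
              ≤ ∫⁻ x, {x | x ∉ box w l 0 ∧ x - (z - z0 i) ∉ box w l 0}.indicator (fun x => ‖K j (x - (z - z0 i)) - K j x‖ₑ) (x - z0 i) := by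
                rw [← lintegral_indicator (MeasurableSet.biUnion hIc fun i _ => measurableSet_tri w i).compl]
                refine lintegral_mono fun x => ?_
                by_cases hx : x ∈ (⋃ i ∈ I, tri w i)ᶜ
                · have hxt : x ∉ tri w i := fun h => hx (Set.mem_biUnion i.2 h)
                  rw [Set.indicator_of_mem hx, Set.indicator_of_mem]
                  · rw [sub_sub_sub_cancel_right]
                  · refine ⟨hnb x hxt _ hzi0, ?_⟩
                    rw [sub_sub_sub_cancel_right]
                    exact hnb x hxt _ hzi
                · rw [Set.indicator_of_notMem hx]; exact zero_le
            _ = _ := by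
                rw [lintegral_sub_right_eq_self, lintegral_indicator hbm]
        · intro j hj
          exact ((hmeas j hj i).comp measurable_swap).lintegral_prod_right'.aemeasurable
    _ = C1 * ∫⁻ z in ⋃ i ∈ I, cell w i, ‖b z‖ₑ := by
        rw [ENNReal.tsum_mul_left, lintegral_biUnion hIc (fun i _ => measurableSet_cell w i) hdis]
    _ ≤ _ := by gcongr; exact Measure.restrict_le_self
end TTsec

section dual
variable {X : Type*} [MeasureSpace X] [SFinite (volume : Measure X)]
variable {H1 H2 : Type*} [NormedAddCommGroup H1] [InnerProductSpace ℂ H1] [NormedAddCommGroup H2] [InnerProductSpace ℂ H2]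

lemma nice_pow {g : X → H2} (hg : Nice g) {p : ℝ} (hp : 2 ≤ p) : Nice (fun x => ((‖g x‖ ^ (p-2) : ℝ) : ℂ) • g x) := by
  obtain ⟨M, hM⟩ := hg.bdd
  have hM0 : ∀ x, ‖((‖g x‖ ^ (p-2) : ℝ) : ℂ)‖ ≤ M ^ (p-2) := by
    intro x
    rw [Complex.norm_real, Real.norm_of_nonneg (by positivity)]
    exact Real.rpow_le_rpow (norm_nonneg _) (hM x) (by linarith)
  have hm : StronglyMeasurable (fun x => ((‖g x‖ ^ (p-2) : ℝ) : ℂ)) := by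
    have h1 : Measurable (fun x => ‖g x‖) := hg.meas.norm.measurable
    exact (Complex.measurable_ofReal.comp (h1.pow_const _)).stronglyMeasurable
  refine ⟨hm.smul hg.meas, ⟨M ^ (p-2) * M, fun x => ?_⟩, ?_⟩
  · rw [norm_smul]
    have := (norm_nonneg _).trans (hM x)
    have h3 := hM0 x
    exact mul_le_mul h3 (hM x) (norm_nonneg _) ((norm_nonneg _).trans h3)
  · exact Integrable.bdd_smul (𝕜 := ℂ) hg.int _ hm.aestronglyMeasurable (Filter.Eventually.of_forall hM0)

lemma duality {p q : ℝ} (hp : 2 ≤ p) (hpq : p.HolderConjugate q) {f : X → H1} (hf : Nice f) {Tf : X → H2} (hTf : Nice Tf)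
    (T' : (X → H2) → X → H1) (hT' : ∀ g, Nice g → Nice (T' g)) (B : ℝ≥0∞) 
    (hB : ∀ g, Nice g → ∫⁻ x, ‖T' g x‖ₑ ^ q ≤ B * ∫⁻ x, ‖g x‖ₑ ^ q)
    (hd : ∀ g, Nice g → ∫ x, inner ℂ (g x) (Tf x) = ∫ x, inner ℂ (T' g x) (f x)) :
    ∫⁻ x, ‖Tf x‖ₑ ^ p ≤ B ^ (p - 1) * ∫⁻ x, ‖f x‖ₑ ^ p := by
  set g : X → H2 := fun x => ((‖Tf x‖ ^ (p-2) : ℝ) : ℂ) • Tf x with hg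
  have hgN : Nice g := nice_pow hTf hp
  have hp0 : 0 < p := by linarith
  have hq0 : 0 < q := hpq.symm.pos
  have hpow : ∀ x, ‖g x‖ = ‖Tf x‖ ^ (p-1) := by
    intro x
    simp only [hg]
    rw [norm_smul, Complex.norm_real, Real.norm_of_nonneg (by positivity)]
    by_cases h : ‖Tf x‖ = 0
    · rw [h, mul_zero, Real.zero_rpow (by linarith)]
    · rw [show p - 1 = (p - 2) + 1 by ring, Real.rpow_add_one h]
  have hq1 : (p-1) * q = p := by have := hpq.sub_one_mul_conj; linarith
  have hgq : ∀ x, ‖g x‖ₑ ^ q = ‖Tf x‖ₑ ^ p := by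
    intro x
    rw [← ofReal_norm, ← ofReal_norm, hpow, ENNReal.ofReal_rpow_of_nonneg (by positivity) hq0.le,
      ENNReal.ofReal_rpow_of_nonneg (by positivity) hp0.le, ← Real.rpow_mul (norm_nonneg _), hq1]
  set Xx := ∫⁻ x, ‖Tf x‖ₑ ^ p with hX
  set Y := ∫⁻ x, ‖f x‖ₑ ^ p with hY
  have hXf : Xx ≠ ∞ := (hTf.lintegral_rpow_lt_top (by linarith)).ne
  have hin : ∀ x, inner ℂ (g x) (Tf x) = ((‖Tf x‖ ^ p : ℝ) : ℂ) := by
    intro x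
    simp only [hg]
    rw [inner_smul_left, inner_self_eq_norm_sq_to_K, Complex.conj_ofReal]
    have h5 : ‖Tf x‖ ^ p = ‖Tf x‖ ^ (p-2) * ‖Tf x‖ ^ 2 := by
      by_cases h : ‖Tf x‖ = 0
      · rw [h]; simp [Real.zero_rpow hp0.ne']
      · rw [← Real.rpow_natCast, ← Real.rpow_add (lt_of_le_of_ne (norm_nonneg _) (Ne.symm h))]
        congr 1; push_cast; ring
    rw [h5]; push_cast; rfl
  have h1 : Xx = ‖∫ x, inner ℂ (T' g x) (f x)‖ₑ := by
    rw [← hd g hgN]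
    simp only [hin]
    rw [integral_complex_ofReal, ← ofReal_norm, Complex.norm_real, Real.norm_of_nonneg (integral_nonneg fun x => by positivity)]
    rw [integral_eq_lintegral_of_nonneg_ae (Filter.Eventually.of_forall fun x => by positivity)]
    · rw [ENNReal.ofReal_toReal]
      · refine lintegral_congr fun x => ?_
        rw [← ofReal_norm, ENNReal.ofReal_rpow_of_nonneg (norm_nonneg _) hp0.le]
      · convert hXf using 1
        refine lintegral_congr fun x => ?_
        rw [← ofReal_norm, ENNReal.ofReal_rpow_of_nonneg (norm_nonneg _) hp0.le]
    · exact (hTf.meas.norm.measurable.pow_const p).aestronglyMeasurable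
  have h2 : Xx ≤ (B * Xx) ^ (1/q) * Y ^ (1/p) := by
    calc Xx ≤ ∫⁻ x, ‖inner ℂ (T' g x) (f x)‖ₑ := by rw [h1]; exact enorm_integral_le_lintegral_enorm _
      _ ≤ ∫⁻ x, ‖T' g x‖ₑ * ‖f x‖ₑ := by
          refine lintegral_mono fun x => ?_
          rw [← ofReal_norm, ← ofReal_norm, ← ofReal_norm, ← ENNReal.ofReal_mul (norm_nonneg _)]
          exact ENNReal.ofReal_le_ofReal (norm_inner_le_norm _ _)
      _ ≤ (∫⁻ x, ‖T' g x‖ₑ ^ q) ^ (1/q) * (∫⁻ x, ‖f x‖ₑ ^ p) ^ (1/p) :=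
          ENNReal.lintegral_mul_le_Lp_mul_Lq _ hpq.symm (hT' g hgN).meas.enorm.aemeasurable hf.meas.enorm.aemeasurable
      _ ≤ _ := by
          gcongr
          refine (hB g hgN).trans ?_
          simp only [hgq]
          exact le_rfl
  by_cases hX0 : Xx = 0
  · rw [hX0]; exact zero_le
  have hpq1 : 1/p + 1/q = 1 := by have := hpq.inv_add_inv_eq_one; simpa using this
  rw [ENNReal.mul_rpow_of_nonneg _ _ (by positivity)] at h2
  have h3 : Xx ^ (1/p) ≤ B ^ (1/q) * Y ^ (1/p) := by
    have hc : Xx ^ (1/q) ≠ 0 := by simp [ENNReal.rpow_eq_zero_iff, hX0, hXf]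
    have hc' : Xx ^ (1/q) ≠ ∞ := ENNReal.rpow_ne_top_of_nonneg (by positivity) hXf
    refine (ENNReal.mul_le_mul_iff_right hc hc').1 ?_
    rw [← ENNReal.rpow_add _ _ hX0 hXf, add_comm, hpq1, ENNReal.rpow_one]
    refine h2.trans (le_of_eq (by ring))
  have h4 := ENNReal.rpow_le_rpow h3 hp0.le
  rw [ENNReal.mul_rpow_of_nonneg _ _ hp0.le, ← ENNReal.rpow_mul, ← ENNReal.rpow_mul, ← ENNReal.rpow_mul] at h4
  have e1 : 1 / p * p = 1 := by field_simp
  have e2 : 1 / q * p = p - 1 := by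
    rw [← hq1]; field_simp
    linarith
  rwa [e1, e2, ENNReal.rpow_one, ENNReal.rpow_one] at h4
end dual

end SR
end

section
open scoped ENNReal NNReal Topology ComplexConjugate

namespace SR

variable {Γ : Type} [Fintype Γ] (w : Γ → ℕ)

/-- reflected conjugate kernel -/
def kt (K : (Γ → ℝ) → ℂ) (y : Γ → ℝ) : ℂ := conj (K (-y))

lemma kt_nice {K : (Γ → ℝ) → ℂ} (hK : Nice K) : Nice (kt K) := by
  obtain ⟨M, hM⟩ := hK.bdd
  refine ⟨?_, ⟨M, fun x => ?_⟩, ?_⟩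
  · exact Complex.continuous_conj.comp_stronglyMeasurable (hK.meas.comp_measurable measurable_neg)
  · simpa [kt] using hM (-x)
  · exact (LinearIsometryEquiv.integrable_comp_iff (Complex.conjLIE) (φ := fun y => K (-y))).2 hK.int.comp_neg

section adj
variable {H : Type} [NormedAddCommGroup H] [InnerProductSpace ℂ H] [CompleteSpace H]

lemma adj_one {K : (Γ → ℝ) → ℂ} (hK : Nice K) {f g : (Γ → ℝ) → H} (hf : Nice f) (hg : Nice g) :
    ∫ x, inner ℂ (g x) (Op K id f x) = ∫ x, inner ℂ (Op (kt K) id g x) (f x) := by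
  have h1 : ∀ x, inner ℂ (g x) (Op K id f x) = ∫ z, K (x - z) * inner ℂ (g x) (f z) := by
    intro x
    rw [op_conv, ← integral_inner (op_conv_integrable hK hf x)]
    simp only [inner_smul_right]
  have h2 : ∀ z, inner ℂ (Op (kt K) id g z) (f z) = ∫ x, K (x - z) * inner ℂ (g x) (f z) := by
    intro z
    rw [← inner_conj_symm, op_conv, ← integral_inner (op_conv_integrable (kt_nice hK) hg z), ← integral_conj]
    simp only [inner_smul_right, map_mul, inner_conj_symm, kt, Complex.conj_conj, neg_sub]
  simp only [h1, h2]
  rw [integral_integral_swap]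
  obtain ⟨M, hM⟩ := hK.bdd
  have hm : StronglyMeasurable (fun z : (Γ → ℝ) × (Γ → ℝ) => K (z.1 - z.2)) :=
    hK.meas.comp_measurable (measurable_fst.sub measurable_snd)
  have hin : Integrable (fun z : (Γ → ℝ) × (Γ → ℝ) => (inner ℂ (g z.1) (f z.2) : ℂ)) (volume.prod volume) := by
    refine Integrable.mono' (hg.int.norm.mul_prod hf.int.norm) ?_ ?_
    · exact ((hg.meas.comp_measurable measurable_fst).inner (hf.meas.comp_measurable measurable_snd)).aestronglyMeasurable
    · exact Filter.Eventually.of_forall fun z => norm_inner_le_norm _ _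
  exact hin.bdd_mul (c := M) hm.aestronglyMeasurable (Filter.Eventually.of_forall fun z => hM _)

variable {H2 : Type} [NormedAddCommGroup H2] [InnerProductSpace ℂ H2] [CompleteSpace H2]

lemma inner_nice_integrable {f g : (Γ → ℝ) → H} (hf : Nice f) (hg : Nice g) : Integrable (fun x => (inner ℂ (f x) (g x) : ℂ)) := by
  obtain ⟨M, hM⟩ := hf.bdd
  refine Integrable.mono' (hg.int.norm.const_mul M) (hf.meas.inner hg.meas).aestronglyMeasurable ?_
  refine Filter.Eventually.of_forall fun z => (norm_inner_le_norm _ _).trans ?_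
  exact mul_le_mul_of_nonneg_right (hM z) (norm_nonneg _)

lemma adj_TT {J : Type} {s : Finset J} {A : J → H →L[ℂ] H2} {K : J → (Γ → ℝ) → ℂ} (hK : ∀ j ∈ s, Nice (K j))
    {f : (Γ → ℝ) → H} {g : (Γ → ℝ) → H2} (hf : Nice f) (hg : Nice g) :
    ∫ x, inner ℂ (g x) (TT s A K f x) = ∫ x, inner ℂ (TT s (fun j => (A j).adjoint) (fun j => kt (K j)) g x) (f x) := by
  unfold TT
  simp only [inner_sum, sum_inner]
  have hop : ∀ j ∈ s, Nice (Op (K j) id f) := fun j hj => hf.op (hK j hj).meas.measurable (hK j hj).int measurable_id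
  have hop' : ∀ j ∈ s, Nice (Op (kt (K j)) id g) := fun j hj => hg.op (kt_nice (hK j hj)).meas.measurable (kt_nice (hK j hj)).int measurable_id
  rw [integral_finsetSum _ (fun j hj => inner_nice_integrable hg ((hop j hj).clm (A j))),
    integral_finsetSum _ (fun j hj => inner_nice_integrable ((hop' j hj).clm (A j).adjoint) hf)]
  refine Finset.sum_congr rfl fun j hj => ?_
  have e1 : ∀ x, (inner ℂ (g x) (A j (Op (K j) id f x)) : ℂ) = inner ℂ ((A j).adjoint (g x)) (Op (K j) id f x) := by
    intro x; rw [ContinuousLinearMap.adjoint_inner_left]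
  simp only [e1]
  rw [adj_one (hK j hj) hf (hg.clm (A j).adjoint)]
  refine integral_congr_ae (Filter.Eventually.of_forall fun x => ?_)
  simp only
  rw [op_clm (kt_nice (hK j hj)).int measurable_id hg]
end adj

lemma Hor.kt {J : Type} {s : Finset J} {K : J → (Γ → ℝ) → ℂ} {C1 : ℝ≥0∞} (h : Hor w s K C1) :
    Hor w s (fun j => SR.kt (K j)) C1 := by
  intro l h' hh
  have hneg : ∀ x, -x ∈ box w l 0 ↔ x ∈ box w l 0 := by intro x; simp [box]
  refine le_trans (le_of_eq ?_) (h l (-h') ((hneg _).2 hh))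
  refine Finset.sum_congr rfl fun j hj => ?_
  have hbm : ∀ h' : Γ → ℝ, MeasurableSet {x | x ∉ box w l 0 ∧ x - h' ∉ box w l 0} := fun h' =>
            (measurableSet_box w l 0).compl.inter ((measurableSet_box w l 0).compl.preimage (measurable_id.sub measurable_const))
  rw [← lintegral_indicator (hbm _), ← lintegral_indicator (hbm _), ← lintegral_neg_eq_self]
  refine lintegral_congr fun x => ?_
  have hS : x ∈ {x | x ∉ box w l 0 ∧ x - -h' ∉ box w l 0} ↔ -x ∈ {x | x ∉ box w l 0 ∧ x - h' ∉ box w l 0} := by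
    simp only [Set.mem_ofPred_eq, hneg]
    rw [← hneg (x - -h')]
    rw [show -(x - -h') = -x - h' by abel]
  by_cases hx : x ∈ {x | x ∉ box w l 0 ∧ x - -h' ∉ box w l 0}
  · rw [Set.indicator_of_mem hx, Set.indicator_of_mem (hS.1 hx)]
    simp only [SR.kt]
    rw [← map_sub, ← ofReal_norm, ← ofReal_norm, RCLike.norm_conj]
    congr 4
    · abel
    · abel
  · rw [Set.indicator_of_notMem hx, Set.indicator_of_notMem (fun h => hx (hS.2 h))]

lemma lin_le_exp (δ : ℝ) (hδ : 0 < δ) : ∃ C : ℝ, 0 < C ∧ ∀ n : ℕ, (1 + n : ℝ) ≤ C * (2:ℝ) ^ (δ * n) := by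
  have hL : 0 < Real.log 2 * δ := mul_pos (Real.log_pos (by norm_num)) hδ
  refine ⟨1 + 1 / (Real.log 2 * δ), by positivity, fun n => ?_⟩
  have h1 : Real.log 2 * δ * n + 1 ≤ (2:ℝ) ^ (δ * n) := by
    rw [Real.rpow_def_of_pos (by norm_num), ← mul_assoc]
    exact Real.add_one_le_exp _
  have h2 : (0:ℝ) ≤ n := by positivity
  calc (1 + n : ℝ) ≤ (1 + 1 / (Real.log 2 * δ)) * (Real.log 2 * δ * n + 1) := by
        have : (1 + 1 / (Real.log 2 * δ)) * (Real.log 2 * δ * n + 1) = 1 + n + 1 / (Real.log 2 * δ) + Real.log 2 * δ * n := by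
          field_simp; ring
        rw [this]
        have : 0 ≤ 1 / (Real.log 2 * δ) := by positivity
        have : 0 ≤ Real.log 2 * δ * n := by positivity
        linarith
    _ ≤ _ := by gcongr

theorem thmS_lt [Nonempty Γ] (hw : ∀ α, 1 ≤ w α) (p : ℝ) (hp : 1 < p) (hp2 : p < 2) (c ε : ℝ) (hc : 0 < c) (hε : 0 < ε) :
    ∃ C δ : ℝ, 0 < C ∧ 0 < δ ∧ ∀ (n : ℕ) (J H1 H2 : Type) [NormedAddCommGroup H1] [NormedSpace ℂ H1] [CompleteSpace H1]
      [NormedAddCommGroup H2] [NormedSpace ℂ H2] (s : Finset J) (A : J → H1 →L[ℂ] H2) (K : J → (Γ → ℝ) → ℂ),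
      (∀ j, ‖A j‖ ≤ 1) → (∀ j ∈ s, Nice (K j)) → Hor w s K (ENNReal.ofReal (c * (1 + n))) →
      (∀ f, Nice f → ∫⁻ x, ‖TT s A K f x‖ₑ ^ (2:ℝ) ≤ ENNReal.ofReal (c * 2 ^ (-(ε * n))) ^ (2:ℝ) * ∫⁻ x, ‖f x‖ₑ ^ (2:ℝ)) →
      ∀ f, Nice f → ∫⁻ x, ‖TT s A K f x‖ₑ ^ p ≤ ENNReal.ofReal (C * 2 ^ (-(δ * n))) * ∫⁻ x, ‖f x‖ₑ ^ p := by
  obtain ⟨B, hB, hcz⟩ := cz_abs w hw p hp hp2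
  set δ := ε * (p-1) / 2 with hδ
  have hδ0 : 0 < δ := by have : 0 < p - 1 := by linarith
                         positivity
  obtain ⟨E, hE0, hE⟩ := lin_le_exp δ hδ0
  refine ⟨(B.toReal + 1) * (c ^ (2:ℝ) + 1 + c * E), δ, by positivity, hδ0, ?_⟩
  intro n J H1 H2 _ _ _ _ _ s A K hA hK hH hL2 f hf
  have hn : (0:ℝ) ≤ n := by positivity
  have h := hcz H1 H2 (TT s A K) _ _ (fun f hf => (hf.TT hK).meas.enorm)
    (fun f g hf hg x => by rw [TT_add hK hf hg]; exact enorm_add_le _ _) hL2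
    (fun I b hdis hb hb0 hbi => TT_cz w hA hK hH I b hdis hb hb0 hbi) f hf (2 ^ (ε * n)) (by positivity)
  refine h.trans ?_
  gcongr
  have hBle : B ≤ ENNReal.ofReal (B.toReal + 1) := by
    rw [← ENNReal.ofReal_toReal hB]
    apply ENNReal.ofReal_le_ofReal; simp
  rw [ENNReal.ofReal_rpow_of_pos (by positivity), ← ENNReal.ofReal_mul (by positivity), ← ENNReal.ofReal_mul (by positivity),
    ← ENNReal.ofReal_add (by positivity) (by positivity), ← ENNReal.ofReal_add (by positivity) (by positivity)]
  refine (mul_le_mul_left hBle _).trans ?_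
  rw [← ENNReal.ofReal_mul (by positivity)]
  apply ENNReal.ofReal_le_ofReal
  rw [mul_assoc (B.toReal + 1)]
  refine mul_le_mul_of_nonneg_left ?_ (show (0:ℝ) ≤ B.toReal + 1 by positivity)
  rw [add_mul, add_mul]
  rw [Real.mul_rpow hc.le (by positivity), ← Real.rpow_mul (by norm_num), ← Real.rpow_mul (by norm_num), ← Real.rpow_mul (by norm_num), ← Real.rpow_mul (by norm_num)]
  have hpp : 0 < p - 1 := by linarith
  have h2 : (1:ℝ) ≤ 2 := by norm_num
  have hεn : 0 ≤ ε * n := by positivity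
  refine add_le_add (add_le_add ?_ ?_) ?_
  · rw [mul_assoc, ← Real.rpow_add (by norm_num)]
    refine mul_le_mul_of_nonneg_left (Real.rpow_le_rpow_of_exponent_le h2 ?_) (by positivity)
    rw [hδ]
    nlinarith [mul_nonneg hεn hpp.le]
  · rw [one_mul]
    refine Real.rpow_le_rpow_of_exponent_le h2 ?_
    rw [hδ]
    nlinarith [mul_nonneg hεn hpp.le]
  · calc c * (1 + n) * 2 ^ (ε * n * (1-p)) ≤ c * (E * 2 ^ (δ * n)) * 2 ^ (ε * n * (1-p)) := by
          gcongr
          exact hE n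
      _ = c * E * 2 ^ (-(δ * n)) := by
          rw [mul_assoc, mul_assoc, mul_assoc, mul_assoc, ← Real.rpow_add (by norm_num)]
          congr 3; rw [hδ]; ring

theorem thmS [Nonempty Γ] (hw : ∀ α, 1 ≤ w α) (p : ℝ) (hp : 1 < p) (c ε : ℝ) (hc : 0 < c) (hε : 0 < ε) :
    ∃ C δ : ℝ, 0 < C ∧ 0 < δ ∧ ∀ (n : ℕ) (J H1 H2 : Type) [NormedAddCommGroup H1] [InnerProductSpace ℂ H1] [CompleteSpace H1]
      [NormedAddCommGroup H2] [InnerProductSpace ℂ H2] [CompleteSpace H2] (s : Finset J) (A : J → H1 →L[ℂ] H2) (K : J → (Γ → ℝ) → ℂ),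
      (∀ j, ‖A j‖ ≤ 1) → (∀ j ∈ s, Nice (K j)) → Hor w s K (ENNReal.ofReal (c * (1 + n))) →
      (∀ f, Nice f → ∫⁻ x, ‖TT s A K f x‖ₑ ^ (2:ℝ) ≤ ENNReal.ofReal (c * 2 ^ (-(ε * n))) ^ (2:ℝ) * ∫⁻ x, ‖f x‖ₑ ^ (2:ℝ)) →
      ∀ f, Nice f → ∫⁻ x, ‖TT s A K f x‖ₑ ^ p ≤ ENNReal.ofReal (C * 2 ^ (-(δ * n))) * ∫⁻ x, ‖f x‖ₑ ^ p := by
  rcases lt_trichotomy p 2 with h2 | h2 | h2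
  · obtain ⟨C, δ, hC, hδ, h⟩ := thmS_lt w hw p hp h2 c ε hc hε
    exact ⟨C, δ, hC, hδ, fun n J H1 H2 _ _ _ _ _ _ s A K => h n J H1 H2 s A K⟩
  · subst h2
    refine ⟨c ^ (2:ℝ), ε * 2, by positivity, by positivity, ?_⟩
    intro n J H1 H2 _ _ _ _ _ _ s A K hA hK hH hL2 f hf
    convert hL2 f hf using 2
    rw [ENNReal.ofReal_rpow_of_pos (by positivity), Real.mul_rpow hc.le (by positivity), ← Real.rpow_mul (by norm_num)]
    congr 3; ring
  · set q := p / (p-1) with hq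
    have hpq : p.HolderConjugate q := Real.HolderConjugate.conjExponent hp
    have hq1 : 1 < q := hpq.symm.lt
    have hq2 : q < 2 := by rw [hq, div_lt_iff₀ (by linarith)]; linarith
    obtain ⟨C, δ, hC, hδ, h⟩ := thmS_lt w hw q hq1 hq2 c ε hc hε
    have hpp : 0 < p - 1 := by linarith
    refine ⟨C ^ (p-1), δ * (p-1), by positivity, by positivity, ?_⟩
    intro n J H1 H2 _ _ _ _ _ _ s A K hA hK hH hL2 f hf
    have hK' : ∀ j ∈ s, Nice (kt (K j)) := fun j hj => kt_nice (hK j hj)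
    -- adjoint L2
    have hL2' : ∀ g : (Γ → ℝ) → H2, Nice g → ∫⁻ x, ‖TT s (fun j => (A j).adjoint) (fun j => kt (K j)) g x‖ₑ ^ (2:ℝ) ≤ ENNReal.ofReal (c * 2 ^ (-(ε * n))) ^ (2:ℝ) * ∫⁻ x, ‖g x‖ₑ ^ (2:ℝ) := by
      intro g hg
      have := duality (p := 2) (q := 2) le_rfl (Real.HolderConjugate.two_two) hg (hg.TT hK') (TT s A K) (fun f hf => hf.TT hK) _ hL2
        (fun f hf => by
          have := adj_TT hK (A := A) hf hg
          have h3 := congrArg conj this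
          rw [← integral_conj, ← integral_conj] at h3
          simp only [inner_conj_symm] at h3
          exact h3.symm)
      rwa [show (2:ℝ) - 1 = 1 by norm_num, ENNReal.rpow_one] at this
    have hq' := h n J H2 H1 s (fun j => (A j).adjoint) (fun j => kt (K j)) (fun j => by rw [LinearIsometryEquiv.norm_map]; exact hA j) hK' hH.kt hL2'
    have := duality h2.le hpq hf (hf.TT hK) (TT s (fun j => (A j).adjoint) (fun j => kt (K j))) (fun g hg => hg.TT hK') _ hq'
      (fun g hg => adj_TT hK hf hg)
    convert this using 2
    rw [ENNReal.ofReal_rpow_of_pos (by positivity), Real.mul_rpow hC.le (by positivity), ← Real.rpow_mul (by norm_num)]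
    congr 3; ring

end SR
end

section

namespace SR

variable {Γ : Type} [Fintype Γ] (w : Γ → ℕ)

/-- rescaling -/
def rsc (l : ℤ) (x : Γ → ℝ) : Γ → ℝ := fun α => x α / sc w l α

/-- unnormalized tent -/
def tent (l : ℤ) (x : Γ → ℝ) : ℝ := max 0 (1 - ‖rsc w l x‖)

/-- tent mass -/
def tm (l : ℤ) : ℝ := ∫ x, tent w l x

/-- normalized tent kernel -/
def sk (l : ℤ) (x : Γ → ℝ) : ℂ := ((tm w l)⁻¹ * tent w l x : ℝ)

/-- anisotropic frequency size -/
def rho (l : ℤ) (ξ : Γ → ℝ) : ℝ := ‖fun α => sc w l α * ξ α‖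

lemma tent_nonneg (l : ℤ) (x : Γ → ℝ) : 0 ≤ tent w l x := le_max_left _ _

lemma tent_le_one (l : ℤ) (x : Γ → ℝ) : tent w l x ≤ 1 := by
  unfold tent; apply max_le zero_le_one; linarith [norm_nonneg (rsc w l x)]

lemma continuous_tent (l : ℤ) : Continuous (tent w l) := by
  unfold tent rsc; fun_prop

lemma mem_box_zero {l : ℤ} {x : Γ → ℝ} : x ∈ box w l 0 ↔ ∀ α, |x α| ≤ sc w l α := by
  simp [box]

lemma norm_rsc_le {l : ℤ} {x : Γ → ℝ} {t : ℝ} (ht : 0 ≤ t) : ‖rsc w l x‖ ≤ t ↔ ∀ α, |x α| ≤ t * sc w l α := by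
  rw [pi_norm_le_iff_of_nonneg ht]
  refine forall_congr' fun α => ?_
  have := sc_pos w l α
  rw [rsc, Real.norm_eq_abs, abs_div, abs_of_pos this, div_le_iff₀ this]

lemma tent_supp {l : ℤ} {x : Γ → ℝ} (hx : x ∉ box w l 0) : tent w l x = 0 := by
  have : ¬ ‖rsc w l x‖ ≤ 1 := by
    rw [norm_rsc_le w zero_le_one]; simpa [mem_box_zero] using hx
  unfold tent; apply max_eq_left; linarith

lemma tent_lip (l : ℤ) (x h : Γ → ℝ) {t : ℝ} (ht : 0 ≤ t) (hh : ∀ α, |h α| ≤ t * sc w l α) :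
    |tent w l (x - h) - tent w l x| ≤ t := by
  have h1 : ‖rsc w l h‖ ≤ t := (norm_rsc_le w ht).2 hh
  have h2 : rsc w l (x - h) = rsc w l x - rsc w l h := by
    ext α; simp [rsc, sub_div]
  unfold tent
  have h3 : |max 0 (1 - ‖rsc w l (x-h)‖) - max 0 (1 - ‖rsc w l x‖)| ≤ |(1 - ‖rsc w l (x-h)‖) - (1 - ‖rsc w l x‖)| := by
    rw [max_comm 0, max_comm 0]; exact abs_max_sub_max_le_abs _ _ _
  refine h3.trans ?_
  rw [h2]
  have := abs_norm_sub_norm_le (rsc w l x - rsc w l h) (rsc w l x)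
  have h5 : rsc w l x - rsc w l h - rsc w l x = - rsc w l h := by abel
  rw [h5, norm_neg] at this
  calc _ = |‖rsc w l x - rsc w l h‖ - ‖rsc w l x‖| := by rw [← abs_neg]; congr 1; ring
    _ ≤ _ := this.trans h1

lemma lintegral_le_box {F : (Γ → ℝ) → ℝ≥0∞} {l : ℤ} {a : ℝ≥0∞} (h0 : ∀ x, x ∉ box w l 0 → F x = 0)
    (ha : ∀ x, F x ≤ a) : ∫⁻ x, F x ≤ a * (2 ^ Fintype.card Γ * vl w l) := by
  calc ∫⁻ x, F x ≤ ∫⁻ x, (box w l 0).indicator (fun _ => a) x := by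
        apply lintegral_mono; intro x
        by_cases hx : x ∈ box w l 0
        · simp [hx, ha]
        · simp [hx, h0 x hx]
    _ = _ := by rw [lintegral_indicator_const (measurableSet_box w l 0), volume_box]

lemma integrable_tent (l : ℤ) : Integrable (tent w l) := by
  refine ⟨(continuous_tent w l).aestronglyMeasurable, ?_⟩
  refine (lintegral_le_box w (l := l) (a := 1) (fun x hx => by simp [tent_supp w hx]) (fun x => ?_)).trans_lt ?_
  · rw [← ofReal_norm, Real.norm_eq_abs, abs_of_nonneg (tent_nonneg w l x)]
    exact ENNReal.ofReal_le_one.2 (tent_le_one w l x)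
  · have := vl_ne_top w l
    finiteness

/-- the tent mass is comparable to the cell volume -/
lemma vl_le_tm (hw : ∀ α, 1 ≤ w α) (l : ℤ) : vl w l ≤ 2 * vl w 1 * ENNReal.ofReal (tm w l) := by
  have h1 : ENNReal.ofReal (tm w l) = ∫⁻ x, ENNReal.ofReal (tent w l x) :=
    ofReal_integral_eq_lintegral_ofReal (integrable_tent w l) (Filter.Eventually.of_forall (tent_nonneg w l))
  have h2 : (ENNReal.ofReal (1/2)) * vl w (l-1) ≤ ∫⁻ x, ENNReal.ofReal (tent w l x) := by
    calc (ENNReal.ofReal (1/2)) * vl w (l-1) ≤ (ENNReal.ofReal (1/2)) * volume (box w (l-1) 0) := by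
          rw [volume_box]; gcongr
          exact le_mul_of_one_le_left zero_le' (one_le_pow₀ one_le_two)
      _ = ∫⁻ x in box w (l-1) 0, ENNReal.ofReal (1/2) := by rw [setLIntegral_const]
      _ ≤ ∫⁻ x in box w (l-1) 0, ENNReal.ofReal (tent w l x) := by
          apply setLIntegral_mono (continuous_tent w l).measurable.ennreal_ofReal
          intro x hx
          apply ENNReal.ofReal_le_ofReal
          have : ‖rsc w l x‖ ≤ 1/2 := by
            rw [norm_rsc_le w (by norm_num)]; intro α
            have h3 := (mem_box_zero w).1 hx α
            have h4 := two_mul_sc_le w hw (l-1) α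
            rw [sub_add_cancel] at h4; linarith
          unfold tent; apply le_max_of_le_right; linarith
      _ ≤ _ := setLIntegral_le_lintegral _ _
  have h3 : vl w l = vl w (l-1) * vl w 1 := by rw [← vl_add]; simp
  rw [h1, h3]
  calc vl w (l-1) * vl w 1 = 2 * vl w 1 * (ENNReal.ofReal (1/2) * vl w (l-1)) := by
        have : (2:ℝ≥0∞) * ENNReal.ofReal (1/2) = 1 := by
          rw [show (2:ℝ≥0∞) = ENNReal.ofReal 2 by simp, ← ENNReal.ofReal_mul (by norm_num)]; norm_num
        calc _ = (2 * ENNReal.ofReal (1/2)) * (vl w 1 * vl w (l-1)) := by rw [this, one_mul, mul_comm]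
          _ = _ := by ring
    _ ≤ _ := by gcongr

lemma tm_pos (hw : ∀ α, 1 ≤ w α) (l : ℤ) : 0 < tm w l := by
  by_contra h
  have := vl_le_tm w hw l
  rw [ENNReal.ofReal_of_nonpos (not_lt.1 h), mul_zero] at this
  exact vl_ne_zero w l (le_zero_iff.1 this)

lemma tm_inv_le (hw : ∀ α, 1 ≤ w α) (l : ℤ) : ENNReal.ofReal (tm w l)⁻¹ * vl w l ≤ 2 * vl w 1 := by
  have hp := tm_pos w hw l
  calc _ ≤ ENNReal.ofReal (tm w l)⁻¹ * (2 * vl w 1 * ENNReal.ofReal (tm w l)) := by gcongr; exact vl_le_tm w hw l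
    _ = (ENNReal.ofReal (tm w l)⁻¹ * ENNReal.ofReal (tm w l)) * (2 * vl w 1) := by ring
    _ = _ := by rw [← ENNReal.ofReal_mul (by positivity), inv_mul_cancel₀ hp.ne']; simp

lemma enorm_sk (hw : ∀ α, 1 ≤ w α) (l : ℤ) (x : Γ → ℝ) : ‖sk w l x‖ₑ = ENNReal.ofReal (tm w l)⁻¹ * ENNReal.ofReal (tent w l x) := by
  have hp := tm_pos w hw l
  rw [sk, ← ofReal_norm, Complex.norm_real, Real.norm_eq_abs,
    abs_of_nonneg (mul_nonneg (by positivity) (tent_nonneg w l x)), ENNReal.ofReal_mul (by positivity)]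

lemma sk_le (hw : ∀ α, 1 ≤ w α) (l : ℤ) (x : Γ → ℝ) : ‖sk w l x‖ₑ ≤ ENNReal.ofReal (tm w l)⁻¹ := by
  rw [enorm_sk w hw]
  calc _ ≤ ENNReal.ofReal (tm w l)⁻¹ * 1 := by
        gcongr; exact ENNReal.ofReal_le_one.2 (tent_le_one w l x)
    _ = _ := mul_one _

lemma sk_supp {l : ℤ} {x : Γ → ℝ} (hx : x ∉ box w l 0) : sk w l x = 0 := by
  simp [sk, tent_supp w hx]

lemma continuous_sk (l : ℤ) : Continuous (sk w l) := by
  unfold sk; have := continuous_tent w l; fun_prop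

lemma sk_nice (hw : ∀ α, 1 ≤ w α) (l : ℤ) : Nice (sk w l) := by
  refine ⟨(continuous_sk w l).stronglyMeasurable, ⟨(tm w l)⁻¹, fun x => ?_⟩, ?_⟩
  · have hp := tm_pos w hw l
    have := sk_le w hw l x
    rwa [← ofReal_norm, ENNReal.ofReal_le_ofReal_iff (by positivity)] at this
  · exact ((integrable_tent w l).const_mul _).ofReal

lemma integral_sk (hw : ∀ α, 1 ≤ w α) (l : ℤ) : ∫ x, sk w l x = 1 := by
  have hp := tm_pos w hw l
  unfold sk
  rw [integral_complex_ofReal, integral_const_mul]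
  change (((tm w l)⁻¹ * tm w l : ℝ) : ℂ) = 1
  rw [inv_mul_cancel₀ hp.ne']; simp

lemma lintegral_sk (hw : ∀ α, 1 ≤ w α) (l : ℤ) : ∫⁻ x, ‖sk w l x‖ₑ = 1 := by
  have hp := tm_pos w hw l
  simp_rw [enorm_sk w hw]
  rw [lintegral_const_mul _ (continuous_tent w l).measurable.ennreal_ofReal,
    ← ofReal_integral_eq_lintegral_ofReal (integrable_tent w l) (Filter.Eventually.of_forall (tent_nonneg w l)),
    ← ENNReal.ofReal_mul (by positivity)]
  change ENNReal.ofReal ((tm w l)⁻¹ * tm w l) = 1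
  rw [inv_mul_cancel₀ hp.ne']; simp

/-- the kernel constant -/
def kc : ℝ := 2 + (2 * vl w 1 * (2 ^ Fintype.card Γ * vl w 1)).toReal

lemma kc_pos : 2 ≤ kc w := by unfold kc; linarith [@ENNReal.toReal_nonneg (2 * vl w 1 * (2 ^ Fintype.card Γ * vl w 1))]

lemma le_ofReal_kc : 2 * vl w 1 * (2 ^ Fintype.card Γ * vl w 1) ≤ ENNReal.ofReal (kc w) := by
  have : 2 * vl w 1 * (2 ^ Fintype.card Γ * vl w 1) ≠ ∞ := by have := vl_ne_top w 1; finiteness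
  rw [← ENNReal.ofReal_toReal this]; apply ENNReal.ofReal_le_ofReal; unfold kc; linarith

lemma sk_diff_two (hw : ∀ α, 1 ≤ w α) (l : ℤ) (h : Γ → ℝ) : ∫⁻ x, ‖sk w l (x - h) - sk w l x‖ₑ ≤ 2 := by
  calc ∫⁻ x, ‖sk w l (x - h) - sk w l x‖ₑ ≤ ∫⁻ x, (‖sk w l (x - h)‖ₑ + ‖sk w l x‖ₑ) :=
        lintegral_mono fun x => enorm_sub_le
    _ = 1 + 1 := by
        rw [lintegral_add_right _ (continuous_sk w l).measurable.enorm, lintegral_sk w hw,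
          lintegral_sub_right_eq_self (fun x => ‖sk w l x‖ₑ), lintegral_sk w hw]
    _ = 2 := one_add_one_eq_two

lemma sk_diff (hw : ∀ α, 1 ≤ w α) (l : ℤ) (h : Γ → ℝ) {t : ℝ} (ht : 0 ≤ t) (hh : ∀ α, |h α| ≤ t * sc w l α) :
    ∫⁻ x, ‖sk w l (x - h) - sk w l x‖ₑ ≤ ENNReal.ofReal (kc w * t) := by
  have hp := tm_pos w hw l
  rcases le_or_gt 1 t with h1 | h1
  · refine (sk_diff_two w hw l h).trans ?_
    rw [show (2:ℝ≥0∞) = ENNReal.ofReal 2 by simp]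
    apply ENNReal.ofReal_le_ofReal
    nlinarith [kc_pos w]
  · have key := lintegral_le_box w (F := fun x => ‖sk w l (x - h) - sk w l x‖ₑ) (l := l + 1)
      (a := ENNReal.ofReal (tm w l)⁻¹ * ENNReal.ofReal t) ?_ ?_
    · refine key.trans ?_
      rw [vl_add]
      calc _ = ENNReal.ofReal t * ((ENNReal.ofReal (tm w l)⁻¹ * vl w l) * (2 ^ Fintype.card Γ * vl w 1)) := by ring
        _ ≤ ENNReal.ofReal t * (2 * vl w 1 * (2 ^ Fintype.card Γ * vl w 1)) := by
            exact mul_le_mul' le_rfl (mul_le_mul' (tm_inv_le w hw l) le_rfl)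
        _ ≤ ENNReal.ofReal t * ENNReal.ofReal (kc w) := by gcongr; exact le_ofReal_kc w
        _ = _ := by rw [mul_comm, ← ENNReal.ofReal_mul (by linarith [kc_pos w])]
    · intro x hx
      have h2 : x ∉ box w l 0 := fun h => hx (box_mono w (by lia) _ h)
      have h3 : x - h ∉ box w l 0 := by
        intro h3; apply hx
        rw [mem_box_zero] at h3 ⊢
        intro α
        have h4 := h3 α
        have h5 := hh α
        have h6 := two_mul_sc_le w hw l α
        have h7 := sc_pos w l α
        have : x α = (x - h) α + h α := by simp
        rw [this]
        refine (abs_add_le _ _).trans ?_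
        nlinarith
      simp [sk_supp w h2, sk_supp w h3]
    · intro x
      have : sk w l (x - h) - sk w l x = (((tm w l)⁻¹ * (tent w l (x-h) - tent w l x) : ℝ) : ℂ) := by
        simp [sk]; ring
      rw [this, ← ofReal_norm, Complex.norm_real, norm_mul, Real.norm_eq_abs, Real.norm_eq_abs,
        abs_of_pos (inv_pos.2 hp), ENNReal.ofReal_mul (by positivity)]
      gcongr
      exact tent_lip w l x h ht hh

lemma rho_nonneg (l : ℤ) (ξ : Γ → ℝ) : 0 ≤ rho w l ξ := norm_nonneg _

lemma le_rho (l : ℤ) (ξ : Γ → ℝ) (α : Γ) : sc w l α * |ξ α| ≤ rho w l ξ := by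
  have := norm_le_pi_norm (fun α => sc w l α * ξ α) α
  rwa [norm_mul, Real.norm_eq_abs, Real.norm_eq_abs, abs_of_pos (sc_pos w l α)] at this

lemma rho_le_iff {l : ℤ} {ξ : Γ → ℝ} {r : ℝ} (hr : 0 ≤ r) : rho w l ξ ≤ r ↔ ∀ α, sc w l α * |ξ α| ≤ r := by
  unfold rho
  rw [pi_norm_le_iff_of_nonneg hr]
  simp only [norm_mul, Real.norm_eq_abs, abs_of_pos (sc_pos w l _)]

lemma rho_succ (hw : ∀ α, 1 ≤ w α) (l : ℤ) (ξ : Γ → ℝ) : 2 * rho w l ξ ≤ rho w (l+1) ξ := by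
  have : rho w l ξ ≤ rho w (l+1) ξ / 2 := by
    rw [rho_le_iff w (div_nonneg (rho_nonneg w _ _) zero_le_two)]
    intro α
    have h1 := le_rho w (l+1) ξ α
    have h2 := two_mul_sc_le w hw l α
    nlinarith [abs_nonneg (ξ α)]
  linarith

lemma sc_le_pow (m : ℕ) (α : Γ) : sc w m α ≤ 2 ^ (m * ∑ α, w α) := by
  unfold sc
  rw [show ((m:ℤ) * (w α : ℤ)) = ((m * w α : ℕ) : ℤ) by push_cast; ring, zpow_natCast]
  apply pow_le_pow_right₀ one_le_two
  gcongr
  exact Finset.single_le_sum (f := w) (fun _ _ => Nat.zero_le _) (Finset.mem_univ α)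

lemma rho_add_le (l : ℤ) (m : ℕ) (ξ : Γ → ℝ) : rho w (l+m) ξ ≤ 2 ^ (m * ∑ α, w α) * rho w l ξ := by
  rw [rho_le_iff w (mul_nonneg (by positivity) (rho_nonneg w _ _))]
  intro α
  rw [sc_add]
  have h1 := le_rho w l ξ α
  have h2 := sc_le_pow w m α
  have h3 := sc_pos w (m:ℤ) α
  have h4 := mul_nonneg (sc_pos w l α).le (abs_nonneg (ξ α))
  calc sc w l α * sc w m α * |ξ α| = sc w m α * (sc w l α * |ξ α|) := by ring
    _ ≤ _ := by gcongr

lemma dotp_le {l : ℤ} {y : Γ → ℝ} (hy : y ∈ box w l 0) (ξ : Γ → ℝ) : |dotp y ξ| ≤ Fintype.card Γ * rho w l ξ := by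
  unfold dotp
  refine (Finset.abs_sum_le_sum_abs _ _).trans ?_
  rw [← nsmul_eq_mul, ← Finset.card_univ]
  apply Finset.sum_le_card_nsmul
  intro α _
  rw [abs_mul]
  exact (mul_le_mul_of_nonneg_right ((mem_box_zero w).1 hy α) (abs_nonneg _)).trans (le_rho w l ξ α)

/-- generic low frequency bound -/
lemma mu_low {E : Type*} [MeasureSpace E] {k : E → ℂ} {Q : E → Γ → ℝ} (hki : Integrable k) (hQ : Measurable Q)
    {l : ℤ} (hs : ∀ y, k y ≠ 0 → Q y ∈ box w l 0) (ξ : Γ → ℝ) :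
    ‖mu k Q ξ - ∫ y, k y‖ ≤ (∫ y, ‖k y‖) * (2 * Real.pi * (Fintype.card Γ * rho w l ξ)) := by
  unfold mu
  have hi : Integrable (fun y => k y * chi (dotp (Q y) ξ)) := by
    simpa [mul_comm] using chi_smul_integrable hki hQ ξ
  rw [← integral_sub hi hki, ← integral_mul_const]
  refine norm_integral_le_of_norm_le (hki.norm.mul_const _) (Filter.Eventually.of_forall fun y => ?_)
  rw [show k y * chi (dotp (Q y) ξ) - k y = k y * (chi (dotp (Q y) ξ) - 1) by ring, norm_mul]
  by_cases h : k y = 0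
  · simp [h]
  · gcongr
    refine (norm_chi_sub_one _).trans ?_
    have := dotp_le w (hs y h) ξ
    gcongr

lemma integral_norm_sk (hw : ∀ α, 1 ≤ w α) (l : ℤ) : ∫ y, ‖sk w l y‖ = 1 := by
  rw [integral_norm_eq_lintegral_enorm (sk_nice w hw l).int.aestronglyMeasurable, lintegral_sk w hw]; simp

lemma mu_sk_low (hw : ∀ α, 1 ≤ w α) (l : ℤ) (ξ : Γ → ℝ) :
    ‖mu (sk w l) id ξ - 1‖ ≤ 2 * Real.pi * (Fintype.card Γ * rho w l ξ) := by
  have := mu_low w (sk_nice w hw l).int measurable_id (l := l) (fun y hy => by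
    by_contra h; exact hy (sk_supp w h)) ξ
  rwa [integral_sk w hw, integral_norm_sk w hw, one_mul] at this

/-- decay -/
lemma mu_sk_high (hw : ∀ α, 1 ≤ w α) (l : ℤ) (ξ : Γ → ℝ) : ‖mu (sk w l) id ξ‖ * rho w l ξ ≤ kc w := by
  classical
  have hk := kc_pos w
  by_cases hm : ‖mu (sk w l) id ξ‖ = 0
  · rw [hm]; linarith
  have hm' : 0 < ‖mu (sk w l) id ξ‖ := lt_of_le_of_ne (norm_nonneg _) (Ne.symm hm)
  rw [mul_comm, ← le_div_iff₀ hm', rho_le_iff w (by positivity)]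
  intro α
  rw [le_div_iff₀ hm']
  by_cases hξ : ξ α = 0
  · simp [hξ]; linarith
  have hs := sc_pos w l α
  have hξ' : 0 < |ξ α| := abs_pos.2 hξ
  set h : Γ → ℝ := Pi.single α (1 / (2 * ξ α)) with hh
  have hdot : dotp h ξ = 1/2 := by
    unfold dotp
    rw [Finset.sum_eq_single α]
    · simp [hh]; field_simp
    · intro b _ hb; simp [hh, hb]
    · simp
  have hchi : chi (1/2) = -1 := by
    unfold chi
    rw [show ((-2 * Real.pi * (1/2) : ℝ) : ℂ) * Complex.I = -(Real.pi * Complex.I) by push_cast; ring, Complex.exp_neg,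
      Complex.exp_pi_mul_I]; norm_num
  have hi : Integrable (fun y => sk w l y * chi (dotp y ξ)) := by
    simpa [mul_comm] using chi_smul_integrable (sk_nice w hw l).int measurable_id ξ
  have hi2 : Integrable (fun y => sk w l (y - h) * chi (dotp y ξ)) := by
    simpa [mul_comm] using chi_smul_integrable ((sk_nice w hw l).int.comp_sub_right h) measurable_id ξ
  have e1 : ∫ y, sk w l (y - h) * chi (dotp y ξ) = - mu (sk w l) id ξ := by
    rw [← integral_add_right_eq_self _ h]
    simp only [add_sub_cancel_right, dotp_add, hdot, chi_add, hchi]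
    unfold mu; rw [← integral_neg]; congr 1; ext y; simp
  have e2 : ∫ y, (sk w l (y - h) - sk w l y) * chi (dotp y ξ) = - 2 * mu (sk w l) id ξ := by
    simp_rw [sub_mul]
    rw [integral_sub hi2 hi, e1]; unfold mu; simp; ring
  have e3 : ‖(2:ℂ) * mu (sk w l) id ξ‖ₑ ≤ ENNReal.ofReal (kc w * (1 / (2 * |ξ α| * sc w l α))) := by
    have : ‖(2:ℂ) * mu (sk w l) id ξ‖ₑ = ‖∫ y, (sk w l (y - h) - sk w l y) * chi (dotp y ξ)‖ₑ := by
      rw [e2, neg_mul, enorm_neg]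
    rw [this]
    refine (enorm_integral_le_lintegral_enorm _).trans ?_
    simp_rw [enorm_mul, enorm_chi, mul_one]
    apply sk_diff w hw l h (by positivity)
    intro β
    by_cases hb : β = α
    · subst hb; simp only [hh, Pi.single_eq_same, abs_div, abs_mul, abs_one, abs_two]; apply le_of_eq; field_simp
    · simp [hh, hb]; have := sc_pos w l β; positivity
  rw [← ofReal_norm, ENNReal.ofReal_le_ofReal_iff (by positivity), norm_mul, Complex.norm_ofNat] at e3
  have h9 : kc w * (1 / (2 * |ξ α| * sc w l α)) = kc w / (2 * (|ξ α| * sc w l α)) := by rw [mul_one_div, mul_assoc]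
  rw [h9, le_div_iff₀ (by positivity)] at e3
  have h10 : 0 ≤ sc w l α * |ξ α| * ‖mu (sk w l) id ξ‖ := by positivity
  nlinarith

/-- domination by the maximal function -/
lemma op_sk_le_mx (hw : ∀ α, 1 ≤ w α) {H : Type*} [NormedAddCommGroup H] [NormedSpace ℂ H] (l : ℤ) (f : (Γ → ℝ) → H)
    (x : Γ → ℝ) : ‖Op (sk w l) id f x‖ₑ ≤ 2 * vl w 1 * mx w (fun y => ‖f y‖ₑ) x := by
  refine op_norm_le x |>.trans ?_
  have e : ∫⁻ y, ‖sk w l y‖ₑ * ‖f (x - id y)‖ₑ = ∫⁻ y, ‖sk w l (x - y)‖ₑ * ‖f y‖ₑ := by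
    rw [← lintegral_sub_left_eq_self _ x]
    simp
  rw [e]
  calc ∫⁻ y, ‖sk w l (x - y)‖ₑ * ‖f y‖ₑ ≤ ∫⁻ y, (box w l x).indicator (fun y => ENNReal.ofReal (tm w l)⁻¹ * ‖f y‖ₑ) y := by
        apply lintegral_mono; intro y
        by_cases hy : y ∈ box w l x
        · simp only [Set.indicator_of_mem hy]; gcongr; exact sk_le w hw _ _
        · have : x - y ∉ box w l 0 := by rw [box_sub]; rwa [box_comm]
          simp [sk_supp w this]
    _ = ENNReal.ofReal (tm w l)⁻¹ * ∫⁻ y in box w l x, ‖f y‖ₑ := by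
        rw [lintegral_indicator (measurableSet_box w l x), lintegral_const_mul' _ _ ENNReal.ofReal_ne_top]
    _ ≤ ENNReal.ofReal (tm w l)⁻¹ * (vl w l * mx w (fun y => ‖f y‖ₑ) x) := by gcongr; exact box_le_mx w _ l x
    _ = (ENNReal.ofReal (tm w l)⁻¹ * vl w l) * mx w (fun y => ‖f y‖ₑ) x := by ring
    _ ≤ _ := mul_le_mul' (tm_inv_le w hw l) le_rfl

end SR
end

section

namespace SR

lemma geo_sum (r : ℝ) (hr0 : 0 ≤ r) (hr : r < 1) : ∃ C : ℝ, 0 < C ∧ ∀ (s : Finset ℤ) (N : ℤ), ∑ i ∈ s, r ^ (i - N).natAbs ≤ C := by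
  have hs : Summable (fun i : ℤ => r ^ i.natAbs) := by
    apply Summable.of_nat_of_neg
    · simpa using summable_geometric_of_lt_one hr0 hr
    · simpa using summable_geometric_of_lt_one hr0 hr
  refine ⟨1 + ∑' i : ℤ, r ^ i.natAbs, ?_, fun s N => ?_⟩
  · have : 0 ≤ ∑' i : ℤ, r ^ i.natAbs := tsum_nonneg fun i => by positivity
    linarith
  · have h1 : Summable (fun i : ℤ => r ^ (i - N).natAbs) := hs.comp_injective (i := fun i : ℤ => i - N) (fun a b h => by simpa using h)
    have h2 := h1.sum_le_tsum s (fun i _ => by positivity)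
    have h3 : ∑' i : ℤ, r ^ (i - N).natAbs = ∑' i : ℤ, r ^ i.natAbs := (Equiv.subRight N).tsum_eq (fun i : ℤ => r ^ i.natAbs)
    linarith

/-- two-sided decay profile -/
def bb (η ρ : ℝ) : ℝ := min (ρ ^ η) (ρ ^ (-η))

lemma bb_nonneg (η : ℝ) {ρ : ℝ} (h : 0 ≤ ρ) : 0 ≤ bb η ρ := le_min (Real.rpow_nonneg h _) (Real.rpow_nonneg h _)

lemma le_bb {η ρ x C : ℝ} (hη : 0 < η) (hη1 : η ≤ 1) (hC : 0 ≤ C) (hρ : 0 ≤ ρ) (h1 : x ≤ C * ρ) (h2 : 1 ≤ ρ → x ≤ C * ρ ^ (-η)) :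
    x ≤ C * bb η ρ := by
  rcases hρ.eq_or_lt with h0 | h0
  · subst h0; unfold bb; rw [Real.zero_rpow hη.ne', Real.zero_rpow (by linarith)]; simpa using h1
  unfold bb
  rw [mul_min_of_nonneg _ _ hC]
  rcases le_total 1 ρ with h | h
  · have := h2 h
    refine le_min (this.trans ?_) this
    exact mul_le_mul_of_nonneg_left (Real.rpow_le_rpow_of_exponent_le h (by linarith)) hC
  · have a1 : ρ ≤ ρ ^ η := by
      have := Real.rpow_le_rpow_of_exponent_ge h0 h hη1
      rwa [Real.rpow_one] at this
    have a2 : ρ ≤ ρ ^ (-η) := by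
      have := Real.rpow_le_rpow_of_exponent_ge h0 h (show -η ≤ 1 by linarith)
      rwa [Real.rpow_one] at this
    exact le_min (h1.trans (by gcongr)) (h1.trans (by gcongr))

section
variable {Γ : Type} [Fintype Γ] (w : Γ → ℕ)

lemma rho_pow (hw : ∀ α, 1 ≤ w α) (l : ℤ) (n : ℕ) (ξ : Γ → ℝ) : 2 ^ n * rho w l ξ ≤ rho w (l+n) ξ := by
  induction n with
  | zero => simp
  | succ n ih =>
    have := rho_succ w hw (l+n) ξ
    rw [pow_succ]
    have e : l + ((n+1 : ℕ) : ℤ) = l + n + 1 := by push_cast; ring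
    rw [e]; nlinarith

lemma exists_center (hw : ∀ α, 1 ≤ w α) (ξ : Γ → ℝ) (hξ : 0 < rho w 0 ξ) :
    ∃ j0 : ℤ, rho w j0 ξ ≤ 1 ∧ 1 < rho w (j0+1) ξ := by
  obtain ⟨n, hn⟩ := pow_unbounded_of_one_lt (rho w 0 ξ) one_lt_two
  obtain ⟨m, hm⟩ := pow_unbounded_of_one_lt (1 / rho w 0 ξ) one_lt_two
  have ex := Int.exists_greatest_of_bdd (P := fun j => rho w j ξ ≤ 1) ⟨m, fun z hz => ?_⟩ ⟨-n, ?_⟩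
  · obtain ⟨j0, h1, h2⟩ := ex
    refine ⟨j0, h1, ?_⟩
    by_contra h
    have := h2 (j0+1) (not_lt.1 h); lia
  · by_contra h
    have h1 := rho_pow w hw 0 z.toNat ξ
    have e : (0:ℤ) + z.toNat = z := by lia
    rw [e] at h1
    have h2 : (2:ℝ)^m ≤ 2 ^ z.toNat := pow_le_pow_right₀ one_le_two (by lia)
    rw [div_lt_iff₀ hξ] at hm
    nlinarith
  · have h1 := rho_pow w hw (-n) n ξ
    rw [neg_add_cancel] at h1
    have : (0:ℝ) < 2 ^ n := by positivity
    by_contra h; nlinarith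

lemma rho_zero_of (hw : ∀ α, 1 ≤ w α) (ξ : Γ → ℝ) (hξ : rho w 0 ξ = 0) (l : ℤ) : rho w l ξ = 0 := by
  apply le_antisymm _ (rho_nonneg w _ _)
  rw [rho_le_iff w le_rfl]
  intro α
  have := le_rho w 0 ξ α
  rw [hξ] at this
  have h0 := sc_pos w 0 α
  have : |ξ α| = 0 := by
    apply le_antisymm _ (abs_nonneg _)
    by_contra h; nlinarith [not_le.1 h]
  rw [this, mul_zero]

lemma bb_decay (hw : ∀ α, 1 ≤ w α) (η : ℝ) (hη : 0 < η) (ξ : Γ → ℝ) :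
    ∃ j0 : ℤ, ∀ i, bb η (rho w i ξ) ≤ 2 ^ η * ((2:ℝ) ^ (-η)) ^ (i - j0).natAbs := by
  rcases (rho_nonneg w 0 ξ).eq_or_lt with h0 | h0
  · refine ⟨0, fun i => ?_⟩
    rw [rho_zero_of w hw ξ h0.symm i]; unfold bb
    rw [Real.zero_rpow hη.ne', Real.zero_rpow (by linarith), min_self]; positivity
  obtain ⟨j0, h1, h2⟩ := exists_center w hw ξ h0
  refine ⟨j0, fun i => ?_⟩
  have hpos : 0 ≤ rho w i ξ := rho_nonneg w i ξ
  have e : ((2:ℝ) ^ (-η)) ^ (i - j0).natAbs = ((2:ℝ) ^ (i-j0).natAbs)⁻¹ ^ η := by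
    rw [← Real.rpow_natCast, ← Real.rpow_mul zero_le_two, ← Real.rpow_natCast (2:ℝ), ← Real.rpow_neg zero_le_two, ← Real.rpow_mul zero_le_two]
    congr 1; ring
  rw [e]
  have h2η : 1 ≤ (2:ℝ) ^ η := Real.one_le_rpow one_le_two hη.le
  rcases le_or_gt i j0 with h | h
  · have h3 := rho_pow w hw i (i - j0).natAbs ξ
    have e2 : i + ((i - j0).natAbs : ℤ) = j0 := by lia
    rw [e2] at h3
    have h4 : rho w i ξ ≤ ((2:ℝ) ^ (i-j0).natAbs)⁻¹ := by
      rw [← one_div, le_div_iff₀ (by positivity)]; linarith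
    calc bb η (rho w i ξ) ≤ rho w i ξ ^ η := min_le_left _ _
      _ ≤ ((2:ℝ) ^ (i-j0).natAbs)⁻¹ ^ η := by gcongr
      _ ≤ _ := le_mul_of_one_le_left (by positivity) h2η
  · obtain ⟨m, hm⟩ : ∃ m : ℕ, i = j0 + 1 + m := ⟨(i - j0 - 1).toNat, by lia⟩
    have h3 := rho_pow w hw (j0+1) m ξ
    rw [← hm] at h3
    have h4 : (2:ℝ) ^ m ≤ rho w i ξ := by nlinarith [pow_pos (zero_lt_two : (0:ℝ) < 2) m]
    have e3 : (i - j0).natAbs = m + 1 := by lia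
    calc bb η (rho w i ξ) ≤ rho w i ξ ^ (-η) := min_le_right _ _
      _ ≤ ((2:ℝ) ^ m) ^ (-η) := Real.rpow_le_rpow_of_nonpos (by positivity) h4 (by linarith)
      _ = 2 ^ η * ((2:ℝ) ^ (i-j0).natAbs)⁻¹ ^ η := by
        rw [e3, ← Real.mul_rpow zero_le_two (by positivity), pow_succ, Real.rpow_neg (by positivity), ← Real.inv_rpow (by positivity)]
        congr 1; field_simp

lemma mult_sum (hw : ∀ α, 1 ≤ w α) (η : ℝ) (hη : 0 < η) : ∃ C : ℝ, 0 < C ∧ ∀ (ξ : Γ → ℝ) (s : Finset ℤ) (a : ℤ),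
    ∑ i ∈ s, bb η (rho w i ξ) * bb η (rho w (i-a) ξ) ≤ C * 2 ^ (-(η / 2 * a.natAbs)) := by
  have hr : (2:ℝ) ^ (-(η/2)) < 1 := Real.rpow_lt_one_of_one_lt_of_neg one_lt_two (by linarith)
  obtain ⟨G, hG, hg⟩ := geo_sum ((2:ℝ) ^ (-(η/2))) (by positivity) hr
  refine ⟨(2 ^ η) ^ 2 * G, by positivity, fun ξ s a => ?_⟩
  obtain ⟨j0, h⟩ := bb_decay w hw η hη ξ
  set r := (2:ℝ) ^ (-(η/2)) with hrd
  have hr0 : 0 < r := by positivity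
  have e1 : (2:ℝ) ^ (-η) = r ^ 2 := by
    rw [hrd, ← Real.rpow_natCast, ← Real.rpow_mul zero_le_two]; congr 1; push_cast; ring
  have e2 : (2:ℝ) ^ (-(η / 2 * a.natAbs)) = r ^ a.natAbs := by
    rw [hrd, ← Real.rpow_natCast, ← Real.rpow_mul zero_le_two]; congr 1; ring
  rw [e2]
  calc ∑ i ∈ s, bb η (rho w i ξ) * bb η (rho w (i-a) ξ)
      ≤ ∑ i ∈ s, ((2 ^ η) ^ 2 * r ^ a.natAbs) * r ^ (i - j0).natAbs := by
        apply Finset.sum_le_sum; intro i _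
        have h1 := h i
        have h2 := h (i - a)
        calc _ ≤ (2 ^ η * ((2:ℝ) ^ (-η)) ^ (i - j0).natAbs) * (2 ^ η * ((2:ℝ) ^ (-η)) ^ (i - a - j0).natAbs) := by
              gcongr
              exact bb_nonneg _ (rho_nonneg w _ _)
          _ = (2 ^ η) ^ 2 * r ^ (2 * (i - j0).natAbs + 2 * (i - a - j0).natAbs) := by
              rw [e1, ← pow_mul, ← pow_mul, pow_add]; ring
          _ ≤ (2 ^ η) ^ 2 * r ^ (a.natAbs + (i - j0).natAbs) := by
              gcongr ?_ * ?_
              exact pow_le_pow_of_le_one hr0.le hr.le (by lia)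
          _ = _ := by rw [pow_add]; ring
    _ = ((2 ^ η) ^ 2 * r ^ a.natAbs) * ∑ i ∈ s, r ^ (i - j0).natAbs := by rw [Finset.mul_sum]
    _ ≤ ((2 ^ η) ^ 2 * r ^ a.natAbs) * G := by gcongr; exact hg s j0
    _ = _ := by ring

/-- difference kernel -/
def dk (l : ℤ) (x : Γ → ℝ) : ℂ := sk w (l-1) x - sk w l x

lemma dk_nice (hw : ∀ α, 1 ≤ w α) (l : ℤ) : Nice (dk w l) := (sk_nice w hw (l-1)).sub (sk_nice w hw l)

lemma mu_sub {E : Type*} [MeasureSpace E] {k k' : E → ℂ} {Q : E → Γ → ℝ} (hk : Integrable k) (hk' : Integrable k')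
    (hQ : Measurable Q) (ξ : Γ → ℝ) : mu (fun y => k y - k' y) Q ξ = mu k Q ξ - mu k' Q ξ := by
  unfold mu
  have h1 : Integrable (fun y => k y * chi (dotp (Q y) ξ)) := by
    simpa [mul_comm] using chi_smul_integrable hk hQ ξ
  have h2 : Integrable (fun y => k' y * chi (dotp (Q y) ξ)) := by
    simpa [mul_comm] using chi_smul_integrable hk' hQ ξ
  rw [← integral_sub h1 h2]; congr 1; ext y; ring

lemma dk_supp (hw : ∀ α, 1 ≤ w α) {l : ℤ} {x : Γ → ℝ} (hx : x ∉ box w l 0) : dk w l x = 0 := by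
  have : x ∉ box w (l-1) 0 := fun h => hx (box_mono w (by lia) _ h)
  simp [dk, sk_supp w hx, sk_supp w this]

lemma dk_diff (hw : ∀ α, 1 ≤ w α) (l : ℤ) (h : Γ → ℝ) {t : ℝ} (ht : 0 ≤ t) (hh : ∀ α, |h α| ≤ t * sc w (l-1) α) :
    ∫⁻ x, ‖dk w l (x - h) - dk w l x‖ₑ ≤ ENNReal.ofReal (2 * kc w * t) := by
  have h1 := sk_diff w hw (l-1) h ht hh
  have h2 := sk_diff w hw l h ht (fun α => (hh α).trans (mul_le_mul_of_nonneg_left (sc_mono w (by lia) α) ht))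
  have hk := kc_pos w
  calc ∫⁻ x, ‖dk w l (x - h) - dk w l x‖ₑ
      ≤ ∫⁻ x, (‖sk w (l-1) (x - h) - sk w (l-1) x‖ₑ + ‖sk w l (x - h) - sk w l x‖ₑ) := by
        apply lintegral_mono; intro x
        beta_reduce
        have : dk w l (x - h) - dk w l x = (sk w (l-1) (x - h) - sk w (l-1) x) - (sk w l (x - h) - sk w l x) := by
          unfold dk; ring
        rw [this]; exact enorm_sub_le
    _ = _ := lintegral_add_left (by
        have := (continuous_sk w (l-1)).measurable
        fun_prop) _
    _ ≤ ENNReal.ofReal (kc w * t) + ENNReal.ofReal (kc w * t) := add_le_add h1 h2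
    _ = _ := by rw [← ENNReal.ofReal_add (by positivity) (by positivity)]; congr 1; ring

lemma dk_diff_four (hw : ∀ α, 1 ≤ w α) (l : ℤ) (h : Γ → ℝ) :
    ∫⁻ x, ‖dk w l (x - h) - dk w l x‖ₑ ≤ 4 := by
  have h1 := sk_diff_two w hw (l-1) h
  have h2 := sk_diff_two w hw l h
  calc ∫⁻ x, ‖dk w l (x - h) - dk w l x‖ₑ
      ≤ ∫⁻ x, (‖sk w (l-1) (x - h) - sk w (l-1) x‖ₑ + ‖sk w l (x - h) - sk w l x‖ₑ) := by
        apply lintegral_mono; intro x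
        beta_reduce
        have : dk w l (x - h) - dk w l x = (sk w (l-1) (x - h) - sk w (l-1) x) - (sk w l (x - h) - sk w l x) := by
          unfold dk; ring
        rw [this]; exact enorm_sub_le
    _ = _ := lintegral_add_left (by
        have := (continuous_sk w (l-1)).measurable
        fun_prop) _
    _ ≤ 2 + 2 := add_le_add h1 h2
    _ = _ := by norm_num

lemma mu_dk (hw : ∀ α, 1 ≤ w α) (η : ℝ) (hη : 0 < η) (hη1 : η ≤ 1) : ∃ C : ℝ, 0 < C ∧ ∀ l ξ, ‖mu (dk w l) id ξ‖ ≤ C * bb η (rho w l ξ) := by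
  set P := 2 * Real.pi * Fintype.card Γ with hP
  set W := (2:ℝ) ^ (1 * ∑ α, w α) with hW
  have hk := kc_pos w
  have hW1 : 1 ≤ W := one_le_pow₀ one_le_two
  have hP0 : 0 ≤ P := by positivity
  refine ⟨2 * P + 2 * kc w * W, by positivity, fun l ξ => ?_⟩
  have hρ := rho_nonneg w l ξ
  have hρ' := rho_nonneg w (l-1) ξ
  have e : mu (dk w l) id ξ = mu (sk w (l-1)) id ξ - mu (sk w l) id ξ :=
    mu_sub (sk_nice w hw (l-1)).int (sk_nice w hw l).int measurable_id ξ
  have a1 := mu_sk_low w hw l ξ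
  have a2 := mu_sk_low w hw (l-1) ξ
  have a3 := mu_sk_high w hw l ξ
  have a4 := mu_sk_high w hw (l-1) ξ
  have b1 : rho w (l-1) ξ ≤ rho w l ξ := by
    have := rho_succ w hw (l-1) ξ
    rw [sub_add_cancel] at this; linarith
  have b2 : rho w l ξ ≤ W * rho w (l-1) ξ := by
    have := rho_add_le w (l-1) 1 ξ
    simpa [hW] using this
  apply le_bb hη hη1 (by positivity) hρ
  · have : ‖mu (dk w l) id ξ‖ ≤ ‖mu (sk w (l-1)) id ξ - 1‖ + ‖mu (sk w l) id ξ - 1‖ := by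
      rw [e, show mu (sk w (l-1)) id ξ - mu (sk w l) id ξ = (mu (sk w (l-1)) id ξ - 1) - (mu (sk w l) id ξ - 1) by ring]
      exact norm_sub_le _ _
    rw [← mul_assoc, ← hP] at a1 a2
    have c1 : P * rho w (l-1) ξ ≤ P * rho w l ξ := by gcongr
    have c2 : 0 ≤ 2 * kc w * W * rho w l ξ := by positivity
    linarith
  · intro h1
    have hn : ‖mu (dk w l) id ξ‖ ≤ ‖mu (sk w (l-1)) id ξ‖ + ‖mu (sk w l) id ξ‖ := by rw [e]; exact norm_sub_le _ _
    have c1 : ‖mu (dk w l) id ξ‖ * rho w l ξ ≤ 2 * kc w * W := by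
      have d1 : ‖mu (sk w (l-1)) id ξ‖ * rho w l ξ ≤ W * kc w := by
        calc _ ≤ ‖mu (sk w (l-1)) id ξ‖ * (W * rho w (l-1) ξ) := by gcongr
          _ = W * (‖mu (sk w (l-1)) id ξ‖ * rho w (l-1) ξ) := by ring
          _ ≤ _ := by gcongr
      have d2 := mul_le_mul_of_nonneg_right hn hρ
      nlinarith
    have c2 : ‖mu (dk w l) id ξ‖ ≤ (2 * kc w * W) * (rho w l ξ)⁻¹ := by
      rw [← div_eq_mul_inv, le_div_iff₀ (by linarith)]; exact c1
    have c3 : (rho w l ξ)⁻¹ ≤ rho w l ξ ^ (-η) := by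
      rw [← Real.rpow_neg_one]; exact Real.rpow_le_rpow_of_exponent_le h1 (by linarith)
    have c4 : 0 ≤ rho w l ξ ^ (-η) := by positivity
    calc _ ≤ (2 * kc w * W) * rho w l ξ ^ (-η) := c2.trans (by gcongr)
      _ ≤ _ := by gcongr; linarith

end
end SR
end

section

namespace SR

/-- nonconstant monomials -/
abbrev GI (n D : ℕ) : Type := {α : Fin n → Fin (D+1) // α ≠ 0}

/-- total degree of a monomial -/
def wt {n D : ℕ} (α : GI n D) : ℕ := ∑ i, (α.1 i : ℕ)

/-- the universal polynomial mapping -/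
def QQ {n D : ℕ} (y : Fin n → ℝ) : GI n D → ℝ := fun α => ∏ i, y i ^ (α.1 i : ℕ)

lemma one_le_wt {n D : ℕ} (α : GI n D) : 1 ≤ wt α := by
  by_contra h
  apply α.2
  ext i
  have h0 : wt α = 0 := by lia
  unfold wt at h0
  rw [Finset.sum_eq_zero_iff] at h0
  simpa using h0 i (Finset.mem_univ i)

lemma continuous_QQ {n D : ℕ} : Continuous (QQ (n := n) (D := D)) := by
  unfold QQ; fun_prop

/-- kernel hypotheses at scale `2^i` -/
structure KH (n : ℕ) (i : ℤ) (k : (Fin n → ℝ) → ℂ) : Prop where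
  size : ∀ y, ‖k y‖ * ((2:ℝ) ^ i) ^ n ≤ 1
  lip : ∀ y y', ‖k y - k y'‖ * ((2:ℝ) ^ i) ^ (n+1) ≤ ‖y - y'‖
  supp : ∀ y, 4 * (2:ℝ) ^ i < ‖y‖ → k y = 0
  mean : ∫ y, k y = 0

variable {n D : ℕ} {i : ℤ} {k : (Fin n → ℝ) → ℂ}

lemma KH.cont (h : KH n i k) : Continuous k := by
  have hb : (0:ℝ) < (((2:ℝ) ^ i) ^ (n+1))⁻¹ := by positivity
  apply LipschitzWith.continuous (K := NNReal.mk _ hb.le)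
  apply LipschitzWith.of_dist_le_mul
  intro y y'
  rw [dist_eq_norm, dist_eq_norm, NNReal.coe_mk, ← div_eq_inv_mul, le_div_iff₀ (by positivity)]
  exact h.lip y y'

lemma KH.l1 (h : KH n i k) : ∫⁻ y, ‖k y‖ₑ ≤ ENNReal.ofReal (8 ^ n) := by
  have hb : (0:ℝ) < (2:ℝ) ^ i := by positivity
  have hm : MeasurableSet {y : Fin n → ℝ | ‖y‖ ≤ 4 * (2:ℝ) ^ i} := measurableSet_le (by fun_prop) measurable_const
  calc ∫⁻ y, ‖k y‖ₑ ≤ ∫⁻ y, {y : Fin n → ℝ | ‖y‖ ≤ 4 * (2:ℝ) ^ i}.indicator (fun _ => ENNReal.ofReal ((((2:ℝ) ^ i) ^ n)⁻¹)) y := by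
        apply lintegral_mono; intro y
        beta_reduce
        by_cases hy : ‖y‖ ≤ 4 * (2:ℝ) ^ i
        · rw [Set.indicator_of_mem (show y ∈ {y : Fin n → ℝ | ‖y‖ ≤ 4 * (2:ℝ) ^ i} from hy), ← ofReal_norm]
          apply ENNReal.ofReal_le_ofReal
          rw [← one_div, le_div_iff₀ (by positivity)]; exact h.size y
        · simp [h.supp y (not_le.1 hy)]
    _ = ENNReal.ofReal ((((2:ℝ) ^ i) ^ n)⁻¹) * ENNReal.ofReal ((2 * (4 * (2:ℝ)^i)) ^ n) := by
        rw [lintegral_indicator_const hm, volume_ball _ _ (by positivity)]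
    _ = _ := by
        rw [← ENNReal.ofReal_mul (by positivity), ← inv_pow, ← mul_pow]; congr 2; field_simp; norm_num

lemma KH.int (h : KH n i k) : Integrable k :=
  ⟨h.cont.aestronglyMeasurable, h.l1.trans_lt ENNReal.ofReal_lt_top⟩

lemma KH.nint (h : KH n i k) : ∫ y, ‖k y‖ ≤ 8 ^ n := by
  rw [integral_norm_eq_lintegral_enorm h.cont.aestronglyMeasurable]
  exact ENNReal.toReal_le_of_le_ofReal (by positivity) h.l1

lemma QQ_box {y : Fin n → ℝ} (l : ℤ) (hy : ‖y‖ ≤ (2:ℝ) ^ l) : QQ (D := D) y ∈ box wt l 0 := by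
  rw [mem_box_zero]
  intro α
  unfold QQ sc wt
  rw [Finset.abs_prod, zpow_mul, zpow_natCast, ← Finset.prod_pow_eq_pow_sum]
  apply Finset.prod_le_prod (fun i _ => abs_nonneg _)
  intro i _
  rw [abs_pow]
  have : |y i| ≤ (2:ℝ) ^ l := (norm_le_pi_norm y i).trans hy
  gcongr

lemma KH.box (h : KH n i k) (y : Fin n → ℝ) (hy : k y ≠ 0) : QQ (D := D) y ∈ box wt (i+2) 0 := by
  apply QQ_box
  by_contra hc
  apply hy; apply h.supp
  rw [zpow_add₀ two_ne_zero] at hc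
  have : (2:ℝ) ^ (2:ℤ) = 4 := by norm_num
  rw [this] at hc; linarith

lemma mu_rescale (h : KH n i k) (ξ : GI n D → ℝ) :
    mu k QQ ξ = ∫ u, (((((2:ℝ) ^ i) ^ n : ℝ) : ℂ) * k (((2:ℝ)^i) • u)) *
      chi (pol (fun α : Fin n → Fin (D+1) => if h : α = 0 then 0 else sc wt i ⟨α, h⟩ * ξ ⟨α, h⟩) u) := by
  have hb : (0:ℝ) < (2:ℝ) ^ i := by positivity
  have h1 := Measure.integral_comp_smul (volume : Measure (Fin n → ℝ)) (fun y => k y * chi (dotp (QQ y) ξ)) ((2:ℝ)^i)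
  have e : ∀ u, chi (pol (fun α : Fin n → Fin (D+1) => if h : α = 0 then 0 else sc wt i ⟨α, h⟩ * ξ ⟨α, h⟩) u)
      = chi (dotp (QQ (((2:ℝ)^i) • u)) ξ) := by
    intro u; congr 1
    unfold pol dotp
    symm
    apply Fintype.sum_of_injective (Subtype.val : GI n D → (Fin n → Fin (D+1))) Subtype.val_injective
    · intro α hα
      have : α = 0 := by by_contra hc; exact hα ⟨⟨α, hc⟩, rfl⟩
      simp [this]
    · intro α
      beta_reduce
      rw [dif_neg α.2]
      have : QQ (D := D) (((2:ℝ)^i) • u) α = sc wt i α * ∏ j, u j ^ (α.1 j : ℕ) := by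
        unfold QQ sc wt
        simp only [Pi.smul_apply, smul_eq_mul, mul_pow]
        rw [Finset.prod_mul_distrib, Finset.prod_pow_eq_pow_sum, zpow_mul, zpow_natCast]
      rw [this]; ring
  simp_rw [e, mul_assoc]
  rw [integral_const_mul, h1]
  simp only [Module.finrank_fintype_fun_eq_card, Fintype.card_fin]
  rw [abs_of_pos (by positivity)]
  unfold mu
  rw [Complex.real_smul, ← mul_assoc, ← Complex.ofReal_mul, mul_inv_cancel₀ (by positivity)]; simp

lemma KH.mu_high : ∃ C ε : ℝ, 0 < C ∧ 0 < ε ∧ ε ≤ 1 ∧ ∀ (i : ℤ) (k : (Fin n → ℝ) → ℂ), KH n i k → ∀ ξ : GI n D → ℝ,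
    0 < rho wt i ξ → ‖mu k QQ ξ‖ ≤ C * rho wt i ξ ^ (-ε) := by
  obtain ⟨C, ε, hC, hε, hε1, h⟩ := osc_nd 4 (by norm_num) D n
  refine ⟨C * 2, ε, by positivity, hε, hε1, fun i k hk ξ hρ => ?_⟩
  have hb : (0:ℝ) < (2:ℝ) ^ i := by positivity
  obtain ⟨α, hα⟩ : ∃ α, rho wt i ξ / 2 ≤ sc wt i α * |ξ α| := by
    by_contra hc
    push Not at hc
    have : rho wt i ξ ≤ rho wt i ξ / 2 := (rho_le_iff wt (by positivity)).2 fun α => (hc α).le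
    linarith
  rw [mu_rescale hk]
  refine (h _ α.1 (rho wt i ξ / 2) α.2 (by positivity) ?_ _ ?_ ?_ ?_).trans ?_
  · rw [dif_neg α.2, abs_mul, abs_of_pos (sc_pos wt i α)]; exact hα
  · intro y
    rw [norm_mul, Complex.norm_real, Real.norm_of_nonneg (by positivity), mul_comm]
    exact hk.size _
  · intro y y'
    rw [← mul_sub, norm_mul, Complex.norm_real, Real.norm_of_nonneg (by positivity)]
    have := hk.lip (((2:ℝ)^i) • y) (((2:ℝ)^i) • y')
    rw [← smul_sub, norm_smul, Real.norm_of_nonneg hb.le, pow_succ, ← mul_assoc] at this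
    have h2 : (‖k (((2:ℝ)^i) • y) - k (((2:ℝ)^i) • y')‖ * ((2:ℝ) ^ i) ^ n) * 2 ^ i ≤ ‖y - y'‖ * 2 ^ i := by linarith
    rw [mul_comm]; exact le_of_mul_le_mul_right h2 hb
  · intro y hy
    rw [hk.supp, mul_zero]
    rw [norm_smul, Real.norm_of_nonneg hb.le, mul_comm]; gcongr
  · rw [Real.div_rpow hρ.le zero_le_two, Real.rpow_neg zero_le_two, div_inv_eq_mul, mul_assoc, mul_comm 2]
    gcongr
    calc (2:ℝ) ^ ε ≤ 2 ^ (1:ℝ) := Real.rpow_le_rpow_of_exponent_le one_le_two hε1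
      _ = 2 := by norm_num

lemma KH.mu_bb : ∃ C ε : ℝ, 0 < C ∧ 0 < ε ∧ ε ≤ 1 ∧ ∀ (i : ℤ) (k : (Fin n → ℝ) → ℂ), KH n i k → ∀ ξ : GI n D → ℝ,
    ‖mu k QQ ξ‖ ≤ C * bb ε (rho wt i ξ) := by
  obtain ⟨C, ε, hC, hε, hε1, h⟩ := KH.mu_high (n := n) (D := D)
  set W : ℝ := 2 ^ (2 * ∑ α : GI n D, wt α) with hW
  set P := 8 ^ n * (2 * Real.pi * (Fintype.card (GI n D) * W)) with hP
  have hP0 : 0 ≤ P := by positivity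
  refine ⟨C + P, ε, by positivity, hε, hε1, fun i k hk ξ => ?_⟩
  have hρ := rho_nonneg wt i ξ
  apply le_bb hε hε1 (by positivity) hρ
  · have h1 := mu_low wt hk.int continuous_QQ.measurable hk.box ξ
    rw [hk.mean, sub_zero] at h1
    have h2 : rho wt (i+2) ξ ≤ W * rho wt i ξ := rho_add_le wt i 2 ξ
    calc _ ≤ _ := h1
      _ ≤ 8 ^ n * (2 * Real.pi * (Fintype.card (GI n D) * (W * rho wt i ξ))) := by
        have := hk.nint
        have h3 := rho_nonneg wt (i+2) ξ
        gcongr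
      _ = P * rho wt i ξ := by rw [hP]; ring
      _ ≤ _ := by gcongr; linarith
  · intro h1
    refine (h i k hk ξ (by linarith)).trans ?_
    gcongr; linarith

end SR
end

section

namespace SR

lemma l2_enorm {J : Type*} [Fintype J] {β : J → Type*} [∀ j, SeminormedAddCommGroup (β j)] (v : PiLp 2 β) :
    ‖v‖ₑ ^ (2:ℝ) = ∑ j, ‖v j‖ₑ ^ (2:ℝ) := by
  have h := PiLp.norm_sq_eq_of_L2 β v
  rw [← ofReal_norm, ENNReal.ofReal_rpow_of_nonneg (norm_nonneg _) zero_le_two, Real.rpow_two, h,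
    ENNReal.ofReal_sum_of_nonneg (fun i _ => by positivity)]
  refine Finset.sum_congr rfl fun j _ => ?_
  rw [← ofReal_norm, ENNReal.ofReal_rpow_of_nonneg (norm_nonneg _) zero_le_two, Real.rpow_two]

open Classical in
/-- coordinate inclusion -/
def sgl {J : Type} [Fintype J] (H : Type) [NormedAddCommGroup H] [NormedSpace ℂ H] (j : J) : H →L[ℂ] PiLp 2 (fun _ : J => H) :=
  LinearMap.mkContinuous
    { toFun := fun v => PiLp.single 2 j v
      map_add' := fun a b => PiLp.single_add 2 j
      map_smul' := fun c a => by
        ext i; by_cases h : i = j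
        · subst h; simp
        · simp [PiLp.single_eq_of_ne, h] } 1 (fun v => by
      have h := PiLp.norm_sq_eq_of_L2 (fun _ : J => H) (PiLp.single 2 j v)
      rw [Finset.sum_eq_single j (fun b _ hb => by simp [hb]) (by simp)] at h
      simp only [PiLp.single_eq_same] at h
      rw [one_mul]
      exact le_of_eq ((sq_eq_sq₀ (norm_nonneg _) (norm_nonneg _)).1 h))

lemma sgl_norm {J : Type} [Fintype J] (H : Type) [NormedAddCommGroup H] [NormedSpace ℂ H] (j : J) : ‖sgl H j‖ ≤ 1 :=
  LinearMap.mkContinuous_norm_le _ zero_le_one _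

lemma sgl_same {J : Type} [Fintype J] (H : Type) [NormedAddCommGroup H] [NormedSpace ℂ H] (j : J) (v : H) : sgl H j v j = v := by
  classical
  change (PiLp.single 2 j v : PiLp 2 (fun _ : J => H)) j = v
  exact PiLp.single_eq_same (β := fun _ : J => H) 2 j v

lemma sgl_ne {J : Type} [Fintype J] (H : Type) [NormedAddCommGroup H] [NormedSpace ℂ H] {i j : J} (h : i ≠ j) (v : H) : sgl H j v i = 0 := by
  classical
  change (PiLp.single 2 j v : PiLp 2 (fun _ : J => H)) i = 0
  exact PiLp.single_eq_of_ne (β := fun _ : J => H) 2 h v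

section
variable {Γ : Type} [Fintype Γ] (w : Γ → ℕ)

lemma TT_sgl {J : Type} [Fintype J] (H : Type) [NormedAddCommGroup H] [NormedSpace ℂ H] (K : J → (Γ → ℝ) → ℂ)
    (f : (Γ → ℝ) → H) (x : Γ → ℝ) (j : J) : TT Finset.univ (sgl H) K f x j = Op (K j) id f x := by
  unfold TT
  rw [WithLp.ofLp_sum, Finset.sum_apply, Finset.sum_eq_single j (fun b _ hb => sgl_ne H hb.symm _) (by simp), sgl_same]

lemma TT_sgl_enorm {J : Type} [Fintype J] (H : Type) [NormedAddCommGroup H] [NormedSpace ℂ H] (K : J → (Γ → ℝ) → ℂ)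
    (f : (Γ → ℝ) → H) (x : Γ → ℝ) : ‖TT Finset.univ (sgl H) K f x‖ₑ ^ (2:ℝ) = ∑ j, ‖Op (K j) id f x‖ₑ ^ (2:ℝ) := by
  rw [l2_enorm]; simp_rw [TT_sgl]

lemma Nice.shift {V H : Type*} [NormedAddCommGroup V] [MeasureSpace V] [BorelSpace V] [NormedAddCommGroup H]
    [SecondCountableTopology V] [(volume : Measure V).IsAddLeftInvariant] [NormedSpace ℂ H] {f : V → H} (hf : Nice f) (h : V) : Nice (fun x => f (x - h)) := by
  obtain ⟨M, hM⟩ := hf.bdd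
  exact ⟨hf.meas.comp_measurable (measurable_id.sub_const h), ⟨M, fun x => hM _⟩, hf.int.comp_sub_right h⟩

lemma op_diff {E : Type*} [MeasureSpace E] [SFinite (volume : Measure E)] {k : E → ℂ} {Q : E → Γ → ℝ} {d : (Γ → ℝ) → ℂ}
    (hk : Measurable k) (hki : Integrable k) (hQ : Measurable Q) (hd : Nice d) (h : Γ → ℝ) :
    ∫⁻ x, ‖Op k Q d (x - h) - Op k Q d x‖ₑ ≤ (∫⁻ y, ‖k y‖ₑ) * ∫⁻ x, ‖d (x - h) - d x‖ₑ := by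
  have e : ∀ x, Op k Q d (x - h) - Op k Q d x = Op k Q (fun x => d (x - h) - d x) x := by
    intro x
    rw [op_sub hki hQ (hd.shift h) hd]
    congr 1
    unfold Op; congr 1; ext y; rw [sub_right_comm]
  simp_rw [e]
  have := op_young (k := k) (Q := Q) hk hQ ((hd.shift h).sub hd).meas (le_refl (1:ℝ))
  simpa using this

lemma op_supp (hw : ∀ α, 1 ≤ w α) {E : Type*} [MeasureSpace E] {k : E → ℂ} {Q : E → Γ → ℝ} {d : (Γ → ℝ) → ℂ} {M : ℤ}
    (hk : ∀ y, k y ≠ 0 → Q y ∈ box w M 0) (hd : ∀ x, x ∉ box w M 0 → d x = 0) {x : Γ → ℝ} (hx : x ∉ box w (M+1) 0) :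
    Op k Q d x = 0 := by
  unfold Op
  apply integral_eq_zero_of_ae (Filter.Eventually.of_forall fun y => ?_)
  change k y • d (x - Q y) = 0
  by_cases h1 : k y = 0
  · simp [h1]
  rw [hd, smul_zero]
  intro h2
  apply hx
  have h3 := hk y h1
  rw [mem_box_zero] at h2 h3 ⊢
  intro α
  have := two_mul_sc_le w hw M α
  have h4 := h2 α
  have h5 := h3 α
  have e : x α = (x - Q y) α + Q y α := by simp
  rw [e]; exact (abs_add_le _ _).trans (by linarith)

lemma sc_decay (hw : ∀ α, 1 ≤ w α) {l m : ℤ} (h : l ≤ m) (α : Γ) : sc w l α ≤ (1/2) ^ (m - l).natAbs * sc w m α := by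
  obtain ⟨j, rfl⟩ : ∃ j : ℕ, m = l + j := ⟨(m-l).toNat, by lia⟩
  have e : (l + (j:ℤ) - l).natAbs = j := by lia
  rw [e]
  induction j with
  | zero => simp
  | succ j ih =>
    have h1 := ih (by lia) (by lia)
    have h2 := two_mul_sc_le w hw (l + j) α
    have e2 : l + ((j + 1 : ℕ) : ℤ) = l + j + 1 := by push_cast; ring
    rw [e2, pow_succ]
    have : (0:ℝ) < (1/2)^j := by positivity
    nlinarith

end

variable {n D : ℕ}

/-- the frequency-localized pieces -/
def kap (k : ℤ → (Fin n → ℝ) → ℂ) (a i : ℤ) : (GI n D → ℝ) → ℂ := Op (k i) QQ (dk wt (i - a))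

lemma kap_nice {k : ℤ → (Fin n → ℝ) → ℂ} (hk : ∀ i, KH n i (k i)) (a i : ℤ) : Nice (kap (D := D) k a i) :=
  (dk_nice wt one_le_wt (i-a)).op (hk i).cont.measurable (hk i).int continuous_QQ.measurable

lemma kap_hor (n D : ℕ) : ∃ c : ℝ, 0 < c ∧ ∀ k : ℤ → (Fin n → ℝ) → ℂ, (∀ i, KH n i (k i)) → ∀ (a : ℤ) (s : Finset ℤ),
    Hor (wt (n := n) (D := D)) s (kap k a) (ENNReal.ofReal (c * (1 + a.natAbs))) := by
  obtain ⟨G, hG, hg⟩ := geo_sum (1/2) (by norm_num) (by norm_num)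
  have hkc := kc_pos (wt (n := n) (D := D))
  set B : ℝ := 8 ^ n * (2 * kc (wt (n := n) (D := D))) with hB
  have hB0 : 0 < B := by positivity
  refine ⟨B * (5 + G), by positivity, fun k hk a s l h hh => ?_⟩
  set I := Finset.Icc (l - 2 - a.natAbs) (l + a.natAbs + 2) with hI
  have key : ∀ i, ∫⁻ x in {x | x ∉ box wt l 0 ∧ x - h ∉ box wt l 0}, ‖kap (D := D) k a i (x - h) - kap k a i x‖ₑ ≤
      ENNReal.ofReal (B * ((if i ∈ I then 1 else 0) + (1/2) ^ (i - (a + 1 + l)).natAbs)) := by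
    intro i
    rcases le_or_gt (max (i-a) (i+2) + 1) l with hA | hA
    · have : ∫⁻ x in {x | x ∉ box wt l 0 ∧ x - h ∉ box wt l 0}, ‖kap (D := D) k a i (x - h) - kap k a i x‖ₑ
          ≤ ∫⁻ x in {x | x ∉ box (wt (n := n) (D := D)) l 0 ∧ x - h ∉ box wt l 0}, 0 := by
        apply setLIntegral_mono measurable_const
        intro x hx
        have z : ∀ y : GI n D → ℝ, y ∉ box wt l 0 → kap k a i y = 0 := fun y hy =>
          op_supp wt one_le_wt (M := max (i-a) (i+2)) (fun y h => box_mono wt (le_max_right _ _) _ ((hk i).box y h))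
            (fun x hx => dk_supp wt one_le_wt fun h => hx (box_mono wt (le_max_left _ _) _ h))
            (fun h => hy (box_mono wt hA _ h))
        rw [z _ hx.1, z _ hx.2]; simp
      refine this.trans ?_
      simp
    refine (setLIntegral_le_lintegral _ _).trans ((op_diff (hk i).cont.measurable (hk i).int continuous_QQ.measurable
      (dk_nice wt one_le_wt _) h).trans ((mul_le_mul_left (hk i).l1 _).trans ?_))
    have hif : (0:ℝ) ≤ if i ∈ I then 1 else 0 := by split_ifs <;> norm_num
    rcases le_or_gt l (i - a - 1) with hC | hC
    · have := dk_diff wt one_le_wt (i-a) h (t := (1/2) ^ (i - (a + 1 + l)).natAbs) (by positivity) (fun α => by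
        refine ((mem_box_zero wt).1 hh α).trans ?_
        have e : (i - (a+1+l)) = i - a - 1 - l := by ring
        rw [e]
        exact sc_decay wt one_le_wt hC α)
      refine (mul_le_mul_right this _).trans ?_
      rw [← ENNReal.ofReal_mul (by positivity)]
      apply ENNReal.ofReal_le_ofReal
      rw [← mul_assoc, ← hB]
      gcongr; linarith
    · have hi : i ∈ I := by rw [hI, Finset.mem_Icc]; constructor <;> lia
      refine (mul_le_mul_right (dk_diff_four wt one_le_wt (i-a) h) _).trans ?_
      rw [show (4:ℝ≥0∞) = ENNReal.ofReal 4 by simp, ← ENNReal.ofReal_mul (by positivity), if_pos hi]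
      apply ENNReal.ofReal_le_ofReal
      have h1 : (8:ℝ) ^ n * 4 ≤ B := by rw [hB]; gcongr; linarith
      have h2 : (0:ℝ) ≤ (1/2) ^ (i - (a + 1 + l)).natAbs := by positivity
      nlinarith
  refine (Finset.sum_le_sum fun i _ => key i).trans ?_
  have hif : ∀ i, (0:ℝ) ≤ if i ∈ I then 1 else 0 := by intro i; split_ifs <;> norm_num
  rw [← ENNReal.ofReal_sum_of_nonneg (fun i _ => by have := hif i; positivity)]
  apply ENNReal.ofReal_le_ofReal
  rw [← Finset.mul_sum, Finset.sum_add_distrib, mul_assoc B (5 + G)]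
  apply mul_le_mul_of_nonneg_left _ hB0.le
  have h1 := hg s (a+1+l)
  have h2 : ∑ i ∈ s, (if i ∈ I then (1:ℝ) else 0) ≤ 2 * a.natAbs + 5 := by
    rw [Finset.sum_ite_mem, Finset.sum_const, nsmul_eq_mul, mul_one]
    calc ((s ∩ I).card : ℝ) ≤ I.card := by exact_mod_cast Finset.card_le_card Finset.inter_subset_right
      _ = ((2 * a.natAbs + 5 : ℕ) : ℝ) := by congr 1; rw [hI, Int.card_Icc]; lia
      _ = _ := by push_cast; ring
  have h3 : (0:ℝ) ≤ a.natAbs := by positivity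
  nlinarith

lemma kap_mult (n D : ℕ) : ∃ c ε : ℝ, 0 < c ∧ 0 < ε ∧ ∀ k : ℤ → (Fin n → ℝ) → ℂ, (∀ i, KH n i (k i)) → ∀ (a : ℤ) (s : Finset ℤ)
    (ξ : GI n D → ℝ), ∑ i ∈ s, ‖mu (kap k a i) id ξ‖ ≤ c * 2 ^ (-(ε * a.natAbs)) := by
  obtain ⟨C1, ε, hC1, hε, hε1, h1⟩ := KH.mu_bb (n := n) (D := D)
  obtain ⟨C2, hC2, h2⟩ := mu_dk (wt (n := n) (D := D)) one_le_wt ε hε hε1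
  obtain ⟨C3, hC3, h3⟩ := mult_sum (wt (n := n) (D := D)) one_le_wt ε hε
  refine ⟨C1 * C2 * C3, ε / 2, by positivity, by positivity, fun k hk a s ξ => ?_⟩
  calc ∑ i ∈ s, ‖mu (kap k a i) id ξ‖ ≤ ∑ i ∈ s, (C1 * C2) * (bb ε (rho wt i ξ) * bb ε (rho wt (i-a) ξ)) := by
        apply Finset.sum_le_sum; intro i _
        unfold kap
        rw [mu_op (hk i).cont.measurable (hk i).int continuous_QQ.measurable (dk_nice wt one_le_wt _), norm_mul]
        have a1 := h1 i (k i) (hk i) ξ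
        have a2 := h2 (i-a) ξ
        have a3 := bb_nonneg ε (rho_nonneg wt i ξ)
        calc _ ≤ (C1 * bb ε (rho wt i ξ)) * (C2 * bb ε (rho wt (i-a) ξ)) := by gcongr
          _ = _ := by ring
    _ ≤ (C1 * C2) * (C3 * 2 ^ (-(ε / 2 * a.natAbs))) := by
        rw [← Finset.mul_sum]; gcongr; exact h3 ξ s a
    _ = _ := by ring

lemma enorm_sq_rpow {H : Type*} [SeminormedAddCommGroup H] (v : H) (p : ℝ) : ‖v‖ₑ ^ p = (‖v‖ₑ ^ (2:ℝ)) ^ (p/2) := by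
  rw [← ENNReal.rpow_mul]; congr 1; ring

theorem sq_bound [Nonempty (GI n D)] (p : ℝ) (hp : 1 < p) : ∃ C δ : ℝ, 0 < C ∧ 0 < δ ∧
    ∀ k : ℤ → (Fin n → ℝ) → ℂ, (∀ i, KH n i (k i)) → ∀ (a : ℤ) (s : Finset ℤ) (H : Type) [NormedAddCommGroup H]
      [InnerProductSpace ℂ H] [CompleteSpace H] (f : (GI n D → ℝ) → H), Nice f →
      ∫⁻ x, (∑ i ∈ s, ‖Op (kap k a i) id f x‖ₑ ^ (2:ℝ)) ^ (p/2) ≤ ENNReal.ofReal (C * 2 ^ (-(δ * a.natAbs))) * ∫⁻ x, ‖f x‖ₑ ^ p := by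
  obtain ⟨c1, hc1, h1⟩ := kap_hor n D
  obtain ⟨c2, ε, hc2, hε, h2⟩ := kap_mult n D
  obtain ⟨C, δ, hC, hδ, h3⟩ := thmS (wt (n := n) (D := D)) one_le_wt p hp (max c1 c2) ε (by positivity) hε
  refine ⟨C, δ, hC, hδ, fun k hk a s H _ _ _ f hf => ?_⟩
  have key := h3 a.natAbs s H (PiLp 2 (fun _ : s => H)) Finset.univ (sgl H) (fun j : s => kap k a j) (sgl_norm H)
    (fun j _ => kap_nice hk a j) ?_ ?_ f hf
  · refine le_trans (le_of_eq ?_) key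
    congr 1; ext x
    rw [enorm_sq_rpow, TT_sgl_enorm, Finset.sum_coe_sort s (fun i => ‖Op (kap k a i) id f x‖ₑ ^ (2:ℝ))]
  · intro l h hh
    rw [Finset.sum_coe_sort s (fun i => ∫⁻ x in {x | x ∉ box (wt (n := n) (D := D)) l 0 ∧ x - h ∉ box wt l 0}, ‖kap k a i (x - h) - kap k a i x‖ₑ)]
    refine (h1 k hk a s l h hh).trans (ENNReal.ofReal_le_ofReal ?_)
    gcongr; exact le_max_left _ _
  · intro f hf
    simp_rw [TT_sgl_enorm]
    rw [lintegral_finsetSum' _ (fun i _ => ?_)]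
    · refine l2_square (Finset.univ : Finset s) (k := fun j : s => kap k a j) (Q := id) (fun j _ => (kap_nice hk a j).meas.measurable) (fun j _ => (kap_nice hk a j).int) measurable_id hf (fun ξ => ?_)
      rw [Finset.sum_coe_sort s (fun i => ‖mu (kap k a i) id ξ‖)]
      refine (h2 k hk a s ξ).trans ?_
      gcongr; exact le_max_right _ _
    · exact ((hf.op (kap_nice hk a i).meas.measurable (kap_nice hk a i).int measurable_id).meas.enorm.pow_const _).aemeasurable

theorem lin_bound [Nonempty (GI n D)] (p : ℝ) (hp : 1 < p) : ∃ C δ : ℝ, 0 < C ∧ 0 < δ ∧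
    ∀ k : ℤ → (Fin n → ℝ) → ℂ, (∀ i, KH n i (k i)) → ∀ (a : ℤ) (s : Finset ℤ) (H : Type) [NormedAddCommGroup H]
      [InnerProductSpace ℂ H] [CompleteSpace H] (f : (GI n D → ℝ) → H), Nice f →
      ∫⁻ x, ‖∑ i ∈ s, Op (kap k a i) id f x‖ₑ ^ p ≤ ENNReal.ofReal (C * 2 ^ (-(δ * a.natAbs))) * ∫⁻ x, ‖f x‖ₑ ^ p := by
  obtain ⟨c1, hc1, h1⟩ := kap_hor n D
  obtain ⟨c2, ε, hc2, hε, h2⟩ := kap_mult n D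
  obtain ⟨C, δ, hC, hδ, h3⟩ := thmS (wt (n := n) (D := D)) one_le_wt p hp (max c1 c2) ε (by positivity) hε
  refine ⟨C, δ, hC, hδ, fun k hk a s H _ _ _ f hf => ?_⟩
  refine h3 a.natAbs ℤ H H s (fun _ => ContinuousLinearMap.id ℂ H) (kap k a) (fun _ => ContinuousLinearMap.norm_id_le)
    (fun j _ => kap_nice hk a j) ?_ ?_ f hf
  · intro l h hh
    refine (h1 k hk a s l h hh).trans (ENNReal.ofReal_le_ofReal ?_)
    gcongr; exact le_max_left _ _
  · intro f hf
    have e : ∀ x, TT s (fun _ => ContinuousLinearMap.id ℂ H) (kap k a) f x = Op (fun y => ∑ i ∈ s, kap k a i y) id f x := by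
      intro x
      rw [op_ksum (fun i _ => (kap_nice hk a i).int) measurable_id hf]; rfl
    simp_rw [e]
    have hn : Nice (fun y => ∑ i ∈ s, kap (D := D) k a i y) := Nice.sum fun i _ => kap_nice hk a i
    have := l2_square {()} (k := fun _ => fun y => ∑ i ∈ s, kap k a i y) (Q := id) (f := f)
      (fun j _ => hn.meas.measurable) (fun j _ => hn.int) measurable_id hf (C := max c1 c2 * 2 ^ (-(ε * a.natAbs))) (fun ξ => ?_)
    · simpa using this
    · rw [Finset.sum_singleton]
      have e : mu (fun y => ∑ i ∈ s, kap k a i y) id ξ = ∑ i ∈ s, mu (kap k a i) id ξ := by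
        unfold mu
        rw [← integral_finsetSum]
        · congr 1; ext y; rw [Finset.sum_mul]
        · intro i _
          simpa [mul_comm] using chi_smul_integrable (kap_nice hk a i).int measurable_id ξ
      rw [e]
      refine (norm_sum_le _ _).trans ((h2 k hk a s ξ).trans ?_)
      gcongr; exact le_max_right _ _

end SR
end

section

namespace SR
section
variable {Γ : Type} [Fintype Γ] (w : Γ → ℕ)

lemma sk_hor (hw : ∀ α, 1 ≤ w α) : ∃ c : ℝ, 0 < c ∧ ∀ s : Finset ℤ, Hor w s (sk w) (ENNReal.ofReal c) := by
  obtain ⟨G, hG, hg⟩ := geo_sum (1/2) (by norm_num) (by norm_num)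
  have hkc := kc_pos w
  refine ⟨kc w * G, by positivity, fun s l h hh => ?_⟩
  have key : ∀ i, ∫⁻ x in {x | x ∉ box w l 0 ∧ x - h ∉ box w l 0}, ‖sk w i (x - h) - sk w i x‖ₑ ≤
      ENNReal.ofReal (kc w * (1/2) ^ (i - l).natAbs) := by
    intro i
    rcases le_or_gt i l with hA | hA
    · have : ∫⁻ x in {x | x ∉ box w l 0 ∧ x - h ∉ box w l 0}, ‖sk w i (x - h) - sk w i x‖ₑ
          ≤ ∫⁻ x in {x | x ∉ box w l 0 ∧ x - h ∉ box w l 0}, 0 := by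
        apply setLIntegral_mono measurable_const
        intro x hx
        rw [sk_supp w (fun h => hx.1 (box_mono w hA _ h)), sk_supp w (fun h => hx.2 (box_mono w hA _ h))]; simp
      refine this.trans ?_
      simp
    refine (setLIntegral_le_lintegral _ _).trans (sk_diff w hw i h (by positivity) (fun α => ?_))
    exact ((mem_box_zero w).1 hh α).trans (sc_decay w hw hA.le α)
  refine (Finset.sum_le_sum fun i _ => key i).trans ?_
  rw [← ENNReal.ofReal_sum_of_nonneg (fun i _ => by positivity)]
  apply ENNReal.ofReal_le_ofReal
  rw [← Finset.mul_sum]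
  gcongr; exact hg s l

/-- maximal function over finitely many scales -/
def fsup {ι : Type} [Fintype ι] (J : Finset ℤ) (f : (Γ → ℝ) → EuclideanSpace ℂ ι) (t : ι) (x : Γ → ℝ) : ℝ≥0∞ :=
  ⨆ l ∈ J, ‖Op (sk w l) id f x t‖ₑ

lemma op_coord {ι : Type} [Fintype ι] {E V : Type*} [MeasureSpace E] [SFinite (volume : Measure E)]
    [NormedAddCommGroup V] [MeasureSpace V] [BorelSpace V]
    [SecondCountableTopology V] [SFinite (volume : Measure V)]
    [(volume : Measure V).IsAddLeftInvariant] {k : E → ℂ} {Q : E → V} {f : V → EuclideanSpace ℂ ι} (hki : Integrable k)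
    (hQ : Measurable Q) (hf : Nice f) (t : ι) (x : V) : Op k Q f x t = Op k Q (fun x => f x t) x :=
  (op_clm hki hQ hf (EuclideanSpace.proj t : EuclideanSpace ℂ ι →L[ℂ] ℂ) x).symm

lemma Nice.coord {ι : Type} [Fintype ι] {X : Type*} [MeasureSpace X] {f : X → EuclideanSpace ℂ ι} (hf : Nice f) (t : ι) :
    Nice (fun x => f x t) := hf.clm (EuclideanSpace.proj t : EuclideanSpace ℂ ι →L[ℂ] ℂ)

lemma fsup_le (hw : ∀ α, 1 ≤ w α) {ι : Type} [Fintype ι] (J : Finset ℤ) {f : (Γ → ℝ) → EuclideanSpace ℂ ι} (hf : Nice f) (t : ι)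
    (x : Γ → ℝ) : fsup w J f t x ≤ 2 * vl w 1 * mx w (fun y => ‖f y t‖ₑ) x := by
  unfold fsup
  refine iSup₂_le fun l _ => ?_
  rw [op_coord (sk_nice w hw l).int measurable_id hf]
  exact op_sk_le_mx w hw l _ x

lemma fsup_meas (hw : ∀ α, 1 ≤ w α) {ι : Type} [Fintype ι] (J : Finset ℤ) {f : (Γ → ℝ) → EuclideanSpace ℂ ι} (hf : Nice f) (t : ι) :
    Measurable (fsup w J f t) := by
  unfold fsup
  exact Measurable.biSup _ (Finset.countable_toSet J) fun l _ =>
    (((hf.op (sk_nice w hw l).meas.measurable (sk_nice w hw l).int measurable_id).coord t).meas.enorm)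

lemma vl_one_ne_top : vl w 1 ≠ ∞ := by
  unfold vl; exact ENNReal.prod_ne_top fun _ _ => ENNReal.ofReal_ne_top

/-- weighted bound at exponent two -/
lemma fs_weight [Nonempty Γ] (hw : ∀ α, 1 ≤ w α) : ∃ C : ℝ≥0∞, C ≠ ∞ ∧ ∀ (ι : Type) [Fintype ι] (J : Finset ℤ)
    (f : (Γ → ℝ) → EuclideanSpace ℂ ι), Nice f → ∀ u : (Γ → ℝ) → ℝ≥0∞, Measurable u →
    ∫⁻ x, u x * ∑ t, fsup w J f t x ^ (2:ℝ) ≤ C * ∫⁻ x, mx w u x * ‖f x‖ₑ ^ (2:ℝ) := by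
  obtain ⟨C, hC, h⟩ := mx_strong w hw 2 (by norm_num)
  have hv := vl_one_ne_top w
  refine ⟨(2 * vl w 1) ^ (2:ℝ) * C, ENNReal.mul_ne_top (ENNReal.rpow_ne_top_of_nonneg (by norm_num) (ENNReal.mul_ne_top (by simp) hv)) hC,
    fun ι _ J f hf u hu => ?_⟩
  have hfm : ∀ t, Measurable fun y => ‖f y t‖ₑ := fun t => (hf.coord t).meas.enorm
  calc ∫⁻ x, u x * ∑ t, fsup w J f t x ^ (2:ℝ)
      ≤ ∫⁻ x, (2 * vl w 1) ^ (2:ℝ) * ∑ t, u x * mx w (fun y => ‖f y t‖ₑ) x ^ (2:ℝ) := by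
        apply lintegral_mono; intro x; beta_reduce
        rw [← Finset.mul_sum, mul_left_comm]
        refine mul_le_mul' le_rfl ?_
        rw [Finset.mul_sum]
        refine Finset.sum_le_sum fun t _ => ?_
        rw [← ENNReal.mul_rpow_of_nonneg _ _ (by norm_num)]
        exact ENNReal.rpow_le_rpow (fsup_le w hw J hf t x) (by norm_num)
    _ = (2 * vl w 1) ^ (2:ℝ) * ∑ t, ∫⁻ x, u x * mx w (fun y => ‖f y t‖ₑ) x ^ (2:ℝ) := by
        have hm : ∀ t, Measurable fun x => u x * mx w (fun y => ‖f y t‖ₑ) x ^ (2:ℝ) := fun t =>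
          hu.mul ((measurable_mx w _ (hfm t)).pow_const _)
        rw [lintegral_const_mul _ (Finset.measurable_fun_sum _ fun t _ => hm t), lintegral_finsetSum _ fun t _ => hm t]
    _ ≤ (2 * vl w 1) ^ (2:ℝ) * ∑ t, C * ∫⁻ x, mx w u x * ‖f x t‖ₑ ^ (2:ℝ) := by
        refine mul_le_mul' le_rfl (Finset.sum_le_sum fun t _ => ?_)
        exact h _ u (hf.coord t).int.2.ne (hfm t) hu
    _ = _ := by
        have hm' : ∀ t ∈ (Finset.univ : Finset ι), Measurable fun x => mx w u x * ‖f x t‖ₑ ^ (2:ℝ) := fun t _ =>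
          (measurable_mx w _ hu).mul ((hfm t).pow_const _)
        rw [← Finset.mul_sum, ← lintegral_finsetSum _ hm', mul_assoc]
        congr 2
        congr 1; ext x
        rw [l2_enorm, Finset.mul_sum]

lemma fs_two [Nonempty Γ] (hw : ∀ α, 1 ≤ w α) : ∃ C : ℝ≥0∞, C ≠ ∞ ∧ ∀ (ι : Type) [Fintype ι] (J : Finset ℤ)
    (f : (Γ → ℝ) → EuclideanSpace ℂ ι), Nice f →
    ∫⁻ x, ∑ t, fsup w J f t x ^ (2:ℝ) ≤ C * ∫⁻ x, ‖f x‖ₑ ^ (2:ℝ) := by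
  obtain ⟨C, hC, h⟩ := fs_weight w hw
  refine ⟨C * 2 ^ Fintype.card Γ, ENNReal.mul_ne_top hC (by simp), fun ι _ J f hf => ?_⟩
  have := h ι J f hf (fun _ => 1) measurable_const
  simp only [one_mul] at this
  refine this.trans ?_
  rw [mul_assoc, ← lintegral_const_mul _ (hf.meas.enorm.pow_const _)]
  refine mul_le_mul' le_rfl (lintegral_mono fun x => ?_)
  exact mul_le_mul' (mx_one_le w x) le_rfl

lemma pi_enorm_eq (J : Finset ℤ) (g : ℤ → ℂ) : ‖(fun l : J => g l)‖ₑ = ⨆ l ∈ J, ‖g l‖ₑ := by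
  apply le_antisymm
  · by_cases hJ : (⨆ l ∈ J, ‖g l‖ₑ) = ∞
    · rw [hJ]; exact le_top
    rw [← ENNReal.ofReal_toReal hJ, ← ofReal_norm]
    apply ENNReal.ofReal_le_ofReal
    rw [pi_norm_le_iff_of_nonneg ENNReal.toReal_nonneg]
    intro l
    rw [← toReal_enorm]
    exact ENNReal.toReal_mono hJ (le_iSup₂_of_le (l:ℤ) l.2 le_rfl)
  · refine iSup₂_le fun l hl => ?_
    rw [← ofReal_norm, ← ofReal_norm]
    exact ENNReal.ofReal_le_ofReal (norm_le_pi_norm (fun l : J => g l) ⟨l, hl⟩)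

open Classical in
/-- inclusion of coordinate `l` in the sup-valued space -/
def inc (ι : Type) [Fintype ι] (J : Finset ℤ) (l : ℤ) : EuclideanSpace ℂ ι →L[ℂ] PiLp 2 (fun _ : ι => (J → ℂ)) :=
  LinearMap.mkContinuous
    { toFun := fun v => WithLp.toLp 2 (fun t => fun m : J => if (m:ℤ) = l then v t else 0)
      map_add' := fun a b => by
        ext t m; by_cases h : (m:ℤ) = l <;> simp [h]
      map_smul' := fun c a => by
        ext t m; by_cases h : (m:ℤ) = l <;> simp [h] } 1 (fun v => by
      have h := PiLp.norm_sq_eq_of_L2 (fun _ : ι => (J → ℂ)) (WithLp.toLp 2 (fun t => fun m : J => if (m:ℤ) = l then v t else 0))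
      have h2 := PiLp.norm_sq_eq_of_L2 (fun _ : ι => ℂ) v
      rw [one_mul]
      refine (sq_le_sq₀ (norm_nonneg _) (norm_nonneg _)).1 ?_
      erw [h, h2]
      refine Finset.sum_le_sum fun t _ => ?_
      gcongr
      rw [pi_norm_le_iff_of_nonneg (norm_nonneg _)]
      intro m
      dsimp
      split_ifs <;> simp)

lemma inc_norm (ι : Type) [Fintype ι] (J : Finset ℤ) (l : ℤ) : ‖inc ι J l‖ ≤ 1 :=
  LinearMap.mkContinuous_norm_le _ zero_le_one _

open Classical in
lemma inc_apply (ι : Type) [Fintype ι] (J : Finset ℤ) (l : ℤ) (v : EuclideanSpace ℂ ι) (t : ι) (m : J) :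
    inc ι J l v t m = if (m:ℤ) = l then v t else 0 := rfl

lemma TT_inc {ι : Type} [Fintype ι] (J : Finset ℤ) (f : (Γ → ℝ) → EuclideanSpace ℂ ι) (x : Γ → ℝ) (t : ι) :
    TT J (inc ι J) (sk w) f x t = fun l : J => Op (sk w l) id f x t := by
  classical
  ext m
  unfold TT
  rw [WithLp.ofLp_sum, Finset.sum_apply, Finset.sum_apply]
  simp_rw [inc_apply]
  rw [Finset.sum_ite_eq, if_pos m.2]

lemma TT_inc_enorm {ι : Type} [Fintype ι] (J : Finset ℤ) (f : (Γ → ℝ) → EuclideanSpace ℂ ι) (x : Γ → ℝ) :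
    ‖TT J (inc ι J) (sk w) f x‖ₑ ^ (2:ℝ) = ∑ t, fsup w J f t x ^ (2:ℝ) := by
  rw [l2_enorm]
  refine Finset.sum_congr rfl fun t _ => ?_
  rw [TT_inc, pi_enorm_eq J (fun l => Op (sk w l) id f x t)]; rfl

lemma fs_lt [Nonempty Γ] (hw : ∀ α, 1 ≤ w α) (p : ℝ) (hp : 1 < p) (hp2 : p < 2) : ∃ C : ℝ≥0∞, C ≠ ∞ ∧ ∀ (ι : Type) [Fintype ι] (J : Finset ℤ)
    (f : (Γ → ℝ) → EuclideanSpace ℂ ι), Nice f →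
    ∫⁻ x, (∑ t, fsup w J f t x ^ (2:ℝ)) ^ (p/2) ≤ C * ∫⁻ x, ‖f x‖ₑ ^ p := by
  obtain ⟨C2, hC2, h2⟩ := fs_two w hw
  obtain ⟨c1, hc1, h1⟩ := sk_hor w hw
  set c := max c1 (1 + C2.toReal) with hc
  have hc0 : 0 < c := lt_max_of_lt_left hc1
  obtain ⟨C, δ, hC, hδ, h⟩ := thmS_lt w hw p hp hp2 c 1 hc0 one_pos
  refine ⟨ENNReal.ofReal (C * 2 ^ (-(δ * (0:ℕ)))), ENNReal.ofReal_ne_top, fun ι _ J f hf => ?_⟩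
  have key := h 0 ℤ (EuclideanSpace ℂ ι) (PiLp 2 (fun _ : ι => (J → ℂ))) J (inc ι J) (sk w) (inc_norm ι J) (fun l _ => sk_nice w hw l)
    ?_ ?_ f hf
  · refine le_trans (le_of_eq ?_) key
    congr 1; ext x
    rw [enorm_sq_rpow, TT_inc_enorm]
  · intro l h hh
    refine (h1 J l h hh).trans (ENNReal.ofReal_le_ofReal ?_)
    simp [hc]
  · intro f hf
    simp_rw [TT_inc_enorm]
    refine (h2 ι J f hf).trans (mul_le_mul' ?_ le_rfl)
    have : (1:ℝ) + C2.toReal ≤ c := le_max_right _ _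
    have h0 : (0:ℝ) ≤ C2.toReal := ENNReal.toReal_nonneg
    simp only [Nat.cast_zero, mul_zero, neg_zero, Real.rpow_zero, mul_one]
    rw [ENNReal.ofReal_rpow_of_nonneg hc0.le (by norm_num), Real.rpow_two, ← ENNReal.ofReal_toReal hC2]
    apply ENNReal.ofReal_le_ofReal
    nlinarith

lemma fs_gt [Nonempty Γ] (hw : ∀ α, 1 ≤ w α) (p : ℝ) (hp2 : 2 < p) : ∃ C : ℝ≥0∞, C ≠ ∞ ∧ ∀ (ι : Type) [Fintype ι] (J : Finset ℤ)
    (f : (Γ → ℝ) → EuclideanSpace ℂ ι), Nice f →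
    ∫⁻ x, (∑ t, fsup w J f t x ^ (2:ℝ)) ^ (p/2) ≤ C * ∫⁻ x, ‖f x‖ₑ ^ p := by
  set r := p / 2 with hr
  have hr1 : 1 < r := by rw [hr]; linarith
  set q := r / (r - 1) with hq
  have hrq : r.HolderConjugate q := Real.HolderConjugate.conjExponent hr1
  obtain ⟨C1, hC1, h1⟩ := fs_weight w hw
  obtain ⟨C2, hC2, h2⟩ := mx_lp w hw q hrq.symm.lt
  set B := C1 * C2 ^ (1/q) with hB
  have hq0 : 0 < q := hrq.symm.pos
  have hBt : B ≠ ∞ := ENNReal.mul_ne_top hC1 (ENNReal.rpow_ne_top_of_nonneg (by positivity) hC2)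
  refine ⟨B ^ r, ENNReal.rpow_ne_top_of_nonneg (by linarith) hBt, fun ι _ J f hf => ?_⟩
  set G : (Γ → ℝ) → ℝ≥0∞ := fun x => ∑ t, fsup w J f t x ^ (2:ℝ) with hG
  have hGm : Measurable G := Finset.measurable_fun_sum _ fun t _ => (fsup_meas w hw J hf t).pow_const _
  obtain ⟨M, hM⟩ : ∃ M : ℝ≥0, ∀ x, G x ≤ M := by
    have : ∀ t, ∃ M : ℝ≥0, ∀ x, fsup w J f t x ^ (2:ℝ) ≤ M := by
      intro t
      have : ∀ l, ∃ M : ℝ≥0, ∀ x, ‖Op (sk w l) id f x t‖ₑ ≤ M := by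
        intro l
        obtain ⟨M, hM⟩ := ((hf.op (sk_nice w hw l).meas.measurable (sk_nice w hw l).int measurable_id).coord t).bdd
        refine ⟨M.toNNReal, fun x => ?_⟩
        rw [← ofReal_norm]; exact ENNReal.ofReal_le_ofReal (hM x)
      choose M hM using this
      refine ⟨(∑ l ∈ J, M l)^(2:ℝ), fun x => ?_⟩
      rw [ENNReal.coe_rpow_of_nonneg _ (by norm_num)]
      refine ENNReal.rpow_le_rpow (iSup₂_le fun l hl => (hM l x).trans ?_) (by norm_num)
      exact_mod_cast Finset.single_le_sum (f := M) (fun _ _ => zero_le) hl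
    choose M hM using this
    refine ⟨∑ t, M t, fun x => ?_⟩
    push_cast
    exact Finset.sum_le_sum fun t _ => hM t x
  have key : ∀ N : ℕ, ∫⁻ x in Metric.closedBall 0 N, G x ^ r ≤ B ^ r * ∫⁻ x, ‖f x‖ₑ ^ p := by
    intro N
    set S := Metric.closedBall (0 : Γ → ℝ) N with hS
    have hSm : MeasurableSet S := measurableSet_closedBall
    have hSv : volume S ≠ ∞ := measure_closedBall_lt_top.ne
    set X := ∫⁻ x in S, G x ^ r with hX
    have hXt : X ≠ ∞ := by
      refine ne_top_of_le_ne_top (b := (M:ℝ≥0∞) ^ r * volume S) ?_ ?_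
      · exact ENNReal.mul_ne_top (ENNReal.rpow_ne_top_of_nonneg (by linarith) (by simp)) hSv
      · rw [← setLIntegral_const]
        exact lintegral_mono fun x => ENNReal.rpow_le_rpow (hM x) (by linarith)
    set u : (Γ → ℝ) → ℝ≥0∞ := S.indicator (fun x => G x ^ (r-1)) with hu
    have hum : Measurable u := (hGm.pow_const _).indicator hSm
    have hui : ∫⁻ x, u x ≠ ∞ := by
      rw [hu, lintegral_indicator hSm]
      refine ne_top_of_le_ne_top (b := (M:ℝ≥0∞) ^ (r-1) * volume S) ?_ ?_
      · exact ENNReal.mul_ne_top (ENNReal.rpow_ne_top_of_nonneg (by linarith) (by simp)) hSv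
      · rw [← setLIntegral_const]
        exact lintegral_mono fun x => ENNReal.rpow_le_rpow (hM x) (by linarith)
    have huq : ∫⁻ x, u x ^ q = X := by
      rw [hX, ← lintegral_indicator hSm]
      congr 1; ext x
      by_cases hx : x ∈ S
      · rw [hu, Set.indicator_of_mem hx, Set.indicator_of_mem hx, ← ENNReal.rpow_mul]
        congr 1; rw [hq]; have : r - 1 ≠ 0 := by linarith
        field_simp
      · rw [hu, Set.indicator_of_notMem hx, Set.indicator_of_notMem hx, ENNReal.zero_rpow_of_pos hq0]
    have e1 : X = ∫⁻ x, u x * G x := by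
      rw [hX, ← lintegral_indicator hSm]
      congr 1; ext x
      by_cases hx : x ∈ S
      · rw [hu, Set.indicator_of_mem hx, Set.indicator_of_mem hx]
        conv_rhs => rw [← ENNReal.rpow_one (G x), ← ENNReal.rpow_mul, one_mul]
        rw [← ENNReal.rpow_add_of_nonneg _ _ (by linarith) (by linarith)]
        congr 1; ring
      · rw [hu, Set.indicator_of_notMem hx, Set.indicator_of_notMem hx, zero_mul]
    have e2 : X ≤ B * X ^ (1/q) * (∫⁻ x, ‖f x‖ₑ ^ p) ^ (1/r) := by
      calc X = ∫⁻ x, u x * G x := e1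
        _ ≤ C1 * ∫⁻ x, mx w u x * ‖f x‖ₑ ^ (2:ℝ) := h1 ι J f hf u hum
        _ ≤ C1 * ((∫⁻ x, mx w u x ^ q) ^ (1/q) * (∫⁻ x, (‖f x‖ₑ ^ (2:ℝ)) ^ r) ^ (1/r)) := by
            refine mul_le_mul' le_rfl ?_
            exact ENNReal.lintegral_mul_le_Lp_mul_Lq volume hrq.symm (measurable_mx w _ hum).aemeasurable (hf.meas.enorm.pow_const _).aemeasurable
        _ ≤ C1 * ((C2 * X) ^ (1/q) * (∫⁻ x, ‖f x‖ₑ ^ p) ^ (1/r)) := by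
            refine mul_le_mul' le_rfl (mul_le_mul' (ENNReal.rpow_le_rpow ?_ (by positivity)) (le_of_eq ?_))
            · rw [← huq]; exact h2 u hui hum
            · simp_rw [← ENNReal.rpow_mul, hr]
              congr 3; ext x; congr 1; ring
        _ = _ := by
            rw [ENNReal.mul_rpow_of_nonneg _ _ (by positivity), hB]; ring
    rcases eq_or_ne X 0 with h0 | h0
    · rw [h0]; exact zero_le
    have hr0 : 0 < r := by linarith
    have e3 : X ^ (1/r) ≤ B * (∫⁻ x, ‖f x‖ₑ ^ p) ^ (1/r) := by
      have hs : X = X ^ (1/r) * X ^ (1/q) := by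
        rw [← ENNReal.rpow_add _ _ h0 hXt, one_div, one_div, hrq.inv_add_inv_eq_one, ENNReal.rpow_one]
      have hx0 : X ^ (1/q) ≠ 0 := by simp [h0, hXt, ENNReal.rpow_eq_zero_iff]
      have hxt : X ^ (1/q) ≠ ∞ := ENNReal.rpow_ne_top_of_nonneg (by positivity) hXt
      refine (ENNReal.mul_le_mul_iff_left hx0 hxt).1 ?_
      rw [← hs]
      refine e2.trans (le_of_eq ?_); ring
    calc X = (X ^ (1/r)) ^ r := by rw [← ENNReal.rpow_mul]; simp [hr0.ne']
      _ ≤ (B * (∫⁻ x, ‖f x‖ₑ ^ p) ^ (1/r)) ^ r := ENNReal.rpow_le_rpow e3 hr0.le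
      _ = _ := by rw [ENNReal.mul_rpow_of_nonneg _ _ hr0.le, ← ENNReal.rpow_mul]; simp [hr0.ne']
  have hun : (⋃ N : ℕ, Metric.closedBall (0 : Γ → ℝ) N) = Set.univ := by
    rw [Set.eq_univ_iff_forall]; intro x
    obtain ⟨N, hN⟩ := exists_nat_ge ‖x‖
    exact Set.mem_iUnion.2 ⟨N, by simpa using hN⟩
  rw [← setLIntegral_univ, ← hun, setLIntegral_iUnion_of_directed]
  · exact iSup_le key
  · exact Monotone.directed_le fun a b h => Metric.closedBall_subset_closedBall (by exact_mod_cast h)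

theorem fs [Nonempty Γ] (hw : ∀ α, 1 ≤ w α) (p : ℝ) (hp : 1 < p) : ∃ C : ℝ≥0∞, C ≠ ∞ ∧ ∀ (ι : Type) [Fintype ι] (J : Finset ℤ)
    (f : (Γ → ℝ) → EuclideanSpace ℂ ι), Nice f →
    ∫⁻ x, (∑ t, fsup w J f t x ^ (2:ℝ)) ^ (p/2) ≤ C * ∫⁻ x, ‖f x‖ₑ ^ p := by
  rcases lt_trichotomy p 2 with h | h | h
  · exact fs_lt w hw p hp h
  · subst h; simpa using fs_two w hw
  · exact fs_gt w hw p h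
end
end SR
end

section

namespace SR

/-- mixed norm -/
def NN {X ι : Type*} [MeasureSpace X] [Fintype ι] (p : ℝ) (F : ι → X → ℝ≥0∞) : ℝ≥0∞ :=
  (∫⁻ x, ((∑ t, F t x ^ (2:ℝ)) ^ ((1:ℝ)/2)) ^ p) ^ (1/p)

/-- Lebesgue norm -/
def lpn {X H : Type*} [MeasureSpace X] [NormedAddCommGroup H] (p : ℝ) (f : X → H) : ℝ≥0∞ := (∫⁻ x, ‖f x‖ₑ ^ p) ^ (1/p)

section
variable {X ι : Type*} [MeasureSpace X] [Fintype ι] {p : ℝ}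

lemma NN_mono (hp : 1 ≤ p) {F G : ι → X → ℝ≥0∞} (h : ∀ t x, F t x ≤ G t x) : NN p F ≤ NN p G := by
  unfold NN
  have : 0 ≤ p := by linarith
  gcongr with x t
  exact h t x

lemma l2_meas {F : ι → X → ℝ≥0∞} (hF : ∀ t, Measurable (F t)) : Measurable fun x => (∑ t, F t x ^ (2:ℝ)) ^ ((1:ℝ)/2) :=
  (Finset.measurable_fun_sum _ fun t _ => (hF t).pow_const _).pow_const _

lemma NN_add (hp : 1 ≤ p) {F G : ι → X → ℝ≥0∞} (hF : ∀ t, Measurable (F t)) (hG : ∀ t, Measurable (G t)) :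
    NN p (fun t x => F t x + G t x) ≤ NN p F + NN p G := by
  have h0 : 0 ≤ p := by linarith
  refine le_trans ?_ (ENNReal.lintegral_Lp_add_le (l2_meas hF).aemeasurable (l2_meas hG).aemeasurable hp)
  unfold NN
  gcongr with x
  exact ENNReal.Lp_add_le _ _ _ (by norm_num)

lemma NN_zero (hp : 1 ≤ p) : NN p (fun (_ : ι) (_ : X) => (0:ℝ≥0∞)) = 0 := by
  have h0 : 0 < p := by linarith
  unfold NN
  simp [h0, h0.ne']

lemma NN_sum (hp : 1 ≤ p) {A : Type*} (s : Finset A) {F : A → ι → X → ℝ≥0∞} (hF : ∀ a t, Measurable (F a t)) :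
    NN p (fun t x => ∑ a ∈ s, F a t x) ≤ ∑ a ∈ s, NN p (F a) := by
  classical
  induction s using Finset.induction_on with
  | empty => simp [NN_zero hp]
  | insert a s ha ih =>
    simp_rw [Finset.sum_insert ha]
    exact (NN_add hp (hF a) (fun t => Finset.measurable_fun_sum _ fun b _ => hF b t)).trans (add_le_add le_rfl ih)

lemma NN_mul (hp : 1 ≤ p) (c : ℝ≥0∞) {F : ι → X → ℝ≥0∞} (hF : ∀ t, Measurable (F t)) :
    NN p (fun t x => c * F t x) = c * NN p F := by
  have h0 : 0 < p := by linarith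
  have e : ∀ x, ((∑ t, (c * F t x) ^ (2:ℝ)) ^ ((1:ℝ)/2)) ^ p = c ^ p * ((∑ t, F t x ^ (2:ℝ)) ^ ((1:ℝ)/2)) ^ p := by
    intro x
    simp_rw [ENNReal.mul_rpow_of_nonneg _ _ (zero_le_two : (0:ℝ) ≤ 2)]
    rw [← Finset.mul_sum, ENNReal.mul_rpow_of_nonneg _ _ (by norm_num), ENNReal.mul_rpow_of_nonneg _ _ h0.le, ← ENNReal.rpow_mul c]
    norm_num
  unfold NN
  simp_rw [e]
  rw [lintegral_const_mul _ ((l2_meas hF).pow_const _), ENNReal.mul_rpow_of_nonneg _ _ (by positivity), ← ENNReal.rpow_mul]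
  simp [h0.ne']

lemma NN_eq (p : ℝ) (F : ι → X → ℝ≥0∞) : NN p F = (∫⁻ x, (∑ t, F t x ^ (2:ℝ)) ^ (p/2)) ^ (1/p) := by
  unfold NN
  simp_rw [← ENNReal.rpow_mul]
  congr 3; ext x; congr 1; ring

lemma NN_vec (f : X → EuclideanSpace ℂ ι) : NN p (fun t x => ‖f x t‖ₑ) = lpn p f := by
  rw [NN_eq]; unfold lpn
  congr 2; ext x
  rw [enorm_sq_rpow, l2_enorm]

variable {H : Type*} [NormedAddCommGroup H] [NormedSpace ℂ H]

lemma lpn_add (hp : 1 ≤ p) {f g : X → H} (hf : Nice f) (hg : Nice g) : lpn p (fun x => f x + g x) ≤ lpn p f + lpn p g := by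
  have h0 : 0 ≤ p := by linarith
  refine le_trans ?_ (ENNReal.lintegral_Lp_add_le hf.meas.enorm.aemeasurable hg.meas.enorm.aemeasurable hp)
  unfold lpn
  gcongr with x
  exact enorm_add_le _ _

lemma lpn_sub (hp : 1 ≤ p) {f g : X → H} (hf : Nice f) (hg : Nice g) : lpn p (fun x => f x - g x) ≤ lpn p f + lpn p g := by
  have h0 : 0 ≤ p := by linarith
  refine le_trans ?_ (ENNReal.lintegral_Lp_add_le hf.meas.enorm.aemeasurable hg.meas.enorm.aemeasurable hp)
  unfold lpn
  gcongr with x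
  exact enorm_sub_le

lemma lpn_sum (hp : 1 ≤ p) {A : Type*} (s : Finset A) {f : A → X → H} (hf : ∀ a, Nice (f a)) :
    lpn p (fun x => ∑ a ∈ s, f a x) ≤ ∑ a ∈ s, lpn p (f a) := by
  classical
  induction s using Finset.induction_on with
  | empty =>
    have h0 : 0 < p := by linarith
    simp [lpn, h0, h0.ne']
  | insert a s ha ih =>
    simp_rw [Finset.sum_insert ha]
    exact (lpn_add hp (hf a) (Nice.sum fun b _ => hf b)).trans (add_le_add le_rfl ih)

lemma lpn_op {E V : Type*} [MeasureSpace E] [SFinite (volume : Measure E)]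
    [NormedAddCommGroup V] [MeasureSpace V] [BorelSpace V]
    [SecondCountableTopology V] [SFinite (volume : Measure V)]
    [(volume : Measure V).IsAddLeftInvariant] (hp : 1 ≤ p) {k : E → ℂ} {Q : E → V} {f : V → H} (hk : Measurable k)
    (hQ : Measurable Q) (hf : Nice f) : lpn p (Op k Q f) ≤ (∫⁻ y, ‖k y‖ₑ) * lpn p f := by
  have h0 : 0 < p := by linarith
  unfold lpn
  refine (ENNReal.rpow_le_rpow (op_young hk hQ hf.meas hp) (by positivity)).trans (le_of_eq ?_)
  rw [ENNReal.mul_rpow_of_nonneg _ _ (by positivity), ← ENNReal.rpow_mul]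
  simp [h0.ne']

lemma lpn_of_le (hp : 1 ≤ p) {Y : Type*} [MeasureSpace Y] {H' : Type*} [NormedAddCommGroup H'] {f : X → H} {g : Y → H'} {C : ℝ≥0∞}
    (h : ∫⁻ x, ‖f x‖ₑ ^ p ≤ C * ∫⁻ x, ‖g x‖ₑ ^ p) : lpn p f ≤ C ^ (1/p) * lpn p g := by
  have h0 : 0 < p := by linarith
  unfold lpn
  rw [← ENNReal.mul_rpow_of_nonneg _ _ (by positivity)]
  exact ENNReal.rpow_le_rpow h (by positivity)
end

section
variable {Γ : Type} [Fintype Γ] (w : Γ → ℕ) {H : Type*} [NormedAddCommGroup H] [NormedSpace ℂ H] [CompleteSpace H] {p : ℝ}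

lemma sk_op_nice (hw : ∀ α, 1 ≤ w α) (l : ℤ) {f : (Γ → ℝ) → H} (hf : Nice f) : Nice (Op (sk w l) id f) :=
  hf.op (sk_nice w hw l).meas.measurable (sk_nice w hw l).int measurable_id

lemma vl_ge [Nonempty Γ] (hw : ∀ α, 1 ≤ w α) (L : ℕ) : ENNReal.ofReal (2 ^ L) ≤ vl w L := by
  classical
  unfold vl
  obtain ⟨α⟩ := ‹Nonempty Γ›
  have h1 : ∀ β, (2:ℝ) ^ L ≤ sc w L β := by
    intro β
    unfold sc
    rw [← zpow_natCast]
    apply zpow_le_zpow_right₀ (by norm_num)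
    have : (1:ℤ) ≤ w β := by exact_mod_cast hw β
    nlinarith [(Int.natCast_nonneg L)]
  have h2 : ∀ β, (1:ℝ≥0∞) ≤ ENNReal.ofReal (sc w L β) := fun β => by
    rw [← ENNReal.ofReal_one]
    exact ENNReal.ofReal_le_ofReal ((one_le_pow₀ (by norm_num)).trans (h1 β))
  rw [← Finset.mul_prod_erase _ _ (Finset.mem_univ α)]
  calc ENNReal.ofReal (2 ^ L) = ENNReal.ofReal (2 ^ L) * 1 := by simp
    _ ≤ _ := mul_le_mul' (ENNReal.ofReal_le_ofReal (h1 α)) (Finset.one_le_prod' fun β _ => h2 β)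

lemma sup_sk (hw : ∀ α, 1 ≤ w α) (l : ℤ) {f : (Γ → ℝ) → H} (hf : Nice f) (x : Γ → ℝ) :
    ‖Op (sk w l) id f x‖ₑ ≤ ENNReal.ofReal (tm w l)⁻¹ * ∫⁻ y, ‖f y‖ₑ := by
  refine (op_norm_le x).trans ?_
  calc ∫⁻ y, ‖sk w l y‖ₑ * ‖f (x - id y)‖ₑ ≤ ∫⁻ y, ENNReal.ofReal (tm w l)⁻¹ * ‖f (x - y)‖ₑ :=
        lintegral_mono fun y => mul_le_mul' (sk_le w hw l y) le_rfl
    _ = _ := by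
        have hm : Measurable fun y => ‖f (x - y)‖ₑ := hf.meas.enorm.comp (measurable_const.sub measurable_id)
        rw [lintegral_const_mul _ hm]
        congr 1
        exact lintegral_sub_left_eq_self (fun y => ‖f y‖ₑ) x

lemma approx_hi [Nonempty Γ] (hw : ∀ α, 1 ≤ w α) (hp : 1 < p) {f : (Γ → ℝ) → H} (hf : Nice f) {ε : ℝ≥0∞} (hε : ε ≠ 0) :
    ∃ L0 : ℕ, ∀ L : ℕ, L0 ≤ L → lpn p (Op (sk w L) id f) ≤ ε := by
  set I := ∫⁻ y, ‖f y‖ₑ with hI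
  have hIt : I ≠ ∞ := hf.int.2.ne
  have hb : ∀ L : ℕ, lpn p (Op (sk w L) id f) ≤ ((2 * vl w 1 * I * ENNReal.ofReal (1/2) ^ L) ^ (p-1) * I) ^ (1/p) := by
    intro L
    unfold lpn
    refine ENNReal.rpow_le_rpow ?_ (by positivity)
    have h1 : ∀ x, ‖Op (sk w L) id f x‖ₑ ^ p ≤ (2 * vl w 1 * I * ENNReal.ofReal (1/2) ^ L) ^ (p-1) * ‖Op (sk w L) id f x‖ₑ := by
      intro x
      have e : ‖Op (sk w L) id f x‖ₑ ^ p = ‖Op (sk w L) id f x‖ₑ ^ (p-1) * ‖Op (sk w L) id f x‖ₑ := by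
        conv_rhs => rw [← ENNReal.rpow_one ‖Op (sk w L) id f x‖ₑ, ← ENNReal.rpow_mul, one_mul]
        rw [← ENNReal.rpow_add_of_nonneg _ _ (by linarith) (by linarith)]; congr 1; ring
      rw [e]
      refine mul_le_mul' (ENNReal.rpow_le_rpow ((sup_sk w hw L hf x).trans ?_) (by linarith)) le_rfl
      rw [mul_right_comm (2 * vl w 1)]
      refine mul_le_mul' ?_ le_rfl
      have h2 := tm_inv_le w hw L
      have h3 := vl_ge w hw L
      have h4 : ENNReal.ofReal (2^L) * ENNReal.ofReal (1/2) ^ L = 1 := by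
        rw [← ENNReal.ofReal_pow (by positivity), ← ENNReal.ofReal_mul (by positivity), ← mul_pow]; norm_num
      calc ENNReal.ofReal (tm w L)⁻¹ = ENNReal.ofReal (tm w L)⁻¹ * (ENNReal.ofReal (2^L) * ENNReal.ofReal (1/2) ^ L) := by rw [h4, mul_one]
        _ ≤ ENNReal.ofReal (tm w L)⁻¹ * (vl w L * ENNReal.ofReal (1/2) ^ L) := mul_le_mul' le_rfl (mul_le_mul' h3 le_rfl)
        _ ≤ _ := by rw [← mul_assoc]; exact mul_le_mul' h2 le_rfl
    refine (lintegral_mono h1).trans ?_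
    rw [lintegral_const_mul _ (sk_op_nice w hw L hf).meas.enorm]
    refine mul_le_mul' le_rfl ?_
    have := op_young (k := sk w L) (Q := id) (sk_nice w hw L).meas.measurable measurable_id hf.meas (le_refl (1:ℝ))
    simpa [lintegral_sk w hw] using this
  have hlim : Filter.Tendsto (fun L : ℕ => ((2 * vl w 1 * I * ENNReal.ofReal (1/2) ^ L) ^ (p-1) * I) ^ (1/p)) Filter.atTop (𝓝 0) := by
    have h1 : Filter.Tendsto (fun L : ℕ => 2 * vl w 1 * I * ENNReal.ofReal (1/2) ^ L) Filter.atTop (𝓝 0) := by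
      have := ENNReal.Tendsto.const_mul (a := 2 * vl w 1 * I) (ENNReal.tendsto_pow_atTop_nhds_zero_of_lt_one (r := ENNReal.ofReal (1/2)) (by
        rw [← ENNReal.ofReal_one]; exact (ENNReal.ofReal_lt_ofReal_iff one_pos).2 (by norm_num)))
        (Or.inr (ENNReal.mul_ne_top (ENNReal.mul_ne_top (by simp) (vl_one_ne_top w)) hIt))
      simpa using this
    have h2 := h1.ennrpow_const (p-1)
    rw [ENNReal.zero_rpow_of_pos (by linarith)] at h2
    have h3 := ENNReal.Tendsto.mul_const (b := I) h2 (Or.inr hIt)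
    rw [zero_mul] at h3
    have h4 := h3.ennrpow_const (1/p)
    rwa [ENNReal.zero_rpow_of_pos (by positivity)] at h4
  obtain ⟨L0, h0⟩ := Filter.eventually_atTop.1 (hlim.eventually (Iic_mem_nhds hε.bot_lt))
  exact ⟨L0, fun L hL => (hb L).trans (h0 L hL)⟩

lemma approx_lo [Nonempty Γ] (hw : ∀ α, 1 ≤ w α) (hp : 1 < p) {f : (Γ → ℝ) → H} (hf : Nice f) {ε : ℝ≥0∞} (hε : ε ≠ 0) :
    ∃ L0 : ℕ, ∀ L : ℕ, L0 ≤ L → lpn p (fun x => f x - Op (sk w (-L)) id f x) ≤ ε := by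
  have hp0 : 0 < p := by linarith
  have hpt : ENNReal.ofReal p ≠ ∞ := ENNReal.ofReal_ne_top
  have hε3 : ε / 3 ≠ 0 := by simp [hε]
  obtain ⟨g, hgs, hg, hgc, hgm⟩ := (hf.memLp hp.le).exists_hasCompactSupport_eLpNorm_sub_le hpt hε3
  have hgN : Nice g := by
    refine ⟨hgc.stronglyMeasurable, ?_, hgc.integrable_of_hasCompactSupport hgs⟩
    exact hgs.exists_bound_of_continuous hgc
  have hfg : lpn p (fun x => f x - g x) ≤ ε / 3 := by
    rw [eLpNorm_eq_lintegral_rpow_enorm_toReal (by simpa using hp0) hpt, ENNReal.toReal_ofReal hp0.le] at hg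
    exact hg
  set S := Metric.cthickening 1 (tsupport g) with hS
  have hSc : IsCompact S := IsCompact.cthickening hgs
  have hSv : volume S ≠ ∞ := hSc.measure_lt_top.ne
  obtain ⟨ω, hω0, hω⟩ : ∃ ω : ℝ, 0 < ω ∧ ENNReal.ofReal ω * volume S ^ (1/p) ≤ ε / 3 := by
    have hlim : Filter.Tendsto (fun ω : ℝ => ENNReal.ofReal ω * volume S ^ (1/p)) (𝓝[>] 0) (𝓝 0) := by
      have h1 : Filter.Tendsto (fun ω : ℝ => ENNReal.ofReal ω) (𝓝[>] 0) (𝓝 0) := by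
        have := (ENNReal.continuous_ofReal.tendsto 0).mono_left (nhdsWithin_le_nhds (s := Set.Ioi (0:ℝ)))
        simpa using this
      have := ENNReal.Tendsto.mul_const (b := volume S ^ (1/p)) h1 (Or.inr (ENNReal.rpow_ne_top_of_nonneg (by positivity) hSv))
      simpa using this
    obtain ⟨ω, h1, h2⟩ := ((hlim.eventually (Iic_mem_nhds hε3.bot_lt)).and self_mem_nhdsWithin).exists
    exact ⟨ω, h2, h1⟩
  have huc := hgs.uniformContinuous_of_continuous hgc
  rw [Metric.uniformContinuous_iff] at huc
  obtain ⟨δ, hδ, hu⟩ := huc ω hω0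
  obtain ⟨L0, hL0⟩ := exists_pow_lt_of_lt_one hδ (by norm_num : (1/2:ℝ) < 1)
  refine ⟨L0, fun L hL => ?_⟩
  have hbox : ∀ h ∈ box w (-L) 0, ‖h‖ < δ ∧ ‖h‖ ≤ 1 := by
    intro h hh
    have h1 : ‖h‖ ≤ (1/2) ^ L := by
      rw [pi_norm_le_iff_of_nonneg (by positivity)]
      intro α
      refine ((mem_box_zero w).1 hh α).trans ?_
      have := sc_decay w hw (l := -L) (m := 0) (by simp) α
      have e0 : sc w 0 α = 1 := by simp [sc]
      rw [e0, mul_one] at this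
      simpa using this
    constructor
    · refine (h1.trans ?_).trans_lt hL0
      exact pow_le_pow_of_le_one (by norm_num) (by norm_num) hL
    · exact h1.trans (pow_le_one₀ (by norm_num) (by norm_num))
  have hgd : lpn p (fun x => g x - Op (sk w (-L)) id g x) ≤ ε / 3 := by
    have hpt : ∀ x, ‖g x - Op (sk w (-L)) id g x‖ₑ ^ p ≤ S.indicator (fun _ => ENNReal.ofReal ω ^ p) x := by
      intro x
      have e : g x - Op (sk w (-L)) id g x = ∫ y, sk w (-L) y • (g x - g (x - y)) := by
        simp_rw [smul_sub]
        rw [integral_sub, integral_smul_const, integral_sk w hw, one_smul]; rfl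
        · exact (sk_nice w hw _).int.smul_const _
        · exact op_integrable (sk_nice w hw _).int measurable_id hgN x
      rw [e]
      by_cases hx : x ∈ S
      · rw [Set.indicator_of_mem hx]
        refine ENNReal.rpow_le_rpow ?_ hp0.le
        refine (enorm_integral_le_lintegral_enorm _).trans ?_
        calc ∫⁻ y, ‖sk w (-L) y • (g x - g (x - y))‖ₑ ≤ ∫⁻ y, ‖sk w (-L) y‖ₑ * ENNReal.ofReal ω := by
              apply lintegral_mono; intro y; beta_reduce
              rw [enorm_smul]
              by_cases hy : y ∈ box w (-L) 0
              · refine mul_le_mul' le_rfl ?_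
                rw [← ofReal_norm]
                apply ENNReal.ofReal_le_ofReal
                have := hu (a := x) (b := x - y) (by simpa [dist_eq_norm] using (hbox y hy).1)
                rw [dist_eq_norm] at this; exact this.le
              · rw [sk_supp w hy]; simp
          _ = _ := by rw [lintegral_mul_const _ (sk_nice w hw _).meas.enorm, lintegral_sk w hw, one_mul]
      · rw [Set.indicator_of_notMem hx, integral_eq_zero_of_ae]
        · simp [hp0]
        · refine Filter.Eventually.of_forall fun y => ?_
          change sk w (-L) y • (g x - g (x - y)) = 0
          by_cases hy : y ∈ box w (-L) 0
          · have hz : ∀ z, dist x z ≤ 1 → g z = 0 := by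
              intro z hz
              by_contra h
              exact hx (Metric.mem_cthickening_of_dist_le x z 1 _ (subset_tsupport g h) hz)
            rw [hz x (by simp), hz (x-y) (by simpa [dist_eq_norm] using (hbox y hy).2)]; simp
          · rw [sk_supp w hy]; simp
    refine le_trans ?_ hω
    unfold lpn
    calc _ ≤ (∫⁻ x, S.indicator (fun _ => ENNReal.ofReal ω ^ p) x) ^ (1/p) := ENNReal.rpow_le_rpow (lintegral_mono hpt) (by positivity)
      _ = _ := by
        rw [lintegral_indicator_const hSc.measurableSet, ENNReal.mul_rpow_of_nonneg _ _ (by positivity), ← ENNReal.rpow_mul]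
        simp [hp0.ne']
  have hd := hf.sub hgN
  have e : (fun x => f x - Op (sk w (-L)) id f x) = fun x => ((f x - g x) - Op (sk w (-L)) id (fun x => f x - g x) x) + (g x - Op (sk w (-L)) id g x) := by
    ext x
    rw [op_sub (sk_nice w hw _).int measurable_id hf hgN]; abel
  rw [e]
  have h1 := lpn_add hp.le (hd.sub (sk_op_nice w hw (-L) hd)) (hgN.sub (sk_op_nice w hw (-L) hgN))
  have h2 := lpn_sub hp.le hd (sk_op_nice w hw (-L) hd)
  have h3 := lpn_op hp.le (sk_nice w hw (-L)).meas.measurable measurable_id hd (k := sk w (-L)) (Q := id)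
  rw [lintegral_sk w hw, one_mul] at h3
  calc _ ≤ _ := h1
    _ ≤ (ε / 3 + ε / 3) + ε / 3 := add_le_add (h2.trans (add_le_add hfg (h3.trans hfg))) hgd
    _ = ε := ENNReal.add_thirds ε
end
end SR
end

section

namespace SR

lemma telescope {A : Type*} [AddCommGroup A] (s : ℤ → A) {a b : ℤ} (h : a ≤ b) : ∑ l ∈ Finset.Ioc a b, (s (l-1) - s l) = s a - s b := by
  induction b, h using Int.le_induction with
  | base => simp
  | succ b hb ih =>
    have : Finset.Ioc a (b+1) = insert (b+1) (Finset.Ioc a b) := by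
      ext x; simp only [Finset.mem_Ioc, Finset.mem_insert]; lia
    rw [this, Finset.sum_insert (by simp), ih, add_sub_cancel_right]
    abel

lemma sum_reindex {A : Type*} [AddCommMonoid A] (I Λ : Finset ℤ) (M : ℤ) (hM : ∀ i ∈ I, ∀ l ∈ Λ, |i - l| ≤ M) (c : ℤ → ℤ → A) :
    ∑ i ∈ I, ∑ l ∈ Λ, c i l = ∑ a ∈ Finset.Icc (-M) M, ∑ i ∈ I.filter (fun i => i - a ∈ Λ), c i (i - a) := by
  simp_rw [Finset.sum_filter]
  conv_rhs => rw [Finset.sum_comm]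
  refine Finset.sum_congr rfl fun i hi => ?_
  rw [← Finset.sum_filter]
  refine Finset.sum_nbij' (fun l => i - l) (fun a => i - a) ?_ ?_ ?_ ?_ ?_
  · intro l hl
    have := hM i hi l hl
    rw [abs_le] at this
    simp only [Finset.mem_filter, Finset.mem_Icc, sub_sub_cancel]
    exact ⟨this, hl⟩
  · intro a ha; exact (Finset.mem_filter.1 ha).2
  · intro l _; simp
  · intro a _; simp
  · intro l _; simp

lemma comb (I Λ : Finset ℤ) (M : ℤ) (hM : ∀ i ∈ I, ∀ l ∈ Λ, |i - l| ≤ M) (c : ℤ → ℤ → ℂ) (j : ℤ) :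
    ‖∑ i ∈ I.filter (fun i => j ≤ i), ∑ l ∈ Λ, c i l‖ₑ ≤ ‖∑ l ∈ Λ.filter (fun l => j ≤ l), ∑ i ∈ I, c i l‖ₑ +
      ∑ a ∈ Finset.Icc (-M) M, (a.natAbs : ℝ≥0∞) * (∑ i ∈ I, ‖c i (i-a)‖ₑ ^ (2:ℝ)) ^ ((1:ℝ)/2) := by
  have e1 : ∑ i ∈ I.filter (fun i => j ≤ i), ∑ l ∈ Λ, c i l = ∑ i ∈ I, ∑ l ∈ Λ, if j ≤ i then c i l else 0 := by
    rw [Finset.sum_filter]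
    refine Finset.sum_congr rfl fun i _ => ?_
    split_ifs <;> simp
  have e2 : ∑ l ∈ Λ.filter (fun l => j ≤ l), ∑ i ∈ I, c i l = ∑ i ∈ I, ∑ l ∈ Λ, if j ≤ l then c i l else 0 := by
    rw [Finset.sum_filter, Finset.sum_comm]
    refine Finset.sum_congr rfl fun i _ => ?_
    split_ifs <;> simp
  have e3 : ∑ i ∈ I.filter (fun i => j ≤ i), ∑ l ∈ Λ, c i l = ∑ l ∈ Λ.filter (fun l => j ≤ l), ∑ i ∈ I, c i l +
      ∑ i ∈ I, ∑ l ∈ Λ, ((if j ≤ i then c i l else 0) - (if j ≤ l then c i l else 0)) := by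
    rw [e1, e2]; simp_rw [Finset.sum_sub_distrib]; abel
  rw [e3]
  refine (enorm_add_le _ _).trans (add_le_add le_rfl ?_)
  rw [sum_reindex I Λ M hM]
  refine (enorm_sum_le _ _).trans (Finset.sum_le_sum fun a _ => (enorm_sum_le _ _).trans ?_)
  set Sq := (∑ i ∈ I, ‖c i (i-a)‖ₑ ^ (2:ℝ)) ^ ((1:ℝ)/2) with hSq
  have hle : ∀ i ∈ I, ‖c i (i-a)‖ₑ ≤ Sq := by
    intro i hi
    have := Finset.single_le_sum (f := fun i => ‖c i (i-a)‖ₑ ^ (2:ℝ)) (fun _ _ => zero_le) hi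
    have h2 := ENNReal.rpow_le_rpow this (by norm_num : (0:ℝ) ≤ 1/2)
    rwa [← ENNReal.rpow_mul, show (2:ℝ) * (1/2) = 1 by norm_num, ENNReal.rpow_one] at h2
  set W := Finset.Ico j (j+a) ∪ Finset.Ico (j+a) j with hW
  have hWc : W.card ≤ a.natAbs := by
    rw [hW]
    refine (Finset.card_union_le _ _).trans ?_
    rw [Int.card_Ico, Int.card_Ico]; lia
  calc _ ≤ ∑ i ∈ I.filter (fun i => i - a ∈ Λ), if i ∈ W then Sq else 0 := by
        refine Finset.sum_le_sum fun i hi => ?_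
        have hi' := hle i (Finset.mem_filter.1 hi).1
        by_cases h : i ∈ W
        · rw [if_pos h]
          split_ifs <;> simp [hi']
        · rw [if_neg h]
          rw [hW, Finset.mem_union, Finset.mem_Ico, Finset.mem_Ico] at h
          by_cases h1 : j ≤ i
          · have h2 : j ≤ i - a := by lia
            simp [h1, h2]
          · have h2 : ¬ j ≤ i - a := by lia
            rw [if_neg h1, if_neg h2]; simp
    _ = (((I.filter (fun i => i - a ∈ Λ)) ∩ W).card : ℝ≥0∞) * Sq := by
        rw [Finset.sum_ite_mem, Finset.sum_const, nsmul_eq_mul]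
    _ ≤ _ := by
        refine mul_le_mul' ?_ le_rfl
        exact_mod_cast (Finset.card_le_card Finset.inter_subset_right).trans hWc

lemma coef_sum (C δ p : ℝ) (hC : 0 < C) (hδ : 0 < δ) (hp : 0 < p) : ∃ B : ℝ≥0∞, B ≠ ∞ ∧ ∀ s : Finset ℤ,
    ∑ a ∈ s, (1 + a.natAbs : ℝ≥0∞) * ENNReal.ofReal (C * 2 ^ (-(δ * a.natAbs))) ^ (1/p) ≤ B := by
  set η := δ / (2 * p) with hη
  have hη0 : 0 < η := by positivity
  obtain ⟨C1, hC1, h1⟩ := lin_le_exp η hη0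
  obtain ⟨G, hG, h2⟩ := geo_sum (2 ^ (-η)) (by positivity) (Real.rpow_lt_one_of_one_lt_of_neg (by norm_num) (by linarith))
  refine ⟨ENNReal.ofReal (C1 * C ^ (1/p) * G), ENNReal.ofReal_ne_top, fun s => ?_⟩
  have key : ∀ a : ℤ, (1 + a.natAbs : ℝ≥0∞) * ENNReal.ofReal (C * 2 ^ (-(δ * a.natAbs))) ^ (1/p) ≤
      ENNReal.ofReal (C1 * C ^ (1/p) * (2 ^ (-η)) ^ (a - 0).natAbs) := by
    intro a
    have e : (1 + a.natAbs : ℝ≥0∞) = ENNReal.ofReal (1 + a.natAbs) := by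
      rw [ENNReal.ofReal_add (by norm_num) (by positivity), ENNReal.ofReal_one, ENNReal.ofReal_natCast]
    rw [e, ENNReal.ofReal_rpow_of_nonneg (by positivity) (by positivity), ← ENNReal.ofReal_mul (by positivity)]
    apply ENNReal.ofReal_le_ofReal
    rw [Real.mul_rpow hC.le (by positivity), ← Real.rpow_mul (by norm_num), sub_zero, ← Real.rpow_natCast, ← Real.rpow_mul (by norm_num)]
    calc _ ≤ (C1 * 2 ^ (η * a.natAbs)) * (C ^ (1/p) * 2 ^ (-(δ * a.natAbs) * (1/p))) := by gcongr; exact h1 _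
      _ = C1 * C ^ (1/p) * (2 ^ (η * a.natAbs) * 2 ^ (-(δ * a.natAbs) * (1/p))) := by ring
      _ = _ := by
        rw [← Real.rpow_add (by norm_num)]; congr 2; rw [hη]; field_simp; ring
  refine (Finset.sum_le_sum fun a _ => key a).trans ?_
  rw [← ENNReal.ofReal_sum_of_nonneg (fun i _ => by positivity)]
  apply ENNReal.ofReal_le_ofReal
  rw [← Finset.mul_sum]
  gcongr; exact h2 s 0

variable {n D : ℕ}

lemma coord_sum {ι A : Type*} [Fintype ι] (s : Finset A) (f : A → EuclideanSpace ℂ ι) (t : ι) : (∑ a ∈ s, f a) t = ∑ a ∈ s, f a t := by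
  rw [WithLp.ofLp_sum, Finset.sum_apply]

theorem maxV [Nonempty (GI n D)] (p : ℝ) (hp : 1 < p) : ∃ C : ℝ≥0∞, C ≠ ∞ ∧
    ∀ k : ℤ → (Fin n → ℝ) → ℂ, (∀ i, KH n i (k i)) → ∀ (ι : Type) [Fintype ι] (i0 i1 : ℤ) 
      (f : (GI n D → ℝ) → EuclideanSpace ℂ ι), Nice f →
      NN p (fun t x => ⨆ j ∈ Finset.Icc i0 i1, ‖∑ i ∈ Finset.Icc j i1, Op (k i) QQ f x t‖ₑ) ≤ C * lpn p f := by
  have hp0 : 0 < p := by linarith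
  obtain ⟨C1, δ1, hC1, hδ1, h1⟩ := sq_bound (n := n) (D := D) p hp
  obtain ⟨C2, δ2, hC2, hδ2, h2⟩ := lin_bound (n := n) (D := D) p hp
  obtain ⟨C3, hC3, h3⟩ := fs (wt (n := n) (D := D)) one_le_wt p hp
  obtain ⟨B1, hB1, b1⟩ := coef_sum C1 δ1 p hC1 hδ1 hp0
  obtain ⟨B2, hB2, b2⟩ := coef_sum C2 δ2 p hC2 hδ2 hp0
  set c3 := C3 ^ (1/p) with hc3
  have hc3t : c3 ≠ ∞ := ENNReal.rpow_ne_top_of_nonneg (by positivity) hC3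
  refine ⟨2 * c3 * B2 + B1, ENNReal.add_ne_top.2 ⟨ENNReal.mul_ne_top (ENNReal.mul_ne_top (by simp) hc3t) hB2, hB1⟩,
    fun k hk ι _ i0 i1 f hf => ?_⟩
  set I := Finset.Icc i0 i1 with hI
  set w := wt (n := n) (D := D) with hw'
  have hw := one_le_wt (n := n) (D := D)
  have sn : ∀ {g : (GI n D → ℝ) → EuclideanSpace ℂ ι} (hg : Nice g) (i : ℤ), Nice (Op (k i) QQ g) := fun hg i =>
    hg.op (hk i).cont.measurable (hk i).int continuous_QQ.measurable
  have dn : ∀ l, Nice (Op (dk w l) id f) := fun l => hf.op (dk_nice w hw l).meas.measurable (dk_nice w hw l).int measurable_id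
  -- error term
  set m : ℝ≥0∞ := (1 + 2 * c3) * (I.card * ENNReal.ofReal (8 ^ n)) with hm
  have hmt : m ≠ ∞ := ENNReal.mul_ne_top (ENNReal.add_ne_top.2 ⟨by simp, ENNReal.mul_ne_top (by simp) hc3t⟩)
    (ENNReal.mul_ne_top (by simp) ENNReal.ofReal_ne_top)
  refine ENNReal.le_of_forall_pos_le_add fun ε hε _ => ?_
  set η : ℝ≥0∞ := ε / (m + 1) / 2 with hη
  have hη0 : η ≠ 0 := by
    rw [hη]
    refine (ENNReal.div_pos (ENNReal.div_pos (by exact_mod_cast hε.ne') ?_).ne' (by simp)).ne'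
    exact ENNReal.add_ne_top.2 ⟨hmt, by simp⟩
  obtain ⟨La, hLa⟩ := approx_lo w hw hp hf hη0
  obtain ⟨Lb, hLb⟩ := approx_hi w hw hp hf hη0
  set L : ℕ := max (max La Lb) (i0.natAbs + i1.natAbs + 1) with hL
  have hL1 := hLa L (by lia)
  have hL2 := hLb L (by lia)
  set E : (GI n D → ℝ) → EuclideanSpace ℂ ι := fun x => (f x - Op (sk w (-L)) id f x) + Op (sk w L) id f x with hE
  have hEn : Nice E := (hf.sub (sk_op_nice w hw _ hf)).add (sk_op_nice w hw _ hf)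
  have hEb : lpn p E ≤ ε / (m+1) := by
    refine (lpn_add hp.le (hf.sub (sk_op_nice w hw _ hf)) (sk_op_nice w hw _ hf)).trans ((add_le_add hL1 hL2).trans ?_)
    rw [hη, ENNReal.add_halves]
  set Λ := Finset.Ioc (-(L:ℤ)) L with hΛ
  have dsub : ∀ {g : (GI n D → ℝ) → EuclideanSpace ℂ ι} (hg : Nice g) l x, Op (dk w l) id g x = Op (sk w (l-1)) id g x - Op (sk w l) id g x :=
    fun hg l x => op_ksub (sk_nice w hw _).int (sk_nice w hw _).int measurable_id hg x
  have hdec : f = fun x => E x + ∑ l ∈ Λ, Op (dk w l) id f x := by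
    ext1 x
    simp_rw [dsub hf]
    rw [telescope (fun l => Op (sk w l) id f x) (by lia), hE]; beta_reduce; abel
  have hσ : ∀ i x, Op (k i) QQ f x = Op (k i) QQ E x + ∑ l ∈ Λ, Op (k i) QQ (Op (dk w l) id f) x := by
    intro i x
    conv_lhs => rw [hdec]
    rw [op_add (hk i).int continuous_QQ.measurable hEn (Nice.sum fun l _ => dn l), op_sum (hk i).int continuous_QQ.measurable fun l _ => dn l]
  set M : ℤ := i0.natAbs + i1.natAbs + 2 * L with hM
  have hMb : ∀ i ∈ I, ∀ l ∈ Λ, |i - l| ≤ M := by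
    intro i hi l hl
    rw [hI, Finset.mem_Icc] at hi; rw [hΛ, Finset.mem_Ioc] at hl
    rw [abs_le]; constructor <;> lia
  set c : ℤ → ℤ → (GI n D → ℝ) → EuclideanSpace ℂ ι := fun i l x => Op (k i) QQ (Op (dk w l) id f) x with hc
  have cn : ∀ i l, Nice (c i l) := fun i l => sn (dn l) i
  have ckap : ∀ a i x, Op (kap k a i) id f x = c i (i-a) x := fun a i x =>
    op_assoc (hk i).cont.measurable (hk i).int continuous_QQ.measurable (dk_nice w hw _) hf x
  set Tf : (GI n D → ℝ) → EuclideanSpace ℂ ι := fun x => ∑ i ∈ I, Op (k i) QQ f x with hTf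
  have hTn : Nice Tf := Nice.sum fun i _ => sn hf i
  have hEs : ∑ i ∈ I, lpn p (Op (k i) QQ E) ≤ (I.card * ENNReal.ofReal (8 ^ n)) * lpn p E := by
    refine (Finset.sum_le_sum fun i _ => (lpn_op hp.le (hk i).cont.measurable continuous_QQ.measurable hEn).trans
      (mul_le_mul' (hk i).l1 le_rfl)).trans (le_of_eq ?_)
    rw [Finset.sum_const, nsmul_eq_mul, mul_assoc]
  have hTb : lpn p Tf ≤ (I.card * ENNReal.ofReal (8 ^ n)) * lpn p E + B2 * lpn p f := by
    have e : Tf = fun x => (∑ i ∈ I, Op (k i) QQ E x) + ∑ a ∈ Finset.Icc (-M) M, ∑ i ∈ I.filter (fun i => i - a ∈ Λ), Op (kap k a i) id f x := by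
      ext1 x
      simp_rw [ckap]
      rw [← sum_reindex I Λ M hMb (fun i l => c i l x), ← Finset.sum_add_distrib]
      exact Finset.sum_congr rfl fun i _ => hσ i x
    have kn : ∀ a, Nice (fun x => ∑ i ∈ I.filter (fun i => i - a ∈ Λ), Op (kap k a i) id f x) := fun a => Nice.sum fun i _ =>
      hf.op (kap_nice hk a i).meas.measurable (kap_nice hk a i).int measurable_id
    rw [e]
    refine (lpn_add hp.le (Nice.sum fun i _ => sn hEn i) (Nice.sum fun a _ => kn a)).trans (add_le_add ?_ ?_)
    · exact (lpn_sum hp.le I fun i => sn hEn i).trans hEs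
    · refine (lpn_sum hp.le _ kn).trans ?_
      refine le_trans ?_ (mul_le_mul' (b2 (Finset.Icc (-M) M)) le_rfl)
      rw [Finset.sum_mul]
      refine Finset.sum_le_sum fun a _ => ?_
      refine (lpn_of_le hp.le (h2 k hk a _ _ f hf)).trans (mul_le_mul' ?_ le_rfl)
      calc _ = 1 * ENNReal.ofReal (C2 * 2 ^ (-(δ2 * a.natAbs))) ^ (1/p) := by rw [one_mul]
        _ ≤ _ := mul_le_mul' le_self_add le_rfl
  set Sq : ℤ → ι → (GI n D → ℝ) → ℝ≥0∞ := fun a t x => (∑ i ∈ I, ‖c i (i-a) x t‖ₑ ^ (2:ℝ)) ^ ((1:ℝ)/2) with hSq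
  have sqm : ∀ a t, Measurable (Sq a t) := fun a t =>
    (Finset.measurable_fun_sum _ fun i _ => (((cn i (i-a)).coord t).meas.enorm).pow_const _).pow_const _
  have sqb : ∀ a, NN p (Sq a) ≤ ENNReal.ofReal (C1 * 2 ^ (-(δ1 * a.natAbs))) ^ (1/p) * lpn p f := by
    intro a
    rw [NN_eq]
    unfold lpn
    rw [← ENNReal.mul_rpow_of_nonneg _ _ (by positivity)]
    refine ENNReal.rpow_le_rpow (le_trans (le_of_eq ?_) (h1 k hk a I _ f hf)) (by positivity)
    congr 1; ext x; congr 1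
    simp_rw [ckap, l2_enorm, hSq, ← ENNReal.rpow_mul]
    rw [Finset.sum_comm]
    norm_num
  set J := Finset.Icc (-(L:ℤ)) L with hJ
  have hpt : ∀ t x, (⨆ j ∈ I, ‖∑ i ∈ Finset.Icc j i1, Op (k i) QQ f x t‖ₑ) ≤
      ((∑ i ∈ I, ‖Op (k i) QQ E x t‖ₑ) + 2 * fsup w J Tf t x) + ∑ a ∈ Finset.Icc (-M) M, (a.natAbs : ℝ≥0∞) * Sq a t x := by
    intro t x
    refine iSup₂_le fun j hj => ?_
    have hj' := hj
    rw [hI, Finset.mem_Icc] at hj'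
    have eI : Finset.Icc j i1 = I.filter (fun i => j ≤ i) := by
      ext i; rw [hI]; simp only [Finset.mem_Icc, Finset.mem_filter]; lia
    have eΛ : Λ.filter (fun l => j ≤ l) = Finset.Ioc (j-1) L := by
      ext i; rw [hΛ]; simp only [Finset.mem_Ioc, Finset.mem_filter]; lia
    have e1 : ∑ i ∈ Finset.Icc j i1, Op (k i) QQ f x t = ∑ i ∈ I.filter (fun i => j ≤ i), Op (k i) QQ E x t +
        ∑ i ∈ I.filter (fun i => j ≤ i), ∑ l ∈ Λ, c i l x t := by
      rw [eI, ← Finset.sum_add_distrib]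
      refine Finset.sum_congr rfl fun i _ => ?_
      rw [hσ i x, PiLp.add_apply, coord_sum]
    have e2 : ∑ l ∈ Λ.filter (fun l => j ≤ l), ∑ i ∈ I, c i l x t = Op (sk w (j-1)) id Tf x t - Op (sk w L) id Tf x t := by
      rw [eΛ, ← telescope (fun l => Op (sk w l) id Tf x t) (by lia)]
      refine Finset.sum_congr rfl fun l _ => ?_
      rw [← PiLp.sub_apply, ← dsub hTn, hTf, op_sum (dk_nice w hw l).int measurable_id fun i _ => sn hf i, coord_sum]
      refine Finset.sum_congr rfl fun i _ => ?_
      congr 1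
      rw [op_comm (dk_nice w hw l).meas.measurable (dk_nice w hw l).int measurable_id (hk i).cont.measurable (hk i).int continuous_QQ.measurable hf]
    rw [e1]
    refine (enorm_add_le _ _).trans ?_
    rw [add_assoc]
    refine add_le_add ((enorm_sum_le _ _).trans (Finset.sum_le_sum_of_subset (Finset.filter_subset _ _))) ?_
    refine (comb I Λ M hMb (fun i l => c i l x t) j).trans (add_le_add ?_ le_rfl)
    rw [e2, two_mul]
    refine enorm_sub_le.trans (add_le_add ?_ ?_)
    · exact le_iSup₂_of_le (j-1) (by rw [hJ, Finset.mem_Icc]; lia) le_rfl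
    · exact le_iSup₂_of_le (L:ℤ) (by rw [hJ, Finset.mem_Icc]; lia) le_rfl
  have m1 : ∀ i t, Measurable fun x => ‖Op (k i) QQ E x t‖ₑ := fun i t => ((sn hEn i).coord t).meas.enorm
  have m1' : ∀ t, Measurable fun x => ∑ i ∈ I, ‖Op (k i) QQ E x t‖ₑ := fun t => Finset.measurable_fun_sum _ fun i _ => m1 i t
  have m2 := fun t => fsup_meas w hw J hTn t
  have m2' : ∀ t, Measurable fun x => 2 * fsup w J Tf t x := fun t => (m2 t).const_mul _
  have m3 : ∀ a t, Measurable fun x => (a.natAbs : ℝ≥0∞) * Sq a t x := fun a t => (sqm a t).const_mul _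
  refine (NN_mono hp.le hpt).trans ?_
  refine (NN_add hp.le (fun t => (m1' t).add (m2' t)) (fun t => Finset.measurable_fun_sum _ fun a _ => m3 a t)).trans ?_
  have k1 : NN p (fun t x => ∑ i ∈ I, ‖Op (k i) QQ E x t‖ₑ) ≤ (I.card * ENNReal.ofReal (8 ^ n)) * lpn p E := by
    refine (NN_sum hp.le I (F := fun i t x => ‖Op (k i) QQ E x t‖ₑ) m1).trans (le_trans (Finset.sum_le_sum fun i _ => ?_) hEs)
    rw [NN_vec]
  have k2 : NN p (fun t x => 2 * fsup w J Tf t x) ≤ 2 * (c3 * ((I.card * ENNReal.ofReal (8 ^ n)) * lpn p E + B2 * lpn p f)) := by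
    rw [NN_mul hp.le 2 m2]
    refine mul_le_mul' le_rfl (le_trans ?_ (mul_le_mul' le_rfl hTb))
    rw [NN_eq]; unfold lpn
    rw [hc3, ← ENNReal.mul_rpow_of_nonneg _ _ (by positivity)]
    exact ENNReal.rpow_le_rpow (h3 ι J Tf hTn) (by positivity)
  have k3 : NN p (fun t x => ∑ a ∈ Finset.Icc (-M) M, (a.natAbs : ℝ≥0∞) * Sq a t x) ≤ B1 * lpn p f := by
    refine (NN_sum hp.le _ (F := fun (a:ℤ) t x => (a.natAbs : ℝ≥0∞) * Sq a t x) m3).trans ?_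
    refine le_trans ?_ (mul_le_mul' (b1 (Finset.Icc (-M) M)) le_rfl)
    rw [Finset.sum_mul]
    refine Finset.sum_le_sum fun a _ => ?_
    rw [NN_mul hp.le _ (sqm a), mul_assoc]
    exact mul_le_mul' le_add_self (sqb a)
  refine (add_le_add ((NN_add hp.le m1' m2').trans (add_le_add k1 k2)) k3).trans ?_
  have fin : m * lpn p E ≤ ε := by
    calc m * lpn p E ≤ (m+1) * (ε / (m+1)) := mul_le_mul' le_self_add hEb
      _ ≤ ε := ENNReal.mul_div_le
  calc _ = (2 * c3 * B2 + B1) * lpn p f + m * lpn p E := by rw [hm]; ring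
    _ ≤ _ := add_le_add le_rfl fin
end SR
end

section

namespace SR

lemma pi_ball_vol {Γ : Type} [Fintype Γ] (R : ℝ) (hR : 0 ≤ R) :
    volume {v : Γ → ℝ | ‖v‖ ≤ R} = ENNReal.ofReal ((2 * R) ^ Fintype.card Γ) := by
  rw [← Real.volume_pi_closedBall (0 : Γ → ℝ) hR]; congr 1; ext y; simp

lemma avg_limit {A B : ℝ≥0∞} (m : ℕ) (R0 : ℝ) (hR0 : 0 ≤ R0)
    (h : ∀ R : ℝ, 0 < R → ENNReal.ofReal ((2 * R) ^ m) * A ≤ ENNReal.ofReal ((2 * (R + R0)) ^ m) * B) : A ≤ B := by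
  have h1 : ∀ R : ℝ, 0 < R → A ≤ B * ENNReal.ofReal ((1 + R0 * R⁻¹) ^ m) := by
    intro R hR
    have hR2 : 0 < (2 * R) ^ m := by positivity
    have h2 := mul_le_mul_right (h R hR) (ENNReal.ofReal ((2 * R) ^ m)⁻¹)
    rw [← mul_assoc, ← mul_assoc, ← ENNReal.ofReal_mul (by positivity), ← ENNReal.ofReal_mul (by positivity),
      inv_mul_cancel₀ hR2.ne', ENNReal.ofReal_one, one_mul, mul_comm _ B] at h2
    refine h2.trans (le_of_eq ?_)
    congr 2
    rw [← inv_pow, ← mul_pow]; congr 1; field_simp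
  have h2 : Filter.Tendsto (fun R : ℝ => B * ENNReal.ofReal ((1 + R0 * R⁻¹) ^ m)) Filter.atTop (𝓝 (B * ENNReal.ofReal ((1 + R0 * 0) ^ m))) := by
    refine ENNReal.Tendsto.const_mul ?_ (Or.inl (by simp))
    refine ENNReal.tendsto_ofReal (((tendsto_inv_atTop_zero.const_mul R0).const_add 1).pow m)
  have h3 := ge_of_tendsto h2 (Filter.eventually_atTop.2 ⟨1, fun R hR => h1 R (by linarith)⟩)
  simpa using h3

variable {n D d : ℕ}

theorem transfer [Nonempty (GI n D)] (p : ℝ) (hp : 1 < p) : ∃ C : ℝ≥0∞, C ≠ ∞ ∧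
    ∀ k : ℤ → (Fin n → ℝ) → ℂ, (∀ i, KH n i (k i)) → ∀ (ι : Type) [Fintype ι] (i0 i1 : ℤ)
      (L : (GI n D → ℝ) →L[ℝ] EuclideanSpace ℝ (Fin d)) (f : EuclideanSpace ℝ (Fin d) → EuclideanSpace ℂ ι), Nice f →
      NN p (fun t x => ⨆ j ∈ Finset.Icc i0 i1, ‖∑ i ∈ Finset.Icc j i1, Op (k i) (fun y => L (QQ y)) f x t‖ₑ) ≤ C * lpn p f := by
  obtain ⟨C, hC, h⟩ := maxV (n := n) (D := D) p hp
  refine ⟨C, hC, fun k hk ι _ i0 i1 L f hf => ?_⟩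
  have hp0 : 0 < p := by linarith
  have hQm : Measurable (QQ (n := n) (D := D)) := continuous_QQ.measurable
  have hLQ : Measurable (fun y => L (QQ (n := n) (D := D) y)) := (L.continuous.comp continuous_QQ).measurable
  obtain ⟨R0, hR00, hR0⟩ : ∃ R0 : ℝ, 0 ≤ R0 ∧ ∀ i ≤ i1, ∀ y, k i y ≠ 0 → ‖QQ (D := D) y‖ ≤ R0 := by
    obtain ⟨R0, hR⟩ := ((isCompact_closedBall (0 : Fin n → ℝ) (4 * (2:ℝ) ^ i1)).image (continuous_QQ (n := n) (D := D))).isBounded.exists_norm_le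
    refine ⟨max R0 0, le_max_right _ _, fun i hi y hy => (hR _ ⟨y, ?_, rfl⟩).trans (le_max_left _ _)⟩
    rw [mem_closedBall_zero_iff]
    have h1 : ‖y‖ ≤ 4 * (2:ℝ) ^ i := by
      by_contra hc; exact hy ((hk i).supp y (not_le.1 hc))
    refine h1.trans ?_
    have : (2:ℝ) ^ i ≤ 2 ^ i1 := zpow_le_zpow_right₀ (by norm_num) hi
    linarith
  set G : EuclideanSpace ℝ (Fin d) → ℝ≥0∞ := fun x =>
    ((∑ t, (⨆ j ∈ Finset.Icc i0 i1, ‖∑ i ∈ Finset.Icc j i1, Op (k i) (fun y => L (QQ y)) f x t‖ₑ) ^ (2:ℝ)) ^ ((1:ℝ)/2)) ^ p with hG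
  have hGm : Measurable G := by
    rw [hG]
    refine (l2_meas fun t => ?_).pow_const p
    refine Measurable.biSup _ (Set.to_countable _) fun j _ => Measurable.enorm ?_
    refine Finset.measurable_fun_sum _ fun i _ => ?_
    exact (((hf.op (hk i).cont.measurable (hk i).int hLQ).coord t).meas).measurable
  set g : EuclideanSpace ℝ (Fin d) → ℝ≥0∞ := fun x => ‖f x‖ₑ ^ p with hg
  have hgm : Measurable g := hf.meas.enorm.pow_const p
  have main : ∫⁻ x, G x ≤ C ^ p * ∫⁻ x, g x := by
    refine avg_limit (Fintype.card (GI n D)) R0 hR00 fun R hR => ?_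
    set B1 := {v : GI n D → ℝ | ‖v‖ ≤ R} with hB1
    set B2 := {v : GI n D → ℝ | ‖v‖ ≤ R + R0} with hB2
    have mB1 : MeasurableSet B1 := measurableSet_le (by fun_prop) measurable_const
    have mB2 : MeasurableSet B2 := measurableSet_le (by fun_prop) measurable_const
    have hswap : ∀ (B : Set (GI n D → ℝ)) (u : EuclideanSpace ℝ (Fin d) → ℝ≥0∞), Measurable u →
        ∫⁻ x, ∫⁻ v in B, u (L v + x) = volume B * ∫⁻ x, u x := by
      intro B u hu
      rw [lintegral_lintegral_swap]
      · simp_rw [lintegral_add_left_eq_self u]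
        rw [lintegral_const, Measure.restrict_apply_univ, mul_comm]
      · apply Measurable.aemeasurable
        exact hu.comp (by fun_prop)
    rw [← pi_ball_vol R hR.le, ← pi_ball_vol (R + R0) (by positivity), ← hB1, ← hB2, ← hswap B1 G hGm, mul_left_comm, ← hswap B2 g hgm,
      ← lintegral_const_mul _ (by
        apply Measurable.lintegral_prod_right' (f := fun z : EuclideanSpace ℝ (Fin d) × (GI n D → ℝ) => g (L z.2 + z.1))
        exact hgm.comp (by fun_prop))]
    apply lintegral_mono; intro x
    beta_reduce
    set F : (GI n D → ℝ) → EuclideanSpace ℂ ι := B2.indicator (fun v => f (L v + x)) with hF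
    have hFn : Nice F := by
      have hm : StronglyMeasurable F := by
        apply StronglyMeasurable.indicator _ mB2
        exact hf.meas.comp_measurable (by fun_prop)
      obtain ⟨c, hc⟩ := hf.bdd
      have hb : ∀ v, ‖F v‖ ≤ c := fun v => (norm_indicator_le_norm_self _ _).trans (hc _)
      refine ⟨hm, ⟨c, hb⟩, ?_⟩
      rw [hF, integrable_indicator_iff mB2]
      refine Measure.integrableOn_of_bounded (M := c) ?_ ?_ ?_
      · rw [hB2, pi_ball_vol _ (by positivity)]; exact ENNReal.ofReal_ne_top
      · exact (hf.meas.comp_measurable (by fun_prop)).aestronglyMeasurable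
      · exact Filter.Eventually.of_forall fun v => hc _
    have h1 := h k hk ι i0 i1 F hFn
    have h2 : ∫⁻ v, ((∑ t, (⨆ j ∈ Finset.Icc i0 i1, ‖∑ i ∈ Finset.Icc j i1, Op (k i) QQ F v t‖ₑ) ^ (2:ℝ)) ^ ((1:ℝ)/2)) ^ p ≤
        C ^ p * ∫⁻ v, ‖F v‖ₑ ^ p := by
      have h3 := ENNReal.rpow_le_rpow h1 hp0.le
      unfold NN lpn at h3
      rwa [ENNReal.mul_rpow_of_nonneg _ _ hp0.le, ← ENNReal.rpow_mul, ← ENNReal.rpow_mul, one_div_mul_cancel hp0.ne', ENNReal.rpow_one, ENNReal.rpow_one] at h3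
    have h4 : ∫⁻ v, ‖F v‖ₑ ^ p = ∫⁻ v in B2, g (L v + x) := by
      rw [← lintegral_indicator mB2]
      apply lintegral_congr; intro v
      by_cases hv : v ∈ B2
      · simp [hF, hv, hg]
      · simp [hF, hv, hp0]
    rw [← h4]
    refine le_trans ?_ h2
    rw [← lintegral_indicator mB1]
    apply lintegral_mono; intro v
    beta_reduce
    by_cases hv : v ∈ B1
    · rw [Set.indicator_of_mem hv, hG]
      have e : ∀ i ≤ i1, Op (k i) QQ F v = Op (k i) (fun y => L (QQ y)) f (L v + x) := by
        intro i hi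
        unfold Op
        apply integral_congr_ae
        refine Filter.Eventually.of_forall fun y => ?_
        beta_reduce
        by_cases hy : k i y = 0
        · simp [hy]
        · have hm : v - QQ y ∈ B2 := by
            have := hR0 i hi y hy
            rw [hB2, Set.mem_ofPred_eq]
            exact (norm_sub_le _ _).trans (add_le_add hv this)
          rw [hF, Set.indicator_of_mem hm, map_sub]
          congr 2; abel
      beta_reduce
      refine le_of_eq ?_
      congr 3 
      funext t
      congr 1
      refine iSup_congr fun j => iSup_congr fun hj => ?_
      congr 1
      refine Finset.sum_congr rfl fun i hi => ?_
      rw [e i (Finset.mem_Icc.1 hi).2]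
    · rw [Set.indicator_of_notMem hv]; exact zero_le
  unfold NN lpn
  have h3 := ENNReal.rpow_le_rpow main (by positivity : 0 ≤ 1/p)
  rwa [ENNReal.mul_rpow_of_nonneg _ _ (by positivity), ← ENNReal.rpow_mul, mul_one_div_cancel hp0.ne', ENNReal.rpow_one] at h3

end SR
end

section

namespace SR

variable {n D d : ℕ}

/-- the polynomial mapping on Euclidean spaces -/
def Pm (P : Fin d → MvPolynomial (Fin n) ℝ) (y : EuclideanSpace ℝ (Fin n)) : EuclideanSpace ℝ (Fin d) :=
  WithLp.toLp 2 (fun j => MvPolynomial.eval (fun i => y i) (P j))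

lemma Pm_cont (P : Fin d → MvPolynomial (Fin n) ℝ) : Continuous (Pm P) := by
  unfold Pm
  apply (PiLp.continuous_toLp 2 _).comp
  refine continuous_pi fun j => ?_
  exact (MvPolynomial.continuous_eval (P j)).comp (by fun_prop)

lemma eval_QQ (q : MvPolynomial (Fin n) ℝ) (hq : q.totalDegree ≤ D) (h0 : MvPolynomial.eval (fun _ => (0:ℝ)) q = 0) (y : Fin n → ℝ) :
    MvPolynomial.eval y q = ∑ α : GI n D, q.coeff (Finsupp.equivFunOnFinite.symm (fun i => (α.1 i : ℕ))) * QQ y α := by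
  rw [MvPolynomial.eval_eq']
  symm
  have hc : q.coeff 0 = 0 := by
    have h1 : MvPolynomial.eval (fun _ => (0:ℝ)) q = MvPolynomial.constantCoeff q := by
      rw [MvPolynomial.constantCoeff_eq, ← MvPolynomial.constantCoeff_eq]
      exact congrFun (congrArg DFunLike.coe (MvPolynomial.eval_zero' (R := ℝ) (σ := Fin n))) q
    rw [h1, MvPolynomial.constantCoeff_eq] at h0; exact h0
  rw [← Finset.sum_filter_of_ne (p := fun α : GI n D => q.coeff (Finsupp.equivFunOnFinite.symm (fun i => (α.1 i : ℕ))) ≠ 0)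
    (fun α _ h => left_ne_zero_of_mul h)]
  refine Finset.sum_nbij (fun α : GI n D => Finsupp.equivFunOnFinite.symm (fun i => (α.1 i : ℕ))) ?_ ?_ ?_ ?_
  · intro α hα
    rw [MvPolynomial.mem_support_iff]; exact (Finset.mem_filter.1 hα).2
  · intro α _ β _ hαβ
    have h1 := Finsupp.equivFunOnFinite.symm.injective hαβ
    apply Subtype.ext; funext i
    exact Fin.ext (congrFun h1 i)
  · intro m hm
    have hm' : m ∈ q.support := hm
    have hmD : ∀ i, m i < D + 1 := by
      intro i
      have h1 := (MvPolynomial.le_totalDegree hm').trans hq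
      rw [Finsupp.sum_fintype _ _ (by simp)] at h1
      have h2 := Finset.single_le_sum (f := fun i => m i) (fun _ _ => Nat.zero_le _) (Finset.mem_univ i)
      lia
    have hm0 : (fun i => (⟨m i, hmD i⟩ : Fin (D+1))) ≠ 0 := by
      intro h
      have : m = 0 := by
        ext i
        have := congrArg (fun z : Fin (D+1) => (z:ℕ)) (congrFun h i)
        simpa using this
      rw [this, MvPolynomial.mem_support_iff] at hm'
      exact hm' hc
    have he : Finsupp.equivFunOnFinite.symm (fun i => m i) = m := by ext i; simp
    refine ⟨⟨_, hm0⟩, ?_, he⟩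
    rw [Finset.mem_coe, Finset.mem_filter]
    refine ⟨Finset.mem_univ _, ?_⟩
    beta_reduce
    rw [he]
    exact MvPolynomial.mem_support_iff.1 hm'
  · intro α _
    rfl

/-- kernel bounds on Euclidean space -/
structure KE (n : ℕ) (A : ℝ) (i : ℤ) (k : EuclideanSpace ℝ (Fin n) → ℂ) : Prop where
  size : ∀ y, ‖k y‖ * ((2:ℝ) ^ i) ^ n ≤ A
  lip : ∀ y y', ‖k y - k y'‖ * ((2:ℝ) ^ i) ^ (n+1) ≤ A * ‖y - y'‖
  supp : ∀ y, 4 * (2:ℝ) ^ i < ‖y‖ → k y = 0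

lemma sup_le_euc (y : Fin n → ℝ) : ‖y‖ ≤ ‖(WithLp.toLp 2 y : EuclideanSpace ℝ (Fin n))‖ := by
  rw [pi_norm_le_iff_of_nonneg (norm_nonneg _)]
  intro i
  exact PiLp.norm_apply_le (WithLp.toLp 2 y : EuclideanSpace ℝ (Fin n)) i

lemma euc_le_sup (y : Fin n → ℝ) : ‖(WithLp.toLp 2 y : EuclideanSpace ℝ (Fin n))‖ ≤ (n+1) * ‖y‖ := by
  have h : ‖(WithLp.toLp 2 y : EuclideanSpace ℝ (Fin n))‖ ^ 2 ≤ ((n+1) * ‖y‖) ^ 2 := by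
    rw [EuclideanSpace.norm_sq_eq]
    calc ∑ i, ‖(WithLp.toLp 2 y : EuclideanSpace ℝ (Fin n)) i‖ ^ 2 ≤ ∑ i : Fin n, ‖y‖ ^ 2 := by
          refine Finset.sum_le_sum fun i _ => ?_
          have := norm_le_pi_norm y i
          gcongr
      _ = n * ‖y‖ ^ 2 := by simp
      _ ≤ _ := by rw [mul_pow]; gcongr; nlinarith [(Nat.cast_nonneg n : (0:ℝ) ≤ n)]
  exact (pow_le_pow_iff_left₀ (by positivity) (by positivity) two_ne_zero).1 h

lemma KE.toKH {A : ℝ} (hA : 0 < A) {i : ℤ} {k : EuclideanSpace ℝ (Fin n) → ℂ} (h : KE n A i k) (hm : ∫ y, k y = 0) :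
    KH n i (fun y => (((A * (n+1))⁻¹ : ℝ) : ℂ) * k (WithLp.toLp 2 y)) := by
  have hn : (0:ℝ) < n + 1 := by positivity
  have hc : (0:ℝ) < (A * (n+1))⁻¹ := by positivity
  refine ⟨fun y => ?_, fun y y' => ?_, fun y hy => ?_, ?_⟩
  · rw [norm_mul, Complex.norm_real, Real.norm_of_nonneg hc.le, mul_assoc]
    calc _ ≤ (A * (n+1))⁻¹ * A := by gcongr; exact h.size _
      _ = (n+1 : ℝ)⁻¹ := by field_simp
      _ ≤ 1 := inv_le_one_of_one_le₀ (by linarith [(Nat.cast_nonneg n : (0:ℝ) ≤ n)])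
  · rw [← mul_sub, norm_mul, Complex.norm_real, Real.norm_of_nonneg hc.le, mul_assoc]
    calc _ ≤ (A * (n+1))⁻¹ * (A * ‖(WithLp.toLp 2 y : EuclideanSpace ℝ (Fin n)) - WithLp.toLp 2 y'‖) := mul_le_mul_of_nonneg_left (h.lip _ _) hc.le
      _ ≤ (A * (n+1))⁻¹ * (A * ((n+1) * ‖y - y'‖)) := by
        gcongr; rw [← WithLp.toLp_sub]; exact euc_le_sup _
      _ = _ := by field_simp
  · rw [h.supp _ (hy.trans_le (sup_le_euc y)), mul_zero]
  · rw [integral_const_mul]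
    have := (PiLp.volume_preserving_toLp (Fin n)).integral_comp (MeasurableEquiv.toLp 2 (Fin n → ℝ)).measurableEmbedding k
    rw [this, hm, mul_zero]

theorem maxE (hn : 0 < n) (hD : 0 < D) (p : ℝ) (hp : 1 < p) : ∃ C : ℝ≥0∞, C ≠ ∞ ∧
    ∀ A : ℝ, 0 < A → ∀ k : ℤ → EuclideanSpace ℝ (Fin n) → ℂ, (∀ i, KE n A i (k i)) → (∀ i, ∫ y, k i y = 0) →
    ∀ P : Fin d → MvPolynomial (Fin n) ℝ, (∀ j, (P j).totalDegree ≤ D) → (∀ j, MvPolynomial.eval (fun _ => (0 : ℝ)) (P j) = 0) →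
    ∀ (ι : Type) [Fintype ι] (i0 i1 : ℤ) (f : EuclideanSpace ℝ (Fin d) → EuclideanSpace ℂ ι), Nice f →
      NN p (fun t x => ⨆ j ∈ Finset.Icc i0 i1, ‖∑ i ∈ Finset.Icc j i1, Op (k i) (Pm P) f x t‖ₑ) ≤ ENNReal.ofReal A * C * lpn p f := by
  have : Nonempty (GI n D) := by
    refine ⟨⟨fun _ => ⟨1, by lia⟩, fun h => ?_⟩⟩
    have := congrArg (fun z : Fin (D+1) => (z:ℕ)) (congrFun h ⟨0, hn⟩)
    simp at this
  obtain ⟨C, hC, h⟩ := transfer (n := n) (D := D) (d := d) p hp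
  refine ⟨ENNReal.ofReal (n+1) * C, ENNReal.mul_ne_top ENNReal.ofReal_ne_top hC, fun A hA k hk hm P hPd hP0 ι _ i0 i1 f hf => ?_⟩
  set k' : ℤ → (Fin n → ℝ) → ℂ := fun i y => (((A * (n+1))⁻¹ : ℝ) : ℂ) * k i (WithLp.toLp 2 y) with hk'
  have hKH : ∀ i, KH n i (k' i) := fun i => (hk i).toKH hA (hm i)
  set Lf : (GI n D → ℝ) →ₗ[ℝ] EuclideanSpace ℝ (Fin d) :=
    { toFun := fun v => WithLp.toLp 2 (fun j => ∑ α : GI n D, (P j).coeff (Finsupp.equivFunOnFinite.symm (fun i => (α.1 i : ℕ))) * v α)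
      map_add' := by
        intro u v; ext j; simp [mul_add, Finset.sum_add_distrib]
      map_smul' := by
        intro c v; ext j; simp [Finset.mul_sum, mul_left_comm] } with hLf
  set L := LinearMap.toContinuousLinearMap Lf with hL
  have hLP : ∀ y : Fin n → ℝ, L (QQ y) = Pm P (WithLp.toLp 2 y) := by
    intro y
    ext j
    change ∑ α : GI n D, (P j).coeff (Finsupp.equivFunOnFinite.symm (fun i => (α.1 i : ℕ))) * QQ y α = MvPolynomial.eval y (P j)
    rw [eval_QQ (P j) (hPd j) (hP0 j)]
  have e : ∀ i x, Op (k' i) (fun y => L (QQ y)) f x = (((A * (n+1))⁻¹ : ℝ) : ℂ) • Op (k i) (Pm P) f x := by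
    intro i x
    rw [hk', op_kconst_mul]
    congr 1
    unfold Op
    rw [← (PiLp.volume_preserving_toLp (Fin n)).integral_comp (MeasurableEquiv.toLp 2 (Fin n → ℝ)).measurableEmbedding]
    simp_rw [hLP]
  have hc : 0 < A * (n+1) := by positivity
  have e2 : ∀ i x t, Op (k i) (Pm P) f x t = ((A * (n+1) : ℝ) : ℂ) * Op (k' i) (fun y => L (QQ y)) f x t := by
    intro i x t
    rw [e, PiLp.smul_apply, smul_eq_mul, ← mul_assoc, ← Complex.ofReal_mul, mul_inv_cancel₀ hc.ne', Complex.ofReal_one, one_mul]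
  have e3 : (fun (t : ι) x => ⨆ j ∈ Finset.Icc i0 i1, ‖∑ i ∈ Finset.Icc j i1, Op (k i) (Pm P) f x t‖ₑ) =
      fun t x => ENNReal.ofReal (A * (n+1)) * ⨆ j ∈ Finset.Icc i0 i1, ‖∑ i ∈ Finset.Icc j i1, Op (k' i) (fun y => L (QQ y)) f x t‖ₑ := by
    funext t x
    simp_rw [e2, ← Finset.mul_sum, enorm_mul, ENNReal.mul_iSup]
    have : ‖((A * (n+1) : ℝ) : ℂ)‖ₑ = ENNReal.ofReal (A * (n+1)) := by
      rw [← ofReal_norm, Complex.norm_real, Real.norm_of_nonneg hc.le]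
    rw [this]
  rw [e3, NN_mul hp.le]
  · rw [ENNReal.ofReal_mul hA.le, mul_assoc, mul_assoc, mul_assoc]
    gcongr
    exact h k' hKH ι i0 i1 L f hf
  · intro t
    refine Measurable.biSup _ (Set.to_countable _) fun j _ => Measurable.enorm ?_
    refine Finset.measurable_fun_sum _ fun i _ => ?_
    exact (((hf.op (hKH i).cont.measurable (hKH i).int (L.continuous.comp continuous_QQ).measurable).coord t).meas).measurable

end SR
end

section

namespace SR

variable {n D d : ℕ}

section KEalg
variable {A A' : ℝ} {i : ℤ} {k k' : EuclideanSpace ℝ (Fin n) → ℂ}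

lemma KE.zero (n : ℕ) (hA : 0 ≤ A) : KE n A i (fun _ => 0) := by
  refine ⟨fun y => ?_, fun y y' => ?_, fun y _ => rfl⟩
  · simpa using hA
  · simp only [sub_self, norm_zero, zero_mul]; positivity

lemma KE.add (h : KE n A i k) (h' : KE n A' i k') : KE n (A + A') i (fun y => k y + k' y) := by
  refine ⟨fun y => ?_, fun y y' => ?_, fun y hy => by simp [h.supp y hy, h'.supp y hy]⟩
  · calc _ ≤ (‖k y‖ + ‖k' y‖) * ((2:ℝ) ^ i) ^ n := by gcongr; exact norm_add_le _ _
      _ = ‖k y‖ * ((2:ℝ) ^ i) ^ n + ‖k' y‖ * ((2:ℝ) ^ i) ^ n := by ring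
      _ ≤ _ := add_le_add (h.size y) (h'.size y)
  · calc _ ≤ (‖k y - k y'‖ + ‖k' y - k' y'‖) * ((2:ℝ) ^ i) ^ (n+1) := by
          gcongr; rw [add_sub_add_comm]; exact norm_add_le _ _
      _ = ‖k y - k y'‖ * ((2:ℝ) ^ i) ^ (n+1) + ‖k' y - k' y'‖ * ((2:ℝ) ^ i) ^ (n+1) := by ring
      _ ≤ A * ‖y - y'‖ + A' * ‖y - y'‖ := add_le_add (h.lip y y') (h'.lip y y')
      _ = _ := by ring

lemma KE.const_mul (h : KE n A i k) (c : ℂ) : KE n (‖c‖ * A) i (fun y => c * k y) := by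
  refine ⟨fun y => ?_, fun y y' => ?_, fun y hy => by simp [h.supp y hy]⟩
  · rw [norm_mul, mul_assoc]
    exact mul_le_mul_of_nonneg_left (h.size y) (norm_nonneg c)
  · rw [← mul_sub, norm_mul, mul_assoc, mul_assoc]
    exact mul_le_mul_of_nonneg_left (h.lip y y') (norm_nonneg c)

lemma KE.mono (h : KE n A i k) (hA : A ≤ A') : KE n A' i k :=
  ⟨fun y => (h.size y).trans hA, fun y y' => (h.lip y y').trans (mul_le_mul_of_nonneg_right hA (norm_nonneg _)), h.supp⟩

lemma KE.nonneg (h : KE n A i k) : 0 ≤ A := le_trans (by positivity) (h.size 0)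

lemma KE.up (h : KE n A (i-1) k) : KE n (2 ^ (n+1) * A) i k := by
  have e : (2:ℝ) ^ i = 2 * 2 ^ (i-1) := by
    rw [zpow_sub_one₀ (by norm_num)]; ring
  have hA := h.nonneg
  refine ⟨fun y => ?_, fun y y' => ?_, fun y hy => h.supp y (lt_of_le_of_lt ?_ hy)⟩
  · rw [e, mul_pow]
    calc _ = 2 ^ n * (‖k y‖ * ((2:ℝ) ^ (i-1)) ^ n) := by ring
      _ ≤ 2 ^ (n+1) * A := by
        gcongr
        · norm_num
        · lia
        · exact h.size y
  · rw [e, mul_pow]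
    calc _ = 2 ^ (n+1) * (‖k y - k y'‖ * ((2:ℝ) ^ (i-1)) ^ (n+1)) := by ring
      _ ≤ 2 ^ (n+1) * (A * ‖y - y'‖) := mul_le_mul_of_nonneg_left (h.lip y y') (by positivity)
      _ = _ := by ring
  · rw [e]; have : (0:ℝ) < 2 ^ (i-1) := by positivity
    linarith

lemma KE.cont (h : KE n A i k) : Continuous k := by
  have hb : (0:ℝ) ≤ A * (((2:ℝ) ^ i) ^ (n+1))⁻¹ := mul_nonneg h.nonneg (by positivity)
  apply LipschitzWith.continuous (K := NNReal.mk _ hb)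
  apply LipschitzWith.of_dist_le_mul
  intro y y'
  rw [dist_eq_norm, dist_eq_norm, NNReal.coe_mk, mul_right_comm, ← div_eq_mul_inv, le_div_iff₀ (by positivity)]
  exact h.lip y y'

lemma KE.int (h : KE n A i k) : Integrable k := by
  apply h.cont.integrable_of_hasCompactSupport
  apply HasCompactSupport.intro (isCompact_closedBall (0 : EuclideanSpace ℝ (Fin n)) (4 * (2:ℝ) ^ i))
  intro y hy
  rw [mem_closedBall_zero_iff, not_le] at hy
  exact h.supp y hy

end KEalg

/-- volume of the Euclidean unit ball -/
def vb (n : ℕ) : ℝ := volume.real (Metric.closedBall (0 : EuclideanSpace ℝ (Fin n)) 1)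

lemma vb_nonneg : 0 ≤ vb n := measureReal_nonneg

lemma ball_vol (r : ℝ) (hr : 0 ≤ r) : volume.real (Metric.closedBall (0 : EuclideanSpace ℝ (Fin n)) r) = r ^ n * vb n := by
  unfold vb Measure.real
  rw [Measure.addHaar_closedBall' _ _ hr]
  simp [ENNReal.toReal_mul, pow_nonneg hr]

lemma ball_ind (b c : ℝ) (hb : 0 < b) (hc : 0 ≤ c) :
    Integrable ((Metric.closedBall (0 : EuclideanSpace ℝ (Fin n)) (c * b)).indicator fun _ => (b ^ n)⁻¹) ∧
    ∫ y, (Metric.closedBall (0 : EuclideanSpace ℝ (Fin n)) (c * b)).indicator (fun _ => (b ^ n)⁻¹) y = c ^ n * vb n := by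
  constructor
  · rw [integrable_indicator_iff Metric.isClosed_closedBall.measurableSet]
    exact integrableOn_const (measure_closedBall_lt_top.ne)
  · rw [integral_indicator Metric.isClosed_closedBall.measurableSet, setIntegral_const, ball_vol _ (by positivity), smul_eq_mul, mul_pow]
    field_simp

/-- cutoff -/
def cut (j : ℤ) (y : EuclideanSpace ℝ (Fin n)) : ℝ := max 0 (min 1 (‖y‖ / 2 ^ j - 1))

lemma cut_nonneg (j : ℤ) (y : EuclideanSpace ℝ (Fin n)) : 0 ≤ cut j y := le_max_left _ _
lemma cut_le_one (j : ℤ) (y : EuclideanSpace ℝ (Fin n)) : cut j y ≤ 1 := max_le zero_le_one (min_le_left _ _)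
lemma cut_zero {j : ℤ} {y : EuclideanSpace ℝ (Fin n)} (h : ‖y‖ ≤ 2 ^ j) : cut j y = 0 := by
  unfold cut
  apply max_eq_left
  refine (min_le_right _ _).trans ?_
  have : ‖y‖ / 2 ^ j ≤ 1 := (div_le_one (by positivity)).2 h
  linarith
lemma cut_one {j : ℤ} {y : EuclideanSpace ℝ (Fin n)} (h : 2 * 2 ^ j ≤ ‖y‖) : cut j y = 1 := by
  unfold cut
  have : 2 ≤ ‖y‖ / 2 ^ j := (le_div_iff₀ (by positivity)).2 h
  rw [min_eq_left (by linarith)]; simp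
lemma cut_lip (j : ℤ) (y y' : EuclideanSpace ℝ (Fin n)) : |cut j y - cut j y'| ≤ ‖y - y'‖ / 2 ^ j := by
  unfold cut
  have h1 := abs_max_sub_max_le_abs (min 1 (‖y‖ / 2 ^ j - 1)) (min 1 (‖y'‖ / 2 ^ j - 1)) 0
  have h2 := abs_min_sub_min_le_max 1 (‖y‖ / 2 ^ j - 1) 1 (‖y'‖ / 2 ^ j - 1)
  rw [max_comm 0, max_comm 0]
  refine h1.trans (h2.trans ?_)
  rw [sub_self, abs_zero, max_eq_right (abs_nonneg _), sub_sub_sub_cancel_right, ← sub_div, abs_div, abs_of_pos (by positivity : (0:ℝ) < 2 ^ j)]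
  gcongr
  exact abs_norm_sub_norm_le y y'
lemma cut_cont (j : ℤ) : Continuous (cut (n := n) j) := by unfold cut; fun_prop

/-- normalizing constant -/
def ac (n : ℕ) : ℝ := ∫ y : EuclideanSpace ℝ (Fin n), max 0 (1 - ‖y‖)

lemma ac_pos : 0 < ac n := by
  unfold ac
  have hc : Continuous fun y : EuclideanSpace ℝ (Fin n) => max 0 (1 - ‖y‖) := by fun_prop
  apply hc.integral_pos_of_hasCompactSupport_nonneg_nonzero (x := 0)
  · apply HasCompactSupport.intro (isCompact_closedBall (0 : EuclideanSpace ℝ (Fin n)) 1)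
    intro y hy
    rw [mem_closedBall_zero_iff, not_le] at hy
    exact max_eq_left (by linarith)
  · intro y; exact le_max_left _ _
  · simp

/-- normalized bump at scale `2^j` -/
def bm (j : ℤ) (y : EuclideanSpace ℝ (Fin n)) : ℝ := (ac n)⁻¹ * ((((2:ℝ) ^ j) ^ n)⁻¹ * max 0 (1 - ‖y‖ / 2 ^ j))

lemma bm_nonneg (j : ℤ) (y : EuclideanSpace ℝ (Fin n)) : 0 ≤ bm j y := by
  unfold bm
  have := ac_pos (n := n)
  positivity

lemma bm_KE (j : ℤ) : KE n (ac n)⁻¹ j (fun y => (bm j y : ℂ)) := by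
  have ha := ac_pos (n := n)
  have hb : (0:ℝ) < 2 ^ j := by positivity
  refine ⟨fun y => ?_, fun y y' => ?_, fun y hy => ?_⟩
  · rw [Complex.norm_real, Real.norm_of_nonneg (bm_nonneg j y)]
    unfold bm
    have : max 0 (1 - ‖y‖ / 2 ^ j) ≤ 1 := max_le zero_le_one (by linarith [div_nonneg (norm_nonneg y) hb.le])
    calc _ = (ac n)⁻¹ * max 0 (1 - ‖y‖ / 2 ^ j) := by field_simp
      _ ≤ (ac n)⁻¹ * 1 := by gcongr
      _ = _ := mul_one _
  · rw [← Complex.ofReal_sub, Complex.norm_real, Real.norm_eq_abs]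
    unfold bm
    rw [← mul_sub, ← mul_sub, abs_mul, abs_mul, abs_of_pos (inv_pos.2 ha), abs_of_pos (by positivity : 0 < (((2:ℝ) ^ j) ^ n)⁻¹)]
    have h1 : |max 0 (1 - ‖y‖ / 2 ^ j) - max 0 (1 - ‖y'‖ / 2 ^ j)| ≤ ‖y - y'‖ / 2 ^ j := by
      rw [max_comm 0, max_comm 0]
      refine (abs_max_sub_max_le_abs _ _ _).trans ?_
      rw [sub_sub_sub_cancel_left, ← sub_div, abs_div, abs_of_pos hb, abs_sub_comm]
      gcongr
      exact abs_norm_sub_norm_le y y'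
    calc _ ≤ (ac n)⁻¹ * ((((2:ℝ) ^ j) ^ n)⁻¹ * (‖y - y'‖ / 2 ^ j)) * ((2:ℝ) ^ j) ^ (n+1) := by gcongr
      _ = _ := by rw [pow_succ]; field_simp
  · unfold bm
    have : 1 ≤ ‖y‖ / 2 ^ j := (le_div_iff₀ hb).2 (by linarith)
    rw [max_eq_left (by linarith)]; simp

lemma bm_int (j : ℤ) : ∫ y : EuclideanSpace ℝ (Fin n), (bm j y : ℂ) = 1 := by
  have ha := ac_pos (n := n)
  have hb : (0:ℝ) < 2 ^ j := by positivity
  rw [integral_complex_ofReal]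
  unfold bm
  rw [integral_const_mul, integral_const_mul]
  have h1 := Measure.integral_comp_inv_smul (volume : Measure (EuclideanSpace ℝ (Fin n))) (fun y => max 0 (1 - ‖y‖)) ((2:ℝ)^j)
  have h2 : ∀ y : EuclideanSpace ℝ (Fin n), ‖((2:ℝ)^j)⁻¹ • y‖ = ‖y‖ / 2 ^ j := by
    intro y; rw [norm_smul, norm_inv, Real.norm_of_nonneg hb.le]; field_simp
  simp only [h2] at h1
  rw [h1, finrank_euclideanSpace, Fintype.card_fin, abs_of_pos (by positivity), smul_eq_mul]
  change (((ac n)⁻¹ * ((((2:ℝ) ^ j) ^ n)⁻¹ * (((2:ℝ) ^ j) ^ n * ac n)) : ℝ) : ℂ) = 1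
  rw [inv_mul_cancel_left₀ (by positivity), inv_mul_cancel₀ ha.ne', Complex.ofReal_one]

section CZ
variable {K : EuclideanSpace ℝ (Fin n) → ℂ}

lemma K_size (hK2 : ∀ y : EuclideanSpace ℝ (Fin n), y ≠ 0 → ‖y‖ ^ n * ‖K y‖ + ‖y‖ ^ (n + 1) * ‖fderiv ℝ K y‖ ≤ 1)
    {b : ℝ} (hb : 0 < b) {y : EuclideanSpace ℝ (Fin n)} (hy : b ≤ ‖y‖) : ‖K y‖ * b ^ n ≤ 1 := by
  have h0 : y ≠ 0 := norm_pos_iff.1 (hb.trans_le hy)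
  have := hK2 y h0
  have h2 : b ^ n ≤ ‖y‖ ^ n := by gcongr
  have h3 : 0 ≤ ‖y‖ ^ (n + 1) * ‖fderiv ℝ K y‖ := by positivity
  nlinarith [norm_nonneg (K y)]

lemma K_lip (hK1 : ContDiffOn ℝ 1 K {0}ᶜ)
    (hK2 : ∀ y : EuclideanSpace ℝ (Fin n), y ≠ 0 → ‖y‖ ^ n * ‖K y‖ + ‖y‖ ^ (n + 1) * ‖fderiv ℝ K y‖ ≤ 1)
    {b : ℝ} (hb : 0 < b) {y y' : EuclideanSpace ℝ (Fin n)} (hy : b ≤ ‖y‖) (hyy : ‖y - y'‖ < b / 2) :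
    ‖K y - K y'‖ * b ^ (n+1) ≤ 2 ^ (n+1) * ‖y - y'‖ := by
  have hS : ∀ z ∈ Metric.ball y (b/2), b / 2 ≤ ‖z‖ := by
    intro z hz
    rw [mem_ball_iff_norm] at hz
    have := norm_sub_norm_le y z
    rw [norm_sub_rev] at this
    linarith
  have hz0 : ∀ z ∈ Metric.ball y (b/2), z ≠ 0 := fun z hz => norm_pos_iff.1 (by linarith [hS z hz])
  have hd : ∀ z ∈ Metric.ball y (b/2), DifferentiableAt ℝ K z := by
    intro z hz
    exact (hK1.contDiffAt (isOpen_compl_singleton.mem_nhds (hz0 z hz))).differentiableAt (by norm_num)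
  have hbd : ∀ z ∈ Metric.ball y (b/2), ‖fderiv ℝ K z‖ ≤ ((b/2) ^ (n+1))⁻¹ := by
    intro z hz
    have h1 := hK2 z (hz0 z hz)
    have h2 : (b/2) ^ (n+1) ≤ ‖z‖ ^ (n+1) := by gcongr; exact hS z hz
    rw [← one_div, le_div_iff₀ (by positivity)]
    have h3 : 0 ≤ ‖z‖ ^ n * ‖K z‖ := by positivity
    nlinarith [norm_nonneg (fderiv ℝ K z)]
  have := (convex_ball y (b/2)).norm_image_sub_le_of_norm_fderiv_le hd hbd (y := y) (x := y')
    (by rw [mem_ball_iff_norm, norm_sub_rev]; exact hyy) (Metric.mem_ball_self (by positivity))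
  calc _ ≤ (((b/2) ^ (n+1))⁻¹ * ‖y - y'‖) * b ^ (n+1) := by gcongr
    _ = _ := by rw [div_pow]; field_simp

lemma Ku_KE (hK1 : ContDiffOn ℝ 1 K {0}ᶜ)
    (hK2 : ∀ y : EuclideanSpace ℝ (Fin n), y ≠ 0 → ‖y‖ ^ n * ‖K y‖ + ‖y‖ ^ (n + 1) * ‖fderiv ℝ K y‖ ≤ 1)
    (i : ℤ) : KE n (4 + 2 ^ (n+1)) i (fun y => K y * ((cut i y - cut (i+1) y : ℝ) : ℂ)) := by
  have hb : (0:ℝ) < 2 ^ i := by positivity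
  have e : (2:ℝ) ^ (i+1) = 2 * 2 ^ i := by rw [zpow_add_one₀ (by norm_num)]; ring
  have hp : (0:ℝ) < 2 ^ (n+1) := by positivity
  set u : EuclideanSpace ℝ (Fin n) → ℝ := fun y => cut i y - cut (i+1) y with hu
  have hu1 : ∀ y, |u y| ≤ 1 := by
    intro y
    have h1 := cut_nonneg i y; have h2 := cut_le_one i y
    have h3 := cut_nonneg (i+1) y; have h4 := cut_le_one (i+1) y
    rw [abs_le]; constructor <;> simp only [hu] <;> linarith
  have hu0 : ∀ y, ‖y‖ ≤ 2 ^ i → u y = 0 := by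
    intro y hy
    simp only [hu]
    rw [cut_zero hy, cut_zero (by linarith), sub_zero]
  have hul : ∀ y y', |u y - u y'| ≤ 2 * (‖y - y'‖ / 2 ^ i) := by
    intro y y'
    have h1 := cut_lip i y y'
    have h2 := cut_lip (i+1) y y'
    have h3 : ‖y - y'‖ / 2 ^ (i+1) ≤ ‖y - y'‖ / 2 ^ i := by
      rw [e]; gcongr; linarith
    have : u y - u y' = (cut i y - cut i y') - (cut (i+1) y - cut (i+1) y') := by simp only [hu]; ring
    rw [this]
    refine (abs_sub _ _).trans ?_
    linarith
  have hsz : ∀ y, ‖K y * (u y : ℂ)‖ * ((2:ℝ) ^ i) ^ n ≤ 1 := by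
    intro y
    by_cases hy : ‖y‖ ≤ 2 ^ i
    · rw [hu0 y hy]; simp
    · have h1 := K_size hK2 hb (not_le.1 hy).le
      rw [norm_mul, Complex.norm_real, Real.norm_eq_abs]
      calc ‖K y‖ * |u y| * ((2:ℝ) ^ i) ^ n = (‖K y‖ * ((2:ℝ) ^ i) ^ n) * |u y| := by ring
        _ ≤ 1 * 1 := by gcongr; exact hu1 y
        _ = 1 := one_mul _
  have hlip : ∀ y y', 2 ^ i ≤ ‖y‖ → ‖y - y'‖ < 2 ^ i / 2 →
      ‖K y * (u y : ℂ) - K y' * (u y' : ℂ)‖ * ((2:ℝ) ^ i) ^ (n+1) ≤ (4 + 2 ^ (n+1)) * ‖y - y'‖ := by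
    intro y y' hy hyy
    have h1 := K_size hK2 hb hy
    have h2 := K_lip hK1 hK2 hb hy hyy
    have e1 : K y * (u y : ℂ) - K y' * (u y' : ℂ) = K y * ((u y - u y' : ℝ) : ℂ) + (K y - K y') * (u y' : ℂ) := by
      push_cast; ring
    rw [e1]
    calc _ ≤ (‖K y‖ * |u y - u y'| + ‖K y - K y'‖ * |u y'|) * ((2:ℝ) ^ i) ^ (n+1) := by
          gcongr
          refine (norm_add_le _ _).trans (le_of_eq ?_)
          rw [norm_mul, norm_mul, Complex.norm_real, Complex.norm_real, Real.norm_eq_abs, Real.norm_eq_abs]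
      _ = (‖K y‖ * ((2:ℝ) ^ i) ^ n) * (|u y - u y'| * 2 ^ i) + (‖K y - K y'‖ * ((2:ℝ) ^ i) ^ (n+1)) * |u y'| := by ring
      _ ≤ 1 * ((2 * (‖y - y'‖ / 2 ^ i)) * 2 ^ i) + (2 ^ (n+1) * ‖y - y'‖) * 1 := by
          gcongr
          · exact hul y y'
          · exact hu1 y'
      _ ≤ _ := by
          have : (2 * (‖y - y'‖ / 2 ^ i)) * 2 ^ i = 2 * ‖y - y'‖ := by field_simp
          rw [this]; nlinarith [norm_nonneg (y - y')]
  refine ⟨fun y => (hsz y).trans (by linarith), fun y y' => ?_, fun y hy => ?_⟩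
  · by_cases hyy : ‖y - y'‖ < 2 ^ i / 2
    · by_cases h1 : 2 ^ i ≤ ‖y‖
      · exact hlip y y' h1 hyy
      · by_cases h2 : 2 ^ i ≤ ‖y'‖
        · rw [norm_sub_rev, norm_sub_rev y]; rw [norm_sub_rev] at hyy
          exact hlip y' y h2 hyy
        · have a1 := hu0 y (not_le.1 h1).le
          have a2 := hu0 y' (not_le.1 h2).le
          simp only [hu] at a1 a2
          rw [a1, a2]; simp; positivity
    · rw [not_lt] at hyy
      calc _ ≤ (‖K y * (u y : ℂ)‖ + ‖K y' * (u y' : ℂ)‖) * ((2:ℝ) ^ i) ^ (n+1) := by gcongr; exact norm_sub_le _ _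
        _ = (‖K y * (u y : ℂ)‖ * ((2:ℝ) ^ i) ^ n + ‖K y' * (u y' : ℂ)‖ * ((2:ℝ) ^ i) ^ n) * 2 ^ i := by ring
        _ ≤ (1 + 1) * 2 ^ i := by gcongr; exact hsz y; exact hsz y'
        _ ≤ _ := by nlinarith [norm_nonneg (y - y')]
  · rw [cut_one (by linarith), cut_one (by linarith)]; simp

end CZ

end SR
end

section

namespace SR

variable {n D d : ℕ}

/-- size and smoothness hypotheses of a Calderón–Zygmund kernel -/
structure CZ (n : ℕ) (K : EuclideanSpace ℝ (Fin n) → ℂ) : Prop where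
  diff : ContDiffOn ℝ 1 K {0}ᶜ
  bd : ∀ y : EuclideanSpace ℝ (Fin n), y ≠ 0 → ‖y‖ ^ n * ‖K y‖ + ‖y‖ ^ (n + 1) * ‖fderiv ℝ K y‖ ≤ 1
  canc : ∀ r R : ℝ, 0 < r → r < R → ‖∫ y in {y : EuclideanSpace ℝ (Fin n) | r ≤ ‖y‖ ∧ ‖y‖ ≤ R}, K y‖ ≤ 1

variable {K : EuclideanSpace ℝ (Fin n) → ℂ}

/-- smoothly truncated kernel -/
def Kp (K : EuclideanSpace ℝ (Fin n) → ℂ) (N j : ℤ) (y : EuclideanSpace ℝ (Fin n)) : ℂ := K y * ((cut j y - cut N y : ℝ) : ℂ)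

lemma Kp_sub (N i : ℤ) (y : EuclideanSpace ℝ (Fin n)) : Kp K N i y - Kp K N (i+1) y = Kp K (i+1) i y := by
  unfold Kp; push_cast; ring

lemma Kp_self (N : ℤ) : Kp K N N = fun _ => 0 := by
  funext y; unfold Kp; simp

lemma Kp_good (hK : CZ n K) (N j : ℤ) (hj : j ≤ N) : Integrable (Kp K N j) ∧ Measurable (Kp K N j) := by
  induction j, hj using Int.le_induction_down with
  | base => rw [Kp_self]; exact ⟨integrable_zero _ _ _, measurable_const⟩
  | pred j hj ih =>
    have h := Ku_KE hK.diff hK.bd (j-1)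
    have e : Kp K N (j-1) = fun y => Kp K j (j-1) y + Kp K N j y := by
      funext y
      have := Kp_sub (K := K) N (j-1) y
      rw [sub_add_cancel] at this
      rw [← this]; ring
    rw [sub_add_cancel] at h
    rw [e]
    exact ⟨h.int.add ih.1, h.cont.measurable.add ih.2⟩

/-- total mass -/
def BB (K : EuclideanSpace ℝ (Fin n) → ℂ) (N j : ℤ) : ℂ := ∫ y, Kp K N j y

/-- bound for the masses -/
def bc (n : ℕ) : ℝ := 1 + 2 * 2 ^ n * vb n + 4 ^ n * vb n

lemma BB_bd (hK : CZ n K) (N j : ℤ) (hj : j ≤ N) : ‖BB K N j‖ ≤ bc n := by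
  have hv := vb_nonneg (n := n)
  unfold bc
  rcases hj.eq_or_lt with rfl | hj
  · unfold BB; rw [Kp_self]; simp; positivity
  have hb : (0:ℝ) < 2 ^ j := by positivity
  have hbN : (0:ℝ) < 2 ^ N := by positivity
  have hjN : 2 * (2:ℝ) ^ j ≤ 2 ^ N := by
    calc 2 * (2:ℝ) ^ j = 2 ^ (j+1) := by rw [zpow_add_one₀ (by norm_num)]; ring
      _ ≤ 2 ^ N := zpow_le_zpow_right₀ (by norm_num) (by lia)
  have hu1 : ∀ y : EuclideanSpace ℝ (Fin n), |cut j y - cut N y| ≤ 1 := by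
    intro y
    have h1 := cut_nonneg j y; have h2 := cut_le_one j y
    have h3 := cut_nonneg N y; have h4 := cut_le_one N y
    rw [abs_le]; constructor <;> linarith
  have hsz : ∀ (b : ℝ), 0 < b → ∀ y : EuclideanSpace ℝ (Fin n), b ≤ ‖y‖ → ‖Kp K N j y‖ ≤ (b ^ n)⁻¹ := by
    intro b hb y hy
    have h1 := K_size hK.bd hb hy
    rw [← one_div, le_div_iff₀ (by positivity)]
    unfold Kp
    rw [norm_mul, Complex.norm_real, Real.norm_eq_abs]
    calc ‖K y‖ * |cut j y - cut N y| * b ^ n = (‖K y‖ * b ^ n) * |cut j y - cut N y| := by ring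
      _ ≤ 1 * 1 := by gcongr; exact hu1 y
      _ = 1 := one_mul _
  have hz1 : ∀ y : EuclideanSpace ℝ (Fin n), ‖y‖ ≤ 2 ^ j → Kp K N j y = 0 := by
    intro y hy; unfold Kp; rw [cut_zero hy, cut_zero (by linarith)]; simp
  have hz2 : ∀ y : EuclideanSpace ℝ (Fin n), 2 * 2 ^ N ≤ ‖y‖ → Kp K N j y = 0 := by
    intro y hy; unfold Kp; rw [cut_one hy, cut_one (by linarith)]; simp
  rcases hjN.eq_or_lt with he | hlt
  · obtain ⟨i1, i2⟩ := ball_ind (n := n) (2 ^ j) 4 hb (by norm_num)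
    have : ‖BB K N j‖ ≤ 4 ^ n * vb n := by
      rw [← i2]
      unfold BB
      refine norm_integral_le_of_norm_le i1 (Filter.Eventually.of_forall fun y => ?_)
      by_cases hy1 : ‖y‖ ≤ 2 ^ j
      · rw [hz1 y hy1, norm_zero]; apply Set.indicator_nonneg; intro y _; positivity
      · by_cases hy2 : 2 * 2 ^ N ≤ ‖y‖
        · rw [hz2 y hy2, norm_zero]; apply Set.indicator_nonneg; intro y _; positivity
        · rw [Set.indicator_of_mem]
          · exact hsz _ hb y (by linarith)
          · rw [mem_closedBall_zero_iff]; linarith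
    have h0 : 0 ≤ 1 + 2 * 2 ^ n * vb n := by positivity
    linarith
  · set S := {y : EuclideanSpace ℝ (Fin n) | 2 * 2 ^ j ≤ ‖y‖ ∧ ‖y‖ ≤ 2 ^ N} with hS
    have mS : IsClosed S := (isClosed_le continuous_const continuous_norm).inter (isClosed_le continuous_norm continuous_const)
    have cS : IsCompact S := (isCompact_closedBall (0 : EuclideanSpace ℝ (Fin n)) (2 ^ N)).of_isClosed_subset mS
      (fun y hy => by rw [mem_closedBall_zero_iff]; exact hy.2)
    have iS : IntegrableOn K S := by
      apply ContinuousOn.integrableOn_compact cS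
      apply hK.diff.continuousOn.mono
      intro y hy h0
      have h1 := hy.1
      rw [Set.mem_singleton_iff.1 h0, norm_zero] at h1
      linarith
    have iS' : Integrable (S.indicator K) := (integrable_indicator_iff mS.measurableSet).2 iS
    obtain ⟨i1, i2⟩ := ball_ind (n := n) (2 ^ j) 2 hb (by norm_num)
    obtain ⟨i3, i4⟩ := ball_ind (n := n) (2 ^ N) 2 hbN (by norm_num)
    have h1 : ‖∫ y, S.indicator K y‖ ≤ 1 := by
      rw [integral_indicator mS.measurableSet]
      exact hK.canc _ _ (by positivity) hlt
    have h2 : ‖∫ y, (Kp K N j y - S.indicator K y)‖ ≤ 2 ^ n * vb n + 2 ^ n * vb n := by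
      have i5 := integral_add i1 i3
      rw [i2, i4] at i5
      rw [← i5]
      refine norm_integral_le_of_norm_le (i1.add i3) (Filter.Eventually.of_forall fun y => ?_)
      have p1 : 0 ≤ (Metric.closedBall (0 : EuclideanSpace ℝ (Fin n)) (2 * 2 ^ j)).indicator (fun _ => (((2:ℝ) ^ j) ^ n)⁻¹) y :=
        Set.indicator_nonneg (fun y _ => by positivity) y
      have p2 : 0 ≤ (Metric.closedBall (0 : EuclideanSpace ℝ (Fin n)) (2 * 2 ^ N)).indicator (fun _ => (((2:ℝ) ^ N) ^ n)⁻¹) y :=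
        Set.indicator_nonneg (fun y _ => by positivity) y
      by_cases hy : y ∈ S
      · have : Kp K N j y = K y := by
          unfold Kp; rw [cut_one hy.1, cut_zero hy.2]; simp
        rw [Set.indicator_of_mem hy, this, sub_self, norm_zero]
        exact add_nonneg p1 p2
      · rw [Set.indicator_of_notMem hy, sub_zero]
        by_cases q1 : ‖y‖ ≤ 2 ^ j
        · rw [hz1 y q1, norm_zero]; exact add_nonneg p1 p2
        by_cases q2 : 2 * 2 ^ N ≤ ‖y‖
        · rw [hz2 y q2, norm_zero]; exact add_nonneg p1 p2
        by_cases q3 : ‖y‖ ≤ 2 * 2 ^ j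
        · refine le_trans ?_ (le_add_of_nonneg_right p2)
          rw [Set.indicator_of_mem (by rw [mem_closedBall_zero_iff]; exact q3)]
          exact hsz _ hb y (not_le.1 q1).le
        · refine le_trans ?_ (le_add_of_nonneg_left p1)
          rw [Set.indicator_of_mem (by rw [mem_closedBall_zero_iff]; exact (not_le.1 q2).le)]
          refine hsz _ hbN y ?_
          by_contra q4
          exact hy ⟨(not_le.1 q3).le, (not_le.1 q4).le⟩
    rw [integral_sub (Kp_good hK N j hj.le).1 iS'] at h2
    have h3 : ‖BB K N j‖ ≤ ‖∫ y, S.indicator K y‖ + ‖BB K N j - ∫ y, S.indicator K y‖ := by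
      have := norm_add_le (∫ y, S.indicator K y) (BB K N j - ∫ y, S.indicator K y)
      rwa [add_sub_cancel] at this
    have h4 : 0 ≤ 4 ^ n * vb n := by positivity
    have h5 : ‖BB K N j - ∫ y, S.indicator K y‖ ≤ 2 ^ n * vb n + 2 ^ n * vb n := h2
    linarith

/-- mean zero pieces -/
def kk (K : EuclideanSpace ℝ (Fin n) → ℂ) (N i : ℤ) (y : EuclideanSpace ℝ (Fin n)) : ℂ :=
  if i < N then Kp K (i+1) i y + (-BB K N i) * (bm (i-1) y : ℂ) + BB K N (i+1) * (bm i y : ℂ) else 0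

/-- constant for the pieces -/
def ak (n : ℕ) : ℝ := 4 + 2 ^ (n+1) + bc n * (2 ^ (n+1) * (ac n)⁻¹) + bc n * (ac n)⁻¹

lemma bc_pos : 0 < bc n := by have := vb_nonneg (n := n); unfold bc; positivity
lemma ak_pos : 0 < ak n := by have := bc_pos (n := n); have := ac_pos (n := n); unfold ak; positivity

lemma kk_KE (hK : CZ n K) (N i : ℤ) : KE n (ak n) i (kk K N i) := by
  unfold kk
  have ha := ac_pos (n := n)
  split_ifs with h
  · refine (((Ku_KE hK.diff hK.bd i).add ((bm_KE (i-1)).up.const_mul (-BB K N i))).add ((bm_KE i).const_mul (BB K N (i+1)))).mono ?_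
    unfold ak
    rw [norm_neg]
    have h1 := BB_bd hK N i h.le
    have h2 := BB_bd hK N (i+1) (by lia)
    gcongr
  · exact KE.zero n ak_pos.le

lemma kk_mean (hK : CZ n K) (N i : ℤ) : ∫ y, kk K N i y = 0 := by
  unfold kk
  split_ifs with h
  · have i1 := (Kp_good hK (i+1) i (by lia)).1
    have i2 := (bm_KE (n := n) (i-1)).int.const_mul (-BB K N i)
    have i3 := (bm_KE (n := n) i).int.const_mul (BB K N (i+1))
    have e1 := integral_add (i1.add i2) i3
    simp only [Pi.add_apply] at e1
    rw [e1, integral_add i1 i2, integral_const_mul, integral_const_mul, bm_int, bm_int]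
    have : ∫ y, Kp K (i+1) i y = BB K N i - BB K N (i+1) := by
      unfold BB
      rw [← integral_sub (Kp_good hK N i h.le).1 (Kp_good hK N (i+1) (by lia)).1]
      simp_rw [Kp_sub]
    rw [this]; ring
  · simp

lemma kk_sum (N j : ℤ) (hj : j ≤ N) (y : EuclideanSpace ℝ (Fin n)) :
    Kp K N j y = ∑ i ∈ Finset.Icc j (N-1), kk K N i y + BB K N j * (bm (j-1) y : ℂ) := by
  have h := telescope (fun i => Kp K N (i+1) y - BB K N (i+1) * (bm i y : ℂ)) (a := j-1) (b := N-1) (by lia)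
  have e : Finset.Ioc (j-1) (N-1) = Finset.Icc j (N-1) := by
    ext x; simp only [Finset.mem_Ioc, Finset.mem_Icc]; lia
  rw [e] at h
  have hN : BB K N N = 0 := by unfold BB; rw [Kp_self]; simp
  simp only [sub_add_cancel] at h
  rw [Kp_self, hN] at h
  have h2 : ∑ i ∈ Finset.Icc j (N-1), kk K N i y = ∑ l ∈ Finset.Icc j (N-1),
      (Kp K N l y - BB K N l * (bm (l-1) y : ℂ) - (Kp K N (l+1) y - BB K N (l+1) * (bm l y : ℂ))) := by
    refine Finset.sum_congr rfl fun i hi => ?_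
    have : i < N := by have := (Finset.mem_Icc.1 hi).2; lia
    unfold kk
    rw [if_pos this, ← Kp_sub N i y]; ring
  rw [h2, h]; ring

end SR
end

section

namespace SR

variable {n D d : ℕ}

lemma sup_meas {ι : Type} [Fintype ι] {A : Type*} (s : Finset A) {k : A → EuclideanSpace ℝ (Fin n) → ℂ} (hk : ∀ a ∈ s, Measurable (k a) ∧ Integrable (k a))
    {Q : EuclideanSpace ℝ (Fin n) → EuclideanSpace ℝ (Fin d)} (hQ : Measurable Q)
    {f : EuclideanSpace ℝ (Fin d) → EuclideanSpace ℂ ι} (hf : Nice f) (t : ι) :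
    Measurable fun x => ⨆ j ∈ s, ‖Op (k j) Q f x t‖ₑ :=
  Measurable.biSup _ (Set.to_countable _) fun j hj =>
    (((hf.op (hk j hj).1 (hk j hj).2 hQ).coord t).meas).measurable.enorm

lemma sup_sum_meas {ι : Type} [Fintype ι] (s : Finset ℤ) (i1 : ℤ) {k : ℤ → EuclideanSpace ℝ (Fin n) → ℂ} (hk : ∀ a, Measurable (k a) ∧ Integrable (k a))
    {Q : EuclideanSpace ℝ (Fin n) → EuclideanSpace ℝ (Fin d)} (hQ : Measurable Q)
    {f : EuclideanSpace ℝ (Fin d) → EuclideanSpace ℂ ι} (hf : Nice f) (t : ι) :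
    Measurable fun x => ⨆ j ∈ s, ‖∑ i ∈ Finset.Icc j i1, Op (k i) Q f x t‖ₑ :=
  Measurable.biSup _ (Set.to_countable _) fun j hj => Measurable.enorm <|
    Finset.measurable_fun_sum _ fun i _ => (((hf.op (hk i).1 (hk i).2 hQ).coord t).meas).measurable

lemma bm_l1 (j : ℤ) : ∫⁻ y : EuclideanSpace ℝ (Fin n), ‖(bm j y : ℂ)‖ₑ = 1 := by
  have hi : Integrable (fun y : EuclideanSpace ℝ (Fin n) => bm j y) := by
    have := (bm_KE (n := n) j).int.re
    simpa using this
  have h1 := ofReal_integral_eq_lintegral_ofReal hi (Filter.Eventually.of_forall fun y => bm_nonneg j y)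
  have h2 : ∫ y : EuclideanSpace ℝ (Fin n), bm j y = 1 := by
    have := bm_int (n := n) j
    rw [integral_complex_ofReal] at this
    exact_mod_cast this
  rw [h2, ENNReal.ofReal_one] at h1
  rw [h1]
  apply lintegral_congr; intro y
  rw [← ofReal_norm, Complex.norm_real, Real.norm_of_nonneg (bm_nonneg j y)]

theorem avg_max (hn : 0 < n) (hD : 0 < D) (p : ℝ) (hp : 1 < p) : ∃ C : ℝ≥0∞, C ≠ ∞ ∧
    ∀ P : Fin d → MvPolynomial (Fin n) ℝ, (∀ j, (P j).totalDegree ≤ D) → (∀ j, MvPolynomial.eval (fun _ => (0 : ℝ)) (P j) = 0) →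
    ∀ (ι : Type) [Fintype ι] (i0 i1 : ℤ) (f : EuclideanSpace ℝ (Fin d) → EuclideanSpace ℂ ι), Nice f →
      NN p (fun t x => ⨆ j ∈ Finset.Icc i0 i1, ‖Op (fun y => (bm (j-1) y : ℂ)) (Pm P) f x t‖ₑ) ≤ C * lpn p f := by
  obtain ⟨C, hC, h⟩ := maxE (n := n) (D := D) (d := d) hn hD p hp
  have ha := ac_pos (n := n)
  set A := 2 ^ (n+1) * (ac n)⁻¹ + ‖(-1:ℂ)‖ * (ac n)⁻¹ with hA
  have hA0 : 0 < A := by positivity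
  refine ⟨ENNReal.ofReal A * C + 1, ENNReal.add_ne_top.2 ⟨ENNReal.mul_ne_top ENNReal.ofReal_ne_top hC, ENNReal.one_ne_top⟩,
    fun P hPd hP0 ι _ i0 i1 f hf => ?_⟩
  set k : ℤ → EuclideanSpace ℝ (Fin n) → ℂ := fun i y => (bm (i-1) y : ℂ) + (-1) * (bm i y : ℂ) with hk
  have hKE : ∀ i, KE n A i (k i) := fun i => ((bm_KE (i-1)).up).add ((bm_KE i).const_mul (-1))
  have hm : ∀ i, ∫ y, k i y = 0 := by
    intro i
    rw [hk]; beta_reduce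
    rw [integral_add (bm_KE (n := n) (i-1)).int ((bm_KE (n := n) i).int.const_mul _), integral_const_mul, bm_int, bm_int]; ring
  have hQ := (Pm_cont P).measurable
  have hb : ∀ j : ℤ, Measurable (fun y : EuclideanSpace ℝ (Fin n) => (bm j y : ℂ)) ∧ Integrable (fun y : EuclideanSpace ℝ (Fin n) => (bm j y : ℂ)) :=
    fun j => ⟨(bm_KE j).cont.measurable, (bm_KE j).int⟩
  have key : ∀ t x, ⨆ j ∈ Finset.Icc i0 i1, ‖Op (fun y => (bm (j-1) y : ℂ)) (Pm P) f x t‖ₑ ≤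
      (⨆ j ∈ Finset.Icc i0 i1, ‖∑ i ∈ Finset.Icc j i1, Op (k i) (Pm P) f x t‖ₑ) + ‖Op (fun y => (bm i1 y : ℂ)) (Pm P) f x t‖ₑ := by
    intro t x
    refine iSup₂_le fun j hj => ?_
    have e : Op (fun y => (bm (j-1) y : ℂ)) (Pm P) f x t = ∑ i ∈ Finset.Icc j i1, Op (k i) (Pm P) f x t + Op (fun y => (bm i1 y : ℂ)) (Pm P) f x t := by
      simp_rw [op_coord (hKE _).int hQ hf, op_coord (hb _).2 hQ hf]
      rw [← op_ksum (fun i _ => (hKE i).int) hQ (hf.coord t), ← op_kadd (integrable_finset_sum _ fun i _ => (hKE i).int) (hb i1).2 hQ (hf.coord t)]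
      congr 1
      funext y
      have e1 := telescope (fun i => (bm i y : ℂ)) (a := j-1) (b := i1) (by have := (Finset.mem_Icc.1 hj).2; lia)
      have e2 : Finset.Ioc (j-1) i1 = Finset.Icc j i1 := by
        ext x; simp only [Finset.mem_Ioc, Finset.mem_Icc]; lia
      rw [e2] at e1
      have e3 : ∑ i ∈ Finset.Icc j i1, k i y = ∑ l ∈ Finset.Icc j i1, ((bm (l-1) y : ℂ) - (bm l y : ℂ)) :=
        Finset.sum_congr rfl fun i _ => by rw [hk]; ring
      rw [e3, e1]; ring
    rw [e]
    refine (enorm_add_le _ _).trans (add_le_add ?_ le_rfl)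
    exact le_iSup₂ (f := fun j (_ : j ∈ Finset.Icc i0 i1) => ‖∑ i ∈ Finset.Icc j i1, Op (k i) (Pm P) f x t‖ₑ) j hj
  refine (NN_mono hp.le key).trans ((NN_add hp.le ?_ ?_).trans ?_)
  · exact fun t => sup_sum_meas _ i1 (fun i => ⟨(hKE i).cont.measurable, (hKE i).int⟩) hQ hf t
  · exact fun t => (((hf.op (hb i1).1 (hb i1).2 hQ).coord t).meas).measurable.enorm
  · rw [add_mul, one_mul]
    refine add_le_add (h A hA0 k hKE hm P hPd hP0 ι i0 i1 f hf) ?_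
    rw [NN_vec]
    refine (lpn_op hp.le (hb i1).1 hQ hf).trans ?_
    rw [bm_l1, one_mul]

theorem trunc_max (hn : 0 < n) (hD : 0 < D) (p : ℝ) (hp : 1 < p) : ∃ C : ℝ≥0∞, C ≠ ∞ ∧
    ∀ P : Fin d → MvPolynomial (Fin n) ℝ, (∀ j, (P j).totalDegree ≤ D) → (∀ j, MvPolynomial.eval (fun _ => (0 : ℝ)) (P j) = 0) →
    ∀ K : EuclideanSpace ℝ (Fin n) → ℂ, CZ n K →
    ∀ (ι : Type) [Fintype ι] (i0 N : ℤ) (f : EuclideanSpace ℝ (Fin d) → EuclideanSpace ℂ ι), Nice f →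
      NN p (fun t x => ⨆ j ∈ Finset.Icc i0 (N-1), ‖Op (Kp K N j) (Pm P) f x t‖ₑ) ≤ C * lpn p f := by
  obtain ⟨C, hC, h⟩ := maxE (n := n) (D := D) (d := d) hn hD p hp
  obtain ⟨C', hC', h'⟩ := avg_max (n := n) (D := D) (d := d) hn hD p hp
  refine ⟨ENNReal.ofReal (ak n) * C + ENNReal.ofReal (bc n) * C', ENNReal.add_ne_top.2 ⟨ENNReal.mul_ne_top ENNReal.ofReal_ne_top hC, ENNReal.mul_ne_top ENNReal.ofReal_ne_top hC'⟩,
    fun P hPd hP0 K hK ι _ i0 N f hf => ?_⟩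
  have hQ := (Pm_cont P).measurable
  have hb : ∀ j : ℤ, Measurable (fun y : EuclideanSpace ℝ (Fin n) => (bm j y : ℂ)) ∧ Integrable (fun y : EuclideanSpace ℝ (Fin n) => (bm j y : ℂ)) :=
    fun j => ⟨(bm_KE j).cont.measurable, (bm_KE j).int⟩
  have hKE := fun i => kk_KE hK N i
  have key : ∀ t x, ⨆ j ∈ Finset.Icc i0 (N-1), ‖Op (Kp K N j) (Pm P) f x t‖ₑ ≤
      (⨆ j ∈ Finset.Icc i0 (N-1), ‖∑ i ∈ Finset.Icc j (N-1), Op (kk K N i) (Pm P) f x t‖ₑ) +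
        ENNReal.ofReal (bc n) * ⨆ j ∈ Finset.Icc i0 (N-1), ‖Op (fun y => (bm (j-1) y : ℂ)) (Pm P) f x t‖ₑ := by
    intro t x
    refine iSup₂_le fun j hj => ?_
    have hjN : j ≤ N := by have := (Finset.mem_Icc.1 hj).2; lia
    have e : Op (Kp K N j) (Pm P) f x t = ∑ i ∈ Finset.Icc j (N-1), Op (kk K N i) (Pm P) f x t + BB K N j * Op (fun y => (bm (j-1) y : ℂ)) (Pm P) f x t := by
      simp_rw [op_coord (hKE _).int hQ hf, op_coord (hb _).2 hQ hf, op_coord (Kp_good hK N j hjN).1 hQ hf]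
      rw [← op_ksum (fun i _ => (hKE i).int) hQ (hf.coord t), ← smul_eq_mul, ← op_kconst_mul,
        ← op_kadd (integrable_finset_sum _ fun i _ => (hKE i).int) ((hb (j-1)).2.const_mul _) hQ (hf.coord t)]
      congr 1
      funext y
      exact kk_sum N j hjN y
    rw [e]
    refine (enorm_add_le _ _).trans (add_le_add ?_ ?_)
    · exact le_iSup₂ (f := fun j (_ : j ∈ Finset.Icc i0 (N-1)) => ‖∑ i ∈ Finset.Icc j (N-1), Op (kk K N i) (Pm P) f x t‖ₑ) j hj
    · rw [enorm_mul]
      refine mul_le_mul' ?_ ?_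
      · rw [← ofReal_norm]; exact ENNReal.ofReal_le_ofReal (BB_bd hK N j hjN)
      · exact le_iSup₂ (f := fun j (_ : j ∈ Finset.Icc i0 (N-1)) => ‖Op (fun y => (bm (j-1) y : ℂ)) (Pm P) f x t‖ₑ) j hj
  have m2 : ∀ t : ι, Measurable fun x => ⨆ j ∈ Finset.Icc i0 (N-1), ‖Op (fun y => (bm (j-1) y : ℂ)) (Pm P) f x t‖ₑ :=
    fun t => sup_meas _ (k := fun (j : ℤ) y => (bm (j-1) y : ℂ)) (fun j _ => hb (j-1)) hQ hf t
  refine (NN_mono hp.le key).trans ((NN_add hp.le ?_ ?_).trans ?_)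
  · exact fun t => sup_sum_meas _ _ (fun i => ⟨(hKE i).cont.measurable, (hKE i).int⟩) hQ hf t
  · exact fun t => (m2 t).const_mul _
  · rw [add_mul, NN_mul hp.le _ m2, mul_assoc (ENNReal.ofReal (bc n))]
    refine add_le_add (h (ak n) ak_pos (kk K N) hKE (fun i => kk_mean hK N i) P hPd hP0 ι i0 (N-1) f hf) ?_
    exact mul_le_mul' le_rfl (h' P hPd hP0 ι i0 (N-1) f hf)

end SR
end

section

namespace SR

variable {n D d : ℕ}

open Classical in
/-- Truncation in size and support. -/
def tr (N : ℕ) (f : EuclideanSpace ℝ (Fin d) → ℂ) (x : EuclideanSpace ℝ (Fin d)) : ℂ :=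
  if ‖f x‖ ≤ N ∧ ‖x‖ ≤ N then f x else 0

lemma tr_le (N : ℕ) (f : EuclideanSpace ℝ (Fin d) → ℂ) (x : EuclideanSpace ℝ (Fin d)) : ‖tr N f x‖ ≤ ‖f x‖ := by
  unfold tr; split_ifs <;> simp

lemma tr_nice (N : ℕ) {f : EuclideanSpace ℝ (Fin d) → ℂ} (hf : Measurable f) : Nice (tr N f) := by
  have hm : Measurable (tr N f) := by
    unfold tr
    exact Measurable.ite ((measurableSet_le hf.norm measurable_const).inter (measurableSet_le measurable_norm measurable_const)) hf measurable_const
  have hb : ∀ x, ‖tr N f x‖ ≤ N := by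
    intro x; unfold tr; split_ifs with h
    · exact h.1
    · simp
  refine ⟨hm.stronglyMeasurable, ⟨N, hb⟩, ?_⟩
  have e : tr N f = (Metric.closedBall (0 : EuclideanSpace ℝ (Fin d)) N).indicator (tr N f) := by
    ext x
    by_cases hx : x ∈ Metric.closedBall (0 : EuclideanSpace ℝ (Fin d)) N
    · rw [Set.indicator_of_mem hx]
    · rw [Set.indicator_of_notMem hx]
      unfold tr
      rw [if_neg]
      rintro ⟨_, h⟩
      exact hx (by simpa using h)
  rw [e, integrable_indicator_iff Metric.isClosed_closedBall.measurableSet]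
  exact Measure.integrableOn_of_bounded (M := N) measure_closedBall_lt_top.ne hm.aestronglyMeasurable
    (Filter.Eventually.of_forall hb)

lemma tr_norm_nice (N : ℕ) {f : EuclideanSpace ℝ (Fin d) → ℂ} (hf : Measurable f) : Nice (fun x => ((‖tr N f x‖ : ℝ) : ℂ)) := by
  have h := tr_nice N hf
  obtain ⟨C, hC⟩ := h.bdd
  exact ⟨Complex.continuous_ofReal.comp_stronglyMeasurable h.meas.norm, ⟨C, fun x => by simpa using hC x⟩, h.int.norm.ofReal⟩

lemma vec_nice {N : ℕ} {g : Fin N → EuclideanSpace ℝ (Fin d) → ℂ} (hg : ∀ t, Nice (g t)) :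
    Nice (fun x => (WithLp.toLp 2 (fun t => g t x) : EuclideanSpace ℂ (Fin N))) := by
  have h : Nice (fun x => ∑ t, (ContinuousLinearMap.toSpanSingleton ℂ (EuclideanSpace.single t (1:ℂ) : EuclideanSpace ℂ (Fin N))) (g t x)) :=
    Nice.sum fun t _ => (hg t).clm _
  convert h using 2 with x
  ext s
  simp [ContinuousLinearMap.toSpanSingleton_apply, Pi.single_apply, Finset.sum_apply]

lemma choose_j (r : ℝ) (hr : 0 < r) : ∃ j : ℤ, (2:ℝ) ^ (j-1) < r ∧ r ≤ 2 ^ j := by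
  obtain ⟨j, h1, h2⟩ := exists_mem_Ioc_zpow hr (one_lt_two : (1:ℝ) < 2)
  exact ⟨j+1, by simpa using h1, h2⟩

lemma nice_mul_int {k : EuclideanSpace ℝ (Fin n) → ℂ} (hk : Integrable k) {Q : EuclideanSpace ℝ (Fin n) → EuclideanSpace ℝ (Fin d)} (hQ : Measurable Q)
    {g : EuclideanSpace ℝ (Fin d) → ℂ} (hg : Nice g) (x : EuclideanSpace ℝ (Fin d)) : Integrable fun y => k y * g (x - Q y) := by
  obtain ⟨C, hC⟩ := hg.bdd
  exact hk.mul_bdd (c := C) (hg.meas.measurable.comp (measurable_const.sub hQ)).aestronglyMeasurable (Filter.Eventually.of_forall fun y => hC _)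

lemma rS (r : ℝ) : MeasurableSet {y : EuclideanSpace ℝ (Fin n) | r < ‖y‖} := measurableSet_lt measurable_const measurable_norm

lemma two_zpow_half (j : ℤ) : (2:ℝ) * 2 ^ (j-2) = 2 ^ (j-1) := by
  rw [show j - 1 = (j-2) + 1 by ring, zpow_add_one₀ (by norm_num)]; ring

variable {K : EuclideanSpace ℝ (Fin n) → ℂ}

lemma ker_eq {r : ℝ} {j : ℤ} (hj : (2:ℝ) ^ (j-1) < r) (N : ℤ) {y : EuclideanSpace ℝ (Fin n)} (hy : r < ‖y‖) :
    Kp K N (j-2) y = K y * ((1 - cut N y : ℝ) : ℂ) := by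
  unfold Kp
  rw [cut_one (by rw [two_zpow_half]; linarith)]

/-- the constant in the comparison of sharp and smooth truncations -/
def cc (n : ℕ) : ℝ := ac n * 2 * 8 ^ n

lemma cc_nonneg : 0 ≤ cc n := by have := ac_pos (n := n); unfold cc; positivity

lemma h_bd (hK : CZ n K) {r : ℝ} {j : ℤ} (hj : (2:ℝ) ^ (j-1) < r) (y : EuclideanSpace ℝ (Fin n)) :
    ‖({y : EuclideanSpace ℝ (Fin n) | r < ‖y‖}.indicator (Kp K j (j-2))) y‖ ≤ cc n * bm (j+2) y := by
  have hb := bm_nonneg (n := n) (j+2) y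
  have h0 : 0 ≤ cc n * bm (j+2) y := mul_nonneg cc_nonneg hb
  have hp : (0:ℝ) < 2 ^ (j-1) := by positivity
  by_cases hy : r < ‖y‖
  swap
  · rw [Set.indicator_of_notMem (by simpa using hy)]; simpa using h0
  rw [Set.indicator_of_mem (by simpa using hy), ker_eq hj _ hy]
  have hz : (2:ℝ) ^ (j+2) = 8 * 2 ^ (j-1) := by
    rw [show j + 2 = (j-1) + 3 by ring, zpow_add₀ (by norm_num)]; norm_num; ring
  have hz1 : (2:ℝ) ^ j = 2 * 2 ^ (j-1) := by
    rw [← zpow_one_add₀ (by norm_num)]; congr 1; ring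
  by_cases h2 : 2 * 2 ^ j ≤ ‖y‖
  · rw [cut_one h2]; simpa using h0
  have hs : ‖K y‖ ≤ ((2 ^ (j-1)) ^ n)⁻¹ := by
    rw [← one_div, le_div_iff₀ (by positivity)]
    exact K_size hK.bd hp (by linarith)
  have hc : ‖((1 - cut j y : ℝ) : ℂ)‖ ≤ 1 := by
    rw [Complex.norm_real, Real.norm_eq_abs, abs_le]
    constructor <;> linarith [cut_nonneg j y, cut_le_one j y]
  have hm : (1:ℝ)/2 ≤ max 0 (1 - ‖y‖ / 2 ^ (j+2)) := by
    refine le_max_of_le_right ?_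
    have : ‖y‖ / 2 ^ (j+2) ≤ 1/2 := by
      rw [div_le_iff₀ (by positivity), hz]; linarith
    linarith
  have ha := ac_pos (n := n)
  have e : cc n * bm (j+2) y = ((2 ^ (j-1)) ^ n)⁻¹ * (2 * max 0 (1 - ‖y‖ / 2 ^ (j+2))) := by
    unfold cc bm
    rw [hz] 
    rw [mul_pow]
    have : (8:ℝ) ^ n ≠ 0 := by positivity
    field_simp
  rw [norm_mul, e]
  exact mul_le_mul hs (by linarith) (norm_nonneg _) (by positivity)

lemma ptw (hK : CZ n K) {Q : EuclideanSpace ℝ (Fin n) → EuclideanSpace ℝ (Fin d)} (hQ : Measurable Q)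
    {g : EuclideanSpace ℝ (Fin d) → ℂ} (hg : Nice g) (hg' : Nice fun x => ((‖g x‖ : ℝ) : ℂ)) {r : ℝ} {j N : ℤ} (hj : (2:ℝ) ^ (j-1) < r) (hj2 : r ≤ 2 ^ j) (hN : j ≤ N)
    (x : EuclideanSpace ℝ (Fin d)) :
    ‖∫ y in {y : EuclideanSpace ℝ (Fin n) | r < ‖y‖}, g (x - Q y) * (K y * ((1 - cut N y : ℝ) : ℂ))‖ₑ ≤
      ‖Op (Kp K N j) Q g x‖ₑ + ENNReal.ofReal (cc n) * ‖Op (fun y => (bm (j+2) y : ℂ)) Q (fun x => ((‖g x‖ : ℝ) : ℂ)) x‖ₑ := by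
  set S := {y : EuclideanSpace ℝ (Fin n) | r < ‖y‖} with hS
  have hh := (Kp_good hK j (j-2) (by linarith)).1.indicator (rS r)
  rw [← hS] at hh
  have e : ∫ y in S, g (x - Q y) * (K y * ((1 - cut N y : ℝ) : ℂ)) =
      Op (Kp K N j) Q g x + ∫ y, S.indicator (Kp K j (j-2)) y * g (x - Q y) := by
    rw [← integral_indicator (rS r)]
    unfold Op
    simp only [smul_eq_mul]
    rw [← integral_add (nice_mul_int (Kp_good hK N j hN).1 hQ hg x) (nice_mul_int hh hQ hg x)]
    refine integral_congr_ae (Filter.Eventually.of_forall fun y => ?_)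
    beta_reduce
    by_cases hy : r < ‖y‖
    · rw [Set.indicator_of_mem (by simpa using hy), Set.indicator_of_mem (by simpa [hS] using hy), ker_eq hj _ hy]
      unfold Kp
      push_cast; ring
    · rw [Set.indicator_of_notMem (by simpa using hy), Set.indicator_of_notMem (by simpa [hS] using hy)]
      push Not at hy
      unfold Kp
      rw [cut_zero (hy.trans hj2), cut_zero ((hy.trans hj2).trans (zpow_le_zpow_right₀ (by norm_num) hN))]
      simp
  rw [e]
  refine (enorm_add_le _ _).trans (add_le_add le_rfl ?_)
  have hbi : Integrable fun y : EuclideanSpace ℝ (Fin n) => (bm (j+2) y : ℂ) := (bm_KE (j+2)).int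
  have hi := nice_mul_int hbi hQ hg' x
  have hi' : Integrable fun y => bm (j+2) y * ‖g (x - Q y)‖ := by
    have := hi.re
    refine this.congr (Filter.Eventually.of_forall fun y => ?_)
    beta_reduce
    rw [← Complex.ofReal_mul]; exact Complex.ofReal_re _
  have hO : Op (fun y => (bm (j+2) y : ℂ)) Q (fun x => ((‖g x‖ : ℝ) : ℂ)) x = ((∫ y, bm (j+2) y * ‖g (x - Q y)‖ : ℝ) : ℂ) := by
    unfold Op
    rw [← integral_complex_ofReal]
    congr 1; ext y; simp
  have h0 : 0 ≤ ∫ y, bm (j+2) y * ‖g (x - Q y)‖ := integral_nonneg fun y => mul_nonneg (bm_nonneg _ _) (norm_nonneg _)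
  rw [hO, ← ofReal_norm, ← ofReal_norm, Complex.norm_real, Real.norm_of_nonneg h0, ← ENNReal.ofReal_mul cc_nonneg]
  apply ENNReal.ofReal_le_ofReal
  rw [← integral_const_mul]
  refine norm_integral_le_of_norm_le (hi'.const_mul _) (Filter.Eventually.of_forall fun y => ?_)
  rw [norm_mul, ← mul_assoc]
  exact mul_le_mul_of_nonneg_right (h_bd hK hj y) (norm_nonneg _)

/-- The dominated convergence step. -/
lemma dct (hK : CZ n K) {Q : EuclideanSpace ℝ (Fin n) → EuclideanSpace ℝ (Fin d)} (hQ : Measurable Q)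
    {f : EuclideanSpace ℝ (Fin d) → ℂ} (hf : Measurable f) {r : ℝ} {j : ℤ} (hj : (2:ℝ) ^ (j-1) < r)
    (x : EuclideanSpace ℝ (Fin d))
    (hi : IntegrableOn (fun y => f (x - Q y) * K y) {y : EuclideanSpace ℝ (Fin n) | r < ‖y‖}) :
    Filter.Tendsto (fun N : ℕ => ∫ y in {y : EuclideanSpace ℝ (Fin n) | r < ‖y‖}, tr N f (x - Q y) * (K y * ((1 - cut N y : ℝ) : ℂ)))
      Filter.atTop (𝓝 (∫ y in {y : EuclideanSpace ℝ (Fin n) | r < ‖y‖}, f (x - Q y) * K y)) := by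
  refine tendsto_integral_filter_of_dominated_convergence (fun y => ‖f (x - Q y) * K y‖) ?_ ?_ hi.norm ?_
  · filter_upwards [Filter.eventually_ge_atTop (j-2).toNat] with N hN
    have hN' : j - 2 ≤ (N:ℤ) := by omega
    have h1 : Measurable fun y => tr N f (x - Q y) * Kp K N (j-2) y :=
      ((tr_nice N hf).meas.measurable.comp (measurable_const.sub hQ)).mul (Kp_good hK N (j-2) hN').2
    refine (h1.aestronglyMeasurable (μ := volume.restrict _)).congr ?_
    filter_upwards [ae_restrict_mem (rS r)] with y hy
    rw [ker_eq hj N hy]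
  · refine Filter.Eventually.of_forall fun N => Filter.Eventually.of_forall fun y => ?_
    rw [norm_mul, norm_mul, norm_mul]
    have hc : ‖((1 - cut N y : ℝ) : ℂ)‖ ≤ 1 := by
      rw [Complex.norm_real, Real.norm_eq_abs, abs_le]
      constructor <;> linarith [cut_nonneg N y, cut_le_one N y]
    exact mul_le_mul (tr_le _ _ _) (mul_le_of_le_one_right (norm_nonneg _) hc) (by positivity) (norm_nonneg _)
  · refine Filter.Eventually.of_forall fun y => ?_
    refine tendsto_const_nhds.congr' ?_
    filter_upwards [Filter.eventually_ge_atTop (⌈‖f (x - Q y)‖⌉₊), Filter.eventually_ge_atTop (⌈‖x - Q y‖⌉₊), Filter.eventually_ge_atTop (⌈‖y‖⌉₊)] with N h1 h2 h3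
    have h3' : ‖y‖ ≤ 2 ^ (N:ℤ) := by
      have := Nat.ceil_le.1 h3
      have h4 : (N:ℝ) ≤ 2 ^ N := by exact_mod_cast Nat.lt_two_pow_self.le
      rw [zpow_natCast]; linarith
    rw [cut_zero h3']
    unfold tr
    rw [if_pos ⟨Nat.ceil_le.1 h1, Nat.ceil_le.1 h2⟩]
    simp

/-- The truncated vectors. -/
def FN (N : ℕ) (f : ℕ → EuclideanSpace ℝ (Fin d) → ℂ) (x : EuclideanSpace ℝ (Fin d)) : EuclideanSpace ℂ (Fin N) :=
  WithLp.toLp 2 (fun t => tr N (f t) x)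

def GN (N : ℕ) (f : ℕ → EuclideanSpace ℝ (Fin d) → ℂ) (x : EuclideanSpace ℝ (Fin d)) : EuclideanSpace ℂ (Fin N) :=
  WithLp.toLp 2 (fun t => ((‖tr N (f t) x‖ : ℝ) : ℂ))

lemma FN_nice (N : ℕ) {f : ℕ → EuclideanSpace ℝ (Fin d) → ℂ} (hf : ∀ t, Measurable (f t)) : Nice (FN N f) := vec_nice fun t => tr_nice N (hf t)

lemma GN_nice (N : ℕ) {f : ℕ → EuclideanSpace ℝ (Fin d) → ℂ} (hf : ∀ t, Measurable (f t)) : Nice (GN N f) := vec_nice fun t => tr_norm_nice N (hf t)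

/-- The right-hand side quantity. -/
def LP (p : ℝ) (M : ℕ → EuclideanSpace ℝ (Fin d) → ℝ≥0∞) : ℝ≥0∞ := (∫⁻ x, ((∑' t, M t x ^ (2:ℝ)) ^ ((1:ℝ)/2)) ^ p) ^ (1/p)

lemma NN_le_LP {p : ℝ} (hp : 1 ≤ p) (N : ℕ) (F : Fin N → EuclideanSpace ℝ (Fin d) → ℝ≥0∞) (M : ℕ → EuclideanSpace ℝ (Fin d) → ℝ≥0∞)
    (h : ∀ t x, F t x ≤ M t x) : NN p F ≤ LP p M := by
  have h0 : 0 ≤ p := by linarith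
  unfold NN LP
  gcongr with x
  refine le_trans ?_ (ENNReal.sum_le_tsum (Finset.range N))
  rw [Finset.sum_range]
  gcongr with t
  exact h t x

lemma lpn_FN {p : ℝ} (hp : 1 ≤ p) (N : ℕ) (f : ℕ → EuclideanSpace ℝ (Fin d) → ℂ) : lpn p (FN N f) ≤ LP p (fun t x => ‖f t x‖ₑ) := by
  rw [← NN_vec]
  refine NN_le_LP hp N _ _ fun t x => ?_
  rw [← ofReal_norm, ← ofReal_norm]
  exact ENNReal.ofReal_le_ofReal (tr_le _ _ _)

lemma lpn_GN {p : ℝ} (hp : 1 ≤ p) (N : ℕ) (f : ℕ → EuclideanSpace ℝ (Fin d) → ℂ) : lpn p (GN N f) ≤ LP p (fun t x => ‖f t x‖ₑ) := by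
  rw [← NN_vec]
  refine NN_le_LP hp N _ _ fun t x => ?_
  rw [← ofReal_norm, ← ofReal_norm]
  refine ENNReal.ofReal_le_ofReal ?_
  have : ‖GN N f x t‖ = ‖tr N (f t) x‖ := by
    change ‖((‖tr N (f t) x‖ : ℝ) : ℂ)‖ = _
    simp
  rw [this]
  exact tr_le _ _ _

/-- The approximating maximal functions. -/
def MM (K : EuclideanSpace ℝ (Fin n) → ℂ) (Q : EuclideanSpace ℝ (Fin n) → EuclideanSpace ℝ (Fin d)) (f : ℕ → EuclideanSpace ℝ (Fin d) → ℂ) (N : ℕ)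
    (t : Fin N) (x : EuclideanSpace ℝ (Fin d)) : ℝ≥0∞ :=
  (⨆ j ∈ Finset.Icc (-(N:ℤ)) ((N:ℤ)-1), ‖Op (Kp K N j) Q (FN N f) x t‖ₑ) +
    ENNReal.ofReal (cc n) * ⨆ j ∈ Finset.Icc (-(N:ℤ)) ((N:ℤ)+5), ‖Op (fun y => (bm (j-1) y : ℂ)) Q (GN N f) x t‖ₑ

def ME (K : EuclideanSpace ℝ (Fin n) → ℂ) (Q : EuclideanSpace ℝ (Fin n) → EuclideanSpace ℝ (Fin d)) (f : ℕ → EuclideanSpace ℝ (Fin d) → ℂ) (N : ℕ)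
    (t : ℕ) (x : EuclideanSpace ℝ (Fin d)) : ℝ≥0∞ := if h : t < N then MM K Q f N ⟨t, h⟩ x else 0

lemma MM_meas1 (hK : CZ n K) {Q : EuclideanSpace ℝ (Fin n) → EuclideanSpace ℝ (Fin d)} (hQ : Measurable Q) {f : ℕ → EuclideanSpace ℝ (Fin d) → ℂ}
    (hf : ∀ t, Measurable (f t)) (N : ℕ) (t : Fin N) :
    Measurable fun x => ⨆ j ∈ Finset.Icc (-(N:ℤ)) ((N:ℤ)-1), ‖Op (Kp K N j) Q (FN N f) x t‖ₑ :=
  sup_meas _ (fun j hj => (Kp_good hK N j (by have := (Finset.mem_Icc.1 hj).2; omega)).symm) hQ (FN_nice N hf) t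

lemma MM_meas2 {Q : EuclideanSpace ℝ (Fin n) → EuclideanSpace ℝ (Fin d)} (hQ : Measurable Q) {f : ℕ → EuclideanSpace ℝ (Fin d) → ℂ}
    (hf : ∀ t, Measurable (f t)) (N : ℕ) (t : Fin N) :
    Measurable fun x => ⨆ j ∈ Finset.Icc (-(N:ℤ)) ((N:ℤ)+5), ‖Op (fun y => (bm (j-1) y : ℂ)) Q (GN N f) x t‖ₑ :=
  sup_meas (k := fun j y => (bm (j-1) y : ℂ)) _ (fun j hj => ⟨(bm_KE (j-1)).cont.measurable, (bm_KE (j-1)).int⟩) hQ (GN_nice N hf) t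

lemma ME_meas (hK : CZ n K) {Q : EuclideanSpace ℝ (Fin n) → EuclideanSpace ℝ (Fin d)} (hQ : Measurable Q) {f : ℕ → EuclideanSpace ℝ (Fin d) → ℂ}
    (hf : ∀ t, Measurable (f t)) (N t : ℕ) : Measurable (ME K Q f N t) := by
  by_cases h : t < N
  · have : ME K Q f N t = MM K Q f N ⟨t, h⟩ := by ext x; simp [ME, h]
    rw [this]
    exact (MM_meas1 hK hQ hf N _).add ((MM_meas2 hQ hf N _).const_mul _)
  · have : ME K Q f N t = fun _ => 0 := by ext x; simp [ME, h]
    rw [this]; exact measurable_const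

lemma ME_LP (K : EuclideanSpace ℝ (Fin n) → ℂ) (Q : EuclideanSpace ℝ (Fin n) → EuclideanSpace ℝ (Fin d)) (f : ℕ → EuclideanSpace ℝ (Fin d) → ℂ) (N : ℕ) (p : ℝ) :
    LP p (ME K Q f N) = NN p (MM K Q f N) := by
  unfold LP NN
  have e : ∀ x, ∑' t, ME K Q f N t x ^ (2:ℝ) = ∑ t, MM K Q f N t x ^ (2:ℝ) := by
    intro x
    rw [tsum_eq_sum (s := Finset.range N), Finset.sum_range]
    · refine Finset.sum_congr rfl fun t _ => ?_
      simp [ME]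
    · intro t ht
      simp [ME, show ¬ t < N by simpa using ht]
  simp_rw [e]

lemma MM_bd (hK : CZ n K) {Q : EuclideanSpace ℝ (Fin n) → EuclideanSpace ℝ (Fin d)} (hQ : Measurable Q) {f : ℕ → EuclideanSpace ℝ (Fin d) → ℂ}
    (hf : ∀ t, Measurable (f t)) (N : ℕ) {p : ℝ} (hp : 1 ≤ p) {C1 C2 : ℝ≥0∞}
    (h1 : NN p (fun t x => ⨆ j ∈ Finset.Icc (-(N:ℤ)) ((N:ℤ)-1), ‖Op (Kp K N j) Q (FN N f) x t‖ₑ) ≤ C1 * lpn p (FN N f))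
    (h2 : NN p (fun t x => ⨆ j ∈ Finset.Icc (-(N:ℤ)) ((N:ℤ)+5), ‖Op (fun y => (bm (j-1) y : ℂ)) Q (GN N f) x t‖ₑ) ≤ C2 * lpn p (GN N f)) :
    NN p (MM K Q f N) ≤ (C1 + ENNReal.ofReal (cc n) * C2) * LP p (fun t x => ‖f t x‖ₑ) := by
  unfold MM
  refine (NN_add hp (MM_meas1 hK hQ hf N) (fun t => (MM_meas2 hQ hf N t).const_mul _)).trans ?_
  rw [NN_mul hp _ (MM_meas2 hQ hf N), add_mul, mul_assoc]
  exact add_le_add (h1.trans (mul_le_mul' le_rfl (lpn_FN hp N f))) (mul_le_mul' le_rfl (h2.trans (mul_le_mul' le_rfl (lpn_GN hp N f))))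

lemma T_le (hK : CZ n K) {Q : EuclideanSpace ℝ (Fin n) → EuclideanSpace ℝ (Fin d)} (hQ : Measurable Q) {f : ℕ → EuclideanSpace ℝ (Fin d) → ℂ}
    (hf : ∀ t, Measurable (f t)) (t : ℕ) (x : EuclideanSpace ℝ (Fin d)) (r : ℝ) (hr : 0 < r) :
    ‖∫ y in {y : EuclideanSpace ℝ (Fin n) | r < ‖y‖}, f t (x - Q y) * K y‖ₑ ≤ Filter.liminf (fun N => ME K Q f N t x) Filter.atTop := by
  obtain ⟨j, hj, hj2⟩ := choose_j r hr
  by_cases hi : IntegrableOn (fun y => f t (x - Q y) * K y) {y : EuclideanSpace ℝ (Fin n) | r < ‖y‖}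
  swap
  · rw [integral_undef hi]; simp
  have h := (dct hK hQ (hf t) hj x hi).enorm
  rw [← h.liminf_eq]
  refine Filter.liminf_le_liminf ?_
  filter_upwards [Filter.eventually_ge_atTop (t+1), Filter.eventually_ge_atTop (j.natAbs+1)] with N h1 h2
  have htN : t < N := by omega
  refine (ptw hK hQ (tr_nice N (hf t)) (tr_norm_nice N (hf t)) hj hj2 (by omega) x).trans ?_
  unfold ME
  rw [dif_pos htN]
  unfold MM
  refine add_le_add ?_ (mul_le_mul' le_rfl ?_)
  · refine le_trans (le_of_eq ?_) (le_iSup₂ (f := fun j (_ : j ∈ Finset.Icc (-(N:ℤ)) ((N:ℤ)-1)) => ‖Op (Kp K N j) Q (FN N f) x ⟨t, htN⟩‖ₑ) j (by rw [Finset.mem_Icc]; omega))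
    beta_reduce
    rw [op_coord (Kp_good hK N j (by omega)).1 hQ (FN_nice N hf)]
    rfl
  · refine le_trans (le_of_eq ?_) (le_iSup₂ (f := fun j (_ : j ∈ Finset.Icc (-(N:ℤ)) ((N:ℤ)+5)) => ‖Op (fun y => (bm (j-1) y : ℂ)) Q (GN N f) x ⟨t, htN⟩‖ₑ) (j+3) (by rw [Finset.mem_Icc]; omega))
    beta_reduce
    rw [op_coord (bm_KE _).int hQ (GN_nice N hf), show j + 3 - 1 = j + 2 by ring]
    rfl

lemma rpow_liminf {u : ℕ → ℝ≥0∞} {a : ℝ} (ha : 0 < a) : (Filter.liminf u Filter.atTop) ^ a = Filter.liminf (fun N => u N ^ a) Filter.atTop :=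
  (ENNReal.orderIsoRpow a ha).liminf_apply (by isBoundedDefault) (by isBoundedDefault) (by isBoundedDefault) (by isBoundedDefault)

lemma tsum_liminf (u : ℕ → ℕ → ℝ≥0∞) : ∑' t, Filter.liminf (fun N => u N t) Filter.atTop ≤ Filter.liminf (fun N => ∑' t, u N t) Filter.atTop := by
  have := lintegral_liminf_le (μ := Measure.count) (u := Filter.atTop) (f := u) (fun N => measurable_of_countable _)
  simpa only [lintegral_count] using this

lemma LP_fatou {p : ℝ} (hp : 1 ≤ p) {M : ℕ → ℕ → EuclideanSpace ℝ (Fin d) → ℝ≥0∞} (hM : ∀ N t, Measurable (M N t))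
    {S : ℕ → EuclideanSpace ℝ (Fin d) → ℝ≥0∞} (hS : ∀ t x, S t x ≤ Filter.liminf (fun N => M N t x) Filter.atTop) {B : ℝ≥0∞}
    (hB : ∀ N, LP p (M N) ≤ B) : LP p S ≤ B := by
  have h0 : 0 < p := by linarith
  have e : ∀ x, ((∑' t, S t x ^ (2:ℝ)) ^ ((1:ℝ)/2)) ^ p ≤ Filter.liminf (fun N => ((∑' t, M N t x ^ (2:ℝ)) ^ ((1:ℝ)/2)) ^ p) Filter.atTop := by
    intro x
    rw [← rpow_liminf h0, ← rpow_liminf (by norm_num)]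
    refine ENNReal.rpow_le_rpow (ENNReal.rpow_le_rpow ?_ (by norm_num)) h0.le
    refine le_trans ?_ (tsum_liminf _)
    refine ENNReal.tsum_le_tsum fun t => ?_
    rw [← rpow_liminf (by norm_num)]
    exact ENNReal.rpow_le_rpow (hS t x) (by norm_num)
  have hm : ∀ N, Measurable fun x => ((∑' t, M N t x ^ (2:ℝ)) ^ ((1:ℝ)/2)) ^ p := fun N =>
    ((Measurable.tsum fun t => (hM N t).pow_const _).pow_const _).pow_const _
  have h1 := (lintegral_mono (μ := volume) e).trans (lintegral_liminf_le hm)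
  unfold LP
  rw [one_div p, ENNReal.rpow_inv_le_iff h0]
  refine h1.trans ?_
  refine Filter.liminf_le_of_le (by isBoundedDefault) fun b hb => ?_
  obtain ⟨N, hN⟩ := hb.exists
  refine hN.trans ?_
  rw [← ENNReal.rpow_inv_le_iff h0, ← one_div p]
  exact hB N

theorem final_pos (hn : 0 < n) (hD : 0 < D) (p : ℝ) (hp : 1 < p) : ∃ C : ℝ≥0∞, C ≠ ∞ ∧
    ∀ P : Fin d → MvPolynomial (Fin n) ℝ, (∀ j, (P j).totalDegree ≤ D) → (∀ j, MvPolynomial.eval (fun _ => (0 : ℝ)) (P j) = 0) →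
    ∀ K : EuclideanSpace ℝ (Fin n) → ℂ, CZ n K →
    ∀ f : ℕ → EuclideanSpace ℝ (Fin d) → ℂ, (∀ t, Measurable (f t)) →
      LP p (fun t x => ⨆ (r : ℝ) (_ : 0 < r), ‖∫ y in {y : EuclideanSpace ℝ (Fin n) | r < ‖y‖}, f t (x - Pm P y) * K y‖ₑ) ≤ C * LP p (fun t x => ‖f t x‖ₑ) := by
  obtain ⟨C1, hC1, H1⟩ := trunc_max (n := n) (D := D) (d := d) hn hD p hp
  obtain ⟨C2, hC2, H2⟩ := avg_max (n := n) (D := D) (d := d) hn hD p hp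
  refine ⟨C1 + ENNReal.ofReal (cc n) * C2, ENNReal.add_ne_top.2 ⟨hC1, ENNReal.mul_ne_top ENNReal.ofReal_ne_top hC2⟩, ?_⟩
  intro P hP hP0 K hK f hf
  have hQ := (Pm_cont P).measurable
  refine LP_fatou hp.le (M := ME K (Pm P) f) (fun N t => ME_meas hK hQ hf N t) (fun t x => iSup₂_le fun r hr => T_le hK hQ hf t x r hr) fun N => ?_
  rw [ME_LP]
  exact MM_bd hK hQ hf N hp.le (H1 P hP hP0 K hK (Fin N) _ _ _ (FN_nice N hf)) (H2 P hP hP0 (Fin N) _ _ _ (GN_nice N hf))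

end SR
end

end SRwork

/-- **Theorem (continuous vector-valued maximal theorem for truncated singular Radon
transforms).** -/
theorem statement19 (p : ℝ) (hp : 1 < p) (k d₀ D : ℕ) :
    ∃ C : ℝ, 0 < C ∧
      ∀ P : Fin d₀ → MvPolynomial (Fin k) ℝ,
        (∀ j, (P j).totalDegree ≤ D) →
        (∀ j, MvPolynomial.eval (fun _ => (0 : ℝ)) (P j) = 0) →
        ∀ K : EuclideanSpace ℝ (Fin k) → ℂ, IsCZKernelCont k K →
        ∀ f : ℕ → EuclideanSpace ℝ (Fin d₀) → ℂ,
          (∀ t, Measurable (f t)) →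
          (∫⁻ x : EuclideanSpace ℝ (Fin d₀),
              ((∑' t : ℕ, (‖f t x‖₊ : ℝ≥0∞) ^ (2 : ℝ)) ^ ((1 : ℝ) / 2)) ^ p) ^ (1 / p) ≠ ∞ →
          (∫⁻ x : EuclideanSpace ℝ (Fin d₀),
              ((∑' t : ℕ,
                  (⨆ (r : ℝ) (_ : 0 < r),
                    (‖contTruncRadon k d₀ P K r (f t) x‖₊ : ℝ≥0∞)) ^ (2 : ℝ)) ^
                ((1 : ℝ) / 2)) ^ p) ^ (1 / p)
            ≤ ENNReal.ofReal C *
              (∫⁻ x : EuclideanSpace ℝ (Fin d₀),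
                ((∑' t : ℕ, (‖f t x‖₊ : ℝ≥0∞) ^ (2 : ℝ)) ^ ((1 : ℝ) / 2)) ^ p) ^ (1 / p) := by
  rcases Nat.eq_zero_or_pos k with hk | hk
  · subst hk
    refine ⟨1, one_pos, fun P _ _ K _ f _ _ => ?_⟩
    have hp0 : 0 < p := by linarith
    have e : ∀ (r : ℝ) (_ : 0 < r) t x, contTruncRadon 0 d₀ P K r (f t) x = 0 := by
      intro r hr t x
      have hS : {y : EuclideanSpace ℝ (Fin 0) | r < ‖y‖} = ∅ := by
        ext y
        have : y = 0 := Subsingleton.elim _ _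
        simp [this, hr.le]
      unfold contTruncRadon
      rw [hS]; simp
    have e2 : ∀ t x, (⨆ (r : ℝ) (_ : 0 < r), (‖contTruncRadon 0 d₀ P K r (f t) x‖₊ : ℝ≥0∞)) = 0 := by
      intro t x
      refine le_antisymm (iSup₂_le fun r hr => ?_) bot_le
      rw [e r hr]; simp
    simp only [e2]
    rw [ENNReal.zero_rpow_of_pos (by norm_num), tsum_zero, ENNReal.zero_rpow_of_pos (by norm_num), ENNReal.zero_rpow_of_pos hp0,
      MeasureTheory.lintegral_zero, ENNReal.zero_rpow_of_pos (by positivity)]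
    exact bot_le
  · obtain ⟨C, hC, H⟩ := SR.final_pos (n := k) (D := D + 1) (d := d₀) hk (Nat.succ_pos D) p hp
    refine ⟨C.toReal + 1, by positivity, fun P hP hP0 K hK f hf _ => ?_⟩
    have h := H P (fun j => (hP j).trans (Nat.le_succ D)) hP0 K ⟨hK.1, hK.2.1, hK.2.2⟩ f hf
    have hC2 : C ≤ ENNReal.ofReal (C.toReal + 1) := by
      conv_lhs => rw [← ENNReal.ofReal_toReal hC]
      exact ENNReal.ofReal_le_ofReal (by linarith)
    exact h.trans (mul_le_mul' hC2 le_rfl)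

end
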